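/- For any constant A > 0 there exists C = C(A) > 0 such that for all sufficiently large odd integers N, \sum_{k_1 \le \sqrt{N} L^{-C}} \sum_{k_2 \le \sqrt{N} L^{-C}} \max_{(l_1,k_1)=1, (l_2,k_2)=1} \max_{J_1, J_2 \in \mathcal{J}} | \Delta^{(3)}_{⟨k_1,k_2⟩, ⟨l_1,l_2⟩}(N, ⟨J_1,J_2⟩) | \ll N^2 L^{-A}, where L = log N and the implied constant depends only on A. -/

import Mathlib

open Finset
open scoped Classical

noncomputable section

/-- The Euler factor at p of the singular series 𝔖⁽³⁾_{⟨k₁,k₂⟩,⟨l₁,l₂⟩}(n)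
(in the case where the set 𝓔 is empty). -/
def S3factor (k1 k2 : ℕ) (l1 l2 n : ℤ) (p : ℕ) : ℝ :=
  if p ∣ k1 then
    if p ∣ k2 then 1 + 1 / ((p : ℝ) - 1)
    else if (p : ℤ) ∣ n - l1 then 1 + 1 / ((p : ℝ) - 1) else 1 - 1 / ((p : ℝ) - 1) ^ 2
  else if p ∣ k2 then
    if (p : ℤ) ∣ n - l2 then 1 + 1 / ((p : ℝ) - 1) else 1 - 1 / ((p : ℝ) - 1) ^ 2
  else if (p : ℤ) ∣ n then 1 - 1 / ((p : ℝ) - 1) ^ 2 else 1 + 1 / ((p : ℝ) - 1) ^ 3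

/-- The singular series 𝔖⁽³⁾_{⟨k₁,k₂⟩,⟨l₁,l₂⟩}(n): it vanishes when the set
𝓔 = {p : p ∣ k₁, p ∣ k₂, p ∣ n - l₁ - l₂} is nonempty, and otherwise equals the
product over all primes of the corresponding Euler factors. -/
def S3kl (k1 k2 : ℕ) (l1 l2 n : ℤ) : ℝ :=
  if ∃ p : ℕ, p.Prime ∧ p ∣ k1 ∧ p ∣ k2 ∧ (p : ℤ) ∣ n - l1 - l2 then 0
  else ∏' p : Nat.Primes, S3factor k1 k2 l1 l2 n (p : ℕ)

/-- I⁽³⁾_{⟨k₁,k₂⟩,⟨l₁,l₂⟩}(N, ⟨[a₁,b₁],[a₂,b₂]⟩): the sum of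
(log p₁)(log p₂)(log p₃) over ordered triples of primes with p₁ + p₂ + p₃ = N,
p_i ≡ l_i (mod k_i), p_i ∈ [a_i, b_i] for i = 1, 2. -/
def I3 (k1 k2 : ℕ) (l1 l2 : ℤ) (N a1 b1 a2 b2 : ℕ) : ℝ :=
  ∑ p1 ∈ Finset.range (N + 1), ∑ p2 ∈ Finset.range (N + 1), ∑ p3 ∈ Finset.range (N + 1),
    if p1.Prime ∧ p2.Prime ∧ p3.Prime ∧ p1 + p2 + p3 = N ∧
        (k1 : ℤ) ∣ (p1 : ℤ) - l1 ∧ (k2 : ℤ) ∣ (p2 : ℤ) - l2 ∧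
        a1 ≤ p1 ∧ p1 ≤ b1 ∧ a2 ≤ p2 ∧ p2 ≤ b2 then
      Real.log p1 * Real.log p2 * Real.log p3
    else 0

/-- Φ⁽³⁾(N, ⟨[a₁,b₁],[a₂,b₂]⟩): the number of triples of positive integers
(m₁, m₂, m₃) with m₁ + m₂ + m₃ = N, m₁ ∈ [a₁, b₁], m₂ ∈ [a₂, b₂]. -/
def Phi3 (N a1 b1 a2 b2 : ℕ) : ℕ :=
  ((Finset.Icc 1 N ×ˢ Finset.Icc 1 N ×ˢ Finset.Icc 1 N).filter
    (fun q => q.1 + q.2.1 + q.2.2 = N ∧ a1 ≤ q.1 ∧ q.1 ≤ b1 ∧ a2 ≤ q.2.1 ∧ q.2.1 ≤ b2)).card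

/-- Δ⁽³⁾_{⟨k₁,k₂⟩,⟨l₁,l₂⟩}(N, ⟨[a₁,b₁],[a₂,b₂]⟩). -/
def Delta3 (k1 k2 : ℕ) (l1 l2 : ℤ) (N a1 b1 a2 b2 : ℕ) : ℝ :=
  I3 k1 k2 l1 l2 N a1 b1 a2 b2 -
    S3kl k1 k2 l1 l2 (N : ℤ) * (Phi3 N a1 b1 a2 b2 : ℝ) /
      ((Nat.totient k1 : ℝ) * (Nat.totient k2 : ℝ))

open Real hiding exp_add exp_ne_zero norm_natCast
open Complex hiding exp exp_log exp_nat_mul exp_neg ext inv_def log log_mul norm_natCast sin sin_neg sqrt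
open _root_.Nat hiding Prime add_le_add card_sigma card_univ div_le_self div_lt_iff_lt_mul div_mul_div_comm div_pos dvd_gcd dvd_lcm_left dvd_lcm_right dvd_sub eq_zero_or_pos gcd_comm gcd_mul_right lcm lcm_dvd lcm_dvd_iff lcm_dvd_mul le_div_iff_mul_le le_sqrt' log log_pos log_pow mul_eq_zero mul_le_mul_left mul_le_mul_right pow_succ' sqrt sqrt_le_sqrt zero_le
open ArithmeticFunction hiding add_apply ext log mul_apply zero
open DirichletCharacter hiding Even LSeriesSummable_mul Odd
open Real (pi)
open scoped ArithmeticFunction.Moebius ComplexConjugate ComplexOrder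

/-- The additive character `e(x) = exp(2πix)`. -/
def ee (x : ℝ) : ℂ := Complex.exp (2 * pi * x * I)

lemma ee_add (x y : ℝ) : ee (x + y) = ee x * ee y := by
  simp only [ee, ← exp_add]; congr 1; push_cast; ring

lemma norm_ee (x : ℝ) : ‖ee x‖ = 1 := by
  have : (2 * pi * x * I) = ((2 * pi * x : ℝ)) * I := by
    push_cast; ring
  rw [ee, this, norm_exp_ofReal_mul_I]

lemma ee_neg (x : ℝ) : ee (-x) = (ee x)⁻¹ := by
  simp only [ee, ← Complex.exp_neg]; congr 1; push_cast; ring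

lemma conj_ee (x : ℝ) : (starRingEnd ℂ) (ee x) = ee (-x) := by
  rw [ee_neg, Complex.inv_def, normSq_eq_norm_sq, norm_ee]; simp

lemma ee_int (n : ℤ) : ee n = 1 := by
  have : (2 * pi * ((n : ℝ)) * I) = n * (2 * pi * I) := by
    push_cast; ring
  rw [ee, this, exp_int_mul_two_pi_mul_I]

lemma ee_add_int (x : ℝ) (n : ℤ) : ee (x + n) = ee x := by rw [ee_add, ee_int, mul_one]

lemma ee_sub_int (x : ℝ) (n : ℤ) : ee (x - n) = ee x := by
  have := ee_add_int x (-n)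
  rwa [Int.cast_neg, ← sub_eq_add_neg] at this

lemma ee_nat_mul (n : ℕ) (x : ℝ) : ee (n * x) = ee x ^ n := by
  simp only [ee, ← Complex.exp_nat_mul]; congr 1; push_cast; ring

/-- Lower bound for the chord `|e(x) - 1|`. -/
lemma norm_ee_sub_one_ge {x : ℝ} (hx : |x| ≤ 1 / 2) : 4 * |x| ≤ ‖ee x - 1‖ := by
  have h1 : ‖ee x - 1‖ = 2 * |sin (pi * x)| := by
    have := norm_exp_I_mul_ofReal_sub_one (2 * pi * x)
    have h2 : ee x = Complex.exp (I * ((2 * pi * x : ℝ))) := by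
      rw [ee]; congr 1; push_cast; ring
    rw [h2, this, show 2 * pi * x / 2 = pi * x by ring]
    rw [norm_mul]; simp
  rw [h1]
  have h3 : 2 * |x| ≤ |sin (pi * x)| := by
    have h4 : |sin (pi * x)| = sin (pi * |x|) := by
      rcases le_total 0 x with h | h
      · rw [abs_of_nonneg h]
        rw [abs_of_nonneg h] at hx
        exact abs_of_nonneg (sin_nonneg_of_nonneg_of_le_pi (by positivity)
          (by nlinarith [pi_pos]))
      · rw [abs_of_nonpos h] at hx ⊢
        rw [abs_of_nonpos, mul_neg, sin_neg]
        apply sin_nonpos_of_nonpos_of_neg_pi_le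
        · nlinarith [pi_pos]
        · nlinarith [pi_pos]
    rw [h4]
    have := mul_le_sin (x := pi * |x|) (by positivity) (by nlinarith [pi_pos])
    calc 2 * |x| = 2 / pi * (pi * |x|) := by field_simp
      _ ≤ _ := this
  linarith

/-- Geometric sum bound: if `x` is at distance at least `δ` from every integer, then
the geometric sum with ratio `e(x)` is at most `1/(2δ)`. -/
lemma norm_geom_sum_ee_le {x δ : ℝ} (hδ : 0 < δ) (h : ∀ m : ℤ, δ ≤ |x - m|) (a b : ℕ) :
    ‖∑ n ∈ Finset.Ico a b, ee (n * x)‖ ≤ 1 / (2 * δ) := by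
  set y : ℝ := x - round x
  have hyδ := h (round x)
  have h1 := norm_ee_sub_one_ge (abs_sub_round x)
  rw [← (ee_sub_int x (round x)).symm] at h1
  have hpos : 0 < ‖ee x - 1‖ := by linarith
  rcases le_total a b with hab | hab
  · have h2 : ∑ n ∈ Finset.Ico a b, ee (n * x) = (ee x ^ b - ee x ^ a) / (ee x - 1) := by
      rw [← geom_sum_Ico (fun h0 => by simp [h0] at hpos) hab]
      exact Finset.sum_congr rfl fun n _ => ee_nat_mul n x
    rw [h2, norm_div]
    have h3 : ‖ee x ^ b - ee x ^ a‖ ≤ 2 := by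
      calc _ ≤ ‖ee x ^ b‖ + ‖ee x ^ a‖ := norm_sub_le _ _
        _ = 2 := by simp [norm_pow, norm_ee]; norm_num
    rw [div_le_div_iff₀ hpos (by positivity)]
    nlinarith
  · rw [Finset.Ico_eq_empty_of_le hab]; simp; positivity

lemma sum_range_inv_one_add_sq_le (M : ℕ) : ∑ n ∈ range M, 1 / (1 + (n : ℝ) ^ 2) ≤ 3 := by
  have h : ∀ M, ∑ n ∈ range M, 1 / (1 + (n : ℝ) ^ 2) ≤ 3 - 3 / ((M : ℝ) + 1) := by
    intro M
    induction M with
    | zero => norm_num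
    | succ k ih =>
      rw [sum_range_succ]
      have : 1 / (1 + (k : ℝ) ^ 2) ≤ 3 / (k + 1) - 3 / ((k + 1 : ℕ) + 1) := by
        push_cast
        rw [div_sub_div _ _ (by positivity) (by positivity),
          div_le_div_iff₀ (by positivity) (by positivity)]
        have hk : 0 ≤ (2 * (k : ℝ) - 1) * (k - 1) := by
          rcases Nat.eq_zero_or_pos k with h | h
          · subst h; norm_num
          · have : (1 : ℝ) ≤ k := mod_cast h
            nlinarith
        nlinarith
      linarith
  have := h M
  have h2 : 0 ≤ 3 / ((M : ℝ) + 1) := by positivity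
  linarith

lemma sum_int_inv_one_add_sq_le (F : Finset ℤ) : ∑ j ∈ F, 1 / (1 + (j : ℝ) ^ 2) ≤ 6 := by
  have key : ∀ G : Finset ℤ, Set.InjOn Int.natAbs G →
      ∑ j ∈ G, 1 / (1 + (j : ℝ) ^ 2) ≤ 3 := by
    intro G hG
    have h1 : ∑ j ∈ G, 1 / (1 + (j : ℝ) ^ 2)
        = ∑ n ∈ G.image Int.natAbs, 1 / (1 + (n : ℝ) ^ 2) := by
      rw [sum_image (mod_cast hG)]
      refine sum_congr rfl fun j _ => ?_
      rw [← sq_abs (j : ℝ), cast_natAbs, Int.cast_abs]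
    rw [h1]
    obtain ⟨M, hM⟩ := (G.image Int.natAbs).exists_nat_subset_range
    exact (sum_le_sum_of_subset_of_nonneg hM fun _ _ _ => by positivity).trans
      (sum_range_inv_one_add_sq_le M)
  rw [← sum_filter_add_sum_filter_not F (fun j => 0 ≤ j)]
  have h1 := key (F.filter (fun j => 0 ≤ j)) (by
    intro a ha b hb hab
    simp only [coe_filter, Set.mem_ofPred_eq] at ha hb
    omega)
  have h2 := key (F.filter (fun j => ¬ 0 ≤ j)) (by
    intro a ha b hb hab
    simp only [coe_filter, Set.mem_ofPred_eq] at ha hb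
    omega)
  linarith

/-- A sum over well spaced points on the circle. -/
lemma sum_spaced_le {ι : Type*} (R : Finset ι) (α : ι → ℝ) {δ : ℝ} (hδ : 0 < δ)
    (hs : ∀ r ∈ R, ∀ s ∈ R, r ≠ s → ∀ m : ℤ, δ ≤ |α r - α s - m|) (x : ℝ) :
    ∑ s ∈ R, 1 / (1 + ((x - α s - round (x - α s)) / δ) ^ 2) ≤ 18 := by
  set y : ι → ℝ := fun s => x - α s - round (x - α s) with hy
  have hinj : Set.InjOn (fun s => ⌊y s / δ⌋) R := by
    intro s hsR t htR hst
    by_contra hne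
    have h1 := hs s hsR t htR hne (round (x - α t) - round (x - α s))
    have h2 : α s - α t - ((round (x - α t) - round (x - α s) : ℤ)) = y t - y s := by
      simp only [hy]; push_cast; ring
    rw [h2] at h1
    have h3 := Int.abs_sub_lt_one_of_floor_eq_floor hst
    rw [← sub_div, abs_div, abs_of_pos hδ, div_lt_one hδ, abs_sub_comm] at h3
    linarith
  have h1 : ∀ s ∈ R, 1 / (1 + (y s / δ) ^ 2) ≤ 3 * (1 / (1 + ((⌊y s / δ⌋)) ^ 2)) := by
    intro s _
    have h3 := Int.lt_floor_add_one (y s / δ)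
    set z := y s / δ
    set j : ℝ := ((⌊z⌋) : ℝ)
    rw [mul_one_div, div_le_div_iff₀ (by positivity) (by positivity)]
    nlinarith [sq_nonneg (z + (z - j)), mul_nonneg (sub_nonneg.2 (Int.floor_le (y s / δ))) (sub_nonneg.2 h3.le)]
  calc _ ≤ ∑ s ∈ R, 3 * (1 / (1 + ((⌊y s / δ⌋) : ℝ) ^ 2)) := sum_le_sum h1
    _ = 3 * ∑ j ∈ R.image (fun s => ⌊y s / δ⌋), 1 / (1 + (j : ℝ) ^ 2) := by
        rw [sum_image hinj, mul_sum]
    _ ≤ 3 * 6 := by gcongr; exact sum_int_inv_one_add_sq_le _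
    _ = 18 := by norm_num

/-- Duality principle. -/
lemma duality_bound {ι κ : Type*} (R : Finset ι) (S : Finset κ) (c : ι → κ → ℂ) {D : ℝ}
    (hD : 0 ≤ D)
    (h : ∀ b : ι → ℂ, ∑ n ∈ S, ‖∑ r ∈ R, b r * c r n‖ ^ 2 ≤ D * ∑ r ∈ R, ‖b r‖ ^ 2)
    (a : κ → ℂ) :
    ∑ r ∈ R, ‖∑ n ∈ S, a n * c r n‖ ^ 2 ≤ D * ∑ n ∈ S, ‖a n‖ ^ 2 := by
  set T : ι → ℂ := fun r => ∑ n ∈ S, a n * c r n with hT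
  set X := ∑ r ∈ R, ‖T r‖ ^ 2 with hX
  have hX0 : 0 ≤ X := sum_nonneg fun _ _ => by positivity
  have h1 : X = ∑ n ∈ S, a n * ∑ r ∈ R, (starRingEnd ℂ) (T r) * c r n := by
    simp_rw [mul_sum]
    rw [sum_comm, hX]
    push_cast
    refine sum_congr rfl fun r _ => ?_
    rw [← conj_mul', hT]
    simp only [mul_sum]
    exact sum_congr rfl fun n _ => by ring
  have h2 : X ≤ ∑ n ∈ S, ‖a n‖ * ‖∑ r ∈ R, (starRingEnd ℂ) (T r) * c r n‖ := by
    calc X = ‖(X : ℂ)‖ := by rw [norm_real, norm_of_nonneg hX0]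
      _ ≤ _ := by
        rw [h1]
        exact (norm_sum_le _ _).trans (le_of_eq (sum_congr rfl fun _ _ => norm_mul _ _))
  have h4 := h (fun r => (starRingEnd ℂ) (T r))
  simp only [RCLike.norm_conj] at h4
  have h5 : X ^ 2 ≤ (∑ n ∈ S, ‖a n‖ ^ 2) * (D * X) :=
    (pow_le_pow_left₀ hX0 h2 2).trans ((sum_mul_sq_le_sq_mul_sq S (fun n => ‖a n‖) (fun n => ‖∑ r ∈ R, (starRingEnd ℂ) (T r) * c r n‖)).trans (by gcongr))
  rcases hX0.eq_or_lt with h0 | h0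
  · rw [← h0]; exact mul_nonneg hD (sum_nonneg fun _ _ => by positivity)
  · nlinarith

lemma kernel_bound {N' : ℕ} {δ : ℝ} (hδ : 0 < δ) (hN : 1 / δ ≤ N') (x : ℝ) :
    ‖∑ h ∈ range (2 * N'), ee (h * x)‖ ^ 2 ≤
      8 * N' ^ 2 * (1 / (1 + ((x - round x) / δ) ^ 2)) := by
  set y := x - round x
  have hb1 : ‖∑ h ∈ range (2 * N'), ee (h * x)‖ ≤ 2 * N' := by
    refine (norm_sum_le _ _).trans ?_
    simp [norm_ee]
  have hN' : 1 ≤ N' * δ := by rwa [div_le_iff₀ hδ] at hN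
  rw [mul_one_div, le_div_iff₀ (by positivity)]
  rcases le_or_gt |y| δ with h | h
  · have h1 : (y / δ) ^ 2 ≤ 1 := by
      rw [← sq_abs, abs_div, abs_of_pos hδ]
      exact pow_le_one₀ (by positivity) ((div_le_one hδ).2 h)
    have h2 := pow_le_pow_left₀ (norm_nonneg _) hb1 2
    calc _ ≤ (2 * (N' : ℝ)) ^ 2 * (1 + 1) := by gcongr
      _ = _ := by ring
  · have hypos := hδ.trans h
    have h2 := norm_geom_sum_ee_le hypos (fun m => round_le x m) 0 (2 * N')
    rw [← range_eq_Ico] at h2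
    have h3 := pow_le_pow_left₀ (norm_nonneg _) h2 2
    have h4 : 1 + (y / δ) ^ 2 ≤ 2 * (|y| / δ) ^ 2 := by
      have : 1 ≤ (|y| / δ) ^ 2 := one_le_pow₀ ((one_le_div hδ).2 h.le)
      have h5 : (|y| / δ) ^ 2 = (y / δ) ^ 2 := by rw [div_pow, sq_abs, ← div_pow]
      linarith
    calc _ ≤ (1 / (2 * |y|)) ^ 2 * (2 * (|y| / δ) ^ 2) := by gcongr
      _ = 1 / 2 * (1 / δ) ^ 2 := by field_simp
      _ ≤ 8 * N' ^ 2 := by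
        have := pow_le_pow_left₀ (by positivity) hN 2
        nlinarith [sq_nonneg N']

/-- The dual form of the large sieve inequality. -/
lemma large_sieve_dual {ι : Type*} (R : Finset ι) (α : ι → ℝ) {δ : ℝ} (hδ : 0 < δ)
    (hs : ∀ r ∈ R, ∀ s ∈ R, r ≠ s → ∀ m : ℤ, δ ≤ |α r - α s - m|) (M : ℤ) {N N' : ℕ}
    (hN : N ≤ N') (hN' : 1 / δ ≤ N') (b : ι → ℂ) :
    ∑ n ∈ Ico M (M + N), ‖∑ r ∈ R, b r * ee (n * α r)‖ ^ 2 ≤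
      (144 * N') * ∑ r ∈ R, ‖b r‖ ^ 2 := by
  set B : ℤ → ℂ := fun n => ∑ r ∈ R, b r * ee (n * α r) with hB
  set H := 2 * N'
  have h1 : N' * ∑ n ∈ Ico M (M + N), ‖B n‖ ^ 2 ≤
      ∑ h' ∈ range H, ∑ h ∈ range H, ‖B (M + h - h')‖ ^ 2 := by
    calc N' * ∑ n ∈ Ico M (M + N), ‖B n‖ ^ 2
        = ∑ h' ∈ range N', ∑ n ∈ Ico M (M + N), ‖B n‖ ^ 2 := by simp
      _ ≤ ∑ h' ∈ range N', ∑ h ∈ range H, ‖B (M + h - h')‖ ^ 2 := by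
        refine sum_le_sum fun h' hh' => ?_
        rw [mem_range] at hh'
        have hinj : Set.InjOn (fun h : ℕ => M + h - h') (range H) := by
          intro u _ v _ huv
          simp only at huv; omega
        rw [← sum_image (f := fun n => ‖B n‖ ^ 2) hinj]
        refine sum_le_sum_of_subset_of_nonneg ?_ fun _ _ _ => by positivity
        intro n hn
        rw [mem_Ico] at hn
        rw [mem_image]
        exact ⟨(n - M + h').toNat, by rw [mem_range]; omega, by omega⟩
      _ ≤ _ := sum_le_sum_of_subset_of_nonneg (range_subset_range.2 (by omega))
          fun _ _ _ => sum_nonneg fun _ _ => by positivity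
  have h2 : ((∑ h' ∈ range H, ∑ h ∈ range H, ‖B (M + h - h')‖ ^ 2)) =
      ∑ r ∈ R, ∑ s ∈ R, b r * (starRingEnd ℂ) (b s) * ee (M * (α r - α s)) *
        (‖∑ h ∈ range H, ee (h * (α r - α s))‖ ^ 2 : ℝ) := by
    have e1 : ∀ h' h : ℕ, ((‖B (M + h - h')‖ ^ 2 : ℝ)) =
        ∑ r ∈ R, ∑ s ∈ R, b r * (starRingEnd ℂ) (b s) * ee (M * (α r - α s)) *
          (ee (h * (α r - α s)) * (starRingEnd ℂ) (ee (h' * (α r - α s)))) := by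
      intro h' h
      push_cast
      rw [← mul_conj', hB]
      simp only [map_sum, map_mul, sum_mul_sum]
      refine sum_congr rfl fun r _ => sum_congr rfl fun s _ => ?_
      rw [conj_ee, conj_ee]
      have : ee (M * (α r - α s)) * (ee (h * (α r - α s)) * ee (-(h' * (α r - α s)))) =
          ee ((M + h - h' : ℤ) * α r) * ee (-((M + h - h' : ℤ) * α s)) := by
        rw [← ee_add, ← ee_add, ← ee_add]; congr 1; push_cast; ring
      linear_combination (-(b r * (starRingEnd ℂ) (b s))) * this
    rw [ofReal_sum]
    simp_rw [ofReal_sum, e1]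
    have e2 : ∀ r s, ((‖∑ h ∈ range H, ee (h * (α r - α s))‖ ^ 2 : ℝ)) =
        ∑ h' ∈ range H, ∑ h ∈ range H,
          ee (h * (α r - α s)) * (starRingEnd ℂ) (ee (h' * (α r - α s))) := by
      intro r s
      push_cast
      rw [← mul_conj', map_sum, sum_mul_sum, sum_comm]
    simp_rw [e2, mul_sum]
    have e3 : ∀ f : ℕ → ℕ → ι → ι → ℂ,
        ∑ h' ∈ range H, ∑ h ∈ range H, ∑ r ∈ R, ∑ s ∈ R, f h' h r s =
        ∑ r ∈ R, ∑ s ∈ R, ∑ h' ∈ range H, ∑ h ∈ range H, f h' h r s := by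
      intro f
      calc _ = ∑ h' ∈ range H, ∑ r ∈ R, ∑ s ∈ R, ∑ h ∈ range H, f h' h r s := by
            refine sum_congr rfl fun h' _ => ?_
            rw [sum_comm]
            exact sum_congr rfl fun r _ => sum_comm
        _ = _ := by
            rw [sum_comm]
            exact sum_congr rfl fun r _ => sum_comm
    rw [e3]
  have h3 : ∑ h' ∈ range H, ∑ h ∈ range H, ‖B (M + h - h')‖ ^ 2 ≤
      ∑ r ∈ R, ∑ s ∈ R, ‖b r‖ * ‖b s‖ *
        (8 * N' ^ 2 * (1 / (1 + ((α r - α s - round (α r - α s)) / δ) ^ 2))) := by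
    calc _ = ‖((∑ h' ∈ range H, ∑ h ∈ range H, ‖B (M + h - h')‖ ^ 2 : ℝ) : ℂ)‖ := by
          rw [norm_real, norm_of_nonneg (sum_nonneg fun _ _ => sum_nonneg fun _ _ => by positivity)]
      _ ≤ _ := by
          rw [h2]
          refine (norm_sum_le _ _).trans (sum_le_sum fun r _ => ?_)
          refine (norm_sum_le _ _).trans (sum_le_sum fun s _ => ?_)
          rw [norm_mul, norm_mul, norm_mul, norm_ee, RCLike.norm_conj, mul_one,
            norm_real, norm_of_nonneg (by positivity)]
          gcongr
          exact kernel_bound hδ hN' _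
  have hsym : ∀ r s, (α r - α s - round (α r - α s)) ^ 2 = (α s - α r - round (α s - α r)) ^ 2 := by
    intro r s
    have h1 := round_le (α r - α s) (-round (α s - α r))
    have h2 := round_le (α s - α r) (-round (α r - α s))
    rw [← sq_abs, ← sq_abs (α s - α r - _)]
    have h3 : |α r - α s - ((-round (α s - α r) : ℤ))| = |α s - α r - round (α s - α r)| := by
      rw [← abs_neg]; congr 1; push_cast; ring
    have h4 : |α s - α r - ((-round (α r - α s) : ℤ))| = |α r - α s - round (α r - α s)| := by
      rw [← abs_neg]; congr 1; push_cast; ring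
    rw [h3] at h1; rw [h4] at h2
    rw [le_antisymm h1 h2]
  set K : ι → ι → ℝ := fun r s => 1 / (1 + ((α r - α s - round (α r - α s)) / δ) ^ 2) with hK
  have hKs : ∀ r s, K r s = K s r := by
    intro r s; simp only [hK, div_pow]; rw [hsym]
  have h4 : ∑ r ∈ R, ∑ s ∈ R, ‖b r‖ * ‖b s‖ * (8 * N' ^ 2 * K r s) ≤
      8 * N' ^ 2 * (18 * ∑ r ∈ R, ‖b r‖ ^ 2) := by
    calc _ ≤ ∑ r ∈ R, ∑ s ∈ R, 8 * N' ^ 2 *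
          ((‖b r‖ ^ 2 * K r s) / 2 + (‖b s‖ ^ 2 * K s r) / 2) := by
          refine sum_le_sum fun r _ => sum_le_sum fun s _ => ?_
          rw [hKs s r]
          have h5 : ‖b r‖ * ‖b s‖ ≤ (‖b r‖ ^ 2 + ‖b s‖ ^ 2) / 2 := by
            nlinarith [sq_nonneg (‖b r‖ - ‖b s‖)]
          calc _ ≤ ((‖b r‖ ^ 2 + ‖b s‖ ^ 2) / 2) * (8 * N' ^ 2 * K r s) := by
                have := (fun r s => by simp only [hK]; positivity : ∀ r s, 0 ≤ K r s) r s
                gcongr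
            _ = _ := by ring
      _ = 8 * N' ^ 2 * ∑ r ∈ R, ‖b r‖ ^ 2 * ∑ s ∈ R, K r s := by
          simp_rw [← mul_sum, sum_add_distrib]
          rw [sum_comm (f := fun r s => ‖b s‖ ^ 2 * K s r / 2), ← sum_add_distrib]
          congr 1
          refine sum_congr rfl fun r _ => ?_
          rw [← sum_add_distrib, mul_sum]
          exact sum_congr rfl fun s _ => by ring
      _ ≤ 8 * N' ^ 2 * ∑ r ∈ R, ‖b r‖ ^ 2 * 18 := by
          gcongr with r _; exact (fun r => sum_spaced_le R α hδ hs (α r)) r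
      _ = _ := by rw [← sum_mul]; ring
  exact le_of_mul_le_mul_left ((h1.trans (h3.trans h4)).trans (le_of_eq (by ring))) (lt_of_lt_of_le (by positivity) hN')

/-- The large sieve inequality for well spaced points. -/
theorem large_sieve_additive {ι : Type*} (R : Finset ι) (α : ι → ℝ) {δ : ℝ} (hδ : 0 < δ)
    (hs : ∀ r ∈ R, ∀ s ∈ R, r ≠ s → ∀ m : ℤ, δ ≤ |α r - α s - m|) (M : ℤ) (N : ℕ)
    (a : ℤ → ℂ) :
    ∑ r ∈ R, ‖∑ n ∈ Ico M (M + N), a n * ee (n * α r)‖ ^ 2 ≤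
      288 * (N + 1 / δ) * ∑ n ∈ Ico M (M + N), ‖a n‖ ^ 2 := by
  rcases Nat.eq_zero_or_pos N with h0 | h0
  · subst h0; simp
  have h1 : 1 / δ ≤ (N + ⌈1 / δ⌉₊ : ℕ) := by
    push_cast
    have := le_ceil (1 / δ)
    have h2 : 0 ≤ N := by positivity
    linarith
  refine (duality_bound R (Ico M (M + N)) (fun r n => ee (n * α r)) (by positivity) (fun b => large_sieve_dual R α hδ hs M (by omega) h1 b) a).trans ?_
  have h3 : ((N + ⌈1 / δ⌉₊ : ℕ)) ≤ 2 * (N + 1 / δ) := by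
    push_cast
    have h4 := ceil_lt_add_one (a := 1 / δ) (by positivity)
    have h5 : (1 : ℝ) ≤ N := mod_cast h0
    have h6 : 0 ≤ 1 / δ := by positivity
    linarith
  have h4 : 0 ≤ ∑ n ∈ Ico M (M + N), ‖a n‖ ^ 2 := sum_nonneg fun _ _ => by positivity
  nlinarith

/-- Reordering a sum over divisor pairs of integers up to `x`. -/
lemma sum_Icc_divisorsAntidiagonal {M : Type*} [AddCommMonoid M] (x : ℕ) (f : ℕ → ℕ → M) :
    ∑ n ∈ Icc 1 x, ∑ p ∈ n.divisorsAntidiagonal, f p.1 p.2 =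
      ∑ d ∈ Icc 1 x, ∑ e ∈ Icc 1 (x / d), f d e := by
  rw [sum_sigma', sum_sigma']
  refine sum_bij' (fun a _ => ⟨a.2.1, a.2.2⟩) (fun b _ => ⟨b.1 * b.2, (b.1, b.2)⟩) ?_ ?_ ?_ ?_ ?_
  · rintro ⟨n, d, e⟩ h
    simp only [mem_sigma, mem_Icc, mem_divisorsAntidiagonal] at h ⊢
    obtain ⟨⟨h1, h2⟩, h3, h4⟩ := h
    have hd : 0 < d := Nat.pos_of_ne_zero (by rintro rfl; simp at h3; omega)
    have he : 0 < e := Nat.pos_of_ne_zero (by rintro rfl; simp at h3; omega)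
    refine ⟨⟨hd, ?_⟩, he, ?_⟩
    · exact (Nat.le_mul_of_pos_right d he).trans (h3.le.trans h2)
    · rw [Nat.le_div_iff_mul_le hd, mul_comm]; exact h3.le.trans h2
  · rintro ⟨d, e⟩ h
    simp only [mem_sigma, mem_Icc, mem_divisorsAntidiagonal] at h ⊢
    obtain ⟨⟨h1, h2⟩, h3, h4⟩ := h
    rw [Nat.le_div_iff_mul_le h1, mul_comm] at h4
    have := Nat.mul_pos h1 h3
    exact ⟨⟨this, h4⟩, trivial, by omega⟩
  · rintro ⟨n, d, e⟩ h
    simp only [mem_sigma, mem_Icc, mem_divisorsAntidiagonal] at h ⊢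
    simp [h.2.1]
  · rintro ⟨d, e⟩ h; rfl
  · rintro ⟨n, d, e⟩ h; rfl

/-- The number of divisors. -/
def tau (n : ℕ) : ℕ := n.divisors.card

lemma tau_mul_le (m n : ℕ) : tau (m * n) ≤ tau m * tau n := by
  unfold tau
  rw [divisors_mul]
  exact Finset.card_mul_le

lemma tau_pos {n : ℕ} (h : n ≠ 0) : 1 ≤ tau n := by
  unfold tau
  exact Finset.card_pos.2 ⟨1, by simp [h]⟩

lemma tau_eq_sum (n : ℕ) : (tau n : ℝ) = ∑ _p ∈ n.divisorsAntidiagonal, 1 := by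
  rw [tau, ← map_div_right_divisors]; simp

lemma sum_tau_pow_mul_le (w : ℕ → ℝ) (hw : ∀ n, 0 ≤ w n) (hmul : ∀ m n, w (m * n) = w m * w n)
    (x j : ℕ) :
    ∑ n ∈ Icc 1 x, (tau n) ^ j * w n ≤ (∑ n ∈ Icc 1 x, w n) ^ (2 ^ j) := by
  induction j with
  | zero => simp
  | succ j ih =>
    calc ∑ n ∈ Icc 1 x, (tau n) ^ (j + 1) * w n
        = ∑ n ∈ Icc 1 x, ∑ p ∈ n.divisorsAntidiagonal, (tau (p.1 * p.2)) ^ j * w (p.1 * p.2) := by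
          refine sum_congr rfl fun n _ => ?_
          rw [pow_succ, mul_assoc, mul_comm (tau n : ℝ) (w n), ← mul_assoc, tau_eq_sum n, mul_sum]
          refine sum_congr rfl fun p hp => ?_
          rw [(mem_divisorsAntidiagonal.1 hp).1, ← tau_eq_sum, mul_one]
      _ = ∑ d ∈ Icc 1 x, ∑ e ∈ Icc 1 (x / d), (tau (d * e)) ^ j * w (d * e) :=
          sum_Icc_divisorsAntidiagonal x fun d e => (tau (d * e)) ^ j * w (d * e)
      _ ≤ ∑ d ∈ Icc 1 x, ∑ e ∈ Icc 1 x, ((tau d) ^ j * w d) * ((tau e) ^ j * w e) := by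
          refine sum_le_sum fun d _ => ?_
          calc _ ≤ ∑ e ∈ Icc 1 (x / d), ((tau d) ^ j * w d) * ((tau e) ^ j * w e) := by
                refine sum_le_sum fun e _ => ?_
                have h1 : (tau (d * e) : ℝ) ≤ tau d * tau e := mod_cast tau_mul_le d e
                calc _ ≤ ((tau d) * tau e) ^ j * (w d * w e) := by
                      rw [hmul]
                      have := mul_nonneg (hw d) (hw e)
                      gcongr
                  _ = _ := by ring
            _ ≤ _ := by
                refine sum_le_sum_of_subset_of_nonneg (Icc_subset_Icc_right (Nat.div_le_self _ _)) ?_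
                intro e _ _
                have := hw d
                have := hw e
                positivity
      _ = (∑ d ∈ Icc 1 x, (tau d) ^ j * w d) ^ 2 := by rw [sq, sum_mul_sum]
      _ ≤ ((∑ n ∈ Icc 1 x, w n) ^ (2 ^ j)) ^ 2 := by
          refine pow_le_pow_left₀ (sum_nonneg fun d _ => ?_) ih 2
          have := hw d
          positivity
      _ = _ := by rw [← pow_mul, pow_succ 2 j]

lemma sum_inv_le_log (x : ℕ) : ∑ n ∈ Icc 1 x, (1 : ℝ) / n ≤ 1 + log x := by
  have := harmonic_le_one_add_log x
  rw [harmonic_eq_sum_Icc] at this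
  push_cast at this
  simpa [one_div] using this

lemma one_add_log_nonneg (x : ℕ) : 0 ≤ 1 + log x := by
  have := log_natCast_nonneg x
  linarith

lemma sum_tau_pow_div_le (x j : ℕ) :
    ∑ n ∈ Icc 1 x, (tau n : ℝ) ^ j / n ≤ (1 + log x) ^ (2 ^ j) := by
  have h := sum_tau_pow_mul_le (fun n => 1 / n) (fun n => by positivity)
    (fun m n => by push_cast; rw [one_div_mul_one_div]) x j
  simp only [mul_one_div] at h
  refine h.trans (pow_le_pow_left₀ (sum_nonneg fun _ _ => by positivity) (sum_inv_le_log x) _)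

lemma sum_tau_pow_le (x j : ℕ) :
    ∑ n ∈ Icc 1 x, (tau n : ℝ) ^ j ≤ x * (1 + log x) ^ (2 ^ j) := by
  induction j generalizing x with
  | zero =>
    have := log_natCast_nonneg x
    simp only [pow_zero, sum_const, card_Icc, nsmul_eq_mul, mul_one, pow_one]
    push_cast
    have hx : 0 ≤ x := by positivity
    nlinarith
  | succ j ih =>
    calc ∑ n ∈ Icc 1 x, (tau n : ℝ) ^ (j + 1)
        = ∑ n ∈ Icc 1 x, ∑ p ∈ n.divisorsAntidiagonal, (tau (p.1 * p.2) : ℝ) ^ j := by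
          refine sum_congr rfl fun n _ => ?_
          rw [pow_succ, tau_eq_sum n, mul_sum]
          refine sum_congr rfl fun p hp => ?_
          rw [(mem_divisorsAntidiagonal.1 hp).1, ← tau_eq_sum, mul_one]
      _ = ∑ d ∈ Icc 1 x, ∑ e ∈ Icc 1 (x / d), (tau (d * e) : ℝ) ^ j :=
          sum_Icc_divisorsAntidiagonal x fun d e => (tau (d * e) : ℝ) ^ j
      _ ≤ ∑ d ∈ Icc 1 x, (tau d) ^ j * ∑ e ∈ Icc 1 (x / d), (tau e : ℝ) ^ j := by
          refine sum_le_sum fun d _ => ?_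
          rw [mul_sum]
          refine sum_le_sum fun e _ => ?_
          have h1 : (tau (d * e) : ℝ) ≤ tau d * tau e := mod_cast tau_mul_le d e
          rw [← mul_pow]
          gcongr
      _ ≤ ∑ d ∈ Icc 1 x, (tau d) ^ j * ((x / d) * (1 + log x) ^ (2 ^ j)) := by
          refine sum_le_sum fun d hd => ?_
          rw [mem_Icc] at hd
          refine mul_le_mul_of_nonneg_left ((ih (x / d)).trans ?_) (by positivity)
          have h2 : log (x / d : ℕ) ≤ log x := by
            rcases Nat.eq_zero_or_pos (x / d) with h | h
            · rw [h]; simpa using log_natCast_nonneg x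
            · exact log_le_log (mod_cast h)
                (mod_cast Nat.div_le_self x d)
          exact mul_le_mul cast_div_le (pow_le_pow_left₀ (one_add_log_nonneg (x / d)) (by linarith) _) (by positivity)
            (by positivity)
      _ = x * (1 + log x) ^ (2 ^ j) * ∑ d ∈ Icc 1 x, (tau d : ℝ) ^ j / d := by
          rw [mul_sum]
          exact sum_congr rfl fun d _ => by ring
      _ ≤ x * (1 + log x) ^ (2 ^ j) * (1 + log x) ^ (2 ^ j) := by
          have := one_add_log_nonneg x
          gcongr
          exact sum_tau_pow_div_le x j
      _ = _ := by ring

lemma le_totient_mul_tau (n : ℕ) : n ≤ n.totient * tau n := by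
  rcases Nat.eq_zero_or_pos n with h | h
  · simp [h]
  calc n = ∑ d ∈ n.divisors, d.totient := (sum_totient n).symm
    _ ≤ ∑ _d ∈ n.divisors, n.totient := sum_le_sum fun d hd =>
        le_of_dvd (totient_pos.2 h) (totient_dvd_of_dvd (dvd_of_mem_divisors hd))
    _ = _ := by rw [sum_const, smul_eq_mul, mul_comm, tau]

lemma inv_totient_le (n : ℕ) : 1 / (φ n : ℝ) ≤ tau n / n := by
  rcases Nat.eq_zero_or_pos n with h | h
  · simp [h]
  rw [div_le_div_iff₀ (mod_cast totient_pos.2 h) (mod_cast h), one_mul, mul_comm]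
  exact_mod_cast le_totient_mul_tau n

lemma sum_inv_totient_le (x : ℕ) :
    ∑ n ∈ Icc 1 x, 1 / (φ n : ℝ) ≤ (1 + log x) ^ 2 := by
  have := sum_tau_pow_div_le x 1
  simp only [pow_one] at this
  exact (sum_le_sum fun n _ => inv_totient_le n).trans this

lemma sum_filter_dvd_Icc {M : Type*} [AddCommMonoid M] (x : ℕ) {d : ℕ} (hd : 0 < d) (f : ℕ → M) :
    ∑ k ∈ (Icc 1 x).filter (d ∣ ·), f k = ∑ j ∈ Icc 1 (x / d), f (d * j) := by
  symm
  refine sum_bij (fun j _ => d * j) ?_ ?_ ?_ ?_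
  · intro j hj
    simp only [mem_filter, mem_Icc] at hj ⊢
    rw [Nat.le_div_iff_mul_le hd, mul_comm] at hj
    exact ⟨⟨Nat.mul_pos hd hj.1, hj.2⟩, dvd_mul_right _ _⟩
  · intro a _ b _ h
    exact Nat.eq_of_mul_eq_mul_left hd h
  · intro k hk
    simp only [mem_filter, mem_Icc] at hk
    obtain ⟨⟨h1, h2⟩, j, rfl⟩ := hk
    refine ⟨j, ?_, rfl⟩
    rw [mem_Icc, Nat.le_div_iff_mul_le hd, mul_comm]
    exact ⟨Nat.pos_of_mul_pos_left h1, h2⟩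
  · intros; rfl

lemma sum_filter_dvd_inv_totient_le (x : ℕ) {d : ℕ} (hd : 0 < d) :
    ∑ k ∈ (Icc 1 x).filter (d ∣ ·), 1 / (φ k : ℝ) ≤
      1 / (φ d) * (1 + log x) ^ 2 := by
  rw [sum_filter_dvd_Icc x hd]
  have hd' : 0 < d.totient := mod_cast totient_pos.2 hd
  calc ∑ j ∈ Icc 1 (x / d), 1 / ((d * j).totient : ℝ)
      ≤ ∑ j ∈ Icc 1 (x / d), 1 / (φ d : ℝ) * (1 / (φ j)) := by
        refine sum_le_sum fun j hj => ?_
        have hj' : 0 < j.totient := by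
          exact_mod_cast totient_pos.2 (mem_Icc.1 hj).1
        rw [one_div_mul_one_div]
        refine one_div_le_one_div_of_le (by positivity) ?_
        exact_mod_cast totient_super_multiplicative d j
    _ ≤ ∑ j ∈ Icc 1 x, 1 / (φ d : ℝ) * (1 / (φ j)) :=
        sum_le_sum_of_subset_of_nonneg (Icc_subset_Icc_right (Nat.div_le_self _ _))
          fun _ _ _ => by positivity
    _ ≤ _ := by
        rw [← mul_sum]
        gcongr
        exact sum_inv_totient_le x

lemma sum_filter_dvd_inv_le (x : ℕ) {d : ℕ} (hd : 0 < d) :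
    ∑ k ∈ (Icc 1 x).filter (d ∣ ·), 1 / (k : ℝ) ≤ 1 / d * (1 + log x) := by
  rw [sum_filter_dvd_Icc x hd]
  calc ∑ j ∈ Icc 1 (x / d), 1 / ((d * j : ℕ) : ℝ)
      = ∑ j ∈ Icc 1 (x / d), 1 / (d : ℝ) * (1 / j) := by
        refine sum_congr rfl fun j hj => ?_
        push_cast
        rw [one_div_mul_one_div]
    _ ≤ ∑ j ∈ Icc 1 x, 1 / (d : ℝ) * (1 / j) :=
        sum_le_sum_of_subset_of_nonneg (Icc_subset_Icc_right (Nat.div_le_self _ _))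
          fun _ _ _ => by positivity
    _ ≤ _ := by
        rw [← mul_sum]
        gcongr
        exact sum_inv_le_log x

/-- Partial summation with weight `1/q`. -/
lemma sum_div_le_of_sum_le (S : ℕ → ℝ) (hS : ∀ q, 0 ≤ S q) {R K : ℕ} (hR : 1 ≤ R) {a b c : ℝ}
    (ha : 0 ≤ a) (hb : 0 ≤ b) (hc : 0 ≤ c)
    (h : ∀ P, R < P → P ≤ K → ∑ q ∈ Icc 1 P, S q ≤ a + b * P + c * P ^ 2) :
    ∑ q ∈ Ioc R K, S q / q ≤ a / R + b * (2 + log K) + 2 * c * K := by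
  have hlog := log_natCast_nonneg K
  rcases le_or_gt K R with hKR | hKR
  · rw [Ioc_eq_empty_of_le hKR]; simp; positivity
  have abel : ∀ K, R + 1 ≤ K → ∑ q ∈ Ioc R K, S q / q ≤
      (∑ q ∈ Icc 1 K, S q) / K + ∑ m ∈ Ico (R + 1) K, (∑ q ∈ Icc 1 m, S q) / (m * (m + 1)) := by
    intro K hK
    induction K, hK using le_induction with
    | base =>
      rw [(by ext; simp : Ioc R (R + 1) = {R + 1})]
      simp only [sum_singleton, Ico_self, sum_empty, add_zero]
      gcongr
      exact single_le_sum (fun q _ => hS q) (by simp)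
    | succ K hK ih =>
      rw [(by ext; simp; omega : Ioc R (K + 1) = insert (K + 1) (Ioc R K)), sum_insert (by simp), (by ext; simp; omega : Icc 1 (K + 1) = insert (K + 1) (Icc 1 K)), sum_insert (by simp), sum_Ico_succ_top hK]
      have hK0 : 0 < K := mod_cast (by omega)
      have e3 : (∑ q ∈ Icc 1 K, S q) / K =
          (∑ q ∈ Icc 1 K, S q) / ((K + 1 : ℕ)) + (∑ q ∈ Icc 1 K, S q) / (K * (K + 1)) := by
        push_cast; field_simp
      rw [add_div]
      linarith
  have tele : ∀ K, R + 1 ≤ K → 1 / K + ∑ m ∈ Ico (R + 1) K, 1 / ((m : ℝ) * (m + 1)) =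
      1 / (R + 1) := by
    intro K hK
    induction K, hK using le_induction with
    | base => simp
    | succ K hK ih =>
      rw [sum_Ico_succ_top hK, ← ih]
      have hK0 : 0 < K := mod_cast (by omega)
      push_cast; field_simp; ring
  have hK0 : (0 : ℝ) < K := mod_cast (by omega)
  have hR0 : 0 < R := mod_cast hR
  refine (abel K hKR).trans ?_
  have h1 : (∑ q ∈ Icc 1 K, S q) / K ≤ a * (1 / K) + b + c * K := by
    rw [div_le_iff₀ hK0]
    refine (h K hKR le_rfl).trans (le_of_eq ?_)
    field_simp
  have h2 : ∑ m ∈ Ico (R + 1) K, (∑ q ∈ Icc 1 m, S q) / (m * (m + 1)) ≤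
      ∑ m ∈ Ico (R + 1) K, (a * (1 / (m * (m + 1))) + b * (1 / m) + c) := by
    refine sum_le_sum fun m hm => ?_
    rw [mem_Ico] at hm
    have hm0 : 0 < m := mod_cast (by omega)
    rw [div_le_iff₀ (by positivity)]
    refine (h m (by omega) (by omega)).trans ?_
    rw [(by field_simp : (a * (1 / (m * (m + 1))) + b * (1 / m) + c) * (m * (m + 1)) = a + b * (m + 1) + c * (m * (m + 1)))]
    nlinarith
  have h3 : ∑ m ∈ Ico (R + 1) K, (a * (1 / (m * (m + 1))) + b * (1 / m) + c) ≤
      a * ∑ m ∈ Ico (R + 1) K, 1 / ((m : ℝ) * (m + 1)) + b * (1 + log K) + c * K := by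
    rw [sum_add_distrib, sum_add_distrib, ← mul_sum, ← mul_sum, sum_const, nsmul_eq_mul]
    have h4 : ∑ m ∈ Ico (R + 1) K, 1 / (m : ℝ) ≤ 1 + log K := by
      refine (sum_le_sum_of_subset_of_nonneg ?_ fun _ _ _ => by positivity).trans (sum_inv_le_log K)
      intro m hm
      rw [mem_Ico] at hm; rw [mem_Icc]; omega
    have h5 : ((Ico (R + 1) K).card : ℝ) ≤ K := by
      rw [card_Ico]; exact_mod_cast sub_le _ _
    have := mul_le_mul_of_nonneg_left h4 hb
    have := mul_le_mul_of_nonneg_right h5 hc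
    linarith
  have h6 : a * (1 / K) + a * ∑ m ∈ Ico (R + 1) K, 1 / ((m : ℝ) * (m + 1)) ≤ a / R := by
    rw [← mul_add, tele K hKR, mul_one_div]
    gcongr
    linarith
  linarith

lemma lt_indicator_eq_sum (J : ℕ) : ∀ m t, t < 2 ^ J →
    (if m < t then (1 : ℂ) else 0) =
      ∑ j ∈ range J, if (t / 2 ^ j) % 2 = 1 ∧ m / 2 ^ j + 1 = t / 2 ^ j then 1 else 0 := by
  induction J with
  | zero => intro m t ht; simp at ht; simp [ht]
  | succ J ih =>
    intro m t ht
    rw [sum_range_succ']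
    have h2 : ∀ a j, a / 2 ^ (j + 1) = a / 2 / 2 ^ j := by
      intro a j; rw [pow_succ', Nat.div_div_eq_div_mul]
    simp only [h2, ← ih (m / 2) (t / 2) (by rw [pow_succ] at ht; omega), pow_zero, Nat.div_one]
    by_cases h3 : m / 2 < t / 2
    · have h4 : ¬ (t % 2 = 1 ∧ m + 1 = t) := by omega
      have h5 : m < t := by omega
      simp [h3, h4, h5]
    · by_cases h4 : t % 2 = 1 ∧ m + 1 = t
      · have h5 : m < t := by omega
        simp [h3, h4, h5]
      · have h5 : ¬ m < t := by omega
        simp [h3, h4, h5]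

/-- A bilinear estimate remains true, up to a logarithmic factor, when one variable is
restricted by a threshold depending on the other one. -/
lemma bilinear_threshold {ρ : Type*} (Q : Finset ρ) (w : ρ → ℝ) (hw : ∀ r ∈ Q, 0 ≤ w r)
    (G : ρ → ℕ → ℕ → ℂ) (S T : Finset ℕ) {D : ℝ} (hD : 0 ≤ D)
    (h : ∀ u v : ℕ → ℂ, ∑ r ∈ Q, w r * ‖∑ c ∈ S, ∑ m ∈ T, u c * v m * G r c m‖ ≤
      D * (√(∑ c ∈ S, ‖u c‖ ^ 2) * √(∑ m ∈ T, ‖v m‖ ^ 2)))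
    (t : ℕ → ℕ) (J : ℕ) (ht : ∀ c ∈ S, t c < 2 ^ J) (u v : ℕ → ℂ) :
    ∑ r ∈ Q, w r * ‖∑ c ∈ S, ∑ m ∈ T with m < t c, u c * v m * G r c m‖ ≤
      J * (D * (√(∑ c ∈ S, ‖u c‖ ^ 2) * √(∑ m ∈ T, ‖v m‖ ^ 2))) := by
  set us : ℕ → ℕ → ℕ → ℂ := fun j s c =>
    if (t c / 2 ^ j) % 2 = 1 ∧ t c / 2 ^ j = s + 1 then u c else 0 with hus
  set vs : ℕ → ℕ → ℕ → ℂ := fun j s m => if m / 2 ^ j = s then v m else 0 with hvs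
  set I : ℕ → Finset ℕ := fun j => T.image (fun m => m / 2 ^ j)
  have key : ∀ r, ∑ c ∈ S, ∑ m ∈ T with m < t c, u c * v m * G r c m =
      ∑ j ∈ range J, ∑ s ∈ I j, ∑ c ∈ S, ∑ m ∈ T, us j s c * vs j s m * G r c m := by
    intro r
    have e1 : ∀ c ∈ S, ∑ m ∈ T with m < t c, u c * v m * G r c m =
        ∑ j ∈ range J, ∑ s ∈ I j, ∑ m ∈ T, us j s c * vs j s m * G r c m := by
      intro c hc
      rw [sum_filter]
      calc _ = ∑ m ∈ T, ∑ j ∈ range J, ∑ s ∈ I j, us j s c * vs j s m * G r c m := by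
            refine sum_congr rfl fun m hm => ?_
            have e3 : (if m < t c then u c * v m * G r c m else 0) =
                (if m < t c then 1 else 0) * (u c * v m * G r c m) := by
              split_ifs <;> simp
            rw [e3, lt_indicator_eq_sum J m (t c) (ht c hc), sum_mul]
            refine sum_congr rfl fun j _ => ?_
            rw [sum_eq_single (m / 2 ^ j)]
            · simp only [hus, hvs, if_true]
              by_cases h5 : t c / 2 ^ j % 2 = 1 ∧ m / 2 ^ j + 1 = t c / 2 ^ j
              · rw [if_pos h5, if_pos ⟨h5.1, h5.2.symm⟩, one_mul]
              · rw [if_neg h5, if_neg (fun h6 => h5 ⟨h6.1, h6.2.symm⟩)]; simp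
            · intro s _ hs
              simp only [hvs]
              rw [if_neg (Ne.symm hs)]; simp
            · intro h6
              exact absurd (mem_image_of_mem _ hm) h6
        _ = _ := by
            rw [sum_comm]
            exact sum_congr rfl fun j _ => sum_comm
    rw [sum_congr rfl e1, sum_comm]
    exact sum_congr rfl fun j _ => sum_comm
  have hU : ∀ j, ∑ s ∈ I j, ∑ c ∈ S, ‖us j s c‖ ^ 2 ≤ ∑ c ∈ S, ‖u c‖ ^ 2 := by
    intro j
    rw [sum_comm]
    refine sum_le_sum fun c _ => ?_
    calc ∑ s ∈ I j, ‖us j s c‖ ^ 2 ≤ ∑ s ∈ I j, if s = t c / 2 ^ j - 1 then ‖u c‖ ^ 2 else 0 := by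
          refine sum_le_sum fun s _ => ?_
          simp only [hus]
          split_ifs with h1 h2 h2
          · exact le_rfl
          · omega
          · simp
          · simp
      _ ≤ _ := by
          rw [sum_ite_eq']
          split_ifs
          · exact le_rfl
          · positivity
  have hV : ∀ j, ∑ s ∈ I j, ∑ m ∈ T, ‖vs j s m‖ ^ 2 ≤ ∑ m ∈ T, ‖v m‖ ^ 2 := by
    intro j
    rw [sum_comm]
    refine sum_le_sum fun m _ => ?_
    calc ∑ s ∈ I j, ‖vs j s m‖ ^ 2 ≤ ∑ s ∈ I j, if s = m / 2 ^ j then ‖v m‖ ^ 2 else 0 := by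
          refine sum_le_sum fun s _ => ?_
          simp only [hvs]
          split_ifs with h1 h2 h2
          · exact le_rfl
          · exact absurd h1.symm h2
          · simp
          · simp
      _ ≤ _ := by
          rw [sum_ite_eq']
          split_ifs
          · exact le_rfl
          · positivity
  have lvl : ∀ j, ∑ r ∈ Q, w r * ‖∑ s ∈ I j, ∑ c ∈ S, ∑ m ∈ T, us j s c * vs j s m * G r c m‖ ≤
      D * (√(∑ c ∈ S, ‖u c‖ ^ 2) * √(∑ m ∈ T, ‖v m‖ ^ 2)) := by
    intro j
    calc _ ≤ ∑ r ∈ Q, ∑ s ∈ I j, w r * ‖∑ c ∈ S, ∑ m ∈ T, us j s c * vs j s m * G r c m‖ := by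
          refine sum_le_sum fun r hr => ?_
          rw [← mul_sum]
          exact mul_le_mul_of_nonneg_left (norm_sum_le _ _) (hw r hr)
      _ = ∑ s ∈ I j, ∑ r ∈ Q, w r * ‖∑ c ∈ S, ∑ m ∈ T, us j s c * vs j s m * G r c m‖ := sum_comm
      _ ≤ ∑ s ∈ I j, D * (√(∑ c ∈ S, ‖us j s c‖ ^ 2) * √(∑ m ∈ T, ‖vs j s m‖ ^ 2)) :=
          sum_le_sum fun s _ => h _ _
      _ ≤ D * (√(∑ s ∈ I j, ∑ c ∈ S, ‖us j s c‖ ^ 2) * √(∑ s ∈ I j, ∑ m ∈ T, ‖vs j s m‖ ^ 2)) := by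
          rw [← mul_sum]
          refine mul_le_mul_of_nonneg_left ?_ hD
          exact sum_sqrt_mul_sqrt_le _ (fun s => sum_nonneg fun _ _ => by positivity)
            (fun s => sum_nonneg fun _ _ => by positivity)
      _ ≤ _ := by
          gcongr
          · exact hU j
          · exact hV j
  calc _ ≤ ∑ r ∈ Q, ∑ j ∈ range J,
        w r * ‖∑ s ∈ I j, ∑ c ∈ S, ∑ m ∈ T, us j s c * vs j s m * G r c m‖ := by
        refine sum_le_sum fun r hr => ?_
        rw [key, ← mul_sum]
        exact mul_le_mul_of_nonneg_left (norm_sum_le _ _) (hw r hr)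
    _ = ∑ j ∈ range J, ∑ r ∈ Q,
        w r * ‖∑ s ∈ I j, ∑ c ∈ S, ∑ m ∈ T, us j s c * vs j s m * G r c m‖ := sum_comm
    _ ≤ ∑ j ∈ range J, D * (√(∑ c ∈ S, ‖u c‖ ^ 2) * √(∑ m ∈ T, ‖v m‖ ^ 2)) :=
        sum_le_sum fun j _ => lvl j
    _ = _ := by rw [sum_const, card_range, nsmul_eq_mul]

/-- Summation by parts against a nonnegative monotone weight. -/
lemma norm_sum_mul_le_of_monotone (w : ℕ → ℝ) (F : ℕ → ℂ) {E : ℝ} (y : ℕ) (h0 : 0 ≤ w 1)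
    (hw : ∀ m n, 1 ≤ m → m ≤ n → w m ≤ w n)
    (hF : ∀ z ≤ y, ‖∑ d ∈ Icc 1 z, F d‖ ≤ E) (hy : 1 ≤ y) :
    ‖∑ d ∈ Icc 1 y, (w d) * F d‖ ≤ 2 * w y * E := by
  have abel : ∀ y, 1 ≤ y → ∑ d ∈ Icc 1 y, (w d) * F d = w y * ∑ d ∈ Icc 1 y, F d -
      ∑ j ∈ Ico 1 y, ((w (j + 1) - w j : ℝ)) * ∑ d ∈ Icc 1 j, F d := by
    intro y hy
    induction y, hy using le_induction with
    | base => simp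
    | succ y hy ih =>
      rw [(by ext; simp; omega : Icc 1 (y + 1) = insert (y + 1) (Icc 1 y)), sum_insert (by simp), sum_insert (by simp), ih, sum_Ico_succ_top hy]
      push_cast; ring
  have hwy := h0.trans (hw 1 y le_rfl hy)
  rw [abel y hy]
  refine (norm_sub_le _ _).trans ?_
  have h1 : ‖(w y) * ∑ d ∈ Icc 1 y, F d‖ ≤ w y * E := by
    rw [norm_mul, norm_real, norm_of_nonneg hwy]
    exact mul_le_mul_of_nonneg_left (hF y le_rfl) hwy
  have h2 : ‖∑ j ∈ Ico 1 y, ((w (j + 1) - w j : ℝ)) * ∑ d ∈ Icc 1 j, F d‖ ≤ w y * E := by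
    calc _ ≤ ∑ j ∈ Ico 1 y, (w (j + 1) - w j) * E := by
          refine (norm_sum_le _ _).trans (sum_le_sum fun j hj => ?_)
          rw [mem_Ico] at hj
          have h3 := sub_nonneg.2 (hw j (j + 1) hj.1 (by omega))
          rw [norm_mul, norm_real, norm_of_nonneg h3]
          exact mul_le_mul_of_nonneg_left (hF j (by omega)) h3
      _ = (w y - w 1) * E := by rw [← sum_mul, sum_Ico_sub _ hy]
      _ ≤ _ := mul_le_mul_of_nonneg_right (by linarith) ((norm_nonneg _).trans (hF 0 (by omega)))
  linarith

/-- Low part of the von Mangoldt function. -/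
def LamLo (V : ℕ) : ArithmeticFunction ℝ :=
  ⟨fun n => if n ≤ V then Λ n else 0, by simp⟩

/-- High part of the von Mangoldt function. -/
def LamHi (V : ℕ) : ArithmeticFunction ℝ :=
  ⟨fun n => if n ≤ V then 0 else Λ n, by simp⟩

/-- Low part of the Möbius function. -/
def MuLo (U : ℕ) : ArithmeticFunction ℝ :=
  ⟨fun n => if n ≤ U then (μ n : ℝ) else 0, by simp⟩

/-- High part of the Möbius function. -/
def MuHi (U : ℕ) : ArithmeticFunction ℝ :=
  ⟨fun n => if n ≤ U then 0 else (μ n : ℝ), by simp⟩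

lemma vaughan_identity (U V : ℕ) : Λ =
    LamLo V + MuLo U * ArithmeticFunction.log - MuLo U * LamLo V * zeta +
      LamHi V * (MuHi U * zeta) := by
  have h1 : Λ = LamLo V + LamHi V := by
    ext n
    change _ = (if n ≤ V then Λ n else 0) + (if n ≤ V then 0 else Λ n)
    split_ifs <;> simp
  have h2 : (μ) = MuLo U + MuHi U := by
    ext n
    change _ = (if n ≤ U then (μ n : ℝ) else 0) + (if n ≤ U then 0 else (μ n : ℝ))
    split_ifs <;> simp
  have h3 : (μ : ArithmeticFunction ℝ) *
      zeta = 1 := coe_moebius_mul_coe_zeta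
  have h4 := vonMangoldt_mul_zeta
  rw [h2] at h3
  rw [h1] at h4
  rw [← h4, h1]
  linear_combination (-LamHi V) * h3

lemma sum_mul_arith (f g : ArithmeticFunction ℝ) (F : ℕ → ℂ) (x : ℕ) :
    ∑ n ∈ Icc 1 x, ((f * g) n) * F n =
      ∑ d ∈ Icc 1 x, ∑ e ∈ Icc 1 (x / d), (f d) * (g e) * F (d * e) := by
  rw [← sum_Icc_divisorsAntidiagonal x fun d e => (f d) * (g e) * F (d * e)]
  refine sum_congr rfl fun n _ => ?_
  rw [ArithmeticFunction.mul_apply]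
  push_cast
  rw [sum_mul]
  refine sum_congr rfl fun p hp => ?_
  rw [(mem_divisorsAntidiagonal.1 hp).1]

/-- Coefficients of the bilinear part in Vaughan's identity. -/
def vaughanA (U : ℕ) : ArithmeticFunction ℝ := MuHi U * (zeta : ArithmeticFunction ℝ)

lemma vaughanA_eq_zero {U m : ℕ} (h : m ≤ U) : vaughanA U m = 0 := by
  rw [vaughanA, coe_mul_zeta_apply]
  refine sum_eq_zero fun d hd => ?_
  rw [MuHi, coe_mk, if_pos ((divisor_le hd).trans h)]

lemma abs_moebius_le_one_real (d : ℕ) : |(μ d : ℝ)| ≤ 1 := by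
  exact_mod_cast abs_moebius_le_one

lemma abs_vaughanA_le (U m : ℕ) : |vaughanA U m| ≤ tau m := by
  rw [vaughanA, coe_mul_zeta_apply]
  refine (abs_sum_le_sum_abs _ _).trans ?_
  calc _ ≤ ∑ d ∈ m.divisors, (1 : ℝ) := by
        refine sum_le_sum fun d _ => ?_
        rw [MuHi, coe_mk]
        split_ifs
        · simp
        · exact abs_moebius_le_one_real d
    _ = _ := by simp [tau]

lemma vaughanB_eq_zero {U V m : ℕ} (h : U * V < m) : (MuLo U * LamLo V) m = 0 := by
  rw [ArithmeticFunction.mul_apply]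
  refine sum_eq_zero fun p hp => ?_
  rw [mem_divisorsAntidiagonal] at hp
  simp only [MuLo, LamLo, coe_mk]
  by_cases h1 : p.1 ≤ U
  · by_cases h2 : p.2 ≤ V
    · have := Nat.mul_le_mul h1 h2; omega
    · simp [h2]
  · simp [h1]

lemma abs_vaughanB_le (U V m : ℕ) : |(MuLo U * LamLo V) m| ≤ log m := by
  have h1 : log m = ∑ p ∈ m.divisorsAntidiagonal,
      (zeta : ArithmeticFunction ℝ) p.1 * Λ p.2 := by
    rw [← ArithmeticFunction.mul_apply, coe_zeta_mul_apply, vonMangoldt_sum]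
  rw [h1, ArithmeticFunction.mul_apply]
  refine (abs_sum_le_sum_abs _ _).trans (sum_le_sum fun p hp => ?_)
  have hp1 : p.1 ≠ 0 := by
    rintro h
    rw [mem_divisorsAntidiagonal, h] at hp
    omega
  rw [abs_mul]
  simp only [MuLo, LamLo, coe_mk, natCoe_apply, zeta_apply, if_neg hp1]
  refine mul_le_mul ?_ ?_ (abs_nonneg _) (by simp)
  · split_ifs
    · simpa using abs_moebius_le_one_real p.1
    · simp
  · split_ifs
    · rw [abs_of_nonneg (vonMangoldt_nonneg (n := p.2))]
    · simp

lemma abs_LamLo_le (V n : ℕ) : |LamLo V n| ≤ log n := by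
  simp only [LamLo, coe_mk]
  split_ifs
  · rw [abs_of_nonneg vonMangoldt_nonneg]
    exact vonMangoldt_le_log
  · simpa using log_natCast_nonneg n

lemma abs_LamHi_le (V n : ℕ) : |LamHi V n| ≤ log n := by
  simp only [LamHi, coe_mk]
  split_ifs
  · simp [log_natCast_nonneg]
  · rw [abs_of_nonneg vonMangoldt_nonneg]
    exact vonMangoldt_le_log

lemma LamHi_eq_zero {V n : ℕ} (h : n ≤ V) : LamHi V n = 0 := by
  simp [LamHi, h]

lemma log_le_log_of_le {m n : ℕ} (h : m ≤ n) : log m ≤ log n := by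
  rcases Nat.eq_zero_or_pos m with h0 | h0
  · rw [h0]; simpa using log_natCast_nonneg n
  · exact log_le_log (mod_cast h0) (mod_cast h)

/-- Vaughan's identity with the linear sums estimated by the largest incomplete sum. -/
lemma vaughan_bound {U V x : ℕ} (F : ℕ → ℂ)
    (hF : ∀ n, ‖F n‖ ≤ 1) {E : ℝ}
    (hE : ∀ b, 1 ≤ b → b ≤ U * V → ∀ y ≤ x, ‖∑ d ∈ Icc 1 y, F (b * d)‖ ≤ E)
    (hU0 : 1 ≤ U) (hV : 1 ≤ V) :
    ‖∑ n ∈ Icc 1 x, (Λ n) * F n‖ ≤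
      V * log x + 3 * (U * V) * log x * E +
      ‖∑ c ∈ Icc 1 x, ∑ m ∈ Icc 1 (x / c), (LamHi V c) * (vaughanA U m) * F (c * m)‖ := by
  have split : ∑ n ∈ Icc 1 x, (Λ n) * F n =
      ∑ n ∈ Icc 1 x, (LamLo V n) * F n
      + ∑ d ∈ Icc 1 x, ∑ e ∈ Icc 1 (x / d), (MuLo U d) * (ArithmeticFunction.log e) * F (d * e)
      - ∑ d ∈ Icc 1 x, ∑ e ∈ Icc 1 (x / d), ((MuLo U * LamLo V) d) *
          (((zeta : ArithmeticFunction ℝ) e)) * F (d * e)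
      + ∑ c ∈ Icc 1 x, ∑ m ∈ Icc 1 (x / c), (LamHi V c) * (vaughanA U m) * F (c * m) := by
    rw [← sum_mul_arith, ← sum_mul_arith, ← sum_mul_arith, ← sum_add_distrib, ← sum_sub_distrib,
      ← sum_add_distrib]
    refine sum_congr rfl fun n _ => ?_
    have h : Λ n +
        (MuLo U * LamLo V * zeta) n =
        LamLo V n + (MuLo U * ArithmeticFunction.log) n + (LamHi V * vaughanA U) n := by
      have h0 := vaughan_identity U V
      rw [show ∀ a b c d, a + b - c + d = a + b + d - c from
        fun a b c d => by ring] at h0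
      exact congrArg (fun f => f n) (eq_sub_iff_add_eq.1 h0)
    rw [congrArg (fun t => t) (eq_sub_iff_add_eq.2 h)]
    push_cast; ring
  have hE0 := (norm_nonneg _).trans (hE 1 le_rfl (Nat.mul_pos hU0 hV) 0 (by omega))
  have hcount : ∀ (W : ℕ) (B : ℝ), 0 ≤ B → ∀ f : ℕ → ℂ, (∀ n, 1 ≤ n → n ≤ x → n ≤ W → ‖f n‖ ≤ B) →
      (∀ n, W < n → f n = 0) → ‖∑ n ∈ Icc 1 x, f n‖ ≤ W * B := by
    intro W B hB f h1 h2
    calc ‖∑ n ∈ Icc 1 x, f n‖ ≤ ∑ n ∈ Icc 1 x, ‖f n‖ := norm_sum_le _ _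
      _ = ∑ n ∈ (Icc 1 x).filter (· ≤ W), ‖f n‖ := by
          rw [sum_filter]
          refine sum_congr rfl fun n _ => ?_
          split_ifs with h
          · rfl
          · rw [h2 n (by omega), norm_zero]
      _ ≤ ∑ n ∈ (Icc 1 x).filter (· ≤ W), B := by
          refine sum_le_sum fun n hn => ?_
          rw [mem_filter, mem_Icc] at hn
          exact h1 n hn.1.1 hn.1.2 hn.2
      _ ≤ W * B := by
          rw [sum_const, nsmul_eq_mul]
          refine mul_le_mul_of_nonneg_right ?_ hB
          have : (Icc 1 x).filter (· ≤ W) ⊆ Icc 1 W := by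
            intro n hn
            rw [mem_filter, mem_Icc] at hn
            rw [mem_Icc]; omega
          have := card_le_card this
          rw [card_Icc] at this
          exact_mod_cast this
  have b1 : ‖∑ n ∈ Icc 1 x, (LamLo V n) * F n‖ ≤ V * log x := by
    refine hcount V _ (log_natCast_nonneg x) _ ?_ ?_
    · intro n _ hn _
      rw [norm_mul, norm_real, norm_eq_abs]
      calc _ ≤ log n * 1 := by
            have := abs_LamLo_le V n
            have := log_natCast_nonneg n
            gcongr
            exact hF n
        _ ≤ _ := by rw [mul_one]; exact log_le_log_of_le hn
    · intro n hn
      simp [LamLo, not_le.2 hn]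
  have b2 : ‖∑ d ∈ Icc 1 x, ∑ e ∈ Icc 1 (x / d),
      (MuLo U d) * (ArithmeticFunction.log e) * F (d * e)‖ ≤
      (U * V : ℕ) * (2 * log x * E) := by
    refine hcount _ _ (by positivity) _ ?_ ?_
    · intro d hd hdx hdU
      simp_rw [mul_assoc, ← mul_sum]
      rw [norm_mul, norm_real, norm_eq_abs]
      have h1 : |MuLo U d| ≤ 1 := by
        simp only [MuLo, coe_mk]
        split_ifs
        · exact abs_moebius_le_one_real d
        · simp
      have h2 := norm_sum_mul_le_of_monotone (fun e => log e) (fun e => F (d * e))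
        (x / d) (by simp) (fun m n hm hmn => log_le_log_of_le hmn)
        (fun z hz => hE d hd hdU z (hz.trans (Nat.div_le_self _ _))) (Nat.div_pos hdx hd)
      simp only [log_apply]
      calc _ ≤ 1 * (2 * log (x / d : ℕ) * E) := by gcongr
        _ ≤ _ := by
          rw [one_mul]
          have := log_le_log_of_le (Nat.div_le_self x d)
          nlinarith [mul_le_mul_of_nonneg_right this hE0]
    · intro d hd
      have := lt_of_le_of_lt (Nat.le_mul_of_pos_right U hV) hd
      refine sum_eq_zero fun e _ => ?_
      simp [MuLo, not_le.2 this]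
  have b3 : ‖∑ d ∈ Icc 1 x, ∑ e ∈ Icc 1 (x / d), ((MuLo U * LamLo V) d) *
      (((zeta : ArithmeticFunction ℝ) e)) * F (d * e)‖ ≤
      (U * V : ℕ) * (log x * E) := by
    refine hcount _ _ (by positivity) _ ?_ ?_
    · intro d hd hdx hdU
      simp_rw [mul_assoc, ← mul_sum]
      rw [norm_mul, norm_real, norm_eq_abs]
      have h2 : ∑ e ∈ Icc 1 (x / d),
          (((zeta : ArithmeticFunction ℝ) e)) * F (d * e) =
          ∑ e ∈ Icc 1 (x / d), F (d * e) := by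
        refine sum_congr rfl fun e he => ?_
        have : e ≠ 0 := by rw [mem_Icc] at he; omega
        simp [natCoe_apply, zeta_apply, this]
      rw [h2]
      have h3 := hE d hd hdU (x / d) (Nat.div_le_self _ _)
      have h4 := (abs_vaughanB_le U V d).trans (log_le_log_of_le hdx)
      gcongr
    · intro d hd
      refine sum_eq_zero fun e _ => ?_
      rw [vaughanB_eq_zero hd]; simp
  rw [split]
  refine (norm_add_le _ _).trans (add_le_add ?_ le_rfl)
  refine (norm_sub_le _ _).trans ?_
  refine (add_le_add (norm_add_le _ _) le_rfl).trans ?_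
  push_cast at b2 b3
  linarith

lemma sum_Icc_eq_sum_dyadic (x : ℕ) (f : ℕ → ℂ) (hf : ∀ c, x < c → f c = 0) :
    ∑ c ∈ Icc 1 x, f c = ∑ i ∈ range (Nat.log 2 x + 1), ∑ c ∈ Ico (2 ^ i) (2 * 2 ^ i), f c := by
  have h1 : ∀ J, ∑ i ∈ range J, ∑ c ∈ Ico (2 ^ i) (2 * 2 ^ i), f c =
      ∑ c ∈ Ico 1 (2 ^ J), f c := by
    intro J
    induction J with
    | zero => simp
    | succ J ih =>
      rw [sum_range_succ, ih, pow_succ', sum_Ico_consecutive _ Nat.one_le_two_pow (by omega)]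
  rw [h1]
  have h2 : x < 2 ^ (Nat.log 2 x + 1) := lt_pow_succ_log_self (by norm_num) x
  refine sum_subset ?_ ?_
  · intro c hc
    rw [mem_Icc] at hc
    rw [mem_Ico]; omega
  · intro c hc hc2
    rw [mem_Ico] at hc
    rw [mem_Icc] at hc2
    exact hf c (by omega)

/-- The bilinear part of Vaughan's identity, given bounds for general dyadic bilinear forms. -/
lemma vaughan_bilinear {ρ : Type*} (Q : Finset ρ) (w : ρ → ℝ) (hw : ∀ r ∈ Q, 0 ≤ w r)
    (G : ρ → ℕ → ℂ) {U V x : ℕ} (hx : 1 ≤ x) {D : ℝ} (hD : 0 ≤ D)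
    (h : ∀ M, 1 ≤ M → V < 2 * M → M * U ≤ x → ∀ u v : ℕ → ℂ,
      ∑ r ∈ Q, w r * ‖∑ c ∈ Ico M (2 * M), ∑ m ∈ Icc 1 (x / M), u c * v m * G r (c * m)‖ ≤
      D * (√(∑ c ∈ Ico M (2 * M), ‖u c‖ ^ 2) * √(∑ m ∈ Icc 1 (x / M), ‖v m‖ ^ 2))) :
    ∑ r ∈ Q, w r * ‖∑ c ∈ Icc 1 x, ∑ m ∈ Icc 1 (x / c),
        (LamHi V c) * (vaughanA U m) * G r (c * m)‖ ≤
      (Nat.log 2 x + 2 : ℕ) ^ 2 * (D * (√x * (1 + log x) ^ 3)) := by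
  have hlog := log_natCast_nonneg x
  set J := Nat.log 2 x + 2 with hJ
  set u : ℕ → ℂ := fun c => if c ≤ x then (LamHi V c) else 0 with hu
  set v : ℕ → ℂ := fun m => (vaughanA U m) with hv
  have lvl : ∀ i, i < Nat.log 2 x + 1 →
      ∑ r ∈ Q, w r * ‖∑ c ∈ Ico (2 ^ i) (2 * 2 ^ i), ∑ m ∈ Icc 1 (x / c),
        (LamHi V c) * (vaughanA U m) * G r (c * m)‖ ≤
      J * (D * (√x * (1 + log x) ^ 3)) := by
    intro i hi
    set M := 2 ^ i
    have hM1 : 1 ≤ M := Nat.one_le_two_pow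
    by_cases hVM : V < 2 * M
    swap
    · calc _ = ∑ r ∈ Q, (0 : ℝ) := by
            refine sum_congr rfl fun r _ => ?_
            rw [sum_eq_zero, norm_zero, mul_zero]
            intro c hc
            rw [mem_Ico] at hc
            refine sum_eq_zero fun m _ => ?_
            rw [LamHi_eq_zero (by omega)]; simp
        _ ≤ _ := by rw [sum_const_zero]; positivity
    by_cases hMU : M * U ≤ x
    swap
    · calc _ = ∑ r ∈ Q, (0 : ℝ) := by
            refine sum_congr rfl fun r _ => ?_
            rw [sum_eq_zero, norm_zero, mul_zero]
            intro c hc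
            rw [mem_Ico] at hc
            refine sum_eq_zero fun m hm => ?_
            rw [mem_Icc] at hm
            have h1 := (Nat.le_div_iff_mul_le (by omega)).1 hm.2
            have h2 : m ≤ U := by
              by_contra h3
              have : M * U ≤ c * m := Nat.mul_le_mul hc.1 (by omega)
              rw [mul_comm c m] at this
              omega
            rw [vaughanA_eq_zero h2]; simp
        _ ≤ _ := by rw [sum_const_zero]; positivity
    have e : ∀ r, ∑ c ∈ Ico M (2 * M), ∑ m ∈ Icc 1 (x / c),
        (LamHi V c) * (vaughanA U m) * G r (c * m) =
        ∑ c ∈ Ico M (2 * M), ∑ m ∈ Icc 1 (x / M) with m < x / c + 1, u c * v m * G r (c * m) := by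
      intro r
      refine sum_congr rfl fun c hc => ?_
      rw [mem_Ico] at hc
      have e1 : (Icc 1 (x / M)).filter (fun m => m < x / c + 1) = Icc 1 (x / c) := by
        ext m
        have := div_le_div_left (a := x) hc.1 hM1
        simp only [mem_filter, mem_Icc]
        omega
      rw [e1]
      refine sum_congr rfl fun m hm => ?_
      rw [mem_Icc] at hm
      have h1 := (Nat.le_div_iff_mul_le (by omega)).1 hm.2
      have h2 := (Nat.le_mul_of_pos_left c (by omega)).trans h1
      simp only [hu, hv, if_pos h2]
    simp_rw [e]
    refine (bilinear_threshold Q w hw (fun r c m => G r (c * m)) _ _ hD (h M hM1 hVM hMU)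
      (fun c => x / c + 1) J ?_ u v).trans ?_
    · intro c _
      have h2 : x < 2 ^ (Nat.log 2 x + 1) := lt_pow_succ_log_self (by norm_num) x
      have h3 := Nat.div_le_self x c
      rw [hJ, pow_succ]
      omega
    · refine mul_le_mul_of_nonneg_left (mul_le_mul_of_nonneg_left ?_ hD) (by positivity)
      rw [← sqrt_mul (sum_nonneg fun _ _ => by positivity)]
      refine sqrt_le_iff.2 ⟨by positivity, ?_⟩
      have h1 : ∑ c ∈ Ico M (2 * M), ‖u c‖ ^ 2 ≤ M * (1 + log x) ^ 2 := by
        calc _ ≤ ∑ c ∈ Ico M (2 * M), (1 + log x) ^ 2 := by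
              refine sum_le_sum fun c _ => ?_
              simp only [hu]
              split_ifs with hc
              · rw [norm_real, norm_eq_abs]
                have h1 := abs_LamHi_le V c
                have h2 := log_le_log_of_le hc
                exact pow_le_pow_left₀ (abs_nonneg _) (by linarith) 2
              · simp; positivity
          _ = _ := by
              rw [sum_const, card_Ico, nsmul_eq_mul]
              congr 2; omega
      have h2 : ∑ m ∈ Icc 1 (x / M), ‖v m‖ ^ 2 ≤ (x / M : ℕ) * (1 + log x) ^ 4 := by
        calc _ ≤ ∑ m ∈ Icc 1 (x / M), (tau m : ℝ) ^ 2 := by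
              refine sum_le_sum fun c _ => ?_
              simp only [hv]
              rw [norm_real, norm_eq_abs]
              exact pow_le_pow_left₀ (abs_nonneg _) (abs_vaughanA_le U c) 2
          _ ≤ (x / M : ℕ) * (1 + log (x / M : ℕ)) ^ (2 ^ 2) := sum_tau_pow_le _ 2
          _ ≤ _ := by
              have := log_le_log_of_le (Nat.div_le_self x M)
              have := log_natCast_nonneg (x / M)
              norm_num
              gcongr
      calc _ ≤ (M * (1 + log x) ^ 2) * ((x / M : ℕ) * (1 + log x) ^ 4) := by
            gcongr
        _ = (M * (x / M : ℕ)) * (1 + log x) ^ 6 := by ring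
        _ ≤ x * (1 + log x) ^ 6 := by
            gcongr
            exact_mod_cast mul_div_le x M
        _ = _ := by rw [mul_pow, sq_sqrt (by positivity)]; ring
  have e : ∀ r, ∑ c ∈ Icc 1 x, ∑ m ∈ Icc 1 (x / c),
        (LamHi V c) * (vaughanA U m) * G r (c * m) =
      ∑ i ∈ range (Nat.log 2 x + 1), ∑ c ∈ Ico (2 ^ i) (2 * 2 ^ i), ∑ m ∈ Icc 1 (x / c),
        (LamHi V c) * (vaughanA U m) * G r (c * m) := by
    intro r
    refine sum_Icc_eq_sum_dyadic x _ fun c hc => ?_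
    rw [div_eq_of_lt hc]; simp
  calc _ ≤ ∑ r ∈ Q, ∑ i ∈ range (Nat.log 2 x + 1),
        w r * ‖∑ c ∈ Ico (2 ^ i) (2 * 2 ^ i), ∑ m ∈ Icc 1 (x / c),
        (LamHi V c) * (vaughanA U m) * G r (c * m)‖ := by
        refine sum_le_sum fun r hr => ?_
        rw [e, ← mul_sum]
        exact mul_le_mul_of_nonneg_left (norm_sum_le _ _) (hw r hr)
    _ = _ := sum_comm
    _ ≤ ∑ i ∈ range (Nat.log 2 x + 1), J * (D * (√x * (1 + log x) ^ 3)) :=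
        sum_le_sum fun i hi => lvl i (mem_range.1 hi)
    _ = ((Nat.log 2 x + 1 : ℕ)) * (J * (D * (√x * (1 + log x) ^ 3))) := by
        rw [sum_const, card_range, nsmul_eq_mul]
    _ ≤ J * (J * (D * (√x * (1 + log x) ^ 3))) := by
        refine mul_le_mul_of_nonneg_right ?_ (by positivity)
        rw [hJ]; push_cast; linarith
    _ = _ := by ring

lemma large_sieve_additive_nat {ι : Type*} (R : Finset ι) (α : ι → ℝ) {δ : ℝ} (hδ : 0 < δ)
    (hs : ∀ r ∈ R, ∀ s ∈ R, r ≠ s → ∀ m : ℤ, δ ≤ |α r - α s - m|) (N : ℕ) (a : ℕ → ℂ) :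
    ∑ r ∈ R, ‖∑ n ∈ Icc 1 N, a n * ee (n * α r)‖ ^ 2 ≤
      288 * (N + 1 / δ) * ∑ n ∈ Icc 1 N, ‖a n‖ ^ 2 := by
  have e : ∀ {E : Type} [AddCommMonoid E] (f : ℤ → E),
      ∑ n ∈ Ico (1 : ℤ) (1 + N), f n = ∑ n ∈ Icc 1 N, f n := by
    intro E _ f
    symm
    refine sum_bij (fun n _ => n) ?_ ?_ ?_ ?_
    · intro n hn; rw [mem_Icc] at hn; rw [mem_Ico]; omega
    · intro n _ m _ h; exact_mod_cast h
    · intro n hn; rw [mem_Ico] at hn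
      exact ⟨n.toNat, by rw [mem_Icc]; omega, by omega⟩
    · intro n _; rfl
  have h := large_sieve_additive R α hδ hs 1 N (fun n => a n.toNat)
  simp only [e] at h
  simpa using h

lemma abs_sub_int_ge_of_approx {α : ℝ} {a : ℤ} {q : ℕ} (hq : 1 ≤ q) (hcop : IsCoprime a q)
    (hα : |α - a / q| ≤ 1 / q ^ 2) {b : ℤ} (hb0 : b ≠ 0) (hb : 2 * |b| ≤ q) (m : ℤ) :
    1 / (2 * q) ≤ |b * α - m| := by
  have h1 : b * a - m * q ≠ 0 := by
    intro h
    have h3 := hcop.symm.dvd_of_dvd_mul_right (⟨m, by linarith⟩ : (q : ℤ) ∣ b * a)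
    have h4 := Int.le_of_dvd (abs_pos.2 hb0) ((dvd_abs _ _).2 h3)
    have := abs_pos.2 hb0
    omega
  have h3 : |(b : ℝ) * a / q - m| ≥ 1 / q := by
    rw [(by push_cast; field_simp : (b : ℝ) * a / q - m = (b * a - m * q) / q), abs_div, abs_of_pos (mod_cast hq : (0 : ℝ) < q)]
    gcongr
    exact_mod_cast (mod_cast Int.one_le_abs h1)
  have h4 : |b * α - b * a / q| ≤ 1 / (2 * q) := by
    rw [(by ring : b * α - b * a / q = b * (α - a / q)), abs_mul]
    have hb' : 2 * |(b : ℝ)| ≤ q := mod_cast hb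
    calc _ ≤ ((q : ℝ) / 2) * (1 / q ^ 2) := by
          gcongr; linarith
      _ = _ := by field_simp
  have h5 : |(b : ℝ) * a / q - m| ≤ |b * α - m| + |b * α - b * a / q| := by
    have := abs_sub_le ((b : ℝ) * a / q) (b * α) m
    rw [abs_sub_comm ((b : ℝ) * a / q) (b * α)] at this
    linarith
  have : (1 : ℝ) / q = 1 / (2 * q) + 1 / (2 * q) := by field_simp; norm_num
  linarith

lemma log_two_le_two_mul_log (x : ℕ) : ((Nat.log 2 x + 2 : ℕ)) ≤ 2 * (1 + log x) := by
  rcases Nat.eq_zero_or_pos x with rfl | hx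
  · simp
  have h2 : (Nat.log 2 x) * log 2 ≤ log x := by
    rw [← log_pow]
    exact log_le_log (by positivity) (mod_cast (pow_log_le_self 2 (by omega)))
  have h3 := log_two_gt_d9
  push_cast
  nlinarith [cast_nonneg (α := ℝ) (Nat.log 2 x)]

lemma bilinear_exp_bound {α : ℝ} {a : ℤ} {q : ℕ} (hq : 1 ≤ q) (hcop : IsCoprime a q)
    (hα : |α - a / q| ≤ 1 / q ^ 2) {M y : ℕ} (u v : ℕ → ℂ) :
    ‖∑ c ∈ Ico M (2 * M), ∑ m ∈ Icc 1 y, u c * v m * ee ((c * m : ℕ) * α)‖ ≤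
      √(288 * (2 * M / q + 1) * (y + 2 * q)) *
      (√(∑ c ∈ Ico M (2 * M), ‖u c‖ ^ 2) * √(∑ m ∈ Icc 1 y, ‖v m‖ ^ 2)) := by
  set H := (q + 1) / 2
  have hH0 : 0 < H := by omega
  have hHq : (q : ℝ) ≤ 2 * H := mod_cast (by omega)
  have block : ∀ i, ∑ c ∈ Ico M (2 * M) with (c - M) / H = i,
      ‖∑ m ∈ Icc 1 y, v m * ee (m * (c * α))‖ ^ 2 ≤
      288 * (y + 2 * q) * ∑ m ∈ Icc 1 y, ‖v m‖ ^ 2 := by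
    intro i
    have := large_sieve_additive_nat ((Ico M (2 * M)).filter fun c => (c - M) / H = i)
      (fun c => c * α) (δ := 1 / (2 * q)) (by positivity) ?_ y v
    · simpa using this
    · intro r hr s hs hrs m
      rw [mem_filter, mem_Ico] at hr hs
      have h1 := abs_sub_int_ge_of_approx hq hcop hα (b := r - s) (by omega) ?_ m
      · push_cast at h1
        rw [← sub_mul]; exact h1
      · have e1 := div_add_mod (r - M) H
        have e2 := div_add_mod (s - M) H
        have e3 := mod_lt (r - M) hH0
        have e4 := mod_lt (s - M) hH0
        rw [hr.2] at e1; rw [hs.2] at e2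
        generalize H * i = z at e1 e2
        have e5 : |(r : ℤ) - s| ≤ H - 1 := abs_le.2 ⟨by omega, by omega⟩
        omega
  have total : ∑ c ∈ Ico M (2 * M), ‖∑ m ∈ Icc 1 y, v m * ee (m * (c * α))‖ ^ 2 ≤
      288 * (2 * M / q + 1) * (y + 2 * q) * ∑ m ∈ Icc 1 y, ‖v m‖ ^ 2 := by
    have hmap : ∀ c ∈ Ico M (2 * M), (c - M) / H ∈ range (M / H + 1) := by
      intro c hc
      rw [mem_Ico] at hc
      rw [mem_range]
      have := Nat.div_le_div_right (c := H) (by omega : c - M ≤ M)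
      omega
    rw [← sum_fiberwise_of_maps_to hmap]
    calc _ ≤ ∑ i ∈ range (M / H + 1), 288 * (y + 2 * q) * ∑ m ∈ Icc 1 y, ‖v m‖ ^ 2 :=
          sum_le_sum fun i _ => block i
      _ = (M / H + 1 : ℕ) * (288 * (y + 2 * q) * ∑ m ∈ Icc 1 y, ‖v m‖ ^ 2) := by
          rw [sum_const, card_range, nsmul_eq_mul]
      _ ≤ (2 * M / q + 1) * (288 * (y + 2 * q) * ∑ m ∈ Icc 1 y, ‖v m‖ ^ 2) := by
          refine mul_le_mul_of_nonneg_right ?_ (by positivity)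
          push_cast
          have h1 : ((M / H : ℕ) : ℝ) ≤ M / H := cast_div_le
          have h2 : (M : ℝ) / H ≤ 2 * M / q := by
            rw [div_le_div_iff₀ (by positivity) (mod_cast hq)]
            have := mul_le_mul_of_nonneg_left hHq (cast_nonneg M)
            linarith
          linarith
      _ = _ := by ring
  have e : ∑ c ∈ Ico M (2 * M), ∑ m ∈ Icc 1 y, u c * v m * ee ((c * m : ℕ) * α) =
      ∑ c ∈ Ico M (2 * M), u c * ∑ m ∈ Icc 1 y, v m * ee (m * (c * α)) := by
    refine sum_congr rfl fun c _ => ?_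
    rw [mul_sum]
    refine sum_congr rfl fun m _ => ?_
    rw [mul_assoc]
    congr 3
    push_cast; ring
  rw [e]
  calc _ ≤ ∑ c ∈ Ico M (2 * M), ‖u c‖ * ‖∑ m ∈ Icc 1 y, v m * ee (m * (c * α))‖ := by
        refine (norm_sum_le _ _).trans (sum_le_sum fun c _ => ?_)
        rw [norm_mul]
    _ ≤ √(∑ c ∈ Ico M (2 * M), ‖u c‖ ^ 2) *
        √(∑ c ∈ Ico M (2 * M), ‖∑ m ∈ Icc 1 y, v m * ee (m * (c * α))‖ ^ 2) :=
        sum_mul_le_sqrt_mul_sqrt _ _ _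
    _ ≤ √(∑ c ∈ Ico M (2 * M), ‖u c‖ ^ 2) *
        √(288 * (2 * M / q + 1) * (y + 2 * q) * ∑ m ∈ Icc 1 y, ‖v m‖ ^ 2) := by gcongr
    _ = _ := by rw [sqrt_mul (by positivity)]; ring

/-- Vinogradov's estimate for exponential sums over primes. -/
lemma norm_sum_vonMangoldt_ee_le {α : ℝ} {a : ℤ} {q : ℕ} (hq : 1 ≤ q)
    (hcop : IsCoprime a q) (hα : |α - a / q| ≤ 1 / q ^ 2) {W x : ℕ} (hW : 1 ≤ W)
    (hWq : 2 * (W * W) ≤ q) (hx : 1 ≤ x) :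
    ‖∑ n ∈ Icc 1 x, (Λ n) * ee (n * α)‖ ≤
      W * log x + 3 * (W * W) * log x * q +
      4 * (1 + log x) ^ 5 * √(288 * x * (2 * x / q + 6 * x / W + 2 * q)) := by
  have hq0 : 0 < q := mod_cast hq
  have hW0 : (0 : ℝ) < W := mod_cast hW
  have hlog := log_natCast_nonneg x
  refine (vaughan_bound (fun n => ee (n * α))
    (fun n => (norm_ee _).le) (E := q) ?_ hW hW).trans ?_
  · intro b hb hbW y _
    have h1 := norm_geom_sum_ee_le (δ := 1 / (2 * q)) (by positivity)
      (fun m => by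
        have := abs_sub_int_ge_of_approx hq hcop hα (b := b) (by omega)
          (by rw [abs_of_nonneg (by positivity)]; omega) m
        simpa using this) 1 (y + 1)
    have e : ∑ d ∈ Icc 1 y, ee ((b * d : ℕ) * α) = ∑ n ∈ Ico 1 (y + 1), ee (n * (b * α)) := by
      rw [(by ext; simp : Icc 1 y = Ico 1 (y + 1))]
      refine sum_congr rfl fun n _ => ?_
      congr 1; push_cast; ring
    rw [e]
    refine h1.trans (le_of_eq ?_)
    field_simp
  · set D := √(288 * (2 * x / q + 6 * x / W + 2 * q)) with hD
    have h := vaughan_bilinear (univ : Finset Unit) (fun _ => 1) (by simp)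
      (fun _ n => ee (n * α)) (U := W) (V := W) hx (D := D) (by positivity) ?_
    · simp only [univ_unique, sum_singleton, one_mul] at h
      have h2 : ((Nat.log 2 x + 2 : ℕ)) ^ 2 * (D * (√x * (1 + log x) ^ 3)) ≤
          4 * (1 + log x) ^ 5 * √(288 * x * (2 * x / q + 6 * x / W + 2 * q)) := by
        have e : √(288 * x * (2 * x / q + 6 * x / W + 2 * q)) = D * √x := by
          rw [hD, ← sqrt_mul (by positivity)]; congr 1; ring
        rw [e]
        calc _ ≤ (2 * (1 + log x)) ^ 2 * (D * (√x * (1 + log x) ^ 3)) := by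
              gcongr
              exact log_two_le_two_mul_log x
          _ = _ := by ring
      linarith
    · intro M hM hWM hMx u v
      simp only [univ_unique, sum_singleton, one_mul]
      refine (bilinear_exp_bound hq hcop hα u v).trans ?_
      refine mul_le_mul_of_nonneg_right (sqrt_le_sqrt ?_) (by positivity)
      have h1 : ((x / M : ℕ) : ℝ) ≤ x / M := cast_div_le
      have h2 : (x : ℝ) / M ≤ 2 * x / W := by
        rw [div_le_div_iff₀ (mod_cast hM) hW0]
        have : (W : ℝ) ≤ 2 * M := mod_cast hWM.le
        nlinarith [cast_nonneg (α := ℝ) x]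
      have h3 : (M : ℝ) ≤ x / W := by
        rw [le_div_iff₀ hW0]; exact_mod_cast hMx
      calc 288 * (2 * (M : ℝ) / q + 1) * ((x / M : ℕ) + 2 * q) ≤
          288 * (2 * M / q + 1) * (x / M + 2 * q) := by gcongr
        _ = 288 * (2 * x / q + 4 * M + x / M + 2 * q) := by field_simp; ring
        _ ≤ 288 * (2 * x / q + 4 * (x / W) + 2 * x / W + 2 * q) := by gcongr
        _ = _ := by ring

lemma norm_ofReal_cpow_neg {u : ℝ} (hu : 0 < u) (s : ℂ) : ‖(u : ℂ) ^ (-s)‖ = u ^ (-s.re) := by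
  rw [norm_cpow_eq_rpow_re_of_pos hu]; simp

lemma norm_cpow_neg_sub_le {u v : ℝ} (hu : 0 < u) (huv : u ≤ v) {s : ℂ} (hσ : 0 < s.re) :
    ‖(v : ℂ) ^ (-s) - u ^ (-s)‖ ≤ ‖s‖ * u ^ (-s.re - 1) * (v - u) := by
  have h := Convex.norm_image_sub_le_of_norm_hasDerivWithin_le
    (f := fun x : ℝ => (x : ℂ) ^ (-s)) (f' := fun x => -s * x ^ (-s - 1))
    (C := ‖s‖ * u ^ (-s.re - 1)) ?_ ?_ (convex_Icc u v)
    (Set.left_mem_Icc.2 huv) (Set.right_mem_Icc.2 huv)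
  · rwa [norm_of_nonneg (sub_nonneg.2 huv)] at h
  · intro x hx
    exact (hasDerivAt_ofReal_cpow_const (by linarith [hx.1]) (by simpa using (by rintro rfl; simp at hσ))).hasDerivWithinAt
  · intro x hx
    rw [norm_mul, norm_neg, norm_cpow_eq_rpow_re_of_pos (hu.trans_le hx.1)]
    refine mul_le_mul_of_nonneg_left ?_ (norm_nonneg _)
    rw [(by simp : (-s - 1).re = -s.re - 1)]
    exact rpow_le_rpow_of_nonpos hu hx.1 (by linarith)

lemma min_two_le_rpow {y z θ : ℝ} (hy : 0 ≤ y) (h1 : z ≤ 2) (h2 : z ≤ y) (hθ0 : 0 ≤ θ)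
    (hθ : θ ≤ 1) : z ≤ 2 * y ^ θ := by
  rcases le_total 1 y with h | h
  · have := one_le_rpow h hθ0; linarith
  · have : y ^ (1 : ℝ) ≤ y ^ θ := by
      rcases hy.eq_or_lt with h0 | h0
      · rw [← h0, zero_rpow one_ne_zero]; positivity
      · exact rpow_le_rpow_of_exponent_ge h0 h hθ
    rw [rpow_one] at this
    have : 0 ≤ y ^ θ := by positivity
    linarith

lemma norm_cpow_neg_sub_le_rpow {u v : ℝ} (hu : 0 < u) (huv : u ≤ v) {s : ℂ} (hσ : 0 < s.re)
    {θ : ℝ} (hθ0 : 0 ≤ θ) (hθ : θ ≤ 1) :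
    ‖(v : ℂ) ^ (-s) - u ^ (-s)‖ ≤ 2 * (‖s‖ * (v - u) / u) ^ θ * u ^ (-s.re) := by
  have hu' : 0 < u ^ (-s.re) := by positivity
  rw [← div_le_iff₀ hu']
  have hvu := sub_nonneg.2 huv
  refine min_two_le_rpow (by positivity) ?_ ?_ hθ0 hθ
  · rw [div_le_iff₀ hu']
    refine (norm_sub_le _ _).trans ?_
    rw [norm_ofReal_cpow_neg hu, norm_ofReal_cpow_neg (hu.trans_le huv)]
    have := rpow_le_rpow_of_nonpos hu huv (by linarith : -s.re ≤ 0)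
    linarith
  · rw [div_le_iff₀ hu']
    refine (norm_cpow_neg_sub_le hu huv hσ).trans (le_of_eq ?_)
    rw [rpow_sub_one hu.ne']
    ring

lemma sum_range_zmod {E : Type*} [AddCommMonoid E] (q : ℕ) [NeZero q] (f : ZMod q → E) :
    ∑ a ∈ range q, f a = ∑ a : ZMod q, f a := by
  refine sum_bij (fun a _ => a) (by simp) ?_ ?_ (fun _ _ => rfl)
  · intro a ha b hb hab
    rw [mem_range] at ha hb
    have := congrArg ZMod.val hab
    rwa [ZMod.val_natCast_of_lt ha, ZMod.val_natCast_of_lt hb] at this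
  · intro z _
    exact ⟨z.val, mem_range.2 (ZMod.val_lt z), ZMod.natCast_zmod_val z⟩

/-- The `b`-th block of length `q` of the Dirichlet series of `χ`. -/
def chiBlock {q : ℕ} (χ : DirichletCharacter ℂ q) (b : ℕ) (s : ℂ) : ℂ :=
  ∑ a ∈ range q, χ (a : ZMod q) * ((b * q + a : ℕ) : ℂ) ^ (-s)

/-- The value of the `L`-function of a nontrivial character as a conditionally convergent series. -/
def chiH {q : ℕ} (χ : DirichletCharacter ℂ q) (s : ℂ) : ℂ := ∑' b, chiBlock χ b s

lemma norm_chiBlock_succ_le {q : ℕ} [NeZero q] {χ : DirichletCharacter ℂ q} (hχ : χ ≠ 1) (b : ℕ)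
    {η : ℝ} (hη0 : 0 < η) (hη : η ≤ 1 / 2) {s : ℂ} (hs : 1 - η ≤ s.re) :
    ‖chiBlock χ (b + 1) s‖ ≤ 2 * q ^ η * ‖s‖ ^ (2 * η) * ((b + 1 : ℕ)) ^ (-1 - η) := by
  have hq : (0 : ℝ) < q := mod_cast Nat.pos_of_ne_zero (NeZero.ne q)
  set B : ℝ := ((b + 1 : ℕ) : ℝ) with hB
  have hB1 : 1 ≤ B := by rw [hB]; exact_mod_cast succ_le_succ (Nat.zero_le b)
  have hB0 : 0 < B := by linarith
  have e : chiBlock χ (b + 1) s = ∑ a ∈ range q, χ a *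
      (((B * q + a : ℝ)) ^ (-s) - ((B * q : ℝ)) ^ (-s)) := by
    simp_rw [mul_sub]
    rw [sum_sub_distrib, ← sum_mul, sum_range_zmod q (fun a => χ a),
      MulChar.sum_eq_zero_of_ne_one hχ, zero_mul, sub_zero, chiBlock]
    refine sum_congr rfl fun a _ => ?_
    rw [hB]; push_cast; rfl
  rw [e]
  calc _ ≤ ∑ a ∈ range q, (2 * (‖s‖ / B) ^ (2 * η) * (B * q) ^ (-1 + η)) := by
        refine (norm_sum_le _ _).trans (sum_le_sum fun a ha => ?_)
        rw [mem_range] at ha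
        have ha' : a ≤ q := mod_cast ha.le
        rw [norm_mul]
        have h2 : (‖s‖ * (B * q + a - B * q) / (B * q)) ≤ ‖s‖ / B := by
          rw [div_le_div_iff₀ (by positivity) hB0]
          have : ‖s‖ * a ≤ ‖s‖ * q := by gcongr
          nlinarith [norm_nonneg s]
        have h3 : (B * q) ^ (-s.re) ≤ (B * q) ^ (-1 + η) :=
          rpow_le_rpow_of_exponent_le (one_le_mul_of_one_le_of_one_le hB1 (mod_cast one_le_iff_ne_zero.2 (NeZero.ne q))) (by linarith)
        have h4 : 0 ≤ (‖s‖ * (B * q + a - B * q) / (B * q)) := by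
          rw [(by ring : (B * q + a - B * q) = a)]; positivity
        calc _ ≤ 1 * (2 * (‖s‖ / B) ^ (2 * η) * (B * q) ^ (-1 + η)) := by
              refine mul_le_mul (norm_le_one χ _) ((norm_cpow_neg_sub_le_rpow (u := B * q) (v := B * q + a) (θ := 2 * η) (by positivity) (by linarith [cast_nonneg (α := ℝ) a]) (by linarith) (by linarith) (by linarith)).trans ?_) (norm_nonneg _)
                zero_le_one
              gcongr
          _ = _ := one_mul _
    _ = q * (2 * (‖s‖ / B) ^ (2 * η) * (B * q) ^ (-1 + η)) := by
        rw [sum_const, card_range, nsmul_eq_mul]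
    _ = _ := by
        rw [div_rpow (norm_nonneg _) hB0.le, mul_rpow hB0.le hq.le,
          show -1 - η = (-1 + η) - 2 * η by ring, rpow_sub hB0, rpow_add hq,
          rpow_neg_one]
        field_simp

/-- The zeta constant bounding tails. -/
def zetaC (η : ℝ) : ℝ := ∑' b : ℕ, ((b + 1 : ℕ) : ℝ) ^ (-1 - η)

lemma summable_zetaC {η : ℝ} (hη : 0 < η) :
    Summable fun b => ((b + 1 : ℕ) : ℝ) ^ (-1 - η) :=
  (summable_nat_add_iff 1).2 (summable_nat_rpow.2 (by linarith))

lemma zetaC_ge_one {η : ℝ} (hη : 0 < η) : 1 ≤ zetaC η := by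
  have := (summable_zetaC hη).le_tsum 0 (fun _ _ => by positivity)
  simpa [zetaC] using this

lemma norm_chiBlock_zero_le {q : ℕ} [NeZero q] (χ : DirichletCharacter ℂ q)
    {η : ℝ} (hη0 : 0 < η) (hη : η ≤ 1 / 2) {s : ℂ} (hs : 1 - η ≤ s.re) :
    ‖chiBlock χ 0 s‖ ≤ q ^ (2 * η) * zetaC η := by
  have hs0 : s ≠ 0 := by rintro rfl; simp at hs; linarith
  rw [chiBlock]
  have hsplit : ∀ f : ℕ → ℂ, f 0 = 0 → ‖∑ a ∈ range q, f a‖ ≤ ∑ a ∈ range (q - 1), ‖f (a + 1)‖ := by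
    intro f hf
    obtain ⟨p, hp⟩ : ∃ p, q = p + 1 := ⟨q - 1, by have := NeZero.ne q; omega⟩
    rw [(by omega : q - 1 = p), hp, sum_range_succ', hf, add_zero]
    exact norm_sum_le _ _
  refine (hsplit _ (by simp [hs0])).trans ?_
  calc _ ≤ ∑ a ∈ range (q - 1), (q : ℝ) ^ (2 * η) * ((a + 1 : ℕ)) ^ (-1 - η) := by
        refine sum_le_sum fun a ha => ?_
        rw [mem_range] at ha
        have h0 : (0 : ℝ) < ((a + 1 : ℕ)) := by positivity
        have h2 : ((a + 1)) ≤ q := mod_cast (by omega)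
        rw [norm_mul, zero_mul, zero_add]
        have := norm_ofReal_cpow_neg h0 s
        rw [ofReal_natCast] at this
        rw [this]
        calc _ ≤ 1 * ((a + 1 : ℕ) : ℝ) ^ (-s.re) := by
              gcongr; exact norm_le_one χ _
          _ ≤ ((a + 1 : ℕ)) ^ (2 * η + (-1 - η)) := by
              rw [one_mul]
              exact rpow_le_rpow_of_exponent_le (mod_cast succ_le_succ (Nat.zero_le a)) (by linarith)
          _ = ((a + 1 : ℕ)) ^ (2 * η) * ((a + 1 : ℕ)) ^ (-1 - η) := rpow_add h0 _ _
          _ ≤ _ := by gcongr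
    _ ≤ _ := by
        rw [← mul_sum]
        gcongr
        exact (summable_zetaC hη0).sum_le_tsum _ (fun _ _ => by positivity)

lemma summable_chiBlock {q : ℕ} [NeZero q] {χ : DirichletCharacter ℂ q} (hχ : χ ≠ 1)
    {η : ℝ} (hη0 : 0 < η) (hη : η ≤ 1 / 2) {s : ℂ} (hs : 1 - η ≤ s.re) :
    Summable fun b => ‖chiBlock χ b s‖ := by
  rw [← summable_nat_add_iff 1]
  exact Summable.of_nonneg_of_le (fun _ => norm_nonneg _)
    (fun b => norm_chiBlock_succ_le hχ b hη0 hη hs) ((summable_zetaC hη0).mul_left _)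

lemma norm_chiH_le {q : ℕ} [NeZero q] {χ : DirichletCharacter ℂ q} (hχ : χ ≠ 1)
    {η : ℝ} (hη0 : 0 < η) (hη : η ≤ 1 / 2) {s : ℂ} (hs : 1 - η ≤ s.re) :
    ‖chiH χ s‖ ≤ 3 * zetaC η * (q * (1 + ‖s‖)) ^ (2 * η) := by
  have hz := zetaC_ge_one hη0
  have hsum := summable_chiBlock hχ hη0 hη hs
  calc ‖chiH χ s‖ ≤ ∑' b, ‖chiBlock χ b s‖ := norm_tsum_le_tsum_norm hsum
    _ = ‖chiBlock χ 0 s‖ + ∑' b, ‖chiBlock χ (b + 1) s‖ := hsum.tsum_eq_zero_add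
    _ ≤ q ^ (2 * η) * zetaC η + 2 * q ^ η * ‖s‖ ^ (2 * η) * zetaC η := by
        refine add_le_add (norm_chiBlock_zero_le χ hη0 hη hs) ?_
        rw [zetaC, ← tsum_mul_left]
        exact Summable.tsum_le_tsum (fun b => norm_chiBlock_succ_le hχ b hη0 hη hs)
          ((summable_nat_add_iff (f := fun b => ‖chiBlock χ b s‖) 1).2 hsum) ((summable_zetaC hη0).mul_left _)
    _ ≤ q ^ (2 * η) * zetaC η * (1 + ‖s‖) ^ (2 * η) +
        2 * q ^ (2 * η) * (1 + ‖s‖) ^ (2 * η) * zetaC η := by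
        have h2 : (q : ℝ) ^ η ≤ q ^ (2 * η) :=
          rpow_le_rpow_of_exponent_le (mod_cast one_le_iff_ne_zero.2 (NeZero.ne q)) (by linarith)
        have h3 : ‖s‖ ^ (2 * η) ≤ (1 + ‖s‖) ^ (2 * η) :=
          rpow_le_rpow (norm_nonneg _) (by linarith) (by linarith)
        refine add_le_add ?_ (by gcongr)
        exact le_mul_of_one_le_right (by positivity) (one_le_rpow (by linarith [norm_nonneg s]) (by linarith))
    _ = _ := by
        rw [mul_rpow (by positivity) (by positivity)]; ring

lemma differentiable_chiBlock {q : ℕ} (χ : DirichletCharacter ℂ q) (b : ℕ) {s : ℂ} (hs : s ≠ 0) :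
    DifferentiableAt ℂ (chiBlock χ b) s := by
  unfold chiBlock
  refine DifferentiableAt.fun_sum fun a _ => (differentiableAt_const _).mul ?_
  refine DifferentiableAt.const_cpow (by fun_prop) (Or.inr (by simpa using hs))

lemma differentiableAt_chiH {q : ℕ} [NeZero q] {χ : DirichletCharacter ℂ q} (hχ : χ ≠ 1)
    {s : ℂ} (hs : 1 / 2 < s.re) : DifferentiableAt ℂ (chiH χ) s := by
  obtain ⟨η, h1, h2⟩ : ∃ η, max (1 / 4) (1 - s.re) < η ∧ η < 1 / 2 :=
    exists_between (max_lt (by norm_num) (by linarith))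
  have hη0 : 0 < η := by linarith [le_max_left (1 / 4) (1 - s.re)]
  have h3 := (le_max_right _ _).trans_lt h1
  set U : Set ℂ := {z | 1 - η < z.re} ∩ {z | ‖z‖ < ‖s‖ + 1}
  have hUo : IsOpen U := (isOpen_lt continuous_const continuous_re).inter
    (isOpen_lt continuous_norm continuous_const)
  have hd : DifferentiableOn ℂ (fun z => ∑' b, chiBlock χ (b + 1) z) U := by
    refine differentiableOn_tsum_of_summable_norm
      (u := fun b => 2 * q ^ η * (‖s‖ + 1) ^ (2 * η) * ((b + 1 : ℕ)) ^ (-1 - η))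
      ((summable_zetaC hη0).mul_left _) (fun b z hz => ?_) hUo (fun b z hz => ?_)
    · refine (differentiable_chiBlock χ _ ?_).differentiableWithinAt
      rintro rfl
      have := hz.1
      simp only [Set.mem_ofPred_eq, zero_re] at this
      linarith
    · refine (norm_chiBlock_succ_le hχ b hη0 h2.le (le_of_lt hz.1)).trans ?_
      have := hz.2
      simp only [Set.mem_ofPred_eq] at this
      gcongr
  have hsU : s ∈ U := ⟨by simp only [Set.mem_ofPred_eq]; linarith, by simp⟩
  refine ((differentiable_chiBlock χ 0 (by rintro rfl; simp at hs; linarith)).add (hd.differentiableAt (hUo.mem_nhds hsU))).congr_of_eventuallyEq ?_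
  filter_upwards [hUo.mem_nhds hsU] with z hz
  exact ((summable_chiBlock hχ hη0 h2.le (le_of_lt hz.1)).of_norm).tsum_eq_zero_add

open Filter Topology in
lemma chiH_eq_LSeries {q : ℕ} [NeZero q] {χ : DirichletCharacter ℂ q} (hχ : χ ≠ 1)
    {s : ℂ} (hs : 1 < s.re) : chiH χ s = LSeries (fun n => χ n) s := by
  have hs0 : s ≠ 0 := by rintro rfl; simp at hs; linarith
  refine tendsto_nhds_unique (((summable_chiBlock hχ (by norm_num) le_rfl (by linarith : 1 - 1 / 2 ≤ s.re)).of_norm).hasSum.tendsto_sum_nat) ((((LSeriesSummable_of_one_lt_re χ hs).hasSum.tendsto_sum_nat).comp (tendsto_atTop_mono (fun B => Nat.le_mul_of_pos_right B (Nat.pos_of_ne_zero (NeZero.ne q))) tendsto_id)).congr fun B => ?_)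
  simp only [Function.comp]
  induction B with
  | zero => simp
  | succ B ih =>
    rw [sum_range_succ, ← ih, succ_mul, sum_range_add]
    congr 1
    rw [chiBlock]
    refine sum_congr rfl fun a _ => ?_
    rw [LSeries.term_def]
    split_ifs with h
    · rw [h]; simp [hs0]
    · rw [cpow_neg, div_eq_mul_inv]
      simp

/-- The `n`-th term in the series of `(s-1)ζ(s)`. -/
def zetaBlk (n : ℕ) (s : ℂ) : ℂ :=
  (s - 1) * (n : ℂ) ^ (-s) + ((n + 1 : ℕ) : ℂ) ^ (1 - s) - (n : ℂ) ^ (1 - s)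

/-- The function `(s-1)ζ(s)` as a series. -/
def zetaK (s : ℂ) : ℂ := 1 + ∑' n : ℕ, zetaBlk (n + 1) s

lemma norm_zetaBlk_succ_le (n : ℕ) {η : ℝ} (hη0 : 0 < η) (hη : η ≤ 1 / 2) {s : ℂ}
    (hs : 1 - η ≤ s.re) :
    ‖zetaBlk (n + 1) s‖ ≤ 2 * ‖s - 1‖ * ‖s‖ ^ (2 * η) * ((n + 1 : ℕ)) ^ (-1 - η) := by
  set u : ℝ := ((n + 1 : ℕ) : ℝ) with hu
  have hu1 : 1 ≤ u := by rw [hu]; exact_mod_cast succ_le_succ (Nat.zero_le n)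
  have hu0 : 0 < u := by linarith
  by_cases h1 : s = 1
  · subst h1; simp [zetaBlk]
  have h := Convex.norm_image_sub_le_of_norm_hasDerivWithin_le
    (f := fun x : ℝ => (s - 1) * u ^ (-s) * x + x ^ (1 - s))
    (f' := fun x => (s - 1) * u ^ (-s) * 1 + (1 - s) * x ^ (1 - s - 1))
    (C := 2 * ‖s - 1‖ * ‖s‖ ^ (2 * η) * u ^ (-1 - η)) ?_ ?_ (convex_Icc u (u + 1))
    (Set.left_mem_Icc.2 (by linarith)) (Set.right_mem_Icc.2 (by linarith))
  · have e : zetaBlk (n + 1) s = ((s - 1) * u ^ (-s) * ((u + 1 : ℝ)) +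
        ((u + 1 : ℝ)) ^ (1 - s)) - ((s - 1) * u ^ (-s) * u + u ^ (1 - s)) := by
      rw [zetaBlk, hu]; push_cast; ring
    rw [e]
    refine h.trans (le_of_eq ?_)
    simp
  · intro x hx
    refine (HasDerivAt.add ((Complex.ofRealCLM.hasDerivAt).const_mul _) ?_).hasDerivWithinAt
    exact hasDerivAt_ofReal_cpow_const (by linarith [hx.1]) (sub_ne_zero.2 (Ne.symm h1))
  · intro x hx
    have e : (s - 1) * u ^ (-s) * 1 + (1 - s) * x ^ (1 - s - 1) =
        -((s - 1) * (x ^ (-s) - u ^ (-s))) := by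
      rw [show 1 - s - 1 = -s by ring]; ring
    rw [e, norm_neg, norm_mul]
    have h3 : ‖s‖ * (x - u) / u ≤ ‖s‖ / u := by
      gcongr
      exact mul_le_of_le_one_right (norm_nonneg _) (by linarith [hx.2])
    have h4 : 0 ≤ ‖s‖ * (x - u) / u := by
      have := sub_nonneg.2 hx.1
      positivity
    have h5 : u ^ (-s.re) ≤ u ^ (-1 + η) :=
      rpow_le_rpow_of_exponent_le hu1 (by linarith)
    calc _ ≤ ‖s - 1‖ * (2 * (‖s‖ / u) ^ (2 * η) * u ^ (-1 + η)) := by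
          refine mul_le_mul_of_nonneg_left ((norm_cpow_neg_sub_le_rpow (θ := 2 * η) hu0 hx.1 (by linarith) (by linarith) (by linarith)).trans ?_) (norm_nonneg _)
          gcongr
      _ = _ := by
          rw [div_rpow (norm_nonneg _) hu0.le,
            show -1 - η = (-1 + η) - 2 * η by ring, rpow_sub hu0]
          field_simp

lemma summable_zetaBlk {η : ℝ} (hη0 : 0 < η) (hη : η ≤ 1 / 2) {s : ℂ} (hs : 1 - η ≤ s.re) :
    Summable fun n => ‖zetaBlk (n + 1) s‖ :=
  Summable.of_nonneg_of_le (fun _ => norm_nonneg _)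
    (fun b => norm_zetaBlk_succ_le b hη0 hη hs) ((summable_zetaC hη0).mul_left _)

lemma norm_zetaK_sub_one_le {η : ℝ} (hη0 : 0 < η) (hη : η ≤ 1 / 2) {s : ℂ} (hs : 1 - η ≤ s.re) :
    ‖zetaK s - 1‖ ≤ 2 * zetaC η * (1 + ‖s‖) ^ (2 * η) * ‖s - 1‖ := by
  have hz := zetaC_ge_one hη0
  rw [zetaK, add_sub_cancel_left]
  calc _ ≤ ∑' b, ‖zetaBlk (b + 1) s‖ := norm_tsum_le_tsum_norm (summable_zetaBlk hη0 hη hs)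
    _ ≤ 2 * ‖s - 1‖ * ‖s‖ ^ (2 * η) * zetaC η := by
        rw [zetaC, ← tsum_mul_left]
        exact Summable.tsum_le_tsum (fun b => norm_zetaBlk_succ_le b hη0 hη hs)
          (summable_zetaBlk hη0 hη hs) ((summable_zetaC hη0).mul_left _)
    _ ≤ 2 * ‖s - 1‖ * (1 + ‖s‖) ^ (2 * η) * zetaC η := by
        gcongr; linarith
    _ = _ := by ring

lemma zetaK_one : zetaK 1 = 1 := by
  have := norm_zetaK_sub_one_le (by norm_num) le_rfl (s := 1) (by simp)
  simpa [sub_eq_zero] using this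

lemma differentiableAt_zetaK {s : ℂ} (hs : 1 / 2 < s.re) : DifferentiableAt ℂ zetaK s := by
  obtain ⟨η, h1, h2⟩ : ∃ η, max (1 / 4) (1 - s.re) < η ∧ η < 1 / 2 :=
    exists_between (max_lt (by norm_num) (by linarith))
  have hη0 : 0 < η := by linarith [le_max_left (1 / 4) (1 - s.re)]
  have h3 := (le_max_right _ _).trans_lt h1
  set U : Set ℂ := {z | 1 - η < z.re} ∩ {z | ‖z‖ < ‖s‖ + 1}
  have hUo : IsOpen U := (isOpen_lt continuous_const continuous_re).inter
    (isOpen_lt continuous_norm continuous_const)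
  have hd : DifferentiableOn ℂ (fun z => ∑' b, zetaBlk (b + 1) z) U := by
    refine differentiableOn_tsum_of_summable_norm
      (u := fun b => 2 * (‖s‖ + 2) * (‖s‖ + 1) ^ (2 * η) * ((b + 1 : ℕ)) ^ (-1 - η))
      ((summable_zetaC hη0).mul_left _) (fun b z hz => ?_) hUo (fun b z hz => ?_)
    · have hb : ∀ m, ((m + 1 : ℕ) : ℂ) ≠ 0 := fun m => mod_cast succ_ne_zero m
      unfold zetaBlk
      refine DifferentiableAt.differentiableWithinAt ?_
      refine ((DifferentiableAt.mul (by fun_prop)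
        (DifferentiableAt.const_cpow (by fun_prop) (Or.inl (hb _)))).add
        (DifferentiableAt.const_cpow (by fun_prop) (Or.inl (hb _)))).sub
        (DifferentiableAt.const_cpow (by fun_prop) (Or.inl (hb _)))
    · refine (norm_zetaBlk_succ_le b hη0 h2.le (le_of_lt hz.1)).trans ?_
      have := hz.2
      simp only [Set.mem_ofPred_eq] at this
      have h6 : ‖z - 1‖ ≤ ‖s‖ + 2 := by
        refine (norm_sub_le _ _).trans ?_
        rw [norm_one]; linarith
      gcongr
  exact (differentiableAt_const _).add (hd.differentiableAt (hUo.mem_nhds (⟨by simp only [Set.mem_ofPred_eq]; linarith, by simp⟩)))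

open Filter Topology in
lemma zetaK_eq {s : ℂ} (hs : 1 < s.re) : zetaK s = (s - 1) * riemannZeta s := by
  have hs1 : 1 - s ≠ 0 := by
    intro h
    have := congrArg re h
    simp at this; linarith
  have h3 : Tendsto (fun B => ∑ n ∈ range B, 1 / ((n + 1 : ℕ) : ℂ) ^ s) atTop
      (𝓝 (riemannZeta s)) := by
    rw [zeta_eq_tsum_one_div_nat_add_one_cpow hs]
    simpa using ((summable_nat_add_iff (f := fun n => 1 / (n : ℂ) ^ s) 1).2 (summable_one_div_nat_cpow.2 hs)).hasSum.tendsto_sum_nat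
  have h4 : Tendsto (fun B => ((B + 1 : ℕ) : ℂ) ^ (1 - s)) atTop (𝓝 0) := by
    rw [tendsto_zero_iff_norm_tendsto_zero]
    refine (((tendsto_rpow_neg_atTop (by linarith)).comp tendsto_natCast_atTop_atTop).comp (tendsto_add_atTop_nat 1) : Tendsto (fun B => ((B + 1 : ℕ) : ℝ) ^ (-(s.re - 1))) atTop (𝓝 0)).congr fun B => ?_
    rw [norm_natCast_cpow_of_pos (succ_pos B)]
    simp
  have h6 := ((h3.const_mul (s - 1)).add h4)
  refine tendsto_nhds_unique ((((summable_zetaBlk (by norm_num) le_rfl (by linarith : 1 - 1 / 2 ≤ s.re)).of_norm).hasSum.tendsto_sum_nat).const_add 1) ?_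
  rw [add_zero] at h6
  refine h6.congr fun B => ?_
  induction B with
  | zero => simp
  | succ B ih =>
    rw [sum_range_succ, sum_range_succ, mul_add, ← add_assoc 1, ← ih, zetaBlk, cpow_neg]
    ring

/-- Estermann's lemma: a lower bound for the value at `1` of `(s - 1) * ∑ b n n⁻ˢ`, `b ≥ 0`, given
nonnegativity at a point `β` slightly to the left of `1`. -/
lemma estermann_lower_bound {Φ : ℂ → ℂ} (hd : ∀ s : ℂ, 1 / 2 < s.re → DifferentiableAt ℂ Φ s)
    {b : ℕ → ℂ} (hb : 0 ≤ b) (hb1 : b 1 = 1) (hab : LSeries.abscissaOfAbsConv b ≤ 1)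
    (hΦ : ∀ s : ℂ, 1 < s.re → Φ s = (s - 1) * LSeries b s) {B : ℝ} (hB1 : 1 ≤ B)
    (hB : ∀ s : ℂ, ‖s - 2‖ ≤ 4 / 3 → ‖Φ s‖ ≤ B) {β : ℝ} (hβ0 : 11 / 12 ≤ β) (hβ1 : β < 1)
    (hβ : 0 ≤ (Φ β).re) :
    (1 - β) / 6 * (64 * B) ^ (-5 * (1 - β)) ≤ (Φ 1).re := by
  set g : ℂ → ℂ := dslope Φ 1 with hg
  have hgd : DifferentiableOn ℂ g {s : ℂ | 1 / 2 < s.re} :=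
    (differentiableOn_dslope ((isOpen_lt continuous_const continuous_re).mem_nhds (by norm_num))).2
      fun s hs => (hd s hs).differentiableWithinAt
  have hgne : ∀ s : ℂ, s ≠ 1 → g s = (Φ s - Φ 1) / (s - 1) := fun s hs => by
    rw [hg, dslope_of_ne _ hs, slope_def_field]
  have hball : Metric.ball (2 : ℂ) (3 / 2) ⊆ {s : ℂ | 1 / 2 < s.re} := by
    intro s hs
    rw [Metric.mem_ball, dist_eq_norm] at hs
    have := abs_re_le_norm (s - 2)
    have h2 := (abs_lt.1 (this.trans_lt hs)).1
    simp at h2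
    change 1 / 2 < s.re
    linarith
  set D : ℕ → ℂ := fun n => iteratedDeriv n g 2 with hD
  set c : ℕ → ℝ := fun n => ((-1) ^ n * iteratedDeriv n (LSeries b) 2).re / n.factorial with hc
  have habs : LSeries.abscissaOfAbsConv b < (2 : ℝ) :=
    lt_of_le_of_lt hab (by norm_cast)
  have hc0 : ∀ n, 0 ≤ c n := fun n => by
    have := LSeries.iteratedDeriv_alternating hb habs n
    exact div_nonneg (le_def.1 (by simpa using this)).1 (by positivity)
  have hc1 : 1 ≤ c 0 := by
    have hs : LSeriesSummable b 2 := LSeriesSummable_of_abscissaOfAbsConv_lt_re (by simpa using habs)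
    have hre := (Complex.reCLM.summable hs)
    have : (LSeries b 2).re = ∑' n, (LSeries.term b 2 n).re := re_tsum hs
    simp only [hc, pow_zero, iteratedDeriv_zero, factorial_zero, one_mul, cast_one, div_one]
    rw [this]
    have h0 := fun n => by
      have := LSeries.term_nonneg (hb n) 2
      exact (le_def.1 (by simpa using this)).1
    calc 1 = (LSeries.term b 2 1).re := by simp [hb1]
      _ ≤ _ := hre.le_tsum 1 fun n _ => h0 n
  have hDn : ∀ n, ((-1) ^ n * D n).re / n.factorial = c n - (Φ 1).re := by
    intro n
    have hev : g =ᶠ[nhds 2] fun s => LSeries b s - Φ 1 * (1 * s + (-1))⁻¹ := by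
      filter_upwards [((isOpen_lt continuous_const continuous_re).mem_nhds (by norm_num) : ∀ᶠ s : ℂ in nhds 2, 1 < s.re)] with s hs
      have hs1 : s ≠ 1 := fun h => by simp [h] at hs
      have hs2 := sub_ne_zero.2 hs1
      rw [hgne s hs1, hΦ s hs, one_mul, ← sub_eq_add_neg]
      field_simp
    have h1 : ContDiffAt ℂ n (LSeries b) 2 :=
      (LSeries_analyticOnNhd b 2 (by simpa using habs)).contDiffAt
    have h2 : ContDiffAt ℂ n (fun s : ℂ => (1 * s + (-1))⁻¹) 2 := by
      apply ContDiffAt.inv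
      · fun_prop
      · norm_num
    have h3 : iteratedDeriv n (fun s : ℂ => (1 * s + (-1))⁻¹) 2 = (-1) ^ n * n.factorial := by
      rw [iteratedDeriv_eq_iterate, iter_deriv_inv_linear]
      norm_num
    have : D n = iteratedDeriv n (LSeries b) 2 - Φ 1 * ((-1) ^ n * n.factorial) := by
      rw [hD]; simp only
      rw [hev.iteratedDeriv_eq, iteratedDeriv_fun_sub h1 (contDiffAt_const.mul h2),
        iteratedDeriv_const_mul_field, h3]
    have hf : (n.factorial : ℝ) ≠ 0 := by positivity
    rw [this, mul_sub, sub_re, sub_div]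
    congr 1
    rw [div_eq_iff hf]
    have : (-1) ^ n * (Φ 1 * ((-1) ^ n * n.factorial)) = Φ 1 * ((n.factorial : ℝ)) := by
      push_cast
      linear_combination (Φ 1 * n.factorial) * (by rw [← mul_pow]; simp : (-1 : ℂ) ^ n * (-1) ^ n = 1)
    rw [this, re_mul_ofReal]
  have hDb : ∀ n, ‖D n‖ ≤ n.factorial * (6 * B) / (4 / 3) ^ n := by
    intro n
    refine norm_iteratedDeriv_le_of_forall_mem_sphere_norm_le n (by norm_num) ?_ ?_
    · refine (hgd.mono ?_).diffContOnCl
      rw [closure_ball _ (by norm_num)]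
      exact (Metric.closedBall_subset_ball (by norm_num)).trans hball
    · intro z hz
      rw [mem_sphere_iff_norm] at hz
      have h1 : (1 / 3) ≤ ‖z - 1‖ := by
        have : ‖z - 2‖ ≤ ‖z - 1‖ + ‖(1 : ℂ)‖ := by
          have := norm_sub_le (z - 1) 1
          rwa [sub_sub, one_add_one_eq_two] at this
        rw [hz] at this; simp at this; linarith
      rw [hgne z fun h => by norm_num [h] at h1, norm_div]
      have h2 : ‖Φ z - Φ 1‖ ≤ 2 * B := by
        have := norm_sub_le (Φ z) (Φ 1)
        have h3 := hB z hz.le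
        have h4 := hB 1 (by norm_num)
        linarith
      rw [div_le_iff₀ (by linarith)]
      nlinarith
  have hsum := hasSum_taylorSeries_on_ball
    (hgd.mono hball) (z := β) (by
      rw [Metric.mem_ball, dist_eq_norm]
      rw [(by push_cast; ring : (β : ℂ) - 2 = ((β - 2 : ℝ))), norm_real, norm_eq_abs, abs_lt]
      constructor <;> linarith)
  have hβne : (β : ℂ) ≠ 1 := by
    intro h
    have : β = 1 := mod_cast h
    linarith
  have hterm : ∀ n, ((n.factorial : ℂ)⁻¹ • ((β : ℂ) - 2) ^ n • iteratedDeriv n g 2).re =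
      (c n - (Φ 1).re) * (2 - β) ^ n := by
    intro n
    have e : (n.factorial : ℂ)⁻¹ • ((β : ℂ) - 2) ^ n • iteratedDeriv n g 2 =
        (((2 - β) ^ n / n.factorial : ℝ)) * ((-1) ^ n * D n) := by
      have : ((β : ℂ) - 2) ^ n = (-1) ^ n * (2 - β) ^ n := by
        rw [← mul_pow]; congr 1; ring
      rw [smul_eq_mul, smul_eq_mul, this, hD]
      push_cast
      field_simp
    rw [e, re_ofReal_mul, ← hDn]
    ring
  have hre := hasSum_re hsum
  simp only [hterm] at hre
  have hgβ : (g β).re = ((Φ 1).re - (Φ β).re) / (1 - β) := by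
    rw [hgne _ hβne]
    have : (Φ β - Φ 1) / (β - 1) = (Φ 1 - Φ β) / ((1 - β : ℝ)) := by
      have h1 := sub_ne_zero.2 hβne
      have h2 := sub_ne_zero.2 (Ne.symm hβne)
      push_cast
      rw [div_eq_div_iff h1 h2]; ring
    rw [this, div_ofReal_re, sub_re]
  rw [hgβ] at hre
  set lam := (Φ 1).re
  have habd : ∀ n, |(c n - lam) * (2 - β) ^ n| ≤ 6 * B * (13 / 16) ^ n := by
    intro n
    rw [← hDn, abs_mul, abs_div, abs_of_pos (show (0 : ℝ) < n.factorial by positivity),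
      abs_of_pos (pow_pos (by linarith : 0 < 2 - β) n)]
    have h1 : |((-1) ^ n * D n).re| ≤ n.factorial * (6 * B) / (4 / 3) ^ n := by
      refine (abs_re_le_norm _).trans ?_
      rw [norm_mul, norm_pow, norm_neg, norm_one, one_pow, one_mul]
      exact hDb n
    have hf : 0 < n.factorial := by positivity
    calc |((-1) ^ n * D n).re| / n.factorial * (2 - β) ^ n
        ≤ (n.factorial * (6 * B) / (4 / 3) ^ n) / n.factorial * (13 / 12) ^ n :=
          mul_le_mul (by gcongr) (pow_le_pow_left₀ (by linarith) (by linarith) _)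
            (pow_nonneg (by linarith) _) (by positivity)
      _ = 6 * B * (13 / 16) ^ n := by
          rw [(by rw [← mul_pow]; norm_num : (13 / 12 : ℝ) ^ n = (13 / 16) ^ n * (4 / 3) ^ n)]; field_simp
  set M : ℕ := ⌈5 * log (64 * B)⌉₊
  have hlog : 0 ≤ log (64 * B) := log_nonneg (by linarith)
  have hM1 : 5 * log (64 * B) ≤ M := le_ceil _
  have hM2 : M < 5 * log (64 * B) + 1 := ceil_lt_add_one (by positivity)
  have hpow : (13 / 16) ^ M ≤ 1 / (64 * B) := by
    have h1 : (13 / 16) ≤ exp (-(1 / 5)) := by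
      have := add_one_le_exp (-(1/5))
      have h3 : (13 / 16 : ℝ) ≤ 0.8125 := by norm_num
      have h4 := exp_bound_div_one_sub_of_interval (x := 1/5) (by norm_num) (by norm_num)
      have h5 : exp (1 / 5) ^ 5 ≤ 2.7182818286 := by
        rw [← exp_nat_mul]; norm_num; exact Real.exp_one_lt_d9.le.trans (by norm_num)
      have h6 : exp (1 / 5) ≤ 16 / 13 := by
        by_contra! h
        have : (16 / 13) ^ 5 < exp (1 / 5) ^ 5 := pow_lt_pow_left₀ h (by norm_num) (by norm_num)
        norm_num at this h5
        linarith
      rw [exp_neg]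
      rw [le_inv_comm₀ (by norm_num) (exp_pos _)]
      exact h6.trans (by norm_num)
    calc (13 / 16) ^ M ≤ exp (-(1 / 5)) ^ M := by gcongr
      _ = exp (-(M / 5)) := by rw [← exp_nat_mul]; congr 1; ring
      _ ≤ exp (-log (64 * B)) := exp_le_exp.2 (by linarith)
      _ = 1 / (64 * B) := by rw [exp_neg, exp_log (by linarith)]; ring
  have htail : -(1 / 2) ≤ (lam - (Φ β).re) / (1 - β) -
      ∑ n ∈ range M, (c n - lam) * (2 - β) ^ n := by
    have h2 : HasSum (fun n => -(6 * B * (13 / 16) ^ (n + M))) (-(6 * B * (13 / 16) ^ M * (1 - 13 / 16)⁻¹)) := by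
      have := ((hasSum_geometric_of_lt_one (r := (13 / 16)) (by norm_num) (by norm_num)).mul_left
        (6 * B * (13 / 16) ^ M)).neg
      refine this.congr_fun ?_ |> id
      intro n; ring
    refine le_trans ?_ (hasSum_le (fun n => (neg_le_of_abs_le (habd (n + M)))) h2 ((hasSum_nat_add_iff' M).2 hre))
    have : 6 * B * (13 / 16) ^ M ≤ 6 * B * (1 / (64 * B)) := by gcongr
    rw [(by field_simp : 6 * B * (1 / (64 * B)) = 6 / 64)] at this
    norm_num
    linarith
  have hlow : c 0 - lam * ∑ n ∈ range M, (2 - β) ^ n ≤ ∑ n ∈ range M, (c n - lam) * (2 - β) ^ n := by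
    have hM0 : 0 < M := ceil_pos.2 (by
      have : 0 < log (64 * B) := log_pos (by linarith)
      linarith)
    simp only [sub_mul, sum_sub_distrib, ← mul_sum]
    have : c 0 ≤ ∑ n ∈ range M, c n * (2 - β) ^ n := by
      have := single_le_sum (f := fun n => c n * (2 - β) ^ n)
        (fun n _ => mul_nonneg (hc0 n) (pow_nonneg (by linarith) n)) (mem_range.2 hM0)
      simpa using this
    linarith
  have hgeo : (∑ n ∈ range M, (2 - β) ^ n) = ((2 - β) ^ M - 1) / (1 - β) := by
    rw [geom_sum_eq (by linarith)]
    congr 1; ring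
  have h1β : 0 < 1 - β := by linarith
  rw [hgeo] at hlow
  have hfin : 1 / 2 ≤ lam * ((2 - β) ^ M / (1 - β)) := by
    have e : lam * ((2 - β) ^ M / (1 - β)) = lam * (((2 - β) ^ M - 1) / (1 - β)) + lam / (1 - β) := by
      ring
    have e2 : (lam - (Φ β).re) / (1 - β) ≤ lam / (1 - β) := by gcongr; linarith
    rw [e]
    linarith
  have hup : (2 - β) ^ M ≤ 3 * (64 * B) ^ (5 * (1 - β)) := by
    calc (2 - β) ^ M ≤ exp (1 - β) ^ M := pow_le_pow_left₀ (by linarith) (by have := add_one_le_exp (1 - β); linarith) _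
      _ = exp (M * (1 - β)) := by rw [← exp_nat_mul]
      _ ≤ exp (1 + log (64 * B) * (5 * (1 - β))) := by
          apply exp_le_exp.2; nlinarith
      _ ≤ 3 * (64 * B) ^ (5 * (1 - β)) := by
          rw [Real.exp_add, rpow_def_of_pos (by linarith)]
          gcongr
          exact Real.exp_one_lt_d9.le.trans (by norm_num)
  have hlam0 : 0 ≤ lam := by
    by_contra! h
    have : lam * ((2 - β) ^ M / (1 - β)) ≤ 0 :=
      mul_nonpos_of_nonpos_of_nonneg h.le (div_nonneg (pow_nonneg (by linarith) _) h1β.le)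
    linarith
  rw [(by ring : (-5 * (1 - β)) = -(5 * (1 - β))), rpow_neg (by linarith)]
  rw [← div_eq_mul_inv, div_le_iff₀ (rpow_pos_of_pos (by linarith) _)]
  have h5 : (1 - β) * (1 / 2) ≤ lam * (2 - β) ^ M := by
    have := mul_le_mul_of_nonneg_left hfin h1β.le
    have e : (1 - β) * (lam * ((2 - β) ^ M / (1 - β))) = lam * (2 - β) ^ M := by field_simp
    linarith
  nlinarith [mul_le_mul_of_nonneg_left hup hlam0]

/-- The arithmetic function attached to a Dirichlet character. -/
def chiA {q : ℕ} (χ : DirichletCharacter ℂ q) : ArithmeticFunction ℂ :=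
  toArithmeticFunction (χ ·)

lemma chiA_apply {q : ℕ} (χ : DirichletCharacter ℂ q) {n : ℕ} (hn : n ≠ 0) : chiA χ n = χ n := by
  simp [chiA, toArithmeticFunction, hn]

lemma chiA_apply_one {q : ℕ} (χ : DirichletCharacter ℂ q) : chiA χ 1 = 1 := by
  simp [chiA_apply]

lemma LSeries_chiA {q : ℕ} (χ : DirichletCharacter ℂ q) (s : ℂ) :
    LSeries (chiA χ) s = LSeries (fun n => χ n) s :=
  LSeries_congr (fun {n} hn => chiA_apply χ hn) s

lemma LSeriesSummable_chiA {q : ℕ} (χ : DirichletCharacter ℂ q) {s : ℂ} (hs : 1 < s.re) :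
    LSeriesSummable (chiA χ) s :=
  LSeriesSummable_of_bounded_of_one_lt_re (fun n hn => by
    rw [chiA_apply χ hn]; exact norm_le_one χ _) hs

lemma LSeries_chiA_one {s : ℂ} (hs : 1 < s.re) :
    LSeries (chiA (1 : DirichletCharacter ℂ 1)) s = riemannZeta s := by
  rw [LSeries_chiA, ← LSeries_one_eq_riemannZeta hs]
  refine LSeries_congr (fun {n} _ => ?_) s
  simp only [Pi.one_apply]
  exact MulChar.one_apply (isUnit_of_subsingleton _)

lemma abscissa_le_one_of_summable {f : ℕ → ℂ} (h : ∀ s, 1 < s.re → LSeriesSummable f s) :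
    LSeries.abscissaOfAbsConv f ≤ 1 := by
  refine LSeries.abscissaOfAbsConv_le_of_forall_lt_LSeriesSummable' fun y hy => h y ?_
  exact_mod_cast hy

/-- `g` is the logarithmic derivative of `a`: `a log = a * g`. -/
def IsLogDer (a g : ArithmeticFunction ℂ) : Prop := ∀ n : ℕ, (log n : ℂ) * a n = (a * g) n

/-- The arithmetic function `χ Λ`. -/
def chiLam {q : ℕ} (χ : DirichletCharacter ℂ q) : ArithmeticFunction ℂ :=
  ⟨fun n => χ n * (Λ n : ℝ), by simp⟩

lemma IsLogDer.mul {a b g h : ArithmeticFunction ℂ} (ha : IsLogDer a g) (hb : IsLogDer b h) :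
    IsLogDer (a * b) (g + h) := by
  intro n
  rw [(by ring : (a * b) * (g + h) = (a * g) * b + a * (b * h)), ArithmeticFunction.add_apply, ArithmeticFunction.mul_apply, ArithmeticFunction.mul_apply,
    ArithmeticFunction.mul_apply, mul_sum, ← sum_add_distrib]
  refine sum_congr rfl fun p hp => ?_
  rw [← ha, ← hb]
  obtain ⟨h1, h2⟩ := mem_divisorsAntidiagonal.1 hp
  rw [← h1, cast_mul, Real.log_mul (mod_cast (by rintro h; simp [h] at h1; exact h2 h1.symm)) (mod_cast (by rintro h; simp [h] at h1; exact h2 h1.symm))]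
  push_cast
  ring

lemma IsLogDer.nonneg {a g : ArithmeticFunction ℂ} (h : IsLogDer a g) (hg : ∀ n, 0 ≤ g n)
    (hg1 : g 1 = 0) (ha1 : a 1 = 1) (n : ℕ) : 0 ≤ a n := by
  induction n using Nat.strong_induction_on with
  | _ n ih =>
    rcases Nat.lt_or_ge n 2 with h2 | h2
    · interval_cases n
      · simp
      · rw [ha1]; exact zero_le_one
    have hl : 0 < log n := Real.log_pos (mod_cast h2)
    have e : a n = ((log n)⁻¹) * (a * g) n := by
      rw [← h n, ofReal_inv, inv_mul_cancel_left₀ (mod_cast hl.ne')]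
    rw [e]
    refine mul_nonneg (mod_cast (inv_pos.2 hl).le) ?_
    rw [ArithmeticFunction.mul_apply]
    refine sum_nonneg fun p hp => ?_
    obtain ⟨h1, h3⟩ := mem_divisorsAntidiagonal.1 hp
    rcases eq_or_ne p.2 1 with h4 | h4
    · rw [h4, hg1, mul_zero]
    · refine mul_nonneg (ih p.1 ?_) (hg _)
      have hp2 : p.2 ≠ 0 := by rintro h; simp [h] at h1; exact h3 h1.symm
      rw [← h1]
      have : 2 ≤ p.2 := by omega
      nlinarith [Nat.pos_of_ne_zero (by rintro h; simp [h] at h1; exact h3 h1.symm : p.1 ≠ 0)]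

lemma isLogDer_chiA {q : ℕ} (χ : DirichletCharacter ℂ q) : IsLogDer (chiA χ) (chiLam χ) := by
  intro n
  rcases eq_or_ne n 0 with rfl | hn
  · simp
  rw [chiA_apply χ hn, ← vonMangoldt_sum, ArithmeticFunction.mul_apply,
    sum_divisorsAntidiagonal' (f := fun a b => chiA χ a * chiLam χ b)]
  push_cast
  rw [sum_mul]
  refine sum_congr rfl fun d hd => ?_
  obtain ⟨e, rfl⟩ := (mem_divisors.1 hd).1
  rw [Nat.mul_div_cancel_left _ (Nat.pos_of_ne_zero (left_ne_zero_of_mul hn)), chiA_apply χ (right_ne_zero_of_mul hn)]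
  change _ = χ e * (χ d * _)
  push_cast
  rw [map_mul]
  ring

/-- The product of two Dirichlet characters of arbitrary levels. -/
def chiMul {q r : ℕ} (χ : DirichletCharacter ℂ q) (ψ : DirichletCharacter ℂ r) :
    DirichletCharacter ℂ (q * r) :=
  changeLevel (Nat.dvd_mul_right q r) χ *
    changeLevel (Nat.dvd_mul_left r q) ψ

lemma chiMul_apply {q r : ℕ} (χ : DirichletCharacter ℂ q) (ψ : DirichletCharacter ℂ r) (n : ℕ) :
    chiMul χ ψ n = χ n * ψ n := by
  by_cases h : n.Coprime (q * r)
  · have hu : IsCoprime (n : ℤ) ((q * r)) := isCoprime_iff_coprime.2 h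
    rw [chiMul, MulChar.mul_apply]
    simpa using congrArg₂ (· * ·) (changeLevel_eq_cast_of_dvd' χ (Nat.dvd_mul_right q r) hu) (changeLevel_eq_cast_of_dvd' ψ (Nat.dvd_mul_left r q) hu)
  · have h0 : chiMul χ ψ n = 0 := by
      apply MulChar.map_nonunit
      rwa [ZMod.isUnit_iff_coprime]
    rw [h0]
    rw [coprime_mul_iff_right, not_and_or] at h
    rcases h with h | h
    · rw [MulChar.map_nonunit χ (by rwa [ZMod.isUnit_iff_coprime]), zero_mul]
    · rw [MulChar.map_nonunit ψ (by rwa [ZMod.isUnit_iff_coprime]), mul_zero]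

lemma quadratic_values {q : ℕ} {χ : DirichletCharacter ℂ q} (h : χ ^ 2 = 1) (a : ZMod q) :
    χ a = 0 ∨ χ a = 1 ∨ χ a = -1 :=
  MulChar.isQuadratic_iff_sq_eq_one.mpr h a

lemma nonneg_two_factor {q : ℕ} {χ : DirichletCharacter ℂ q} (h : χ ^ 2 = 1) (n : ℕ) :
    0 ≤ (chiA (1 : DirichletCharacter ℂ 1) * chiA χ) n := by
  refine ((isLogDer_chiA _).mul (isLogDer_chiA χ)).nonneg (fun n => ?_) ?_ ?_ n
  · change 0 ≤ (1 : DirichletCharacter ℂ 1) n * _ + χ n * _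
    rw [MulChar.one_apply (isUnit_of_subsingleton _), ← add_mul]
    refine mul_nonneg ?_ (mod_cast vonMangoldt_nonneg)
    rcases quadratic_values h n with h | h | h <;> rw [h] <;> norm_num
  · change (1 : DirichletCharacter ℂ 1) _ * _ + χ _ * _ = 0
    simp
  · simp [ArithmeticFunction.mul_apply, chiA_apply_one]

lemma nonneg_four_factor {q r : ℕ} {χ : DirichletCharacter ℂ q} {ψ : DirichletCharacter ℂ r}
    (h : χ ^ 2 = 1) (h' : ψ ^ 2 = 1) (n : ℕ) :
    0 ≤ (chiA (1 : DirichletCharacter ℂ 1) * chiA χ * (chiA ψ * chiA (chiMul χ ψ))) n := by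
  refine (((isLogDer_chiA _).mul (isLogDer_chiA χ)).mul
    ((isLogDer_chiA ψ).mul (isLogDer_chiA (chiMul χ ψ)))).nonneg (fun n => ?_) ?_ ?_ n
  · change 0 ≤ ((1 : DirichletCharacter ℂ 1) n * _ + χ n * _) + (ψ n * _ + chiMul χ ψ n * _)
    rw [MulChar.one_apply (isUnit_of_subsingleton _), ← add_mul, ← add_mul, ← add_mul, chiMul_apply]
    refine mul_nonneg ?_ (mod_cast vonMangoldt_nonneg)
    rcases quadratic_values h n with h | h | h <;> rcases quadratic_values h' n with h' | h' | h' <;>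
      rw [h, h'] <;> norm_num
  · change ((1 : DirichletCharacter ℂ 1) _ * _ + χ _ * _) + (ψ _ * _ + chiMul χ ψ _ * _) = 0
    simp
  · simp [ArithmeticFunction.mul_apply, chiA_apply_one]

lemma chiH_eq_LFunction {q : ℕ} [NeZero q] {χ : DirichletCharacter ℂ q} (hχ : χ ≠ 1) {s : ℂ}
    (hs : 1 / 2 < s.re) : chiH χ s = LFunction χ s := by
  have hopen : IsOpen {s : ℂ | 1 / 2 < s.re} := isOpen_lt continuous_const continuous_re
  refine (DifferentiableOn.analyticOnNhd (fun s hs => (differentiableAt_chiH hχ hs).differentiableWithinAt) hopen : AnalyticOnNhd ℂ (chiH χ) {s : ℂ | 1 / 2 < s.re}).eqOn_of_preconnected_of_eventuallyEq (DifferentiableOn.analyticOnNhd (differentiable_LFunction hχ).differentiableOn hopen) ((convex_halfSpace_re_gt (1 / 2)).isPreconnected) (z₀ := 2) (by norm_num) ?_ hs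
  filter_upwards [((isOpen_lt continuous_const continuous_re).mem_nhds (by norm_num) : ∀ᶠ s : ℂ in nhds 2, 1 < s.re)] with s hs
  rw [chiH_eq_LSeries hχ hs, LFunction_eq_LSeries χ hs]

lemma norm_chiH_le_of_mem {q : ℕ} [NeZero q] {χ : DirichletCharacter ℂ q} (hχ : χ ≠ 1) {s : ℂ}
    (hs : ‖s - 2‖ ≤ 4 / 3) : ‖chiH χ s‖ ≤ 15 * zetaC (1 / 3) * q := by
  have hre : 1 - 1 / 3 ≤ s.re := by
    have := (abs_le.1 ((abs_re_le_norm (s - 2)).trans hs)).1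
    simp at this; linarith
  have hn : 1 + ‖s‖ ≤ 5 := by
    have := norm_add_le (s - 2) 2
    simp at this; linarith
  have hq : (1 : ℝ) ≤ q := mod_cast NeZero.one_le
  have hz := zetaC_ge_one (η := 1 / 3) (by norm_num)
  refine (norm_chiH_le hχ (by norm_num) (by norm_num) hre).trans ?_
  have : (q * (1 + ‖s‖)) ^ (2 * (1 / 3) : ℝ) ≤ 5 * q := by
    calc (q * (1 + ‖s‖)) ^ (2 * (1 / 3) : ℝ) ≤ (5 * q) ^ (2 * (1 / 3)) := by
          apply rpow_le_rpow (by positivity) (by nlinarith) (by norm_num)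
      _ ≤ (5 * q) ^ 1 := rpow_le_rpow_of_exponent_le (by linarith) (by norm_num)
      _ = _ := rpow_one _
  nlinarith [mul_le_mul_of_nonneg_left this (by linarith : 0 ≤ 3 * zetaC (1 / 3))]

lemma norm_zetaK_le_of_mem {s : ℂ} (hs : ‖s - 2‖ ≤ 4 / 3) : ‖zetaK s‖ ≤ 26 * zetaC (1 / 3) := by
  have hre : 1 - 1 / 3 ≤ s.re := by
    have := (abs_le.1 ((abs_re_le_norm (s - 2)).trans hs)).1
    simp at this; linarith
  have hn : 1 + ‖s‖ ≤ 5 := by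
    have := norm_add_le (s - 2) 2
    simp at this; linarith
  have hn1 : ‖s - 1‖ ≤ 5 / 2 := by
    have := norm_add_le (s - 2) 1
    rw [show s - 2 + 1 = s - 1 by ring] at this
    simp at this; linarith
  have hz := zetaC_ge_one (η := 1 / 3) (by norm_num)
  have h1 := norm_zetaK_sub_one_le (by norm_num) (by norm_num) hre
  have h2 := norm_add_le (zetaK s - 1) 1
  rw [sub_add_cancel, norm_one] at h2
  have : (1 + ‖s‖) ^ (2 * (1 / 3) : ℝ) ≤ 5 := by
    calc (1 + ‖s‖) ^ (2 * (1 / 3) : ℝ) ≤ 5 ^ (2 * (1 / 3)) := by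
          apply rpow_le_rpow (by positivity) hn (by norm_num)
      _ ≤ 5 ^ 1 := rpow_le_rpow_of_exponent_le (by norm_num) (by norm_num)
      _ = _ := rpow_one _
  have h3 : 2 * zetaC (1 / 3) * (1 + ‖s‖) ^ (2 * (1 / 3) : ℝ) * ‖s - 1‖ ≤
      2 * zetaC (1 / 3) * 5 * (5 / 2) := by gcongr
  linarith

lemma norm_chiH_one_le {q : ℕ} [NeZero q] {χ : DirichletCharacter ℂ q} (hχ : χ ≠ 1) {η : ℝ}
    (hη0 : 0 < η) (hη : η ≤ 1 / 2) : ‖chiH χ 1‖ ≤ 6 * zetaC η * q ^ (2 * η) := by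
  refine (norm_chiH_le hχ hη0 hη (by simp; linarith)).trans ?_
  have : (q * (1 + ‖(1 : ℂ)‖)) ^ (2 * η) ≤ 2 * q ^ (2 * η) := by
    rw [norm_one, mul_rpow (by positivity) (by norm_num), mul_comm]
    gcongr
    calc (1 + 1) ^ (2 * η) ≤ 2 ^ 1 := by
          rw [one_add_one_eq_two]
          exact rpow_le_rpow_of_exponent_le (by norm_num) (by linarith)
      _ = 2 := rpow_one _
  have hz := zetaC_ge_one hη0
  nlinarith [mul_le_mul_of_nonneg_left this (by linarith)]

lemma chiH_one_ne_zero {q : ℕ} [NeZero q] {χ : DirichletCharacter ℂ q} (hχ : χ ≠ 1) :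
    chiH χ 1 ≠ 0 := by
  rw [chiH_eq_LFunction hχ (by norm_num)]
  exact LFunction_apply_one_ne_zero hχ

lemma chiH_im_eq_zero {q : ℕ} {χ : DirichletCharacter ℂ q} (h : χ ^ 2 = 1) (x : ℝ) :
    (chiH χ x).im = 0 := by
  rw [← conj_eq_iff_im, chiH, conj_tsum]
  refine tsum_congr fun b => ?_
  rw [chiBlock, map_sum]
  refine sum_congr rfl fun a _ => ?_
  rw [map_mul]
  have h1 : (starRingEnd ℂ) (χ a) = χ a := by
    rcases quadratic_values h a with h | h | h <;> rw [h] <;> simp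
  have h2 : (((b * q + a : ℕ) : ℂ) ^ (-(x : ℂ))) = (((b * q + a)) ^ (-x) : ℝ) := by
    rw [ofReal_cpow (by positivity)]; push_cast; rfl
  rw [h1, h2, conj_ofReal]

lemma chiH_two_re_pos {q : ℕ} [NeZero q] {χ : DirichletCharacter ℂ q} (hχ : χ ≠ 1) (h : χ ^ 2 = 1) :
    0 < (chiH χ 2).re := by
  have h1 := chiH_im_eq_zero h 2
  have h2 : 0 < LSeries (chiA (1 : DirichletCharacter ℂ 1) * chiA χ : ArithmeticFunction ℂ) (2 : ℝ) := by
    refine LSeries.positive (fun n => nonneg_two_factor h n)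
      (by simp [ArithmeticFunction.mul_apply, chiA_apply_one]) ?_
    refine lt_of_le_of_lt (abscissa_le_one_of_summable fun s hs =>
      LSeriesSummable_mul (LSeriesSummable_chiA _ hs)
        (LSeriesSummable_chiA _ hs)) (by norm_cast)
  rw [LSeries_mul' (LSeriesSummable_chiA _ (by norm_num))
    (LSeriesSummable_chiA _ (by norm_num)), LSeries_chiA_one (by norm_num), LSeries_chiA,
    ← chiH_eq_LSeries hχ (by norm_num)] at h2
  have h3 : riemannZeta ((2 : ℝ)) = ((pi ^ 2 / 6 : ℝ)) := by
    push_cast; exact riemannZeta_two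
  rw [h3] at h2
  have h4 := (lt_def.1 h2).1
  rw [re_ofReal_mul] at h4
  have := (mul_pos_iff_of_pos_left (by positivity)).1 h4
  simpa using this

lemma exists_zero_of_re_neg {q : ℕ} [NeZero q] {χ : DirichletCharacter ℂ q} (hχ : χ ≠ 1)
    (h : χ ^ 2 = 1) {β : ℝ} (hβ : 1 / 2 < β) (hneg : (chiH χ β).re < 0) :
    ∃ γ, β ≤ γ ∧ γ < 1 ∧ chiH χ γ = 0 := by
  have hβ2 : β ≤ 2 := by
    by_contra! h2
    have h1 : chiH χ β = LFunction χ β := chiH_eq_LFunction hχ (by simpa using hβ)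
    have hc : ContinuousOn (fun x : ℝ => (chiH χ x).re) (Set.Icc 2 β) := fun x hx =>
      (Complex.continuous_re.continuousAt.comp (ContinuousAt.comp
        (differentiableAt_chiH hχ (by simp; linarith [hx.1])).continuousAt
        Complex.continuous_ofReal.continuousAt)).continuousWithinAt
    obtain ⟨γ, hγ, hγ0⟩ := intermediate_value_Icc' h2.le hc (⟨hneg.le, by simpa using (chiH_two_re_pos hχ h).le⟩)
    have : chiH χ γ = 0 := Complex.ext hγ0 (chiH_im_eq_zero h γ)
    rw [chiH_eq_LFunction hχ (by simp; linarith [hγ.1])] at this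
    exact LFunction_ne_zero_of_one_le_re χ (.inl hχ) (by simp; linarith [hγ.1]) this
  have hc : ContinuousOn (fun x : ℝ => (chiH χ x).re) (Set.Icc β 2) := fun x hx =>
      (Complex.continuous_re.continuousAt.comp (ContinuousAt.comp
        (differentiableAt_chiH hχ (by simp; linarith [hx.1])).continuousAt
        Complex.continuous_ofReal.continuousAt)).continuousWithinAt
  obtain ⟨γ, hγ, hγ0⟩ := intermediate_value_Icc hβ2 hc (⟨hneg.le, by simpa using (chiH_two_re_pos hχ h).le⟩)
  have hz : chiH χ γ = 0 := Complex.ext hγ0 (chiH_im_eq_zero h γ)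
  refine ⟨γ, hγ.1, ?_, hz⟩
  by_contra! h1
  rw [chiH_eq_LFunction hχ (by simp; linarith [hγ.1])] at hz
  exact LFunction_ne_zero_of_one_le_re χ (.inl hχ) (by simpa using h1) hz

lemma zetaK_eq_chiA {s : ℂ} (hs : 1 < s.re) :
    zetaK s = (s - 1) * LSeries (chiA (1 : DirichletCharacter ℂ 1)) s := by
  rw [zetaK_eq hs, LSeries_chiA_one hs]

lemma siegel_two_factor {q : ℕ} [NeZero q] {χ : DirichletCharacter ℂ q} (hχ : χ ≠ 1)
    (h : χ ^ 2 = 1) {β : ℝ} (hβ0 : 11 / 12 ≤ β) (hβ1 : β < 1)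
    (hβ : 0 ≤ (zetaK β * chiH χ β).re) :
    (1 - β) / 6 * (64 * (390 * zetaC (1 / 3) ^ 2 * q)) ^ (-5 * (1 - β)) ≤ ‖chiH χ 1‖ := by
  have hz := zetaC_ge_one (η := 1 / 3) (by norm_num)
  have hq : (1 : ℝ) ≤ q := mod_cast NeZero.one_le
  have := estermann_lower_bound (Φ := fun s => zetaK s * chiH χ s)
    (fun s hs => (differentiableAt_zetaK hs).mul (differentiableAt_chiH hχ hs))
    (b := (chiA 1 * chiA χ : ArithmeticFunction ℂ))
    (fun n => nonneg_two_factor h n) (by simp [ArithmeticFunction.mul_apply, chiA_apply_one])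
    (abscissa_le_one_of_summable fun s hs =>
      LSeriesSummable_mul (LSeriesSummable_chiA _ hs) (LSeriesSummable_chiA _ hs))
    (fun s hs => by
      rw [LSeries_mul' (LSeriesSummable_chiA _ hs) (LSeriesSummable_chiA _ hs),
        zetaK_eq_chiA hs, chiH_eq_LSeries hχ hs, LSeries_chiA χ]
      ring) (B := 390 * zetaC (1 / 3) ^ 2 * q) (by nlinarith) (fun s hs => by
      rw [norm_mul]
      calc _ ≤ (26 * zetaC (1 / 3)) * (15 * zetaC (1 / 3) * q) :=
            mul_le_mul (norm_zetaK_le_of_mem hs) (norm_chiH_le_of_mem hχ hs) (norm_nonneg _)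
              (by positivity)
        _ = _ := by ring) hβ0 hβ1 hβ
  refine this.trans ?_
  simp only [zetaK_one, one_mul]
  exact re_le_norm _

lemma siegel_four_factor {q r : ℕ} [NeZero q] [NeZero r] {χ : DirichletCharacter ℂ q}
    {ψ : DirichletCharacter ℂ r} (hχ : χ ≠ 1) (h : χ ^ 2 = 1) (hψ : ψ ≠ 1) (h' : ψ ^ 2 = 1)
    (hm : chiMul χ ψ ≠ 1) {β : ℝ} (hβ0 : 11 / 12 ≤ β) (hβ1 : β < 1) (hβ : chiH ψ β = 0) :
    (1 - β) / 6 * (64 * (87750 * zetaC (1 / 3) ^ 4 * q ^ 2 * r ^ 2)) ^ (-5 * (1 - β)) ≤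
      ‖chiH χ 1‖ * (‖chiH ψ 1‖ * ‖chiH (chiMul χ ψ) 1‖) := by
  have : NeZero (q * r) := ⟨mul_ne_zero (NeZero.ne q) (NeZero.ne r)⟩
  have hz := zetaC_ge_one (η := 1 / 3) (by norm_num)
  have hB : 1 ≤ 87750 * zetaC (1 / 3) ^ 4 * q ^ 2 * r ^ 2 := by
    have h1 := one_le_pow₀ hz (n := 4)
    have h2 := one_le_pow₀ (mod_cast NeZero.one_le : (1 : ℝ) ≤ q) (n := 2)
    have h3 := one_le_pow₀ (mod_cast NeZero.one_le : (1 : ℝ) ≤ r) (n := 2)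
    calc (1 : ℝ) ≤ 87750 * 1 * 1 * 1 := by norm_num
      _ ≤ _ := by gcongr
  have sm := fun (s : ℂ) (hs : 1 < s.re) =>
    LSeriesSummable_mul (LSeriesSummable_chiA (1 : DirichletCharacter ℂ 1) hs)
      (LSeriesSummable_chiA χ hs)
  have sm' := fun (s : ℂ) (hs : 1 < s.re) =>
    LSeriesSummable_mul (LSeriesSummable_chiA ψ hs)
      (LSeriesSummable_chiA (chiMul χ ψ) hs)
  have := estermann_lower_bound (Φ := fun s => zetaK s * chiH χ s * (chiH ψ s * chiH (chiMul χ ψ) s))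
    (fun s hs => ((differentiableAt_zetaK hs).mul (differentiableAt_chiH hχ hs)).mul
      ((differentiableAt_chiH hψ hs).mul (differentiableAt_chiH hm hs)))
    (b := (chiA 1 * chiA χ * (chiA ψ * chiA (chiMul χ ψ)) :
      ArithmeticFunction ℂ))
    (fun n => nonneg_four_factor h h' n) (by simp [ArithmeticFunction.mul_apply, chiA_apply_one])
    (abscissa_le_one_of_summable fun s hs =>
      LSeriesSummable_mul (sm s hs) (sm' s hs))
    (fun s hs => by
      rw [LSeries_mul' (sm s hs) (sm' s hs),
        LSeries_mul' (LSeriesSummable_chiA _ hs) (LSeriesSummable_chiA _ hs),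
        LSeries_mul' (LSeriesSummable_chiA _ hs) (LSeriesSummable_chiA _ hs),
        zetaK_eq_chiA hs, chiH_eq_LSeries hχ hs, LSeries_chiA χ, chiH_eq_LSeries hψ hs,
        LSeries_chiA ψ, chiH_eq_LSeries hm hs, LSeries_chiA (chiMul χ ψ)]
      ring) hB (fun s hs => by
      rw [norm_mul, norm_mul, norm_mul]
      calc _ ≤ (26 * zetaC (1 / 3)) * (15 * zetaC (1 / 3) * q) *
            ((15 * zetaC (1 / 3) * r) * (15 * zetaC (1 / 3) * (q * r : ℕ))) := by
              gcongr
              · exact norm_zetaK_le_of_mem hs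
              · exact norm_chiH_le_of_mem hχ hs
              · exact norm_chiH_le_of_mem hψ hs
              · exact norm_chiH_le_of_mem hm hs
        _ = _ := by push_cast; ring) hβ0 hβ1 (by simp [hβ])
  refine this.trans ?_
  simp only [zetaK_one, one_mul]
  refine (re_le_norm _).trans ?_
  rw [norm_mul, norm_mul]

lemma exists_pos_le_of_finite {ι : Type*} [Finite ι] (f : ι → ℝ) (h : ∀ i, 0 < f i) :
    ∃ c > 0, ∀ i, c ≤ f i := by
  rcases isEmpty_or_nonempty ι with _ | _
  · exact ⟨1, one_pos, fun i => isEmptyElim i⟩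
  · obtain ⟨i, hi⟩ := Finite.exists_min f
    exact ⟨f i, h i, hi⟩

lemma chiMul_ne_one {q r : ℕ} [NeZero q] [NeZero r] {χ : DirichletCharacter ℂ q}
    {ψ : DirichletCharacter ℂ r} (hp : χ.IsPrimitive) (h' : ψ ^ 2 = 1) (hqr : r < q) :
    chiMul χ ψ ≠ 1 := by
  intro h1
  have h3 : changeLevel (Nat.dvd_mul_right q r) χ =
      changeLevel (Nat.dvd_mul_left r q) ψ := by
    rw [chiMul, mul_eq_one_iff_eq_inv] at h1
    rw [h1, ← map_inv, inv_eq_of_mul_eq_one_right (by rw [← sq, h'])]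
  have h5 : χ.conductor ≤ q.gcd r := Nat.sInf_le (factorsThrough_gcd χ ψ h3)
  rw [hp] at h5
  have := gcd_le_right q (Nat.pos_of_ne_zero (NeZero.ne r))
  omega

/-- Siegel's theorem. -/
theorem siegel_lower_bound {ε : ℝ} (hε : 0 < ε) : ∃ c > 0, ∀ (q : ℕ) [NeZero q]
    (χ : DirichletCharacter ℂ q), χ.IsPrimitive → χ ≠ 1 → χ ^ 2 = 1 →
    c * q ^ (-ε) ≤ ‖chiH χ 1‖ := by
  have hz := zetaC_ge_one (η := 1 / 3) (by norm_num)
  set Z := zetaC (1 / 3)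
  obtain ⟨δ, hδ0, hδ1, hδ2, hδ3⟩ : ∃ δ, 0 < δ ∧ δ ≤ 1 / 12 ∧ δ ≤ 1 / (4 * Z) ∧ 12 * δ ≤ ε := by
    refine ⟨min (1 / 12) (min (1 / (4 * Z)) (ε / 12)), by positivity, min_le_left _ _,
      (min_le_right _ _).trans (min_le_left _ _), ?_⟩
    have := (min_le_right (1 / 12) (min (1 / (4 * Z)) (ε / 12))).trans (min_le_right _ _)
    linarith
  by_cases hex : ∃ (r : ℕ) (_ : NeZero r) (ψ : DirichletCharacter ℂ r), ψ ≠ 1 ∧ ψ ^ 2 = 1 ∧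
      (chiH ψ ((1 - δ : ℝ))).re < 0
  · obtain ⟨r, hr, ψ, hψ, hψ2, hneg⟩ := hex
    obtain ⟨β, hβ0, hβ1, hβz⟩ := exists_zero_of_re_neg hψ hψ2 (by linarith) hneg
    have hfin : ∃ c > 0, ∀ i : (Σ q : Fin (r + 1), {χ : DirichletCharacter ℂ (q ) // (q : ℕ) ≠ 0 ∧ χ ≠ 1}),
        c ≤ ‖chiH i.2.1 1‖ := by
      have : Finite (Σ q : Fin (r + 1), {χ : DirichletCharacter ℂ (q ) // q ≠ 0 ∧ χ ≠ 1}) := by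
        have : ∀ q, Finite {χ : DirichletCharacter ℂ (q ) // q ≠ 0 ∧ χ ≠ 1} := by
          intro q
          by_cases hq : (q : ℕ) = 0
          · have : IsEmpty {χ : DirichletCharacter ℂ (q ) // (q : ℕ) ≠ 0 ∧ χ ≠ 1} :=
              ⟨fun x => x.2.1 hq⟩
            infer_instance
          · have : NeZero (q : ℕ) := ⟨hq⟩
            infer_instance
        infer_instance
      refine exists_pos_le_of_finite (fun i : (Σ q : Fin (r + 1), {χ : DirichletCharacter ℂ (q ) // (q : ℕ) ≠ 0 ∧ χ ≠ 1}) => ‖chiH i.2.1 1‖) fun i => ?_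
      have : NeZero (i.1 : ℕ) := ⟨i.2.2.1⟩
      exact norm_pos_iff.2 (chiH_one_ne_zero i.2.2.2)
    obtain ⟨c1, hc1, hfin⟩ := hfin
    set P : ℝ := ‖chiH ψ 1‖
    have hP0 := norm_pos_iff.2 (chiH_one_ne_zero hψ)
    have hr1 : (1 : ℝ) ≤ r := mod_cast hr.one_le
    set c2 : ℝ := (1 - β) / 6 * (64 * (87750 * Z ^ 4 * r ^ 2)) ^ (-5 * δ) /
      (P * (6 * zetaC δ * r ^ (2 * δ))) with hc2
    have hzd := zetaC_ge_one hδ0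
    have hA1 : 1 ≤ 64 * (87750 * Z ^ 4 * r ^ 2) := by
      have h1 := one_le_pow₀ hz (n := 4)
      have h3 := one_le_pow₀ hr1 (n := 2)
      calc (1 : ℝ) ≤ 64 * (87750 * 1 * 1) := by norm_num
        _ ≤ _ := by gcongr
    have hc20 : 0 < c2 := by
      have : 0 < 1 - β := by linarith
      rw [hc2]; positivity
    refine ⟨min c1 c2, lt_min hc1 hc20, fun q hq χ hp hχ h2 => ?_⟩
    have hq1 : (1 : ℝ) ≤ q := mod_cast hq.one_le
    rcases le_or_gt q r with hqr | hqr
    · have := hfin ⟨⟨q, by omega⟩, ⟨χ, NeZero.ne q, hχ⟩⟩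
      refine le_trans ?_ this
      have h1 : (q : ℝ) ^ (-ε) ≤ 1 := rpow_le_one_of_one_le_of_nonpos hq1 (by linarith)
      calc min c1 c2 * q ^ (-ε) ≤ min c1 c2 * 1 := by
            have := (lt_min hc1 hc20).le; gcongr
        _ ≤ c1 := by rw [mul_one]; exact min_le_left _ _
    · have hm := chiMul_ne_one hp hψ2 hqr
      have h4 := siegel_four_factor hχ h2 hψ hψ2 hm (by linarith) hβ1 hβz
      have : NeZero (q * r) := ⟨mul_ne_zero (NeZero.ne q) (NeZero.ne r)⟩
      have h5 := norm_chiH_one_le hm hδ0 (by linarith)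
      have h6 : q ^ (-10 * δ) * (64 * (87750 * Z ^ 4 * r ^ 2)) ^ (-5 * δ) ≤
          (64 * (87750 * Z ^ 4 * q ^ 2 * r ^ 2)) ^ (-5 * (1 - β)) := by
        have e : 64 * (87750 * Z ^ 4 * q ^ 2 * r ^ 2) = q ^ 2 * (64 * (87750 * Z ^ 4 * r ^ 2)) := by
          ring
        rw [e, mul_rpow (x := q ^ 2) (by positivity) (by positivity)]
        have e2 : (q : ℝ) ^ (-10 * δ) = (q ^ 2) ^ (-5 * δ) := by
          rw [← rpow_natCast, ← rpow_mul (by positivity)]; congr 1; push_cast; ring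
        rw [e2]
        exact mul_le_mul
          (rpow_le_rpow_of_exponent_le (one_le_pow₀ hq1) (by linarith only [hβ0]))
          (rpow_le_rpow_of_exponent_le hA1 (by linarith)) (by positivity) (by positivity)
      have h7 : (q : ℝ) ^ (-ε) ≤ q ^ (-12 * δ) :=
        rpow_le_rpow_of_exponent_le hq1 (by linarith)
      have h8 : ((q * r : ℕ) : ℝ) ^ (2 * δ) = q ^ (2 * δ) * r ^ (2 * δ) := by
        push_cast; rw [mul_rpow (by positivity) (by positivity)]
      rw [h8] at h5
      have hq2 : 0 < (q : ℝ) ^ (2 * δ) := by positivity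
      have h9 : (1 - β) / 6 * (q ^ (-10 * δ) * (64 * (87750 * Z ^ 4 * r ^ 2)) ^ (-5 * δ)) ≤
          ‖chiH χ 1‖ * (P * (6 * zetaC δ * (q ^ (2 * δ) * r ^ (2 * δ)))) := by
        refine (mul_le_mul_of_nonneg_left h6 (by linarith)).trans (h4.trans ?_)
        gcongr
      calc min c1 c2 * q ^ (-ε) ≤ c2 * q ^ (-12 * δ) := by
            gcongr; exact min_le_right _ _
        _ = (1 - β) / 6 * (q ^ (-10 * δ) * (64 * (87750 * Z ^ 4 * r ^ 2)) ^ (-5 * δ)) /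
            (P * (6 * zetaC δ * (q ^ (2 * δ) * r ^ (2 * δ)))) := by
            rw [hc2, show -12 * δ = -10 * δ - 2 * δ by ring, rpow_sub (by linarith)]
            field_simp
        _ ≤ ‖chiH χ 1‖ := by
            rw [div_le_iff₀ (by positivity)]
            exact h9
  · push Not at hex
    set c : ℝ := δ / 6 * (64 * (390 * Z ^ 2)) ^ (-5 * δ)
    have hc0 : 0 < c := by positivity
    refine ⟨c, hc0, fun q hq χ hp hχ h2 => ?_⟩
    have h3 : ‖zetaK ((1 - δ : ℝ)) - 1‖ ≤ 1 := by
      refine (norm_zetaK_sub_one_le (η := 1 / 3) (by norm_num) (by norm_num)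
        (by simp; linarith)).trans ?_
      have e1 : ‖((1 - δ : ℝ) : ℂ)‖ ≤ 1 := by
        rw [norm_real, norm_eq_abs, abs_le]; constructor <;> linarith
      have e2 : ‖((1 - δ : ℝ) : ℂ) - 1‖ = δ := by
        rw [show ((1 - δ : ℝ) : ℂ) - 1 = ((-δ : ℝ)) by push_cast; ring, norm_real,
          norm_eq_abs, abs_neg, abs_of_pos hδ0]
      rw [e2]
      have e3 : (1 + ‖((1 - δ : ℝ) : ℂ)‖) ^ (2 * (1 / 3) : ℝ) ≤ 2 := by
        calc (1 + ‖((1 - δ : ℝ) : ℂ)‖) ^ (2 * (1 / 3) : ℝ) ≤ 2 ^ (2 * (1 / 3)) := by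
              apply rpow_le_rpow (by positivity) (by linarith) (by norm_num)
          _ ≤ 2 ^ 1 := rpow_le_rpow_of_exponent_le (by norm_num) (by norm_num)
          _ = _ := rpow_one _
      calc 2 * Z * (1 + ‖((1 - δ : ℝ) : ℂ)‖) ^ (2 * (1 / 3) : ℝ) * δ ≤ 2 * Z * 2 * (1 / (4 * Z)) := by
            gcongr
        _ = 1 := by field_simp; norm_num
    have h4 : 0 ≤ (zetaK ((1 - δ : ℝ))).re := by
      have := (abs_le.1 ((abs_re_le_norm _).trans h3)).1
      rw [sub_re, one_re] at this; linarith
    have h5 := siegel_two_factor hχ h2 (β := 1 - δ) (by linarith) (by linarith) (by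
      rw [mul_re, chiH_im_eq_zero h2, mul_zero, sub_zero]
      exact mul_nonneg h4 (hex q hq χ hχ h2))
    refine le_trans ?_ h5
    rw [show 1 - (1 - δ) = δ by ring, show 64 * (390 * Z ^ 2 * q) = (64 * (390 * Z ^ 2)) * q by ring,
      mul_rpow (by positivity) (by positivity), ← mul_assoc]
    refine mul_le_mul_of_nonneg_left ?_ hc0.le
    exact rpow_le_rpow_of_exponent_le (mod_cast hq.one_le) (by linarith)

lemma lower_of_pow_four {f : ℝ → ℂ} {a b : ℝ} (ha : 0 < a) (hab : a ≤ 2 * b)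
    (hf : ∀ x, 0 < x → x ≤ 1 → a ^ 4 * x ^ 3 ≤ ‖f x‖ ^ 4)
    (hl : ∀ x y, 0 < x → x ≤ y → y ≤ 1 → ‖f x - f y‖ ≤ b * (y - x)) {x : ℝ} (hx : 0 < x)
    (hx1 : x ≤ 1) : a / 2 * (a / (2 * b)) ^ 3 ≤ ‖f x‖ := by
  have hb : 0 < b := by linarith
  set y := a / (2 * b) with hy
  have hx0 : y ^ 4 ≤ 1 := pow_le_one₀ (by positivity : 0 < y).le (by rw [hy, div_le_one (by positivity)]; exact hab)
  have hbig : ∀ z, y ^ 4 ≤ z → z ≤ 1 → a * y ^ 3 ≤ ‖f z‖ := by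
    intro z hz hz1
    have h0 : 0 < y ^ 4 := by positivity
    have h := hf z (by linarith) hz1
    refine le_of_pow_le_pow_left₀ (by norm_num) (norm_nonneg _) (le_trans ?_ h)
    calc (a * y ^ 3) ^ 4 = a ^ 4 * (y ^ 4) ^ 3 := by ring
      _ ≤ _ := by gcongr
  rcases le_total (y ^ 4) x with h | h
  · refine le_trans ?_ (hbig x h hx1)
    have : 0 < a * y ^ 3 := by positivity
    linarith
  · have h1 := hbig _ le_rfl hx0
    have h2 := hl x (y ^ 4) hx h hx0
    have h3 : ‖f (y ^ 4)‖ ≤ ‖f x‖ + ‖f x - f (y ^ 4)‖ := by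
      rw [norm_sub_rev]; have := norm_add_le (f x) (f (y ^ 4) - f x); simpa using this
    have h4 : b * (y ^ 4 - x) ≤ b * y ^ 4 := by gcongr; linarith
    have h5 : b * y ^ 4 = a / 2 * y ^ 3 := by rw [hy]; field_simp
    linarith

lemma rpow_two_mul_le {Y η : ℝ} (hY : 0 ≤ Y) (hη : 0 ≤ η) (hη1 : η ≤ 1) :
    (2 * Y) ^ η ≤ 2 * Y ^ η := by
  rw [mul_rpow (by norm_num) hY]
  gcongr
  calc 2 ^ η ≤ 2 ^ 1 := rpow_le_rpow_of_exponent_le (by norm_num) hη1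
    _ = 2 := rpow_one _

lemma norm_le_of_mem_sphere {s w : ℂ} {η : ℝ} (hη : η ≤ 1 / 4) (hs : |s.re| ≤ 3)
    (hw : w ∈ Metric.sphere s η) : s.re - η ≤ w.re ∧ 1 + ‖w‖ ≤ 2 * (|s.im| + 4) := by
  rw [mem_sphere_iff_norm] at hw
  have h1 := abs_re_le_norm (w - s)
  rw [hw, sub_re, abs_le] at h1
  have h2 : ‖w‖ ≤ ‖s‖ + ‖w - s‖ := by have := norm_add_le s (w - s); simpa using this
  have h3 := norm_le_abs_re_add_abs_im s
  exact ⟨by linarith, by linarith [abs_nonneg s.im]⟩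

lemma norm_deriv_chiH_le {q : ℕ} [NeZero q] {χ : DirichletCharacter ℂ q} (hχ : χ ≠ 1)
    {η : ℝ} (hη0 : 0 < η) (hη : η ≤ 1 / 8) {s : ℂ} (hs : 1 - η ≤ s.re) (hs3 : s.re ≤ 3) :
    ‖deriv (chiH χ) s‖ ≤ 6 * zetaC (2 * η) / η * (q * (|s.im| + 4)) ^ (4 * η) := by
  have hz := zetaC_ge_one (η := 2 * η) (by linarith)
  have h := norm_deriv_le_of_forall_mem_sphere_norm_le (c := s) (f := chiH χ)
    (C := 6 * zetaC (2 * η) * (q * (|s.im| + 4)) ^ (4 * η)) hη0 ?_ ?_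
  · rw [div_mul_eq_mul_div]; exact h
  · refine DifferentiableOn.diffContOnCl fun w hw => ?_
    rw [closure_ball _ hη0.ne', mem_closedBall_iff_norm] at hw
    have h1 := abs_re_le_norm (w - s)
    rw [sub_re, abs_le] at h1
    exact (differentiableAt_chiH hχ (by linarith)).differentiableWithinAt
  · intro w hw
    obtain ⟨h1, h2⟩ := norm_le_of_mem_sphere (by linarith) (abs_le.2 ⟨by linarith, hs3⟩) hw
    refine (norm_chiH_le hχ (η := 2 * η) (by linarith) (by linarith) (by linarith)).trans ?_
    have h3 : (q * (1 + ‖w‖)) ^ (2 * (2 * η)) ≤ 2 * (q * (|s.im| + 4)) ^ (4 * η) := by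
      rw [show 2 * (2 * η) = 4 * η by ring]
      refine le_trans ?_ (rpow_two_mul_le (by positivity) (by linarith) (by linarith))
      refine rpow_le_rpow (by positivity) ?_ (by linarith)
      rw [mul_left_comm]; gcongr
    calc _ ≤ 3 * zetaC (2 * η) * (2 * (q * (|s.im| + 4)) ^ (4 * η)) := by gcongr
      _ = _ := by ring

lemma norm_zetaK_le {η : ℝ} (hη0 : 0 < η) (hη : η ≤ 1 / 4) {w : ℂ} {T : ℝ} (hw : 1 - η ≤ w.re)
    (hT : 4 ≤ T) (hwT : 1 + ‖w‖ ≤ 2 * T) : ‖zetaK w‖ ≤ 9 * zetaC η * T ^ (1 + 2 * η) := by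
  have hz := zetaC_ge_one hη0
  have h := norm_zetaK_sub_one_le hη0 (by linarith) hw
  have h1 : (1 + ‖w‖) ^ (2 * η) ≤ 2 * T ^ (2 * η) :=
    (rpow_le_rpow (by positivity) hwT (by linarith)).trans
      (rpow_two_mul_le (by linarith) (by linarith) (by linarith))
  have h2 : ‖w - 1‖ ≤ 2 * T := by
    have := norm_sub_le w 1; rw [norm_one] at this; linarith
  have h3 : T ^ (1 + 2 * η) = T * T ^ (2 * η) := by
    rw [rpow_add (by linarith), rpow_one]
  have h5 : 2 * zetaC η * (1 + ‖w‖) ^ (2 * η) * ‖w - 1‖ ≤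
      2 * zetaC η * (2 * T ^ (2 * η)) * (2 * T) := by gcongr
  have h6 : ‖zetaK w‖ ≤ ‖zetaK w - 1‖ + 1 := by
    have := norm_add_le (zetaK w - 1) 1; simpa using this
  have h7 := one_le_mul_of_one_le_of_one_le hz (one_le_rpow (by linarith) (by linarith) : 1 ≤ T ^ (1 + 2 * η))
  calc ‖zetaK w‖ ≤ 2 * zetaC η * (2 * T ^ (2 * η)) * (2 * T) + 1 := by linarith
    _ = 8 * (zetaC η * T ^ (1 + 2 * η)) + 1 := by rw [h3]; ring
    _ ≤ _ := by linarith

lemma norm_deriv_zetaK_le {η : ℝ} (hη0 : 0 < η) (hη : η ≤ 1 / 8) {s : ℂ} (hs : 1 - η ≤ s.re)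
    (hs3 : s.re ≤ 3) :
    ‖deriv zetaK s‖ ≤ 9 * zetaC (2 * η) / η * (|s.im| + 4) ^ (1 + 4 * η) := by
  have h := norm_deriv_le_of_forall_mem_sphere_norm_le (c := s) (f := zetaK)
    (C := 9 * zetaC (2 * η) * (|s.im| + 4) ^ (1 + 4 * η)) hη0 ?_ ?_
  · rw [div_mul_eq_mul_div]; exact h
  · refine DifferentiableOn.diffContOnCl fun w hw => ?_
    rw [closure_ball _ hη0.ne', mem_closedBall_iff_norm] at hw
    have h1 := abs_re_le_norm (w - s)
    rw [sub_re, abs_le] at h1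
    exact (differentiableAt_zetaK (by linarith)).differentiableWithinAt
  · intro w hw
    obtain ⟨h1, h2⟩ := norm_le_of_mem_sphere (by linarith) (abs_le.2 ⟨by linarith, hs3⟩) hw
    have := norm_zetaK_le (η := 2 * η) (by linarith) (by linarith)
      (by linarith) (by linarith [abs_nonneg s.im]) h2
    rwa [show 2 * (2 * η) = 4 * η by ring] at this

/-- Mean value inequality on the strip `1 ≤ Re s ≤ 3`, `|Im s| ≤ T`. -/
lemma norm_sub_le_of_deriv_strip {f : ℂ → ℂ} {b T : ℝ}
    (hf : ∀ s, 1 ≤ s.re → s.re ≤ 3 → |s.im| ≤ T → DifferentiableAt ℂ f s ∧ ‖deriv f s‖ ≤ b)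
    {s w : ℂ} (hs : 1 ≤ s.re ∧ s.re ≤ 3 ∧ |s.im| ≤ T) (hw : 1 ≤ w.re ∧ w.re ≤ 3 ∧ |w.im| ≤ T) :
    ‖f s - f w‖ ≤ b * ‖s - w‖ := by
  have hc : Convex ℝ {s : ℂ | 1 ≤ s.re ∧ s.re ≤ 3 ∧ |s.im| ≤ T} := by
    intro x hx y hy a b ha hb hab
    simp only [Set.mem_ofPred_eq, add_re, add_im, smul_re, smul_im,
      smul_eq_mul, abs_le] at *
    obtain ⟨h1, h2, h3, h4⟩ := hx
    obtain ⟨g1, g2, g3, g4⟩ := hy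
    have hb' : b = 1 - a := by linarith
    subst hb'
    refine ⟨?_, ?_, ?_, ?_⟩ <;> nlinarith
  exact hc.norm_image_sub_le_of_norm_deriv_le (fun x hx => (hf x hx.1 hx.2.1 hx.2.2).1)
    (fun x hx => (hf x hx.1 hx.2.1 hx.2.2).2) hw hs

lemma norm_LSeries_le_zetaC {q : ℕ} (χ : DirichletCharacter ℂ q) {x : ℝ} (hx : 0 < x) {s : ℂ}
    (hs : s.re = 1 + x) : ‖LSeries (fun n => χ n) s‖ ≤ zetaC x := by
  have hb : ∀ n, ‖LSeries.term (fun n => χ n) s (n + 1)‖ ≤ ((n + 1 : ℕ)) ^ (-1 - x) := by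
    intro n
    rw [LSeries.norm_term_eq, if_neg (by omega), hs, show -1 - x = -(1 + x) by ring,
      rpow_neg (by positivity), div_eq_mul_inv]
    exact mul_le_of_le_one_left (by positivity) (norm_le_one _ _)
  have h1 :=
    Summable.of_nonneg_of_le (fun _ => norm_nonneg _) hb (summable_zetaC hx)
  rw [LSeries, ((summable_nat_add_iff 1).1 h1.of_norm).tsum_eq_zero_add, LSeries.term_zero, zero_add]
  exact (norm_tsum_le_tsum_norm h1).trans (h1.tsum_le_tsum hb (summable_zetaC hx))

lemma exists_zetaC_le : ∃ C, 1 ≤ C ∧ ∀ x, 0 < x → x ≤ 1 → zetaC x ≤ C / x := by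
  refine ⟨9 * zetaC (1 / 4) * 4 ^ (1 + 2 * (1 / 4) : ℝ), ?_, fun x hx hx1 => ?_⟩
  · have := zetaC_ge_one (η := 1 / 4) (by norm_num)
    have h2 : (1 : ℝ) ≤ 4 ^ (1 + 2 * (1 / 4) : ℝ) := one_le_rpow (by norm_num) (by norm_num)
    nlinarith
  · have h1 : 1 < ((1 + x : ℝ) : ℂ).re := by simpa using hx
    have h2 : (zetaC x) = riemannZeta ((1 + x : ℝ)) := by
      rw [zeta_eq_tsum_one_div_nat_add_one_cpow h1, zetaC, ofReal_tsum]
      refine tsum_congr fun n => ?_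
      rw [ofReal_cpow (by positivity), one_div, ← cpow_neg]
      push_cast; congr 1; ring
    have h3 := norm_zetaK_le (w := ((1 + x : ℝ))) (by norm_num) le_rfl
      (by simp; linarith) le_rfl (by
        rw [norm_real, norm_of_nonneg (by linarith)]; linarith)
    rw [zetaK_eq h1, ← h2, norm_mul, norm_real, norm_of_nonneg
      (by linarith [zetaC_ge_one hx])] at h3
    have h4 : ‖((1 + x : ℝ) : ℂ) - 1‖ = x := by
      push_cast; rw [add_sub_cancel_left, norm_real, norm_of_nonneg hx.le]
    rw [h4] at h3
    rw [le_div_iff₀ hx]; linarith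

lemma prod_primeFactors_one_add_inv_le {q : ℕ} (hq : q ≠ 0) :
    ∏ p ∈ q.primeFactors, (1 + (p : ℝ)⁻¹) ≤ 1 + log q := by
  have h1 : ∏ p ∈ q.primeFactors, (1 + (p : ℝ)⁻¹) =
      ∑ d ∈ q.divisors with Squarefree d, (d : ℝ)⁻¹ := by
    rw [Finset.prod_one_add, sum_divisors_filter_squarefree hq, factors_eq]
    refine sum_congr rfl fun t _ => ?_
    simp [Finset.prod_val]
  rw [h1]
  refine le_trans ?_ (harmonic_le_one_add_log q)
  rw [harmonic_eq_sum_Icc]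
  push_cast
  refine sum_le_sum_of_subset_of_nonneg (fun d hd => ?_) fun _ _ _ => by positivity
  simp only [mem_filter, mem_divisors] at hd
  exact mem_Icc.2 ⟨pos_of_dvd_of_pos hd.1.1 (Nat.pos_of_ne_zero hq), le_of_dvd (Nat.pos_of_ne_zero hq) hd.1.1⟩

lemma norm_LSeries_one_le {q : ℕ} [NeZero q] {s : ℂ} (hs : 1 < s.re) :
    ‖LSeries (fun n => (1 : DirichletCharacter ℂ q) n) s‖ ≤ (1 + log q) * ‖riemannZeta s‖ := by
  rw [← LFunction_eq_LSeries _ hs]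
  have := LFunctionTrivChar_eq_mul_riemannZeta (N := q) (by rintro rfl; simp at hs : s ≠ 1)
  rw [LFunctionTrivChar] at this
  rw [this, norm_mul]
  gcongr
  refine le_trans ?_ (prod_primeFactors_one_add_inv_le (NeZero.ne q))
  rw [norm_prod]
  refine prod_le_prod (fun _ _ => norm_nonneg _) fun p hp => ?_
  have hp0 := (prime_of_mem_primeFactors hp).one_le
  refine (norm_sub_le _ _).trans ?_
  rw [norm_one, norm_natCast_cpow_of_pos (by omega), neg_re]
  gcongr
  rw [← rpow_neg_one]
  exact rpow_le_rpow_of_exponent_le (mod_cast hp0) (by linarith)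

lemma norm_riemannZeta_le {η : ℝ} (hη0 : 0 < η) (hη : η ≤ 1 / 4) {s : ℂ} (hs : 1 < s.re) {T : ℝ}
    (hT : 0 ≤ T) (hwT : 1 + ‖s‖ ≤ 2 * T) :
    ‖riemannZeta s‖ ≤ 1 / ‖s - 1‖ + 4 * zetaC η * T ^ (2 * η) := by
  have hs1 : s - 1 ≠ 0 := by
    rw [sub_ne_zero]; rintro rfl; simp at hs
  have hn := norm_pos_iff.2 hs1
  have hz := zetaC_ge_one hη0
  have h := norm_zetaK_sub_one_le hη0 (by linarith) (by linarith)
  rw [zetaK_eq hs] at h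
  have h1 : (1 + ‖s‖) ^ (2 * η) ≤ 2 * T ^ (2 * η) :=
    (rpow_le_rpow (by positivity) hwT (by linarith)).trans
      (rpow_two_mul_le (by linarith) (by linarith) (by linarith))
  have h2 : ‖s - 1‖ * ‖riemannZeta s‖ ≤ ‖(s - 1) * riemannZeta s - 1‖ + 1 := by
    rw [← norm_mul]
    have := norm_add_le ((s - 1) * riemannZeta s - 1) 1; simpa using this
  have h3 : 2 * zetaC η * (1 + ‖s‖) ^ (2 * η) * ‖s - 1‖ ≤
      2 * zetaC η * (2 * T ^ (2 * η)) * ‖s - 1‖ := by gcongr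
  rw [← mul_le_mul_iff_of_pos_left hn, mul_add, mul_one_div_cancel hn.ne']
  linarith

lemma lower_of_pow_four' {f : ℝ → ℂ} {A b : ℝ} (hA : 0 < A) (hb : 0 < b) (hab : A ≤ (2 * b) ^ 4)
    (hf : ∀ x, 0 < x → x ≤ 1 → A * x ^ 3 ≤ ‖f x‖ ^ 4)
    (hl : ∀ x y, 0 < x → x ≤ y → y ≤ 1 → ‖f x - f y‖ ≤ b * (y - x)) {x : ℝ} (hx : 0 < x)
    (hx1 : x ≤ 1) : A / (16 * b ^ 3) ≤ ‖f x‖ := by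
  have ha : (A ^ (1 / 4 : ℝ)) ^ 4 = A := by
    rw [← rpow_natCast, ← rpow_mul hA.le]; norm_num
  have ha0 : 0 < A ^ (1 / 4 : ℝ) := by positivity
  have := lower_of_pow_four (f := f) (a := A ^ (1 / 4 : ℝ)) (b := b) ha0
    (le_of_pow_le_pow_left₀ (n := 4) (by norm_num) (by positivity) (by rw [ha]; exact hab))
    (by rw [ha]; exact hf) hl hx hx1
  refine le_trans (le_of_eq ?_) this
  nth_rewrite 1 [← ha]
  field_simp; ring

lemma three_four_one {q : ℕ} (χ : DirichletCharacter ℂ q) {C x y M : ℝ}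
    (hC : ∀ x : ℝ, 0 < x → x ≤ 1 → zetaC x ≤ C / x) (hx : 0 < x) (hx1 : x ≤ 1) (hC1 : 1 ≤ C)
    (hM : ‖LSeries (fun n => (χ ^ 2) n) (1 + x + 2 * I * y)‖ ≤ M) (hM0 : 0 < M) :
    1 / (C ^ 3 * M) * x ^ 3 ≤ ‖LSeries (fun n => χ n) (1 + x + I * y)‖ ^ 4 := by
  have h := norm_LSeries_product_ge_one χ hx y
  rw [norm_mul, norm_mul, norm_pow, norm_pow] at h
  have h1 := (norm_LSeries_le_zetaC (1 : DirichletCharacter ℂ q) hx (s := 1 + x) (by simp)).trans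
    (hC x hx hx1)
  have h2 : 1 ≤ (C / x) ^ 3 * ‖LSeries (fun n => χ n) (1 + x + I * y)‖ ^ 4 * M := by
    refine h.le.trans ?_
    gcongr
  rw [div_pow] at h2
  rw [div_mul_eq_mul_div, one_mul, div_le_iff₀ (by positivity)]
  calc x ^ 3 = x ^ 3 * 1 := by ring
    _ ≤ x ^ 3 * (C ^ 3 / x ^ 3 * ‖LSeries (fun n => χ n) (1 + x + I * y)‖ ^ 4 * M) := by
        gcongr
    _ = _ := by field_simp

lemma trivial_lower {q : ℕ} (χ : DirichletCharacter ℂ q) {C x : ℝ} (y : ℝ)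
    (hC : ∀ x : ℝ, 0 < x → x ≤ 1 → zetaC x ≤ C / x) (hx : 0 < x) (hx1 : x ≤ 1) (hC1 : 1 ≤ C) :
    x / C ≤ ‖LSeries (fun n => χ n) (1 + x + I * y)‖ := by
  have h := three_four_one χ (y := y) hC hx hx1 hC1
    ((norm_LSeries_le_zetaC (χ ^ 2) hx (s := 1 + x + 2 * I * y) (by simp)).trans
      (hC x hx hx1)) (by positivity)
  refine le_of_pow_le_pow_left₀ (n := 4) (by norm_num) (norm_nonneg _) (le_trans (le_of_eq ?_) h)
  field_simp

lemma strip_point (x y : ℝ) : (1 + x + I * y : ℂ).re = 1 + x ∧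
    (1 + x + I * y : ℂ).im = y := by simp

lemma one_add_norm_le {x y : ℝ} (hx : 0 < x) (hx1 : x ≤ 1) :
    1 + ‖(1 + x + 2 * I * y : ℂ)‖ ≤ 2 * (|y| + 4) := by
  have := norm_le_abs_re_add_abs_im (1 + x + 2 * I * y : ℂ)
  simp only [add_re, one_re, ofReal_re, mul_re, re_ofNat,
    I_re, mul_zero, im_ofNat, I_im, mul_one, sub_self, zero_mul,
    mul_im, add_zero, ofReal_im, add_im, one_im, zero_add,
    abs_mul, abs_ofNat] at this
  rw [abs_of_pos (by linarith)] at this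
  linarith [abs_nonneg y]

lemma lipschitz_horizontal {f : ℂ → ℂ} {b y : ℝ}
    (hf : ∀ s : ℂ, 1 ≤ s.re → s.re ≤ 3 → |s.im| ≤ |y| → DifferentiableAt ℂ f s ∧ ‖deriv f s‖ ≤ b)
    {x x' : ℝ} (hx : 0 < x) (hxx : x ≤ x') (hx1 : x' ≤ 1) :
    ‖f (1 + x + I * y) - f (1 + x' + I * y)‖ ≤ b * (x' - x) := by
  have h := norm_sub_le_of_deriv_strip hf (s := 1 + x + I * y)
    (w := 1 + x' + I * y)
    (by rw [(strip_point x y).1, (strip_point x y).2]; exact ⟨by linarith, by linarith, le_rfl⟩)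
    (by rw [(strip_point x' y).1, (strip_point x' y).2]; exact ⟨by linarith, by linarith, le_rfl⟩)
  have h2 : ‖(1 + x + I * y : ℂ) - (1 + x' + I * y)‖ = x' - x := by
    rw [show (1 + x + I * y : ℂ) - (1 + x' + I * y) = ((x - x' : ℝ) : ℂ) by
      push_cast; ring, norm_real, norm_eq_abs, abs_sub_comm, abs_of_nonneg (by linarith)]
  rwa [h2] at h

lemma deriv_chiH_strip {q : ℕ} [NeZero q] {χ : DirichletCharacter ℂ q} (hχ : χ ≠ 1)
    {η T : ℝ} (hη0 : 0 < η) (hη : η ≤ 1 / 8) (s : ℂ) (hs : 1 ≤ s.re) (hs3 : s.re ≤ 3)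
    (hT : |s.im| ≤ T) : DifferentiableAt ℂ (chiH χ) s ∧
      ‖deriv (chiH χ) s‖ ≤ 6 * zetaC (2 * η) / η * (q * (T + 4)) ^ (4 * η) := by
  have hz := zetaC_ge_one (η := 2 * η) (by linarith)
  refine ⟨differentiableAt_chiH hχ (by linarith),
    (norm_deriv_chiH_le hχ hη0 hη (by linarith) hs3).trans ?_⟩
  gcongr

lemma chiH_lower_of_sq {q : ℕ} [NeZero q] {χ : DirichletCharacter ℂ q} (hχ : χ ≠ 1) {η C y M : ℝ}
    (hη0 : 0 < η) (hη : η ≤ 1 / 8)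
    (hC : ∀ x : ℝ, 0 < x → x ≤ 1 → zetaC x ≤ C / x) (hC1 : 1 ≤ C) (hM1 : 1 ≤ M)
    (hM : ∀ x : ℝ, 0 < x → x ≤ 1 →
      ‖LSeries (fun n => (χ ^ 2) n) (1 + x + 2 * I * y)‖ ≤ M) {x : ℝ}
    (hx : 0 < x) (hx1 : x ≤ 1) :
    1 / (C ^ 3 * M) / (16 * (6 * zetaC (2 * η) / η * (q * (|y| + 4)) ^ (4 * η)) ^ 3) ≤
      ‖chiH χ (1 + x + I * y)‖ := by
  have hz := zetaC_ge_one (η := 2 * η) (by linarith)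
  have hq1 : (1 : ℝ) ≤ q := by exact_mod_cast one_le_iff_ne_zero.2 (NeZero.ne q)
  have hb : 1 ≤ 6 * zetaC (2 * η) / η * (q * (|y| + 4)) ^ (4 * η) := by
    refine one_le_mul_of_one_le_of_one_le ?_ (one_le_rpow ?_ (by linarith))
    · rw [one_le_div hη0]; linarith
    · nlinarith [abs_nonneg y]
  refine lower_of_pow_four' (f := fun x : ℝ => chiH χ (1 + x + I * y)) (by positivity)
    (by linarith) ?_ (fun x hx hx1 => ?_) (fun x x' hx hxx hx1 => ?_) hx hx1
  · have h1 : 1 ≤ C ^ 3 * M := one_le_mul_of_one_le_of_one_le (one_le_pow₀ hC1) hM1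
    calc 1 / (C ^ 3 * M) ≤ 1 := by rw [div_le_one (by linarith)]; exact h1
      _ ≤ _ := one_le_pow₀ (by linarith)
  · rw [chiH_eq_LSeries hχ (by rw [(strip_point x y).1]; linarith)]
    exact three_four_one χ hC hx hx1 hC1 (hM x hx hx1) (by linarith)
  · exact lipschitz_horizontal (deriv_chiH_strip hχ hη0 hη) hx hxx hx1

lemma one_add_log_le_rpow {η x : ℝ} (hη : 0 < η) (hx : 1 ≤ x) :
    1 + log x ≤ (1 + 1 / η) * x ^ η := by
  have h1 := log_le_rpow_div (by linarith : 0 ≤ x) hη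
  have h2 := one_le_rpow hx hη.le
  rw [add_mul, one_mul, one_div_mul_eq_div]; linarith

theorem chiH_lower_bound {ε : ℝ} (hε : 0 < ε) : ∃ c > 0, ∀ (q : ℕ) [NeZero q]
    (χ : DirichletCharacter ℂ q), χ.IsPrimitive → χ ≠ 1 → ∀ x y : ℝ, 0 < x → x ≤ 1 →
      c * (q * (|y| + 4)) ^ (-ε) ≤ ‖chiH χ (1 + x + I * y)‖ := by
  obtain ⟨C, hC1, hC⟩ := exists_zetaC_le
  obtain ⟨η, hη0, hη, hηε⟩ : ∃ η : ℝ, 0 < η ∧ η ≤ 1 / 8 ∧ 38 * η ≤ ε :=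
    ⟨min (1 / 8) (ε / 38), by positivity, min_le_left _ _, by
      have := min_le_right (1 / 8) (ε / 38); linarith⟩
  obtain ⟨c1, hc1, hS⟩ := siegel_lower_bound (ε := ε / 2) (by linarith)
  have hz := zetaC_ge_one hη0
  have hz2 := zetaC_ge_one (η := 2 * η) (by linarith)
  set B := 6 * zetaC (2 * η) / η with hB
  have hB0 : 0 < B := by positivity
  set κ := ε / 2 + 4 * η with hκ
  set c0 := min 1 (c1 / (20 * B)) with hc0
  have hc00 : 0 < c0 := by positivity
  set M0 := 6 * zetaC η + (1 + 1 / η) * (1 / (2 * c0) + 4 * zetaC η) with hM0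
  have hM00 : 1 ≤ M0 := by
    have : 0 ≤ (1 + 1 / η) * (1 / (2 * c0) + 4 * zetaC η) := by positivity
    linarith
  have hM0' : 0 < M0 := by linarith
  refine ⟨min (1 / (C ^ 3 * M0 * 16 * B ^ 3)) (min (c1 / 2) (c0 / C)), by positivity,
    fun q _ χ hp hχ x y hx hx1 => ?_⟩
  have hq1 : (1 : ℝ) ≤ q := by exact_mod_cast one_le_iff_ne_zero.2 (NeZero.ne q)
  set Q := (q : ℝ) * (|y| + 4) with hQ
  have hqQ : (q : ℝ) ≤ Q := by nlinarith [abs_nonneg y]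
  have hTQ : |y| + 4 ≤ Q := by nlinarith [abs_nonneg y]
  have hQ1 : 1 ≤ Q := hq1.trans hqQ
  have hQ0 : 0 < Q := by linarith
  have caseI : (∀ x : ℝ, 0 < x → x ≤ 1 →
      ‖LSeries (fun n => (χ ^ 2) n) (1 + x + 2 * I * y)‖ ≤ M0 * Q ^ (κ + 3 * η)) →
      1 / (C ^ 3 * M0 * 16 * B ^ 3) * Q ^ (-ε) ≤ ‖chiH χ (1 + x + I * y)‖ := by
    intro h
    have hM1 : 1 ≤ M0 * Q ^ (κ + 3 * η) :=
      one_le_mul_of_one_le_of_one_le hM00 (one_le_rpow hQ1 (by positivity))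
    refine le_trans ?_ (chiH_lower_of_sq hχ hη0 hη hC hC1 hM1 h hx hx1)
    have h1 : 1 / (C ^ 3 * (M0 * Q ^ (κ + 3 * η))) / (16 * (B * Q ^ (4 * η)) ^ 3) =
        1 / (C ^ 3 * M0 * 16 * B ^ 3) * (Q ^ (κ + 3 * η) * (Q ^ (4 * η)) ^ 3)⁻¹ := by
      field_simp
    rw [h1]
    have h2 : (Q ^ (κ + 3 * η) * (Q ^ (4 * η)) ^ 3)⁻¹ = Q ^ (-(κ + 15 * η)) := by
      rw [← rpow_natCast, ← rpow_mul hQ0.le, ← rpow_add hQ0, ← rpow_neg hQ0.le]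
      congr 1; push_cast; ring
    rw [h2]
    have : Q ^ (-ε) ≤ Q ^ (-(κ + 15 * η)) := rpow_le_rpow_of_exponent_le hQ1 (by linarith)
    gcongr
  by_cases h2 : χ ^ 2 = 1
  · by_cases hy : c0 * (q : ℝ) ^ (-κ) ≤ |y|
    · refine le_trans ?_ (caseI fun x hx hx1 => ?_)
      · gcongr; exact min_le_left _ _
      rw [h2]
      have hre : 1 < (1 + x + 2 * I * y : ℂ).re := by simpa using hx
      refine (norm_LSeries_one_le hre).trans ?_
      have g1 := one_add_log_le_rpow hη0 hq1
      have g2 := norm_riemannZeta_le hη0 (by linarith) hre (T := |y| + 4) (by positivity)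
        (one_add_norm_le hx hx1)
      have hq' : 0 < (q : ℝ) ^ (-κ) := by positivity
      have hy0 : 0 < |y| := lt_of_lt_of_le (by positivity) hy
      have g3 : 2 * |y| ≤ ‖(1 + x + 2 * I * y : ℂ) - 1‖ := by
        have := abs_im_le_norm ((1 + x + 2 * I * y : ℂ) - 1)
        simpa [abs_mul] using this
      have g4 : 1 / ‖(1 + x + 2 * I * y : ℂ) - 1‖ ≤ 1 / (2 * c0) * Q ^ κ := by
        calc 1 / ‖(1 + x + 2 * I * y : ℂ) - 1‖ ≤ 1 / (2 * (c0 * (q : ℝ) ^ (-κ))) := by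
              refine one_div_le_one_div_of_le (by positivity) (le_trans ?_ g3)
              gcongr
          _ = 1 / (2 * c0) * (q : ℝ) ^ κ := by
              rw [rpow_neg (by positivity)]; field_simp
          _ ≤ _ := by gcongr
      have hκ2 : 2 * η ≤ κ := by linarith
      have g5 : (|y| + 4) ^ (2 * η) ≤ Q ^ κ :=
        (rpow_le_rpow (by positivity) hTQ (by linarith)).trans
          (rpow_le_rpow_of_exponent_le hQ1 hκ2)
      have g6 : (q : ℝ) ^ η ≤ Q ^ (3 * η) :=
        (rpow_le_rpow (by positivity) hqQ (by linarith)).trans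
          (rpow_le_rpow_of_exponent_le hQ1 (by linarith))
      calc (1 + log q) * ‖riemannZeta (1 + x + 2 * I * y)‖
          ≤ ((1 + 1 / η) * Q ^ (3 * η)) * (1 / (2 * c0) * Q ^ κ + 4 * zetaC η * Q ^ κ) := by
            have e1 : 1 + log q ≤ (1 + 1 / η) * Q ^ (3 * η) := g1.trans (by gcongr)
            have e2 : ‖riemannZeta (1 + x + 2 * I * y)‖ ≤
                1 / (2 * c0) * Q ^ κ + 4 * zetaC η * Q ^ κ :=
              g2.trans (add_le_add g4 (by gcongr))
            gcongr
        _ = (1 + 1 / η) * (1 / (2 * c0) + 4 * zetaC η) * Q ^ (κ + 3 * η) := by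
            rw [rpow_add hQ0 κ]; ring
        _ ≤ M0 * Q ^ (κ + 3 * η) := by gcongr; linarith
    · push Not at hy
      by_cases hxx : c0 * (q : ℝ) ^ (-κ) ≤ x
      · rw [chiH_eq_LSeries hχ (by rw [(strip_point x y).1]; linarith)]
        refine le_trans ?_ (trivial_lower χ y hC hx hx1 hC1)
        calc _ ≤ c0 / C * (q : ℝ) ^ (-κ) := by
              have e1 : Q ^ (-ε) ≤ (q : ℝ) ^ (-κ) := by
                refine le_trans (rpow_le_rpow_of_nonpos (by positivity) hqQ (by linarith)) ?_
                exact rpow_le_rpow_of_exponent_le hq1 (by linarith)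
              gcongr
              exact (min_le_right _ _).trans (min_le_right _ _)
          _ = c0 * (q : ℝ) ^ (-κ) / C := by ring
          _ ≤ _ := by gcongr
      · push Not at hxx
        have hs1 := hS q χ hp hχ h2
        have hqk : (q : ℝ) ^ (-κ) ≤ 1 := rpow_le_one_of_one_le_of_nonpos hq1 (by linarith)
        have hy1 : |y| ≤ 1 := hy.le.trans (by
          have := min_le_left 1 (c1 / (20 * B)); nlinarith)
        have hl := norm_sub_le_of_deriv_strip (deriv_chiH_strip hχ hη0 hη (T := 1))
          (s := 1) (w := 1 + x + I * y) (by simp)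
          (by rw [(strip_point x y).1, (strip_point x y).2]; exact ⟨by linarith, by linarith, hy1⟩)
        have e1 : ‖(1 : ℂ) - (1 + x + I * y)‖ ≤ x + |y| := by
          have := norm_le_abs_re_add_abs_im ((1 : ℂ) - (1 + x + I * y))
          simpa [abs_of_pos hx] using this
        have e2 : (q * (1 + 4) : ℝ) ^ (4 * η) ≤ 5 * (q : ℝ) ^ (4 * η) := by
          rw [mul_rpow (by positivity) (by norm_num), mul_comm]
          gcongr
          calc ((1 : ℝ) + 4) ^ (4 * η) ≤ (1 + 4) ^ (1 : ℝ) :=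
                rpow_le_rpow_of_exponent_le (by norm_num) (by linarith)
            _ = 5 := by norm_num
        have e3 : B * (q * (1 + 4)) ^ (4 * η) * ‖(1 : ℂ) - (1 + x + I * y)‖ ≤
            c1 / 2 * (q : ℝ) ^ (-(ε / 2)) := by
          have hcB : c0 ≤ c1 / (20 * B) := min_le_right _ _
          calc _ ≤ B * (5 * (q : ℝ) ^ (4 * η)) *
                (c1 / (20 * B) * (q : ℝ) ^ (-κ) + c1 / (20 * B) * (q : ℝ) ^ (-κ)) := by
                gcongr
                refine e1.trans (add_le_add (hxx.le.trans (by gcongr)) (hy.le.trans (by gcongr)))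
            _ = c1 / 2 * ((q : ℝ) ^ (4 * η) * (q : ℝ) ^ (-κ)) := by field_simp; ring
            _ = _ := by
                rw [← rpow_add (by linarith)]; congr 2; rw [hκ]; ring
        have e4 : ‖chiH χ 1‖ ≤ ‖chiH χ 1 - chiH χ (1 + x + I * y)‖ +
            ‖chiH χ (1 + x + I * y)‖ := by
          have := norm_add_le (chiH χ 1 - chiH χ (1 + x + I * y))
            (chiH χ (1 + x + I * y)); simpa using this
        have e5 : Q ^ (-ε) ≤ (q : ℝ) ^ (-(ε / 2)) := by
          refine le_trans (rpow_le_rpow_of_nonpos (by positivity) hqQ (by linarith)) ?_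
          exact rpow_le_rpow_of_exponent_le hq1 (by linarith)
        calc _ ≤ c1 / 2 * (q : ℝ) ^ (-(ε / 2)) := by
              gcongr
              exact (min_le_right _ _).trans (min_le_left _ _)
          _ ≤ _ := by linarith
  · refine le_trans ?_ (caseI fun x hx hx1 => ?_)
    · gcongr; exact min_le_left _ _
    have hre : 1 < (1 + x + 2 * I * y : ℂ).re := by simpa using hx
    rw [← chiH_eq_LSeries h2 hre]
    refine (norm_chiH_le h2 hη0 (by linarith) (by linarith)).trans ?_
    have e1 : (q * (1 + ‖(1 + x + 2 * I * y : ℂ)‖)) ^ (2 * η) ≤ 2 * Q ^ (2 * η) := by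
      refine le_trans (rpow_le_rpow (by positivity) ?_ (by linarith))
        (rpow_two_mul_le hQ0.le (by linarith) (by linarith))
      rw [hQ, mul_left_comm]
      gcongr
      exact one_add_norm_le hx hx1
    have e2 : Q ^ (2 * η) ≤ Q ^ (κ + 3 * η) := rpow_le_rpow_of_exponent_le hQ1 (by linarith)
    have e3 : 6 * zetaC η ≤ M0 := by
      have : 0 ≤ (1 + 1 / η) * (1 / (2 * c0) + 4 * zetaC η) := by positivity
      linarith
    calc _ ≤ 3 * zetaC η * (2 * Q ^ (κ + 3 * η)) := by gcongr; linarith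
      _ = 6 * zetaC η * Q ^ (κ + 3 * η) := by ring
      _ ≤ _ := by gcongr

lemma logDeriv_bounds {H : ℂ → ℂ} {s : ℂ} {a b r : ℝ} (ha : 0 < a) (hb : 0 < b)
    (hr : a / (2 * b) ≤ r)
    (hH : ∀ z ∈ Metric.closedBall s r, DifferentiableAt ℂ H z ∧ ‖deriv H z‖ ≤ b)
    (hs : a ≤ ‖H s‖) {z : ℂ} (hz : z ∈ Metric.closedBall s (a / (2 * b))) :
    H z ≠ 0 ∧ ‖deriv H z / H z‖ ≤ 2 * b / a := by
  have hsub := Metric.closedBall_subset_closedBall (x := s) hr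
  have h := (convex_closedBall s (a / (2 * b))).norm_image_sub_le_of_norm_deriv_le
    (fun x hx => (hH x (hsub hx)).1) (fun x hx => (hH x (hsub hx)).2) hz
    (Metric.mem_closedBall_self (by positivity))
  have h1 : b * ‖s - z‖ ≤ a / 2 := by
    rw [mem_closedBall_iff_norm, norm_sub_rev] at hz
    calc b * ‖s - z‖ ≤ b * (a / (2 * b)) := by gcongr
      _ = a / 2 := by field_simp
  have h2 : ‖H s‖ ≤ ‖H s - H z‖ + ‖H z‖ := by
    have := norm_add_le (H s - H z) (H z); simpa using this
  have h3 : a / 2 ≤ ‖H z‖ := by linarith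
  refine ⟨norm_pos_iff.1 (by linarith), ?_⟩
  rw [norm_div]
  calc ‖deriv H z‖ / ‖H z‖ ≤ b / (a / 2) := by
        gcongr; exact (hH z (hsub hz)).2
    _ = _ := by field_simp

lemma isOpen_halfPlane : IsOpen {z : ℂ | 1 / 2 < z.re} :=
  isOpen_lt continuous_const continuous_re

lemma differentiableAt_deriv_of_halfPlane {H : ℂ → ℂ}
    (hH : ∀ z, 1 / 2 < z.re → DifferentiableAt ℂ H z) {z : ℂ} (hz : 1 / 2 < z.re) :
    DifferentiableAt ℂ (deriv H) z :=
  (DifferentiableOn.deriv (fun w hw => (hH w hw).differentiableWithinAt)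
    isOpen_halfPlane).differentiableAt (isOpen_halfPlane.mem_nhds hz)

lemma mem_closedBall_bounds {s z : ℂ} {r : ℝ} (hz : z ∈ Metric.closedBall s r) :
    s.re - r ≤ z.re ∧ z.re ≤ s.re + r ∧ |z.im| ≤ |s.im| + r := by
  rw [mem_closedBall_iff_norm] at hz
  have h1 := (abs_re_le_norm (z - s)).trans hz
  have h2 := (abs_im_le_norm (z - s)).trans hz
  rw [sub_re, abs_le] at h1
  rw [sub_im] at h2
  have h3 : |z.im| ≤ |z.im - s.im| + |s.im| := by
    have := abs_add_le (z.im - s.im) s.im; simpa using this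
  exact ⟨by linarith, by linarith, by linarith⟩

lemma norm_iteratedDeriv_le_of_closedBall {F : ℂ → ℂ} {s : ℂ} {r M : ℝ} (k : ℕ) (hr : 0 < r)
    (hF : ∀ z ∈ Metric.closedBall s r, DifferentiableAt ℂ F z ∧ ‖F z‖ ≤ M) :
    ‖iteratedDeriv k F s‖ ≤ k.factorial * M / r ^ k := by
  refine norm_iteratedDeriv_le_of_forall_mem_sphere_norm_le k hr
    (DifferentiableOn.diffContOnCl fun w hw => ?_)
    fun z hz => (hF z (Metric.sphere_subset_closedBall hz)).2
  rw [closure_ball _ hr.ne'] at hw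
  exact (hF w hw).1.differentiableWithinAt

lemma strip_eq (s : ℂ) : s = 1 + ((s.re - 1 : ℝ)) + I * s.im := by
  apply Complex.ext <;> simp

lemma LSeries_chi_vonMangoldt {q : ℕ} [NeZero q] {χ : DirichletCharacter ℂ q} (hχ : χ ≠ 1) {s : ℂ}
    (hs : 1 < s.re) :
    LSeries (fun n => χ n * (Λ n)) s =
      -deriv (chiH χ) s / chiH χ s := by
  have h1 : deriv (chiH χ) s = deriv (LSeries fun n => χ n) s := by
    refine Filter.EventuallyEq.deriv_eq ?_
    filter_upwards [(isOpen_lt continuous_const continuous_re).mem_nhds hs] with z hz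
    exact chiH_eq_LSeries hχ hz
  rw [chiH_eq_LSeries hχ hs, h1, ← LSeries_twist_vonMangoldt_eq χ hs]
  rfl

lemma iteratedDeriv_congr_halfPlane {F G : ℂ → ℂ} (h : ∀ z, 1 < z.re → F z = G z) {s : ℂ}
    (hs : 1 < s.re) (k : ℕ) : iteratedDeriv k F s = iteratedDeriv k G s := by
  refine Filter.EventuallyEq.iteratedDeriv_eq k ?_
  filter_upwards [(isOpen_lt continuous_const continuous_re).mem_nhds hs] with z hz
  exact h z hz

theorem norm_iteratedDeriv_chi_le (k : ℕ) : ∃ D, 0 ≤ D ∧ ∀ (q : ℕ) [NeZero q]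
    (χ : DirichletCharacter ℂ q), χ.IsPrimitive → χ ≠ 1 → ∀ s, 1 < s.re → s.re ≤ 2 →
      ‖iteratedDeriv k (LSeries fun n => χ n * (Λ n)) s‖ ≤
        D * (q * (|s.im| + 4)) ^ (1 / 2 : ℝ) := by
  obtain ⟨η, hη0, hη, hηk⟩ : ∃ η : ℝ, 0 < η ∧ η ≤ 1 / 8 ∧ 5 * η * (k + 1) ≤ 1 / 2 := by
    refine ⟨1 / (10 * (k + 1)), by positivity, ?_, by field_simp; norm_num⟩
    apply one_div_le_one_div_of_le (by norm_num)
    have : 0 ≤ k := by positivity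
    linarith
  obtain ⟨c', hc'0, hL'⟩ := chiH_lower_bound hη0
  set c := min c' 1
  have hc0 : 0 < c := by positivity
  have hz := zetaC_ge_one (η := 2 * η) (by linarith)
  set B := 2 * (6 * zetaC (2 * η) / η) with hB
  have hB0 : 1 / η ≤ B := by rw [hB, ← mul_div_assoc]; gcongr; linarith
  have hBp : 0 < B := by positivity
  refine ⟨k.factorial * (2 * B / c) ^ (k + 1), by positivity, fun q _ χ hp hχ s hs hs2 => ?_⟩
  rw [iteratedDeriv_congr_halfPlane (fun z hz => LSeries_chi_vonMangoldt hχ hz) hs]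
  have hq1 : (1 : ℝ) ≤ q := mod_cast one_le_iff_ne_zero.2 (NeZero.ne q)
  set Q := q * (|s.im| + 4) with hQ
  have hQ1 : 1 ≤ Q := by nlinarith [abs_nonneg s.im]
  have hQ0 : 0 < Q := by linarith
  have ha : c * Q ^ (-η) ≤ ‖chiH χ s‖ := by
    have := hL' q χ hp hχ (s.re - 1) s.im (by linarith) (by linarith)
    rw [← strip_eq] at this
    refine le_trans ?_ this
    gcongr
    exact min_le_left _ _
  have hb : ∀ z ∈ Metric.closedBall s η, DifferentiableAt ℂ (chiH χ) z ∧
      ‖deriv (chiH χ) z‖ ≤ B * Q ^ (4 * η) := by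
    intro z hz
    obtain ⟨h1, h2, h3⟩ := mem_closedBall_bounds hz
    refine ⟨differentiableAt_chiH hχ (by linarith),
      (norm_deriv_chiH_le hχ hη0 hη (by linarith) (by linarith)).trans ?_⟩
    have h4 : (q * (|z.im| + 4)) ^ (4 * η) ≤ 2 * Q ^ (4 * η) := by
      refine le_trans (rpow_le_rpow (by positivity) ?_ (by linarith))
        (rpow_two_mul_le hQ0.le (by linarith) (by linarith))
      rw [hQ, mul_left_comm]
      gcongr
      linarith [abs_nonneg s.im]
    calc _ ≤ 6 * zetaC (2 * η) / η * (2 * Q ^ (4 * η)) := by gcongr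
      _ = _ := by rw [hB]; ring
  have hQa : Q ^ (-η) ≤ 1 := rpow_le_one_of_one_le_of_nonpos hQ1 (by linarith)
  have hr : c * Q ^ (-η) / (2 * (B * Q ^ (4 * η))) ≤ η := by
    rw [div_le_iff₀ (by positivity)]
    have h1 : c * Q ^ (-η) ≤ 1 := by
      calc c * Q ^ (-η) ≤ 1 * 1 := by gcongr; exact min_le_right _ _
        _ = 1 := by ring
    have h2 : 1 ≤ η * B := by rwa [div_le_iff₀' hη0] at hB0
    have h3 := one_le_mul_of_one_le_of_one_le h2 (one_le_rpow hQ1 (by linarith) : 1 ≤ Q ^ (4 * η))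
    linarith
  have hfin := norm_iteratedDeriv_le_of_closedBall (F := fun z => -deriv (chiH χ) z / chiH χ z) (r := c * Q ^ (-η) / (2 * (B * Q ^ (4 * η)))) k (by positivity) (fun z hz => by
      obtain ⟨h1, h2⟩ := logDeriv_bounds (by positivity) (by positivity) hr hb ha hz
      obtain ⟨g1, -, -⟩ := mem_closedBall_bounds (Metric.closedBall_subset_closedBall hr hz)
      have g2 : 1 / 2 < z.re := by linarith
      refine ⟨((differentiableAt_deriv_of_halfPlane
        (fun w hw => differentiableAt_chiH hχ hw) g2).neg).div (differentiableAt_chiH hχ g2) h1, ?_⟩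
      rw [neg_div, norm_neg]; exact h2)
  refine hfin.trans ?_
  have e1 : 2 * (B * Q ^ (4 * η)) / (c * Q ^ (-η)) = 2 * B / c * Q ^ (5 * η) := by
    rw [show 5 * η = 4 * η - (-η) by ring, rpow_sub hQ0]; field_simp
  have e2 : c * Q ^ (-η) / (2 * (B * Q ^ (4 * η))) = (2 * B / c * Q ^ (5 * η))⁻¹ := by
    rw [← e1, inv_div]
  rw [e1, e2, inv_pow, div_inv_eq_mul, mul_assoc, ← pow_succ', mul_pow, ← mul_assoc]
  gcongr
  rw [← rpow_natCast, ← rpow_mul hQ0.le]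
  exact rpow_le_rpow_of_exponent_le hQ1 (by push_cast; linarith)

lemma LSeries_one_modOne {s : ℂ} (hs : 1 < s.re) :
    LSeries (fun n => (1 : DirichletCharacter ℂ 1) n) s = riemannZeta s := by
  rw [← LFunction_eq_LSeries _ hs, LFunction_modOne_eq]

lemma deriv_zetaK_strip {η T : ℝ} (hη0 : 0 < η) (hη : η ≤ 1 / 8) (s : ℂ) (hs : 1 ≤ s.re)
    (hs3 : s.re ≤ 3) (hT : |s.im| ≤ T) : DifferentiableAt ℂ zetaK s ∧
      ‖deriv zetaK s‖ ≤ 9 * zetaC (2 * η) / η * (T + 4) ^ (1 + 4 * η) := by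
  have hz := zetaC_ge_one (η := 2 * η) (by linarith)
  refine ⟨differentiableAt_zetaK (by linarith),
    (norm_deriv_zetaK_le hη0 hη (by linarith) hs3).trans ?_⟩
  gcongr

lemma one_add_norm_le' {x y : ℝ} (hx : 0 < x) :
    ‖(1 + x + I * y : ℂ)‖ ≤ 1 + x + |y| := by
  have := norm_le_abs_re_add_abs_im (1 + x + I * y : ℂ)
  rwa [(strip_point x y).1, (strip_point x y).2, abs_of_pos (by linarith)] at this

theorem zetaK_lower_bound {ε : ℝ} (hε : 0 < ε) (hε1 : ε ≤ 1) : ∃ c > 0, ∀ x y : ℝ, 0 < x → x ≤ 1 →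
    c * (|y| + 4) ^ (1 - ε) ≤ ‖zetaK (1 + x + I * y)‖ := by
  obtain ⟨C, hC1, hC⟩ := exists_zetaC_le
  obtain ⟨η, hη0, hη, hηε⟩ : ∃ η : ℝ, 0 < η ∧ η ≤ 1 / 8 ∧ 14 * η ≤ ε :=
    ⟨min (1 / 8) (ε / 14), by positivity, min_le_left _ _, by
      have := min_le_right (1 / 8) (ε / 14); linarith⟩
  have hz := zetaC_ge_one hη0
  have hz2 := zetaC_ge_one (η := 2 * η) (by linarith)
  have hz4 := zetaC_ge_one (η := 1 / 4) (by norm_num)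
  set B := 9 * zetaC (2 * η) / η with hB
  have hB1 : 1 ≤ B := by rw [hB, one_le_div hη0]; linarith
  set d := 1 / (32 * zetaC (1 / 4)) with hd
  have hd0 : 0 < d := by positivity
  have hd1 : d ≤ 1 := by rw [hd, div_le_one (by positivity)]; linarith
  set M0 := 1 / (2 * d) + 4 * zetaC η with hM0
  have hM00 : 1 ≤ M0 := by
    have : 0 ≤ 1 / (2 * d) := by positivity
    linarith
  have hM0' : 0 < M0 := by linarith
  refine ⟨min ((d / 5) ^ 4 / (C ^ 3 * M0) / (16 * B ^ 3)) (min (1 / 10) (d ^ 2 / (5 * C))),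
    by positivity, fun x y hx hx1 => ?_⟩
  set T := |y| + 4 with hT
  have hT4 : 4 ≤ T := by linarith [abs_nonneg y]
  have hT0 : 0 < T := by linarith
  by_cases hy : d ≤ |y|
  · have hdT : d / 5 * T ≤ |y| := by
      rw [hT]; nlinarith
    have hM : ∀ x : ℝ, 0 < x → x ≤ 1 → ‖LSeries (fun n => ((1 : DirichletCharacter ℂ 1) ^ 2) n)
        (1 + x + 2 * I * y)‖ ≤ M0 * T ^ (2 * η) := by
      intro x hx hx1
      have hre : 1 < (1 + x + 2 * I * y : ℂ).re := by simpa using hx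
      rw [one_pow, LSeries_one_modOne hre]
      refine (norm_riemannZeta_le hη0 (by linarith) hre (T := T) (by positivity)
        (one_add_norm_le hx hx1)).trans ?_
      have g3 : 2 * d ≤ ‖(1 + x + 2 * I * y : ℂ) - 1‖ := by
        have := abs_im_le_norm ((1 + x + 2 * I * y : ℂ) - 1)
        simp [abs_mul] at this; linarith
      have g4 : 1 ≤ T ^ (2 * η) := one_le_rpow (by linarith) (by linarith)
      rw [hM0, add_mul]
      gcongr
      calc 1 / ‖(1 + x + 2 * I * y : ℂ) - 1‖ ≤ 1 / (2 * d) * 1 := by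
            rw [mul_one]; gcongr
        _ ≤ _ := by gcongr
    have hTp : 1 ≤ T ^ (2 * η) := one_le_rpow (by linarith) (by linarith)
    have hM1 : 1 ≤ M0 * T ^ (2 * η) := one_le_mul_of_one_le_of_one_le hM00 hTp
    have key := lower_of_pow_four' (f := fun x : ℝ => zetaK (1 + x + I * y))
      (A := (d / 5 * T) ^ 4 / (C ^ 3 * (M0 * T ^ (2 * η)))) (b := B * T ^ (1 + 4 * η))
      (by positivity) (by positivity) ?_ (fun x hx hx1 => ?_) (fun x x' hx hxx hx1 => ?_) hx hx1
    · refine le_trans ?_ key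
      have e1 : (d / 5 * T) ^ 4 / (C ^ 3 * (M0 * T ^ (2 * η))) / (16 * (B * T ^ (1 + 4 * η)) ^ 3) =
          (d / 5) ^ 4 / (C ^ 3 * M0) / (16 * B ^ 3) *
            (T ^ (4 : ℕ) * (T ^ (2 * η) * (T ^ (1 + 4 * η)) ^ 3)⁻¹) := by
        field_simp
      rw [e1]
      have e2 : T ^ (4 : ℕ) * (T ^ (2 * η) * (T ^ (1 + 4 * η)) ^ 3)⁻¹ = T ^ (1 - 14 * η) := by
        rw [← rpow_natCast T, ← rpow_natCast (T ^ (1 + 4 * η)), ← rpow_mul hT0.le,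
          ← rpow_add hT0, ← rpow_neg hT0.le, ← rpow_add hT0]
        congr 1; push_cast; ring
      rw [e2]
      have e3 : T ^ (1 - ε) ≤ T ^ (1 - 14 * η) :=
        rpow_le_rpow_of_exponent_le (by linarith) (by linarith)
      gcongr
      exact min_le_left _ _
    · have h1 : 1 ≤ C ^ 3 * (M0 * T ^ (2 * η)) := one_le_mul_of_one_le_of_one_le (one_le_pow₀ hC1) hM1
      have h2 : T ≤ T ^ (1 + 4 * η) := by
        calc T = T ^ (1 : ℝ) := (rpow_one T).symm
          _ ≤ _ := rpow_le_rpow_of_exponent_le (by linarith) (by linarith)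
      calc (d / 5 * T) ^ 4 / (C ^ 3 * (M0 * T ^ (2 * η))) ≤ (d / 5 * T) ^ 4 :=
            div_le_self (by positivity) h1
        _ ≤ (2 * (B * T ^ (1 + 4 * η))) ^ 4 := by
          have : d / 5 * T ≤ 2 * (B * T ^ (1 + 4 * η)) := by nlinarith
          gcongr
    · have hre : 1 < (1 + x + I * y : ℂ).re := by rw [(strip_point x y).1]; linarith
      have h1 := three_four_one (1 : DirichletCharacter ℂ 1) hC hx hx1 hC1 (hM x hx hx1) (by linarith)
      rw [LSeries_one_modOne hre] at h1
      rw [zetaK_eq hre, norm_mul, mul_pow ‖(1 + x + I * y : ℂ) - 1‖]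
      have h2 : d / 5 * T ≤ ‖(1 + x + I * y : ℂ) - 1‖ := by
        have := abs_im_le_norm ((1 + x + I * y : ℂ) - 1)
        simp at this; linarith
      calc (d / 5 * T) ^ 4 / (C ^ 3 * (M0 * T ^ (2 * η))) * x ^ 3 =
            (d / 5 * T) ^ 4 * (1 / (C ^ 3 * (M0 * T ^ (2 * η))) * x ^ 3) := by ring
        _ ≤ _ := by gcongr
    · exact lipschitz_horizontal (deriv_zetaK_strip hη0 hη) hx hxx hx1
  · push Not at hy
    have hT5 : T ^ (1 - ε) ≤ 5 := by
      calc T ^ (1 - ε) ≤ T ^ (1 : ℝ) := rpow_le_rpow_of_exponent_le (by linarith) (by linarith)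
        _ = T := rpow_one T
        _ ≤ 5 := by linarith
    have hre : 1 < (1 + x + I * y : ℂ).re := by rw [(strip_point x y).1]; linarith
    by_cases hxd : d ≤ x
    · have h1 := trivial_lower (1 : DirichletCharacter ℂ 1) y hC hx hx1 hC1
      rw [LSeries_one_modOne hre] at h1
      rw [zetaK_eq hre, norm_mul]
      have h2 : x ≤ ‖(1 + x + I * y : ℂ) - 1‖ := by
        have := (le_abs_self _).trans (abs_re_le_norm ((1 + x + I * y : ℂ) - 1))
        simpa using this
      calc _ ≤ d ^ 2 / (5 * C) * 5 := by
            gcongr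
            exact (min_le_right _ _).trans (min_le_right _ _)
        _ = d * (d / C) := by field_simp
        _ ≤ x * (x / C) := by gcongr
        _ ≤ _ := by gcongr
    · push Not at hxd
      have h1 := norm_zetaK_sub_one_le (η := 1 / 4) (by norm_num) (by norm_num)
        (s := 1 + x + I * y) (by linarith)
      have h2 := one_add_norm_le' (y := y) hx
      have h3 : ‖(1 + x + I * y : ℂ) - 1‖ ≤ 2 * d := by
        have := norm_le_abs_re_add_abs_im ((1 + x + I * y : ℂ) - 1)
        simp [abs_of_pos hx] at this; linarith
      have h4 : (1 + ‖(1 + x + I * y : ℂ)‖) ^ (2 * (1 / 4) : ℝ) ≤ 4 := by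
        calc (1 + ‖(1 + x + I * y : ℂ)‖) ^ (2 * (1 / 4) : ℝ) ≤
              (1 + ‖(1 + x + I * y : ℂ)‖) ^ (1 : ℝ) :=
              rpow_le_rpow_of_exponent_le (by linarith [norm_nonneg (1 + x + I * y : ℂ)])
                (by norm_num)
          _ = _ := rpow_one _
          _ ≤ 4 := by linarith
      have h5 : 2 * zetaC (1 / 4) * (1 + ‖(1 + x + I * y : ℂ)‖) ^ (2 * (1 / 4) : ℝ) *
          ‖(1 + x + I * y : ℂ) - 1‖ ≤ 1 / 2 := by
        calc _ ≤ 2 * zetaC (1 / 4) * 4 * (2 * d) := by gcongr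
          _ = 1 / 2 := by rw [hd]; field_simp; norm_num
      have h6 : 1 ≤ ‖zetaK (1 + x + I * y) - 1‖ + ‖zetaK (1 + x + I * y)‖ := by
        have := norm_sub_le (zetaK (1 + x + I * y)) (zetaK (1 + x + I * y) - 1)
        simp at this; linarith
      have h7 : min ((d / 5) ^ 4 / (C ^ 3 * M0) / (16 * B ^ 3)) (min (1 / 10) (d ^ 2 / (5 * C))) *
          T ^ (1 - ε) ≤ 1 / 10 * 5 := by
        gcongr
        exact (min_le_right _ _).trans (min_le_left _ _)
      linarith

lemma differentiableAt_dslope_zetaK {z : ℂ} (hz : 1 / 2 < z.re) :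
    DifferentiableAt ℂ (dslope zetaK 1) z := by
  exact ((differentiableOn_dslope (isOpen_halfPlane.mem_nhds (by norm_num))).2 fun w hw =>
    (differentiableAt_zetaK hw).differentiableWithinAt).differentiableAt
      (isOpen_halfPlane.mem_nhds hz)

lemma LSeries_vonMangoldt_sub_one {s : ℂ} (hs : 1 < s.re) :
    LSeries (fun n => (Λ n) - 1) s =
      -deriv zetaK s / zetaK s - dslope zetaK 1 s := by
  have hs1 : s ≠ 1 := by rintro rfl; simp at hs
  have hs0 := sub_ne_zero.2 hs1
  have hz0 := riemannZeta_ne_zero_of_one_lt_re hs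
  have h1 : LSeries (fun n => (Λ n) - 1) s =
      -deriv riemannZeta s / riemannZeta s - riemannZeta s := by
    rw [← LSeries_vonMangoldt_eq_deriv_riemannZeta_div hs,
      ← LSeries_one_eq_riemannZeta hs]
    exact LSeries_sub (LSeriesSummable_vonMangoldt hs)
      (LSeriesSummable_one_iff.2 hs)
  have h2 : deriv zetaK s = riemannZeta s + (s - 1) * deriv riemannZeta s := by
    have : deriv zetaK s = deriv (fun z => (z - 1) * riemannZeta z) s := by
      refine Filter.EventuallyEq.deriv_eq ?_
      filter_upwards [(isOpen_lt continuous_const continuous_re).mem_nhds hs] with z hz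
      exact zetaK_eq hz
    rw [this]
    have := ((hasDerivAt_id s).sub_const 1).mul (differentiableAt_riemannZeta hs1).hasDerivAt
    have := this.deriv
    simp only [id_eq, one_mul] at this
    exact this
  rw [h1, h2, dslope_of_ne _ hs1, slope_def_field, zetaK_one, zetaK_eq hs]
  field_simp
  ring

lemma norm_dslope_zetaK_le {η : ℝ} (hη0 : 0 < η) (hη : η ≤ 1 / 8) : ∃ D, 0 ≤ D ∧
    ∀ z, 1 / 2 < z.re → 1 - η ≤ z.re → ‖dslope zetaK 1 z‖ ≤ D * (1 + ‖z‖) ^ (2 * η) := by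
  have hz := zetaC_ge_one (by linarith)
  refine ⟨max (2 * zetaC η) ‖deriv zetaK 1‖, by positivity, fun z hz1 hz2 => ?_⟩
  have h0 : 1 ≤ (1 + ‖z‖) ^ (2 * η) :=
    one_le_rpow (by linarith [norm_nonneg z]) (by linarith)
  by_cases hz : z = 1
  · subst hz
    rw [dslope_same]
    calc ‖deriv zetaK 1‖ = ‖deriv zetaK 1‖ * 1 := by ring
      _ ≤ _ := by gcongr; exact le_max_right _ _
  · rw [dslope_of_ne _ hz, slope_def_field, zetaK_one, norm_div]
    rw [div_le_iff₀ (norm_pos_iff.2 (sub_ne_zero.2 hz))]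
    refine (norm_zetaK_sub_one_le hη0 (by linarith) (by linarith)).trans ?_
    gcongr
    exact le_max_left _ _

theorem norm_iteratedDeriv_one_le (k : ℕ) : ∃ D, 0 ≤ D ∧ ∀ s, 1 < s.re → s.re ≤ 2 →
      ‖iteratedDeriv k (LSeries fun n => (Λ n) - 1) s‖ ≤
        D * (|s.im| + 4) ^ (1 / 2 : ℝ) := by
  obtain ⟨η, hη0, hη, hηk⟩ : ∃ η : ℝ, 0 < η ∧ η ≤ 1 / 8 ∧ 5 * η * (k + 1) ≤ 1 / 2 := by
    refine ⟨1 / (10 * (k + 1)), by positivity, ?_, by field_simp; norm_num⟩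
    apply one_div_le_one_div_of_le (by norm_num)
    have : 0 ≤ k := by positivity
    linarith
  obtain ⟨c', hc'0, hL'⟩ := zetaK_lower_bound hη0 (by linarith)
  obtain ⟨D0, hD0, hD⟩ := norm_dslope_zetaK_le hη0 hη
  set c := min c' 1
  have hz := zetaC_ge_one (η := 2 * η) (by linarith)
  set B := 4 * (9 * zetaC (2 * η) / η) with hB
  have hB0 : 1 / η ≤ B := by rw [hB, ← mul_div_assoc]; gcongr; linarith
  have hBp : 0 < B := by positivity
  refine ⟨k.factorial * ((2 * B / c + 2 * D0) * (2 * B / c) ^ k), by positivity,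
    fun s hs hs2 => ?_⟩
  rw [iteratedDeriv_congr_halfPlane (fun z hz => LSeries_vonMangoldt_sub_one hz) hs]
  set Q := |s.im| + 4 with hQ
  have hQ1 : 1 ≤ Q := by linarith [abs_nonneg s.im]
  have hQ0 : 0 < Q := by linarith
  have ha : c * Q ^ (1 - η) ≤ ‖zetaK s‖ := by
    have := hL' (s.re - 1) s.im (by linarith) (by linarith)
    rw [← strip_eq] at this
    refine le_trans ?_ this
    gcongr
    exact min_le_left _ _
  have hb : ∀ z ∈ Metric.closedBall s η, DifferentiableAt ℂ zetaK z ∧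
      ‖deriv zetaK z‖ ≤ B * Q ^ (1 + 4 * η) := by
    intro z hz
    obtain ⟨h1, h2, h3⟩ := mem_closedBall_bounds hz
    refine ⟨differentiableAt_zetaK (by linarith),
      (norm_deriv_zetaK_le hη0 hη (by linarith) (by linarith)).trans ?_⟩
    have h4 : (|z.im| + 4) ^ (1 + 4 * η) ≤ 4 * Q ^ (1 + 4 * η) := by
      calc (|z.im| + 4) ^ (1 + 4 * η) ≤ (2 * Q) ^ (1 + 4 * η) := by
            apply rpow_le_rpow (by positivity) _ (by linarith)
            rw [hQ]; linarith [abs_nonneg s.im]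
        _ = 2 ^ (1 + 4 * η) * Q ^ (1 + 4 * η) := mul_rpow (by norm_num) hQ0.le
        _ ≤ 2 ^ (2 : ℝ) * Q ^ (1 + 4 * η) := by
            gcongr
            · norm_num
            · linarith
        _ = _ := by norm_num
    calc _ ≤ 9 * zetaC (2 * η) / η * (4 * Q ^ (1 + 4 * η)) := by gcongr
      _ = _ := by rw [hB]; ring
  have e1 : 2 * (B * Q ^ (1 + 4 * η)) / (c * Q ^ (1 - η)) = 2 * B / c * Q ^ (5 * η) := by
    rw [show 5 * η = (1 + 4 * η) - (1 - η) by ring,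
      rpow_sub hQ0 (1 + 4 * η) (1 - η)]
    field_simp
  have e2 : c * Q ^ (1 - η) / (2 * (B * Q ^ (1 + 4 * η))) = (2 * B / c * Q ^ (5 * η))⁻¹ := by
    rw [← e1, inv_div]
  have hr : c * Q ^ (1 - η) / (2 * (B * Q ^ (1 + 4 * η))) ≤ η := by
    rw [e2]
    have h2 : 1 ≤ η * B := by rwa [div_le_iff₀' hη0] at hB0
    have h3 : 1 / η ≤ 2 * B / c * Q ^ (5 * η) := by
      calc 1 / η ≤ B := hB0
        _ ≤ 2 * B / c := by
          rw [le_div_iff₀ (by positivity)]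
          have : c ≤ 1 := min_le_right _ _
          nlinarith
        _ ≤ _ := le_mul_of_one_le_right (by positivity) (one_le_rpow hQ1 (by linarith))
    rw [inv_le_comm₀ (by positivity) hη0]
    simpa using h3
  have hfin := norm_iteratedDeriv_le_of_closedBall
    (F := fun z => -deriv zetaK z / zetaK z - dslope zetaK 1 z) (r := c * Q ^ (1 - η) / (2 * (B * Q ^ (1 + 4 * η))))
    (M := 2 * (B * Q ^ (1 + 4 * η)) / (c * Q ^ (1 - η)) + D0 * (2 * Q ^ (5 * η))) k
    (by positivity) (fun z hz => by
      obtain ⟨h1, h2⟩ := logDeriv_bounds (by positivity) (by positivity) hr hb ha hz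
      obtain ⟨g1, g3, g4⟩ := mem_closedBall_bounds (Metric.closedBall_subset_closedBall hr hz)
      have g2 : 1 / 2 < z.re := by linarith
      refine ⟨(((differentiableAt_deriv_of_halfPlane
        (fun w hw => differentiableAt_zetaK hw) g2).neg).div (differentiableAt_zetaK g2) h1).sub
          (differentiableAt_dslope_zetaK g2), (norm_sub_le _ _).trans (add_le_add ?_ ?_)⟩
      · rw [neg_div, norm_neg]; exact h2
      · refine (hD z g2 (by linarith)).trans ?_
        gcongr
        have g5 : 1 + ‖z‖ ≤ 2 * Q := by
          have := norm_le_abs_re_add_abs_im z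
          rw [abs_of_pos (by linarith)] at this
          linarith [abs_nonneg s.im]
        calc (1 + ‖z‖) ^ (2 * η) ≤ (2 * Q) ^ (2 * η) :=
              rpow_le_rpow (by positivity) g5 (by linarith)
          _ ≤ 2 * Q ^ (2 * η) := rpow_two_mul_le hQ0.le (by linarith) (by linarith)
          _ ≤ 2 * Q ^ (5 * η) := by gcongr <;> linarith)
  refine hfin.trans ?_
  rw [e1, e2, inv_pow, div_inv_eq_mul, mul_pow (2 * B / c)]
  have e3 : (Q ^ (5 * η)) ^ (k + 1) ≤ Q ^ (1 / 2 : ℝ) := by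
    rw [← rpow_natCast, ← rpow_mul hQ0.le]
    exact rpow_le_rpow_of_exponent_le hQ1 (by push_cast; linarith)
  calc _ = k.factorial * ((2 * B / c + 2 * D0) * (2 * B / c) ^ k) * (Q ^ (5 * η)) ^ (k + 1) := by
        ring
    _ ≤ _ := by gcongr

def rieszKernel (t : ℝ) : ℂ :=
  (Set.Ioc (0 : ℝ) 1).indicator (fun _ => (1 : ℂ)) t -
    (Set.Ioc (0 : ℝ) 1).indicator (fun t : ℝ => (t : ℂ) ^ (1 : ℂ)) t

lemma rieszKernel_of_pos {t : ℝ} (ht : 0 < t) : rieszKernel t = ((max (1 - t) 0)) := by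
  rw [rieszKernel]
  by_cases h : t ≤ 1
  · have : t ∈ Set.Ioc 0 1 := ⟨ht, h⟩
    rw [Set.indicator_of_mem this, Set.indicator_of_mem this, max_eq_left (by linarith)]
    simp
  · have : t ∉ Set.Ioc 0 1 := fun h' => h h'.2
    rw [Set.indicator_of_notMem this, Set.indicator_of_notMem this, max_eq_right (by linarith)]
    simp

lemma hasMellin_rieszKernel {s : ℂ} (hs : 0 < s.re) :
    HasMellin rieszKernel s (1 / s - 1 / (s + 1)) := by
  have h1 := hasMellin_one_Ioc hs
  have h2 := hasMellin_cpow_Ioc 1 (by simp; linarith)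
  have := hasMellin_sub h1.1 h2.1
  rwa [h1.2, h2.2] at this

lemma norm_mellin_rieszKernel_le {σ : ℝ} (hσ : 1 ≤ σ) (y : ℝ) :
    ‖1 / (σ + y * I) - 1 / (σ + y * I + 1)‖ ≤ (1 + ‖y‖ ^ 2)⁻¹ := by
  have hn : 1 + y ^ 2 ≤ ‖(σ + y * I)‖ ^ 2 := by
    rw [← normSq_eq_norm_sq, normSq_add_mul_I]; nlinarith
  have hn1 : 1 + y ^ 2 ≤ ‖(σ + y * I + 1)‖ ^ 2 := by
    rw [show (σ + y * I + 1) = ((σ + 1 : ℝ)) + y * I by push_cast; ring,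
      ← normSq_eq_norm_sq, normSq_add_mul_I]; nlinarith
  have h0 : (σ + y * I) ≠ 0 := by
    intro h; rw [h] at hn; simp at hn; nlinarith [sq_nonneg y]
  have h1 : (σ + y * I + 1) ≠ 0 := by
    intro h; rw [h] at hn1; simp at hn1; nlinarith [sq_nonneg y]
  rw [(by field_simp; ring : 1 / (σ + y * I) - 1 / (σ + y * I + 1) = ((σ + y * I) * (σ + y * I + 1))⁻¹), norm_inv, norm_mul, norm_eq_abs, sq_abs]
  gcongr
  have := mul_le_mul hn hn1 (by positivity) (by positivity)
  rw [← mul_pow] at this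
  nlinarith [mul_nonneg (norm_nonneg (σ + y * I))
    (norm_nonneg (σ + y * I + 1)), sq_nonneg y]

lemma integrable_mellin_rieszKernel {σ : ℝ} (hσ : 1 ≤ σ) : MeasureTheory.Integrable
    (fun y : ℝ => 1 / (σ + y * I) - 1 / (σ + y * I + 1)) := by
  refine (integrable_inv_one_add_sq).mono' ?_ (Filter.Eventually.of_forall fun y => ?_)
  · refine (Continuous.sub ?_ ?_).aestronglyMeasurable
    · refine continuous_const.div (by fun_prop) fun y h => ?_
      have := congrArg re h; simp at this; linarith
    · refine continuous_const.div (by fun_prop) fun y h => ?_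
      have := congrArg re h; simp at this; linarith
  · simpa using norm_mellin_rieszKernel_le hσ y

lemma riesz_inversion {σ : ℝ} (hσ : 1 ≤ σ) {x : ℝ} (hx : 0 < x) :
    ∫ y : ℝ, x ^ (-(σ + y * I)) *
      (1 / (σ + y * I) - 1 / (σ + y * I + 1)) =
      2 * pi * ((max (1 - x) 0)) := by
  have hm : ∀ y : ℝ, mellin rieszKernel (σ + y * I) =
      1 / (σ + y * I) - 1 / (σ + y * I + 1) := fun y =>
    (hasMellin_rieszKernel (by simp; linarith)).2
  have hc : ContinuousAt rieszKernel x := by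
    refine (by fun_prop : ContinuousAt (fun t => ((max (1 - t) 0 : ℝ) : ℂ)) x).congr ?_
    filter_upwards [lt_mem_nhds hx] with t ht
    exact (rieszKernel_of_pos ht).symm
  have h := mellinInv_mellin_eq σ rieszKernel hx
    (hasMellin_rieszKernel (by simp; linarith)).1
    (by
      have := integrable_mellin_rieszKernel hσ
      simp_rw [← hm] at this
      exact this) hc
  rw [rieszKernel_of_pos hx, mellinInv] at h
  simp_rw [hm] at h
  rw [← h]
  simp only [smul_eq_mul, real_smul]
  push_cast
  rw [← mul_assoc, mul_one_div_cancel (by simpa using (mod_cast pi_ne_zero)), one_mul]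

def rieszConst : ℝ := ∫ y : ℝ, (|y| + 4) ^ (1 / 2 : ℝ) * (1 + ‖y‖ ^ 2)⁻¹

lemma integrable_rieszConst : MeasureTheory.Integrable
    (fun y => (|y| + 4) ^ (1 / 2 : ℝ) * (1 + ‖y‖ ^ 2)⁻¹) := by
  refine ((integrable_rpow_neg_one_add_norm_sq (r := 3 / 2)
    (by simp; norm_num)).const_mul 4).mono' ?_ (Filter.Eventually.of_forall fun y => ?_)
  · refine (Continuous.mul ?_ ?_).aestronglyMeasurable
    · exact (by fun_prop : Continuous fun y : ℝ => |y| + 4).rpow_const fun y => Or.inr (by norm_num)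
    · exact Continuous.inv₀ (by fun_prop) fun y => by positivity
  · have h0 : 0 < 1 + y ^ 2 := by positivity
    rw [norm_of_nonneg (by positivity), norm_eq_abs, sq_abs]
    have e : (1 + y ^ 2) ^ (-(3 / 2 : ℝ) / 2) = (1 + y ^ 2) ^ (1 / 4 : ℝ) * (1 + y ^ 2)⁻¹ := by
      rw [← rpow_neg_one, ← rpow_add h0]; norm_num
    rw [e, ← mul_assoc]
    gcongr
    have h4 : (4 : ℝ) = 16 ^ (1 / 2 : ℝ) := by
      rw [show (16 : ℝ) = 4 ^ (2 : ℝ) by norm_num, ← rpow_mul (by norm_num)]; norm_num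
    have h5 : (1 + y ^ 2) ^ (1 / 4 : ℝ) = ((1 + y ^ 2) ^ (1 / 2 : ℝ)) ^ (1 / 2 : ℝ) := by
      rw [← rpow_mul h0.le]; norm_num
    rw [h5]
    refine le_trans (rpow_le_rpow (by positivity) ?_ (by norm_num)) (b := (16 *
      (1 + y ^ 2) ^ (1 / 2 : ℝ)) ^ (1 / 2)) (le_of_eq ?_)
    swap
    · rw [mul_rpow (by norm_num) (by positivity), ← h4]
    rw [← sqrt_eq_rpow]
    have h6 : |y| ≤ √(1 + y ^ 2) := abs_le_sqrt (by linarith)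
    have h7 : 1 ≤ √(1 + y ^ 2) := one_le_sqrt.2 (by nlinarith)
    linarith

lemma rieszConst_nonneg : 0 ≤ rieszConst :=
  MeasureTheory.integral_nonneg fun y => by positivity

lemma riesz_mean_le {b : ℕ → ℂ} {D : ℝ} (hD : 0 ≤ D) (hsum : ∀ s, 1 < s.re → LSeriesSummable b s)
    (hb : ∀ s, 1 < s.re → s.re ≤ 2 → ‖LSeries b s‖ ≤ D * (|s.im| + 4) ^ (1 / 2 : ℝ))
    {X : ℕ} (hX : 3 ≤ X) :
    ‖∑ n ∈ Icc 1 X, b n * (X - n)‖ ≤ 3 * rieszConst * D * X ^ 2 := by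
  have hX0 : (0 : ℝ) < X := by positivity
  have hlog : 1 ≤ log X := by
    rw [le_log_iff_exp_le hX0]
    have : (3 : ℝ) ≤ X := mod_cast hX
    linarith [exp_one_lt_d9]
  set σ := 1 + 1 / log X with hσ
  have hσ1 : 1 < σ := by rw [hσ]; have : 0 < 1 / log X := by positivity
                         linarith
  have hσ2 : σ ≤ 2 := by
    have : 1 / log X ≤ 1 := by rw [div_le_one (by linarith)]; exact hlog
    linarith
  have hXσ : (X : ℝ) ^ σ ≤ 3 * X := by
    rw [hσ, rpow_add hX0, rpow_one, one_div, rpow_inv_log hX0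
      (mod_cast (by omega))]
    nlinarith [exp_one_lt_d9]
  set k : ℝ → ℂ := fun y => 1 / (σ + y * I) - 1 / (σ + y * I + 1)
  have hki := integrable_mellin_rieszKernel hσ1.le
  set F : ℕ → ℝ → ℂ := fun n y =>
    LSeries.term b (σ + y * I) n * (X ^ (σ + y * I) * k y) with hF
  have hnorm : ∀ n y, ‖F n y‖ = ‖LSeries.term b σ n‖ * (X ^ σ * ‖k y‖) := by
    intro n y
    rw [hF]
    simp only [norm_mul]
    rw [LSeries.norm_term_eq, LSeries.norm_term_eq, norm_natCast_cpow_of_pos (by omega)]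
    simp
  have hmeas : ∀ n, MeasureTheory.Integrable (F n) := by
    intro n
    refine ((hki.norm.const_mul (X ^ σ)).const_mul ‖LSeries.term b σ n‖).mono' ?_
      (Filter.Eventually.of_forall fun y => (hnorm n y).le)
    refine MeasureTheory.AEStronglyMeasurable.mul (Continuous.aestronglyMeasurable ?_)
      (MeasureTheory.AEStronglyMeasurable.mul (Continuous.aestronglyMeasurable ?_)
        hki.aestronglyMeasurable)
    · rcases Nat.eq_zero_or_pos n with rfl | hn
      · simp [LSeries.term_zero]; exact continuous_const
      · simp only [LSeries.term_of_ne_zero hn.ne']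
        refine continuous_const.div (Continuous.const_cpow (by fun_prop)
          (Or.inl (mod_cast hn.ne'))) fun y => ?_
        simp [cpow_eq_zero_iff, hn.ne']
    · exact Continuous.const_cpow (by fun_prop) (Or.inl (mod_cast (by omega)))
  have hs : Summable fun n => ∫ y, ‖F n y‖ := by
    simp_rw [hnorm, MeasureTheory.integral_const_mul]
    exact ((hsum σ (by simpa using hσ1)).norm).mul_right _
  have H := MeasureTheory.hasSum_integral_of_summable_integral_norm hmeas hs
  have hval : ∀ n, ∫ y, F n y = 2 * pi *
      (if n ∈ Icc 1 X then b n * (1 - n / X) else 0) := by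
    intro n
    rcases Nat.eq_zero_or_pos n with rfl | hn
    · simp [hF]
    have e : ∀ y, F n y = b n * (((n / X : ℝ)) ^ (-(σ + y * I)) * k y) := by
      intro y
      rw [hF]
      simp only [LSeries.term_of_ne_zero hn.ne']
      have h1 : ((n : ℂ)) ^ (σ + y * I) =
          (X) ^ (σ + y * I) * ((n / X : ℝ)) ^ (σ + y * I) := by
        have := mul_cpow_ofReal_nonneg hX0.le (by positivity : 0 ≤ (n : ℝ) / X)
          (σ + y * I)
        rw [ofReal_natCast] at this
        rw [← this]
        congr 1
        push_cast
        have : X ≠ 0 := mod_cast (by omega)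
        field_simp
      have h2 : ((X : ℂ)) ^ (σ + y * I) ≠ 0 := by
        have : X ≠ 0 := by omega
        simp [cpow_eq_zero_iff, this]
      rw [cpow_neg, h1]
      field_simp
    simp_rw [e]
    rw [MeasureTheory.integral_const_mul, riesz_inversion hσ1.le (by positivity)]
    by_cases hnX : n ≤ X
    · rw [if_pos (by simp; omega), max_eq_left]
      · push_cast; ring
      · have : (n : ℝ) / X ≤ 1 := by rw [div_le_one hX0]; exact_mod_cast hnX
        linarith
    · rw [if_neg (by simp; omega), max_eq_right]
      · simp
      · have : 1 ≤ (n : ℝ) / X := by rw [le_div_iff₀ hX0, one_mul]; exact_mod_cast (by omega)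
        linarith
  have H2 : 2 * pi * ∑ n ∈ Icc 1 X, b n * (1 - n / X) = ∫ y, ∑' n, F n y := by
    simp_rw [hval] at H
    rw [← H.tsum_eq, tsum_mul_left, tsum_eq_sum (s := Icc 1 X) (by simp +contextual)]
    congr 1
    exact Finset.sum_congr rfl fun n hn => by rw [if_pos hn]
  have H3 : ‖∫ y, ∑' n, F n y‖ ≤ D * (3 * X) * rieszConst := by
    rw [rieszConst, ← MeasureTheory.integral_const_mul]
    refine MeasureTheory.norm_integral_le_of_norm_le (integrable_rieszConst.const_mul _)
      (Filter.Eventually.of_forall fun y => ?_)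
    have e : ∑' n, F n y = LSeries b (σ + y * I) *
        (X ^ (σ + y * I) * k y) := by
      rw [hF]; simp only; rw [tsum_mul_right]; rfl
    rw [e, norm_mul, norm_mul, norm_natCast_cpow_of_pos (by omega)]
    have h1 := hb (σ + y * I) (by simpa using hσ1) (by simpa using hσ2)
    have h2 := norm_mellin_rieszKernel_le hσ1.le y
    simp only [add_im, ofReal_im, mul_im, I_im, I_re,
      ofReal_re, mul_one, mul_zero, zero_add, add_zero, add_re, mul_re,
      sub_zero, sub_self] at h1 ⊢
    calc _ ≤ D * (|y| + 4) ^ (1 / 2 : ℝ) * (3 * X * (1 + ‖y‖ ^ 2)⁻¹) := by gcongr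
      _ = _ := by ring
  have e4 : ∑ n ∈ Icc 1 X, b n * (X - n) = X * ∑ n ∈ Icc 1 X, b n * (1 - n / X) := by
    rw [Finset.mul_sum]
    refine Finset.sum_congr rfl fun n _ => ?_
    have : X ≠ 0 := mod_cast (by omega)
    field_simp
  rw [e4, norm_mul, Complex.norm_natCast]
  have H4 : ‖∑ n ∈ Icc 1 X, b n * (1 - n / X)‖ ≤ D * (3 * X) * rieszConst := by
    refine le_trans ?_ H3
    rw [← H2, norm_mul]
    refine le_mul_of_one_le_left (norm_nonneg _) ?_
    rw [norm_mul, norm_real, norm_of_nonneg Real.pi_pos.le]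
    norm_num
    linarith [pi_gt_three]
  calc X * _ ≤ X * (D * (3 * X) * rieszConst) := by gcongr
    _ = _ := by ring

/-- Every fixed multiple of a power of `log N` is eventually dominated by a fixed power of `N`. -/
lemma exists_log_pow_le (C : ℝ) (j : ℕ) {ε : ℝ} (hε : 0 < ε) :
    ∃ N0 : ℕ, ∀ N, N0 ≤ N → C * log N ^ j ≤ N ^ ε := by
  obtain ⟨N0, hN0⟩ := Filter.eventually_atTop.1 (((isLittleO_log_rpow_rpow_atTop j hε).comp_tendsto (tendsto_natCast_atTop_atTop)).def (c := (|C| + 1)⁻¹) (by positivity))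
  refine ⟨N0, fun N hN => ?_⟩
  have h2 := hN0 N hN
  simp only [Function.comp, rpow_natCast] at h2
  rw [norm_of_nonneg (r := N ^ ε) (by positivity), norm_eq_abs,
    ← div_eq_inv_mul, le_div_iff₀ (by positivity)] at h2
  calc C * log N ^ j ≤ |C * log N ^ j| := le_abs_self _
    _ = |log N ^ j| * |C| := by rw [abs_mul, mul_comm]
    _ ≤ |log N ^ j| * (|C| + 1) := by gcongr; linarith
    _ ≤ _ := h2

lemma exists_le_log (C : ℝ) : ∃ N0 : ℕ, ∀ N, N0 ≤ N → C ≤ log N := by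
  exact Filter.eventually_atTop.1 ((Real.tendsto_log_atTop.comp (tendsto_natCast_atTop_atTop)).eventually_ge_atTop C)

lemma sum_le_of_riesz {b : ℕ → ℂ} {R w : ℝ} {X h : ℕ} (hh : 1 ≤ h) (hhX : h ≤ X)
    (hR : ∀ Y, X ≤ Y → ‖∑ n ∈ Icc 1 Y, b n * (Y - n)‖ ≤ R * Y ^ 2) (hR0 : 0 ≤ R)
    (hw : ∀ n ∈ Ioc X (X + h), ‖b n‖ ≤ w) :
    ‖∑ n ∈ Icc 1 X, b n‖ ≤ 5 * R * X ^ 2 / h + h * w := by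
  have hw0 := (norm_nonneg _).trans (hw (X + 1) (by simp; omega))
  have e : h * ∑ n ∈ Icc 1 X, b n = ∑ n ∈ Icc 1 (X + h), b n * (((X + h : ℕ)) - n) -
      ∑ n ∈ Icc 1 X, b n * (X - n) - ∑ n ∈ Ioc X (X + h), b n * (((X + h : ℕ)) - n) := by
    have hsplit : Icc 1 (X + h) = Icc 1 X ∪ Ioc X (X + h) := by
      ext n; simp; omega
    rw [hsplit, Finset.sum_union (Finset.disjoint_left.2 fun n h1 h2 => by
      simp at h1 h2; omega), Finset.mul_sum, add_sub_right_comm, add_sub_cancel_right,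
      ← Finset.sum_sub_distrib]
    refine Finset.sum_congr rfl fun n _ => ?_
    push_cast; ring
  have h3 : ‖∑ n ∈ Ioc X (X + h), b n * (((X + h : ℕ)) - n)‖ ≤ h * (w * h) := by
    refine (norm_sum_le _ _).trans ?_
    calc _ ≤ ∑ n ∈ Ioc X (X + h), w * h := by
          refine Finset.sum_le_sum fun n hn => ?_
          rw [norm_mul]
          gcongr
          · exact hw n hn
          · have hn' := Finset.mem_Ioc.1 hn
            rw [← cast_sub hn'.2, Complex.norm_natCast]
            exact_mod_cast (by omega)
      _ = _ := by simp
  have h4 : h * ‖∑ n ∈ Icc 1 X, b n‖ ≤ R * (2 * X) ^ 2 + R * X ^ 2 + h * (w * h) := by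
    rw [← Complex.norm_natCast, ← norm_mul, e]
    refine (norm_sub_le _ _).trans (add_le_add ((norm_sub_le _ _).trans (add_le_add
      ((hR (X + h) (by omega)).trans ?_) (hR X le_rfl))) (by simpa using h3))
    gcongr
    have : (h : ℝ) ≤ X := mod_cast hhX
    push_cast; linarith
  have h5 : h * ‖∑ n ∈ Icc 1 X, b n‖ ≤ h * (5 * R * X ^ 2 / h + h * w) := by
    have : h * (5 * R * X ^ 2 / h + h * w) = 5 * R * X ^ 2 + h * (h * w) := by
      field_simp
    rw [this]; linarith
  exact le_of_mul_le_mul_left h5 (mod_cast hh)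

lemma norm_sum_mul_le_of_antitone (w : ℕ → ℝ) (F : ℕ → ℂ) {E : ℝ} {M y : ℕ} (hMy : M ≤ y)
    (h0 : ∀ n, M ≤ n → 0 ≤ w n) (hw : ∀ m n, M ≤ m → m ≤ n → w n ≤ w m)
    (hF : ∀ z, M ≤ z → z ≤ y → ‖∑ d ∈ Icc 1 z, F d‖ ≤ E) :
    ‖∑ d ∈ Ioc M y, (w d) * F d‖ ≤ 2 * w M * E := by
  have abel : ∀ y, M ≤ y → ∑ d ∈ Ioc M y, (w d) * F d = w y * ∑ d ∈ Icc 1 y, F d -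
      w M * ∑ d ∈ Icc 1 M, F d +
      ∑ j ∈ Ico M y, ((w j - w (j + 1) : ℝ)) * ∑ d ∈ Icc 1 j, F d := by
    intro y hy
    induction y, hy using le_induction with
    | base => simp
    | succ y hy ih =>
      rw [← Finset.insert_Ioc_right_eq_Ioc_add_one hy, Finset.sum_insert (by simp), ih,
        Finset.sum_Ico_succ_top hy, Finset.sum_Icc_succ_top (by omega)]
      push_cast; ring
  have hE := (norm_nonneg _).trans (hF M le_rfl hMy)
  rw [abel y hMy]
  have h1 : ‖∑ j ∈ Ico M y, ((w j - w (j + 1) : ℝ)) * ∑ d ∈ Icc 1 j, F d‖ ≤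
      (w M - w y) * E := by
    refine (norm_sum_le _ _).trans ?_
    have : (w M - w y) * E = ∑ j ∈ Ico M y, (w j - w (j + 1)) * E := by
      rw [← Finset.sum_mul]
      congr 1
      clear h0 hF
      induction y, hMy using le_induction with
      | base => simp
      | succ y hy ih => rw [Finset.sum_Ico_succ_top hy, ← ih]; ring
    rw [this]
    refine Finset.sum_le_sum fun j hj => ?_
    have hj := Finset.mem_Ico.1 hj
    have := hw j (j + 1) hj.1 (by omega)
    rw [norm_mul, norm_real, norm_of_nonneg (by linarith)]
    gcongr
    exact hF j hj.1 hj.2.le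
  have h2 : ‖(w y) * ∑ d ∈ Icc 1 y, F d‖ ≤ w y * E := by
    rw [norm_mul, norm_real, norm_of_nonneg (h0 y hMy)]
    exact mul_le_mul_of_nonneg_left (hF y hMy le_rfl) (h0 y hMy)
  have h3 : ‖(w M) * ∑ d ∈ Icc 1 M, F d‖ ≤ w M * E := by
    rw [norm_mul, norm_real, norm_of_nonneg (h0 M le_rfl)]
    exact mul_le_mul_of_nonneg_left (hF M le_rfl hMy) (h0 M le_rfl)
  refine (norm_add_le _ _).trans ?_
  have := norm_sub_le ((w y) * ∑ d ∈ Icc 1 y, F d) (w M * ∑ d ∈ Icc 1 M, F d)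
  linarith

lemma logMul_iterate (c : ℕ → ℂ) (k n : ℕ) :
    LSeries.logMul^[k] c n = ((log n ^ k : ℝ)) * c n := by
  induction k with
  | zero => simp
  | succ k ih =>
    rw [Function.iterate_succ_apply', LSeries.logMul, ih, ← natCast_log]
    push_cast; ring

theorem sum_le_of_iteratedDeriv_le (A B : ℕ) {D : ℝ} (hD : 0 ≤ D) : ∃ C : ℝ, 0 ≤ C ∧ ∃ N0 : ℕ,
    ∀ (c : ℕ → ℂ) (Q : ℝ), 1 ≤ Q → (∀ n : ℕ, 1 ≤ n → ‖c n‖ ≤ 1 + log n) →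
      (∀ s : ℂ, 1 < s.re → LSeriesSummable c s) →
      (∀ s : ℂ, 1 < s.re → s.re ≤ 2 → ‖iteratedDeriv (2 * A + 1 + B) (LSeries c) s‖ ≤
        D * (Q * (|s.im| + 4)) ^ (1 / 2 : ℝ)) →
      ∀ N : ℕ, N0 ≤ N → Q ≤ log N ^ B → ∀ y ≤ N,
        ‖∑ n ∈ Icc 1 y, c n‖ ≤ C * N / log N ^ A := by
  set k := 2 * A + 1 + B with hk
  obtain ⟨N1, hN1⟩ := exists_le_log 1
  obtain ⟨N2, hN2⟩ := exists_log_pow_le 1 (A + 1) (ε := 1 / 4) (by norm_num)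
  obtain ⟨N3, hN3⟩ := exists_log_pow_le 2 (A + 1) (ε := 1 / 2) (by norm_num)
  have hr := rieszConst_nonneg
  set C1 := 15 * rieszConst * D + 2 * 3 ^ (k + 1) with hC1
  have hC10 : 0 ≤ C1 := by positivity
  refine ⟨1 + 2 * 4 ^ k * C1, by positivity, max (max N1 N2) (max N3 256),
    fun c Q hQ hc hsum hder N hN hQN y hy => ?_⟩
  have hL1 := hN1 N (by omega)
  have hM4 := hN2 N (by omega)
  have hM2 := hN3 N (by omega)
  have hN0 : (0 : ℝ) < N := mod_cast (by omega)
  set L := log N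
  have hL0 : 0 < L := by linarith
  set M := Nat.sqrt N
  have hMN := sqrt_le_self N
  have hsq : √N * √N = N := mul_self_sqrt hN0.le
  have hMge : √N ≤ M + 1 := real_sqrt_le_nat_sqrt_succ
  have h16 : 16 ≤ √N := by
    rw [show 16 = √256 by rw [show (256 : ℝ) = 16 ^ 2 by norm_num]; simp]
    exact sqrt_le_sqrt (mod_cast (by omega))
  have hq4 : (N : ℝ) ^ (1 / 4 : ℝ) ≤ M := by
    have h1 : N ^ (1 / 4 : ℝ) = √√N := by
      rw [sqrt_eq_rpow, sqrt_eq_rpow, ← rpow_mul hN0.le]; norm_num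
    rw [h1]
    have h2 : √√N * √√N = √N := mul_self_sqrt (sqrt_nonneg _)
    have h3 : 4 ≤ √√N := by
      rw [le_sqrt' (by norm_num)]; norm_num; exact h16
    nlinarith
  have hM3 : 3 ≤ M := by
    have : 15 ≤ M := mod_cast (by linarith : (15 : ℝ) ≤ M)
    omega
  have hM0 : 0 < M := mod_cast (by omega)
  have hlogM : L / 4 ≤ log M := by
    have := log_le_log (by positivity) hq4
    rw [log_rpow hN0] at this
    linarith
  set b := LSeries.logMul^[k] c with hb
  have habs' : ∀ s : ℂ, 1 < s.re → LSeries.abscissaOfAbsConv c < s.re := fun s hs =>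
    (LSeries.abscissaOfAbsConv_le_of_forall_lt_LSeriesSummable' fun y hy => hsum y (by simpa using (mod_cast hy : 1 < y)) : LSeries.abscissaOfAbsConv c ≤ 1).trans_lt (mod_cast hs)
  have hbder : ∀ s, 1 < s.re → s.re ≤ 2 →
      ‖LSeries b s‖ ≤ (D * Q) * (|s.im| + 4) ^ (1 / 2 : ℝ) := by
    intro s hs hs2
    have h1 := hder s hs hs2
    rw [LSeries_iteratedDeriv k (habs' s hs), norm_mul, norm_pow, norm_neg, norm_one, one_pow,
      one_mul, mul_rpow (by linarith) (by positivity)] at h1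
    refine h1.trans ?_
    rw [mul_assoc]
    gcongr
    calc Q ^ (1 / 2) ≤ Q ^ 1 := rpow_le_rpow_of_exponent_le hQ (by norm_num)
      _ = Q := rpow_one Q
  have hB : ∀ X, M ≤ X → X ≤ N → ‖∑ n ∈ Icc 1 X, b n‖ ≤ C1 * N * L ^ (A + 1 + B) := by
    intro X hMX hXN
    have hXM : (M : ℝ) ≤ X := mod_cast hMX
    have hXN' : X ≤ N := mod_cast hXN
    set h := ⌈X / L ^ (A + 1)⌉₊
    have hhX := ceil_le.2 (div_le_self (mod_cast (by omega) : (0 : ℝ) < X).le (one_le_pow₀ hL1 : 1 ≤ L ^ (A + 1)))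
    have h1X : 1 ≤ X / L ^ (A + 1) := by
      rw [one_le_div (by positivity)]; linarith
    have hh2 : h ≤ 2 * X / L ^ (A + 1) := by
      have := ceil_lt_add_one (a := X / L ^ (A + 1)) (by positivity)
      rw [mul_div_assoc]; linarith
    have hh3 : X / L ^ (A + 1) ≤ h := le_ceil _
    have h0 := sum_le_of_riesz (one_le_ceil_iff.2 (by positivity)) hhX
      (fun Y hY => riesz_mean_le (by positivity) (fun s hs => LSeriesSummable_of_abscissaOfAbsConv_lt_re (by rw [hb, LSeries.absicssaOfAbsConv_logPowMul]; exact habs' s hs)) hbder (by omega)) (by positivity)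
      (fun n hn => by
        have hn := Finset.mem_Ioc.1 hn
        have hlog : log n ≤ 2 * L := by
          calc log n ≤ log (N * N) := by
                apply log_le_log (mod_cast (by omega))
                exact_mod_cast (by nlinarith)
            _ = 2 * L := by rw [log_mul hN0.ne' hN0.ne']; ring
        have hlog0 := log_natCast_nonneg n
        rw [hb, logMul_iterate, norm_mul, norm_real, norm_of_nonneg (by positivity)]
        calc log n ^ k * ‖c n‖ ≤ (3 * L) ^ k * (3 * L) := by
              gcongr
              · linarith
              · exact (hc n (by omega)).trans (by linarith)
          _ = _ := by rw [← pow_succ, mul_pow])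
    refine h0.trans ?_
    have h5 : 5 * (3 * rieszConst * (D * Q)) * X ^ 2 / h ≤
        15 * rieszConst * D * N * L ^ (A + 1 + B) := by
      calc 5 * (3 * rieszConst * (D * Q)) * X ^ 2 / h ≤
            5 * (3 * rieszConst * (D * L ^ B)) * X ^ 2 / (X / L ^ (A + 1)) := by gcongr
        _ = 15 * rieszConst * D * X * L ^ (A + 1 + B) := by
            rw [pow_add L (A + 1)]; field_simp; ring
        _ ≤ _ := by gcongr
    have h6 : h * (3 ^ (k + 1) * L ^ (k + 1)) ≤ 2 * 3 ^ (k + 1) * N * L ^ (A + 1 + B) := by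
      calc h * (3 ^ (k + 1) * L ^ (k + 1)) ≤
            2 * X / L ^ (A + 1) * (3 ^ (k + 1) * L ^ (k + 1)) := by gcongr
        _ = 2 * 3 ^ (k + 1) * X * L ^ (A + 1 + B) := by
            rw [show k + 1 = (A + 1) + (A + 1 + B) by omega, pow_add L (A + 1)]; field_simp
        _ ≤ _ := by gcongr
    calc _ ≤ _ := add_le_add h5 h6
      _ = _ := by rw [hC1]; ring
  have htriv : ∀ y, y ≤ M → ‖∑ n ∈ Icc 1 y, c n‖ ≤ N / L ^ A := by
    intro y hyM
    calc ‖∑ n ∈ Icc 1 y, c n‖ ≤ ∑ n ∈ Icc 1 y, 2 * L := by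
          refine (norm_sum_le _ _).trans (Finset.sum_le_sum fun n hn => ?_)
          have hn := Finset.mem_Icc.1 hn
          have := log_le_log (x := n) (y := N) (mod_cast hn.1)
            (mod_cast (by omega))
          linarith [hc n hn.1]
      _ = y * (2 * L) := by simp
      _ ≤ √N * (2 * L) := by
          gcongr
          exact le_trans (mod_cast hyM) nat_sqrt_le_real_sqrt
      _ ≤ _ := by
          rw [le_div_iff₀ (by positivity), mul_assoc, mul_assoc, ← pow_succ', ← hsq]
          rw [← sqrt_eq_rpow] at hM2
          gcongr
          exact hsq.le
  have hLA : 0 < L ^ A := by positivity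
  rcases le_or_gt y M with hyM | hyM
  · refine (htriv y hyM).trans ?_
    gcongr
    have : 0 ≤ 2 * 4 ^ k * C1 * N := by positivity
    linarith
  · rw [(by ext n; simp; omega : Icc 1 y = Icc 1 M ∪ Ioc M y), Finset.sum_union (Finset.disjoint_left.2 fun n h1 h2 => by
      simp at h1 h2; omega)]
    have hlogp : ∀ n, M ≤ n → 0 < log n := fun n hn =>
      log_pos (mod_cast (by omega))
    have h1 := norm_sum_mul_le_of_antitone (fun n => (log n ^ k)⁻¹) b hyM.le (fun n hn => by have := hlogp n hn; positivity)
      (fun m n hm hmn => by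
        have := hlogp m hm
        have hm0 : 0 < m := by omega
        gcongr)
      (fun z hz hzy => hB z hz (by omega))
    have e : ∑ d ∈ Ioc M y, (((log d ^ k)⁻¹)) * b d = ∑ d ∈ Ioc M y, c d := by
      refine Finset.sum_congr rfl fun n hn => ?_
      rw [hb, logMul_iterate, ← mul_assoc, ← ofReal_mul, inv_mul_cancel₀]
      · simp
      · exact (pow_pos (hlogp n (Finset.mem_Ioc.1 hn).1.le) k).ne'
    rw [e] at h1
    have h2 : 2 * (log M ^ k)⁻¹ * (C1 * N * L ^ (A + 1 + B)) ≤
        2 * 4 ^ k * C1 * N / L ^ A := by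
      calc _ ≤ 2 * ((L / 4) ^ k)⁻¹ * (C1 * N * L ^ (A + 1 + B)) := by gcongr
        _ = _ := by
          rw [div_pow, show k = A + (A + 1 + B) by omega, pow_add L A]
          field_simp
    refine (norm_add_le _ _).trans ?_
    calc _ ≤ N / L ^ A + 2 * 4 ^ k * C1 * N / L ^ A := add_le_add (htriv M le_rfl) (h1.trans h2)
      _ = _ := by ring

theorem siegel_walfisz (A B : ℕ) : ∃ C, 0 ≤ C ∧ ∃ N0 : ℕ, ∀ N, N0 ≤ N →
    ∀ (q : ℕ) [NeZero q] (χ : DirichletCharacter ℂ q), χ.IsPrimitive → χ ≠ 1 →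
      q ≤ log N ^ B → ∀ y ≤ N,
        ‖∑ n ∈ Icc 1 y, χ n * (Λ n)‖ ≤ C * N / log N ^ A := by
  obtain ⟨D, hD, h⟩ := norm_iteratedDeriv_chi_le (2 * A + 1 + B)
  obtain ⟨C, hC, N0, hN⟩ := sum_le_of_iteratedDeriv_le A B hD
  refine ⟨C, hC, N0, fun N hN0 q _ χ hp hχ hq y hy => hN _ q ?_ (fun n hn => ?_) (fun s hs => ?_)
    (h q χ hp hχ) N hN0 hq y hy⟩
  · exact_mod_cast one_le_iff_ne_zero.2 (NeZero.ne q)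
  · rw [norm_mul, norm_real, norm_of_nonneg vonMangoldt_nonneg]
    have h1 := χ.norm_le_one n
    have h2 : Λ n ≤ log n := vonMangoldt_le_log
    have h3 : 0 ≤ Λ n := vonMangoldt_nonneg
    nlinarith
  · exact LSeriesSummable_twist_vonMangoldt χ hs

theorem prime_number_theorem (A : ℕ) : ∃ C, 0 ≤ C ∧ ∃ N0, ∀ N, N0 ≤ N → ∀ y ≤ N,
    |∑ n ∈ Icc 1 y, Λ n - y| ≤ C * N / log N ^ A := by
  obtain ⟨D, hD, h⟩ := norm_iteratedDeriv_one_le (2 * A + 1 + 0)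
  obtain ⟨C, hC, N0, hN⟩ := sum_le_of_iteratedDeriv_le A 0 hD
  refine ⟨C, hC, N0, fun N hN0 y hy => ?_⟩
  have := hN (fun n => (Λ n) - 1) 1 le_rfl (fun n hn => ?_)
    (fun s hs => ?_) (by simpa using h) N hN0 (by simp) y hy
  · rw [Finset.sum_sub_distrib, ← ofReal_sum] at this
    simp only [Finset.sum_const, card_Icc, Nat.add_sub_cancel, nsmul_eq_mul, mul_one] at this
    rw [← ofReal_natCast, ← ofReal_sub, norm_real] at this
    exact this
  · have h2 : Λ n ≤ log n := vonMangoldt_le_log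
    have := norm_sub_le ((Λ n : ℂ)) 1
    rw [norm_real, norm_of_nonneg vonMangoldt_nonneg, norm_one] at this
    linarith
  · exact (LSeriesSummable_vonMangoldt hs).sub (LSeriesSummable_one_iff.2 hs)

lemma parseval_of_orthogonal {ι κ : Type*} (s : Finset ι) (t : Finset κ) (K : ι → κ → ℂ)
    (f : κ → ℂ) {C : ℝ}
    (h : ∀ x ∈ t, ∀ y ∈ t, ∑ a ∈ s, K a x * conj (K a y) = if x = y then (C : ℂ) else 0) :
    ∑ a ∈ s, ‖∑ x ∈ t, f x * K a x‖ ^ 2 = C * ∑ x ∈ t, ‖f x‖ ^ 2 := by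
  have : ((∑ a ∈ s, ‖∑ x ∈ t, f x * K a x‖ ^ 2 : ℝ) : ℂ) =
      ((C * ∑ x ∈ t, ‖f x‖ ^ 2 : ℝ)) := by
    rw [ofReal_mul, ofReal_sum, ofReal_sum]
    simp_rw [(fun z => by rw [mul_conj, normSq_eq_norm_sq] : ∀ z : ℂ, ((‖z‖ ^ 2 : ℝ)) = z * conj z), map_sum, sum_mul_sum]
    rw [sum_comm, mul_sum]
    refine sum_congr rfl fun x hx => ?_
    rw [sum_comm]
    calc ∑ y ∈ t, ∑ a ∈ s, f x * K a x * conj (f y * K a y)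
        = ∑ y ∈ t, f x * conj (f y) * (if x = y then (C : ℂ) else 0) := by
          refine sum_congr rfl fun y hy => ?_
          rw [← h x hx y hy, mul_sum]
          refine sum_congr rfl fun a _ => ?_
          rw [map_mul]; ring
      _ = _ := by
          simp only [mul_ite, mul_zero, sum_ite_eq, hx, if_true]
          ring
  exact_mod_cast this

lemma stdAddChar_eq_ee (q : ℕ) [NeZero q] (j : ℤ) :
    (ZMod.stdAddChar (j : ZMod q)) = ee (j / q) := by
  rw [ZMod.stdAddChar_coe, ee]
  congr 1
  push_cast
  ring

lemma sum_stdAddChar_mul_conj (q : ℕ) [NeZero q] (x y : ZMod q) :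
    ∑ a : ZMod q, (ZMod.stdAddChar (a * x)) * conj (ZMod.stdAddChar (a * y)) =
      if x = y then (q : ℂ) else 0 := by
  have h := AddChar.sum_mulShift (x - y) (ZMod.isPrimitive_stdAddChar q)
  rw [ZMod.card] at h
  simp only [sub_eq_zero] at h
  push_cast at h
  rw [← h]
  refine sum_congr rfl fun a _ => ?_
  rw [mul_sub, sub_eq_add_neg, AddChar.map_add_eq_mul, AddChar.map_neg_eq_conj]

lemma zmod_parseval (q : ℕ) [NeZero q] (f : ZMod q → ℂ) :
    ∑ a : ZMod q, ‖∑ x, f x * (ZMod.stdAddChar (a * x))‖ ^ 2 = q * ∑ x, ‖f x‖ ^ 2 := by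
  refine parseval_of_orthogonal univ univ (fun a x => (ZMod.stdAddChar (a * x))) f ?_
  intro x _ y _
  rw [sum_stdAddChar_mul_conj]
  norm_num

lemma sum_norm_sq_dirichletCharacter {q : ℕ} [NeZero q] (χ : DirichletCharacter ℂ q) :
    ∑ x : ZMod q, ‖χ x‖ ^ 2 = q.totient := by
  have : ∀ x, ‖χ x‖ ^ 2 = if IsUnit x then 1 else 0 := by
    intro x
    split_ifs with h
    · obtain ⟨u, rfl⟩ := h
      rw [unit_norm_eq_one]; norm_num
    · rw [MulChar.map_nonunit _ h]; norm_num
  rw [sum_congr rfl fun x _ => this x, ← sum_filter, sum_const, nsmul_eq_mul, mul_one,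
    ← ZMod.card_units_eq_totient]
  norm_cast
  rw [← Fintype.card_subtype]
  symm
  exact Fintype.card_congr (Equiv.ofBijective (fun u => ⟨u, u.isUnit⟩)
    ⟨fun u v h => Units.ext (congrArg Subtype.val h), fun x => ⟨x.2.unit, rfl⟩⟩)

lemma norm_sq_gaussSum {q : ℕ} [NeZero q] {χ : DirichletCharacter ℂ q} (hχ : χ.IsPrimitive) :
    ‖gaussSum χ (ZMod.stdAddChar)‖ ^ 2 = q := by
  have h := zmod_parseval q (fun x => χ x)
  have e : ∀ a, ∑ x, χ x * (ZMod.stdAddChar (a * x)) =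
      χ⁻¹ a * gaussSum χ (ZMod.stdAddChar) := by
    intro a
    rw [← gaussSum_mulShift_of_isPrimitive (e := ZMod.stdAddChar) hχ a]
    rfl
  simp_rw [e, norm_mul, mul_pow, ← sum_mul] at h
  rw [sum_norm_sq_dirichletCharacter, sum_norm_sq_dirichletCharacter, mul_comm] at h
  exact mul_right_cancel₀ (mod_cast (totient_pos.2 (NeZero.pos q)).ne') h

/-- Large sieve over the Farey fractions. -/
lemma large_sieve_farey (P N : ℕ) (a : ℕ → ℂ) :
    ∑ q ∈ Icc 1 P, ∑ b ∈ range q with q.Coprime b,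
      ‖∑ n ∈ Icc 1 N, a n * ee (n * (b / q))‖ ^ 2 ≤
      288 * (N + P ^ 2) * ∑ n ∈ Icc 1 N, ‖a n‖ ^ 2 := by
  rcases Nat.eq_zero_or_pos P with rfl | hP
  · simp; positivity
  have h := large_sieve_additive_nat ((Icc 1 P).sigma fun q => {b ∈ range q | q.Coprime b})
    (fun r => r.2 / r.1) (δ := 1 / P ^ 2) (by positivity) ?_ N a
  · rw [sum_sigma, one_div_one_div] at h
    exact h
  rintro ⟨q, b⟩ hr ⟨q', b'⟩ hs hne m
  simp only [mem_sigma, mem_Icc, mem_filter, mem_range] at hr hs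
  obtain ⟨⟨h1, h2⟩, h3, h4⟩ := hr
  obtain ⟨⟨h1', h2'⟩, h3', h4'⟩ := hs
  have hq' : (0 : ℝ) < q' := mod_cast h1'
  set t : ℤ := b * q' - b' * q - m * (q * q') with ht
  have htne : t ≠ 0 := by
    intro h0
    rw [ht] at h0
    have d1 : q ∣ q' := by
      have : (q : ℤ) ∣ b * q' := ⟨b' + m * q', by linarith⟩
      exact h4.dvd_of_dvd_mul_left (mod_cast this)
    have d2 : q' ∣ q := by
      have : (q' : ℤ) ∣ b' * q := ⟨b - m * q, by linarith⟩
      exact h4'.dvd_of_dvd_mul_left (mod_cast this)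
    have hqq := Nat.dvd_antisymm d1 d2
    subst hqq
    have h5 : b - b' - m * q = 0 := by
      rcases mul_eq_zero.1 (by linarith : q * (b - b' - m * q) = 0) with h | h
      · omega
      · exact h
    have h6 : m = 0 := by
      by_contra hm
      rcases lt_or_gt_of_ne hm with hm | hm
      · nlinarith [show m ≤ -1 by omega, show b' < q by exact_mod_cast h3']
      · nlinarith [show 1 ≤ m by omega, show b < q by exact_mod_cast h3]
    subst h6
    exact hne (by rw [(by omega : b = b')])
  have e : (b : ℝ) / q - b' / q' - m = t / (q * q') := by
    rw [ht]; push_cast; field_simp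
  simp only
  rw [e, abs_div, abs_of_pos (mul_pos (mod_cast h1) hq')]
  have h8 : (q : ℝ) * q' ≤ P ^ 2 := by
    rw [pow_two]
    exact mul_le_mul (mod_cast h2) (mod_cast h2') hq'.le (mod_cast hP : (0 : ℝ) < P).le
  exact div_le_div₀ (by positivity) (mod_cast Int.one_le_abs htne) (by positivity) h8

lemma sum_coprime_range_zmod {E : Type*} [AddCommMonoid E] (q : ℕ) [NeZero q] (f : ZMod q → E) :
    ∑ b ∈ range q with q.Coprime b, f b = ∑ a : ZMod q with IsUnit a, f a := by
  rw [sum_filter, sum_filter, ← sum_range_zmod q (fun a => if IsUnit a then f a else 0)]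
  refine sum_congr rfl fun b _ => ?_
  simp only [ZMod.isUnit_iff_coprime, coprime_comm]

/-- Character sums at one modulus are controlled by exponential sums. -/
lemma sum_primitive_norm_sq_le {q : ℕ} [NeZero q] (N : ℕ) (a : ℕ → ℂ) :
    q / φ q * ∑ χ : DirichletCharacter ℂ q with χ.IsPrimitive,
      ‖∑ n ∈ Icc 1 N, a n * χ n‖ ^ 2 ≤
      ∑ b ∈ range q with q.Coprime b, ‖∑ n ∈ Icc 1 N, a n * ee (n * (b / q))‖ ^ 2 := by
  set S : ZMod q → ℂ := fun b => ∑ n ∈ Icc 1 N, a n * (ZMod.stdAddChar (b * (n : ZMod q)))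
    with hS
  have hR : ∑ b ∈ range q with q.Coprime b, ‖∑ n ∈ Icc 1 N, a n * ee (n * (b / q))‖ ^ 2 =
      ∑ b : ZMod q with IsUnit b, ‖S b‖ ^ 2 := by
    rw [← sum_coprime_range_zmod q (fun b => ‖S b‖ ^ 2)]
    refine sum_congr rfl fun b _ => ?_
    rw [hS]
    congr 2
    refine sum_congr rfl fun n _ => ?_
    have := stdAddChar_eq_ee q (b * n)
    push_cast at this
    rw [this]
    congr 2
    ring
  have h1 : ∀ χ : DirichletCharacter ℂ q, χ.IsPrimitive →
      q * ‖∑ n ∈ Icc 1 N, a n * χ n‖ ^ 2 = ‖∑ b : ZMod q with IsUnit b, S b * χ⁻¹ b‖ ^ 2 := by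
    intro χ hχ
    have hχ' : (χ⁻¹).IsPrimitive := by
      rw [isPrimitive_def] at hχ ⊢
      rw [conductor_inv, hχ]
    have h2 : ∀ n, χ n * gaussSum χ⁻¹ (ZMod.stdAddChar) =
        ∑ b : ZMod q, χ⁻¹ b * (ZMod.stdAddChar (b * (n : ZMod q))) := by
      intro n
      have := gaussSum_mulShift_of_isPrimitive
        (e := ZMod.stdAddChar) hχ' n
      rw [inv_inv] at this
      rw [← this]
      refine sum_congr rfl fun b _ => ?_
      rw [AddChar.mulShift_apply, mul_comm (n : ZMod q)]
    have h3 : (∑ n ∈ Icc 1 N, a n * χ n) * gaussSum χ⁻¹ (ZMod.stdAddChar) =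
        ∑ b : ZMod q with IsUnit b, S b * χ⁻¹ b := by
      calc _ = ∑ n ∈ Icc 1 N, ∑ b : ZMod q, a n * (ZMod.stdAddChar (b * (n : ZMod q))) *
            χ⁻¹ b := by
            rw [sum_mul]
            refine sum_congr rfl fun n _ => ?_
            rw [mul_assoc, h2, mul_sum]
            refine sum_congr rfl fun b _ => ?_
            ring
        _ = ∑ b : ZMod q, S b * χ⁻¹ b := by
            rw [sum_comm]
            refine sum_congr rfl fun b _ => ?_
            rw [hS, sum_mul]
        _ = _ := by
            rw [sum_filter]
            refine sum_congr rfl fun b _ => ?_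
            split_ifs with hb
            · rfl
            · rw [MulChar.map_nonunit _ hb, mul_zero]
    rw [← h3, norm_mul, mul_pow, norm_sq_gaussSum hχ', mul_comm]
  have h4 : ∑ χ : DirichletCharacter ℂ q, ‖∑ b : ZMod q with IsUnit b, S b * χ⁻¹ b‖ ^ 2 =
      q.totient * ∑ b : ZMod q with IsUnit b, ‖S b‖ ^ 2 := by
    refine parseval_of_orthogonal univ _ (fun (χ : DirichletCharacter ℂ q) b => χ⁻¹ b) S ?_
    intro x hx y hy
    rw [mem_filter] at hx hy
    have := sum_char_inv_mul_char_eq ℂ hx.2 y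
    push_cast
    rw [← this]
    refine sum_congr rfl fun χ _ => ?_
    obtain ⟨u, rfl⟩ := hx.2
    congr 1
    · simp [MulChar.inv_apply]
    · change star (χ⁻¹ y) = χ y
      rw [MulChar.star_apply', inv_inv]
  rw [hR, div_mul_eq_mul_div, div_le_iff₀ (mod_cast totient_pos.2 (NeZero.pos q)), mul_comm _ (φ q : ℝ), ← h4, mul_sum,
    sum_congr rfl fun χ hχ => h1 χ (mem_filter.1 hχ).2]
  exact sum_le_sum_of_subset_of_nonneg (filter_subset _ _) fun _ _ _ => by positivity

/-- The multiplicative large sieve. -/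
lemma large_sieve_primitive (P N : ℕ) (a : ℕ → ℂ) :
    ∑ q ∈ Icc 1 P, q / φ q * ∑ χ : DirichletCharacter ℂ q with χ.IsPrimitive,
      ‖∑ n ∈ Icc 1 N, a n * χ n‖ ^ 2 ≤
      288 * (N + P ^ 2) * ∑ n ∈ Icc 1 N, ‖a n‖ ^ 2 := by
  refine le_trans (sum_le_sum fun q hq => ?_) (large_sieve_farey P N a)
  haveI : NeZero q := ⟨by rw [mem_Icc] at hq; omega⟩
  exact sum_primitive_norm_sq_le N a

lemma norm_sum_dirichletCharacter_le {q : ℕ} [NeZero q] {χ : DirichletCharacter ℂ q} (hχ : χ ≠ 1)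
    (y : ℕ) : ‖∑ n ∈ Icc 1 y, χ n‖ ≤ q := by
  have h0 : χ ((0 : ℕ)) = 0 := by
    rw [cast_zero]
    refine MulChar.map_nonunit _ ?_
    rw [isUnit_zero_iff]
    intro h
    apply hχ
    have := subsingleton_of_zero_eq_one h
    ext u
    rw [Subsingleton.elim u 1]; simp
  have hr : ∀ y, ‖∑ n ∈ range y, χ n‖ ≤ q := by
    intro y
    induction y using Nat.strong_induction_on with
    | _ y ih =>
      rcases lt_or_ge y q with h | h
      · refine (norm_sum_le _ _).trans ((sum_le_sum (f := fun n : ℕ => ‖χ n‖) fun n _ => χ.norm_le_one n).trans ?_)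
        simp
        exact_mod_cast h.le
      · obtain ⟨z, rfl⟩ := Nat.exists_eq_add_of_le' h
        rw [sum_range_add]
        have : ∑ n ∈ range q, χ ((z + n : ℕ)) = 0 := by
          have e := sum_range_zmod q (fun a => χ (z + a))
          rw [Fintype.sum_equiv (Equiv.addLeft (z : ZMod q)) (fun a => χ (z + a)) (fun a => χ a) (fun a => rfl), MulChar.sum_eq_zero_of_ne_one hχ] at e
          rw [← e]
          push_cast; rfl
        rw [this, add_zero]
        exact ih z (by have := NeZero.pos q; omega)
  have := hr (y + 1)
  rw [range_eq_Ico, sum_eq_sum_Ico_succ_bot (by omega), h0, zero_add] at this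
  exact this

/-- Mean value of twisted prime sums over primitive characters. -/
lemma sum_primitive_vonMangoldt_le {x P W : ℕ} (hx : 1 ≤ x) (hW : 1 ≤ W) :
    ∑ q ∈ Ioc 1 P, q / φ q * ∑ χ : DirichletCharacter ℂ q with χ.IsPrimitive,
      ‖∑ n ∈ Icc 1 x, χ n * (Λ n)‖ ≤
      P ^ 2 * (W * log x + 3 * (W * W) * log x * P) +
      4 * 288 * (1 + log x) ^ 5 * (2 * x + 4 * (P * x / √W) + √x * P ^ 2) := by
  have hlog := log_natCast_nonneg x
  have hW0 : (0 : ℝ) < W := mod_cast hW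
  have hx0 : (0 : ℝ) < x := mod_cast hx
  set Q : Finset (Σ q, DirichletCharacter ℂ q) :=
    (Ioc 1 P).sigma fun q => {χ | χ.IsPrimitive} with hQ
  set w : (Σ q, DirichletCharacter ℂ q) → ℝ := fun r => r.1 / r.1.totient with hw
  have hw0 : ∀ r, 0 ≤ w r := fun r => by positivity
  have hLS : ∀ (N : ℕ) (a : ℕ → ℂ), ∑ r ∈ Q, w r * ‖∑ n ∈ Icc 1 N, a n * r.2 n‖ ^ 2 ≤
      288 * (N + P ^ 2) * ∑ n ∈ Icc 1 N, ‖a n‖ ^ 2 := by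
    intro N a
    refine le_trans ?_ (large_sieve_primitive P N a)
    rw [hQ, sum_sigma]
    simp only [hw, ← mul_sum]
    refine sum_le_sum_of_subset_of_nonneg ?_ fun _ _ _ => by positivity
    intro q hq; rw [mem_Ioc] at hq; rw [mem_Icc]; omega
  have e0 : ∑ q ∈ Ioc 1 P, q / φ q * ∑ χ : DirichletCharacter ℂ q with χ.IsPrimitive,
      ‖∑ n ∈ Icc 1 x, χ n * (Λ n)‖ =
      ∑ r ∈ Q, w r * ‖∑ n ∈ Icc 1 x, (Λ n) * r.2 n‖ := by
    rw [hQ, sum_sigma]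
    simp only [hw, ← mul_sum]
    simp_rw [mul_comm]
  set D : ℝ := 288 * (2 * √x + 4 * P * √(x / W) + P ^ 2) with hD
  have hbil := vaughan_bilinear Q w (fun r _ => hw0 r) (fun r n => r.2 n) (U := W) (V := W) hx
    (D := D) (by positivity) ?_
  · have hI : ∀ r ∈ Q, ‖∑ n ∈ Icc 1 x, (Λ n) * r.2 n‖ ≤
        (W * log x + 3 * (W * W) * log x * P) +
        ‖∑ c ∈ Icc 1 x, ∑ m ∈ Icc 1 (x / c), (LamHi W c) * (vaughanA W m) *
          r.2 (c * m : ℕ)‖ := by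
      rintro ⟨q, χ⟩ hr
      rw [hQ, mem_sigma, mem_Ioc, mem_filter] at hr
      simp only at hr
      haveI : NeZero q := ⟨by omega⟩
      have hχ : χ ≠ 1 := by
        rintro rfl
        have := hr.2.2
        rw [isPrimitive_def, conductor_one] at this
        omega
      refine vaughan_bound (fun n => χ n) (fun n => χ.norm_le_one n) ?_ hW hW
      intro b _ _ y _
      push_cast
      simp_rw [map_mul]
      rw [← mul_sum, norm_mul]
      calc _ ≤ 1 * (q : ℝ) := by
            gcongr
            · exact χ.norm_le_one b
            · exact norm_sum_dirichletCharacter_le hχ y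
        _ ≤ P := by rw [one_mul]; exact_mod_cast hr.1.2
    have hcount : ∑ r ∈ Q, w r ≤ P ^ 2 := by
      rw [hQ, sum_sigma]
      calc _ ≤ ∑ q ∈ Ioc 1 P, (P : ℝ) := by
            refine sum_le_sum fun q hq => ?_
            rw [mem_Ioc] at hq
            haveI : NeZero q := ⟨by omega⟩
            have hφ : 0 < q.totient := mod_cast totient_pos.2 (by omega)
            simp only [hw, sum_const, nsmul_eq_mul]
            have : (#{χ : DirichletCharacter ℂ q | χ.IsPrimitive}) ≤ q.totient := by
              rw [← card_eq_totient_of_hasEnoughRootsOfUnity ℂ q]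
              rw [card_eq_fintype_card]
              exact_mod_cast card_filter_le _ _
            calc _ ≤ (φ q : ℝ) * (q / φ q) := by gcongr
              _ = q := by field_simp
              _ ≤ P := mod_cast hq.2
        _ ≤ _ := by
            rw [sum_const, card_Ioc, nsmul_eq_mul, pow_two]
            gcongr
            omega
    rw [e0]
    have hJ := log_two_le_two_mul_log x
    calc _ ≤ ∑ r ∈ Q, w r * ((W * log x + 3 * (W * W) * log x * P) +
        ‖∑ c ∈ Icc 1 x, ∑ m ∈ Icc 1 (x / c), (LamHi W c) * (vaughanA W m) *
          r.2 (c * m : ℕ)‖) :=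
          sum_le_sum fun r hr => mul_le_mul_of_nonneg_left (hI r hr) (hw0 r)
      _ = (∑ r ∈ Q, w r) * (W * log x + 3 * (W * W) * log x * P) +
        ∑ r ∈ Q, w r * ‖∑ c ∈ Icc 1 x, ∑ m ∈ Icc 1 (x / c), (LamHi W c) *
          (vaughanA W m) * r.2 (c * m : ℕ)‖ := by
          rw [sum_mul, ← sum_add_distrib]; simp_rw [← mul_add]
      _ ≤ P ^ 2 * (W * log x + 3 * (W * W) * log x * P) +
        (2 * (1 + log x)) ^ 2 * (D * (√x * (1 + log x) ^ 3)) := by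
          refine add_le_add (by gcongr) (hbil.trans ?_)
          gcongr
      _ = _ := by
          have h1 : √x * √x = x := mul_self_sqrt hx0.le
          have h2 : √(x / W) = √x / √W := sqrt_div hx0.le _
          rw [hD, h2]
          have h3 : (2 * √x + 4 * P * (√x / √W) + P ^ 2) * √x =
            2 * x + 4 * (P * x / √W) + √x * P ^ 2 := by
            calc _ = 2 * (√x * √x) + 4 * (P * (√x * √x) / √W) + √x * P ^ 2 := by ring
              _ = _ := by rw [h1]
          rw [← h3]; ring
  · intro M hM hWM hMx u v
    have e1 : ∀ r : (Σ q, DirichletCharacter ℂ q),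
        ‖∑ c ∈ Ico M (2 * M), ∑ m ∈ Icc 1 (x / M), u c * v m * r.2 ((c * m : ℕ))‖ =
        ‖∑ c ∈ Icc 1 (2 * M), (if c ∈ Ico M (2 * M) then u c else 0) * r.2 c‖ *
          ‖∑ m ∈ Icc 1 (x / M), v m * r.2 m‖ := by
      intro r
      rw [← norm_mul]
      congr 1
      have : ∑ c ∈ Icc 1 (2 * M), (if c ∈ Ico M (2 * M) then u c else 0) * r.2 c =
          ∑ c ∈ Ico M (2 * M), u c * r.2 c := by
        simp_rw [ite_mul, zero_mul]
        rw [← sum_filter]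
        congr 1
        ext c; simp only [mem_filter, mem_Icc, mem_Ico]; omega
      rw [this, sum_mul_sum]
      refine sum_congr rfl fun c _ => sum_congr rfl fun m _ => ?_
      push_cast; rw [map_mul]; ring
    have hu : ∑ c ∈ Icc 1 (2 * M), ‖(if c ∈ Ico M (2 * M) then u c else 0)‖ ^ 2 =
        ∑ c ∈ Ico M (2 * M), ‖u c‖ ^ 2 := by
      simp_rw [(by intro c; split_ifs <;> simp : ∀ c, ‖(if c ∈ Ico M (2 * M) then u c else 0)‖ ^ 2 = if c ∈ Ico M (2 * M) then ‖u c‖ ^ 2 else 0)]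
      rw [← sum_filter]
      congr 1
      ext c; simp only [mem_filter, mem_Icc, mem_Ico]; omega
    simp_rw [e1]
    set X := fun r : (Σ q, DirichletCharacter ℂ q) =>
      ‖∑ c ∈ Icc 1 (2 * M), (if c ∈ Ico M (2 * M) then u c else 0) * r.2 c‖
    set Y := fun r : (Σ q, DirichletCharacter ℂ q) =>
      ‖∑ m ∈ Icc 1 (x / M), v m * r.2 m‖
    have hxM : ((x / M : ℕ) : ℝ) ≤ x / M := cast_div_le
    have hDsq : 288 * ((2 * M : ℕ) + P ^ 2) * (288 * ((x / M : ℕ) + P ^ 2)) ≤ D ^ 2 := by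
      have h1 : (M : ℝ) ≤ x / W := by rw [le_div_iff₀ hW0]; exact_mod_cast hMx
      have h2 : (x : ℝ) / M ≤ 2 * (x / W) := by
        rw [div_le_iff₀ (mod_cast hM), mul_comm, ← mul_assoc]
        have : (W : ℝ) ≤ 2 * M := mod_cast hWM.le
        rw [← mul_div_assoc, le_div_iff₀ hW0]
        nlinarith
      set y := (x : ℝ) / M
      have hy : 0 < y := by positivity
      set t := √(x / W)
      set s := √x
      have ht0 : 0 ≤ t := sqrt_nonneg _
      have hs0 : 0 ≤ s := sqrt_nonneg _
      rw [((sq_sqrt (by positivity)).symm : x / W = t ^ 2)] at h1 h2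
      have hP0 : 0 ≤ P := cast_nonneg P
      calc 288 * ((2 * M : ℕ) + P ^ 2) * (288 * ((x / M : ℕ) + P ^ 2))
          ≤ 288 * (2 * M + P ^ 2) * (288 * (y + P ^ 2)) := by
            push_cast; gcongr
        _ = 288 ^ 2 * (2 * (M * y) + 2 * M * P ^ 2 + P ^ 2 * y + P ^ 4) := by ring
        _ ≤ 288 ^ 2 * (2 * s ^ 2 + 2 * t ^ 2 * P ^ 2 + P ^ 2 * (2 * t ^ 2) + P ^ 4) := by
            rw [(by field_simp : (M : ℝ) * (x / M) = x), ← (sq_sqrt (by positivity)).symm]; gcongr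
        _ ≤ D ^ 2 := by
            rw [hD, mul_pow]
            gcongr
            linear_combination (by positivity : 0 ≤ 2 * s ^ 2 + 12 * t ^ 2 * P ^ 2 + 16 * s * (P * t) + 4 * s * P ^ 2 + 8 * P ^ 3 * t)
    calc ∑ r ∈ Q, w r * (X r * Y r)
        = ∑ r ∈ Q, (√(w r) * X r) * (√(w r) * Y r) := by
          refine sum_congr rfl fun r _ => ?_
          rw [mul_mul_mul_comm, mul_self_sqrt (hw0 r)]
      _ ≤ √(∑ r ∈ Q, (√(w r) * X r) ^ 2) * √(∑ r ∈ Q, (√(w r) * Y r) ^ 2) :=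
          sum_mul_le_sqrt_mul_sqrt _ _ _
      _ ≤ √(288 * ((2 * M : ℕ) + P ^ 2) * ∑ c ∈ Ico M (2 * M), ‖u c‖ ^ 2) *
          √(288 * ((x / M : ℕ) + P ^ 2) * ∑ m ∈ Icc 1 (x / M), ‖v m‖ ^ 2) := by
          simp_rw [mul_pow, sq_sqrt (hw0 _)]
          rw [← hu]
          exact mul_le_mul (sqrt_le_sqrt (hLS _ _)) (sqrt_le_sqrt (hLS _ _))
            (sqrt_nonneg _) (sqrt_nonneg _)
      _ = √(288 * ((2 * M : ℕ) + P ^ 2) * (288 * ((x / M : ℕ) + P ^ 2))) *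
          (√(∑ c ∈ Ico M (2 * M), ‖u c‖ ^ 2) * √(∑ m ∈ Icc 1 (x / M), ‖v m‖ ^ 2)) := by
          rw [sqrt_mul (x := 288 * ((2 * M : ℕ) + P ^ 2)) (by positivity),
            sqrt_mul (x := 288 * ((x / M : ℕ) + P ^ 2)) (by positivity),
            sqrt_mul (x := 288 * ((2 * M : ℕ) + P ^ 2)) (by positivity)]
          ring
      _ ≤ _ := by
          gcongr
          rw [← sqrt_sq (show 0 ≤ D by positivity)]
          exact sqrt_le_sqrt hDsq

/-- The logarithm supported on the primes. -/
def logPrime (n : ℕ) : ℝ := if n.Prime then log n else 0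

lemma logPrime_nonneg (n : ℕ) : 0 ≤ logPrime n := by
  rw [logPrime]; split_ifs
  · exact log_natCast_nonneg n
  · rfl

lemma logPrime_le_log (n : ℕ) : logPrime n ≤ log n := by
  rw [logPrime]; split_ifs
  · rfl
  · exact log_natCast_nonneg n

lemma logPrime_le_vonMangoldt (n : ℕ) : logPrime n ≤ Λ n := by
  rw [logPrime]; split_ifs with h
  · rw [vonMangoldt_apply_prime h]
  · exact vonMangoldt_nonneg

lemma sum_logPrime_not_coprime_le {m : ℕ} (hm : m ≠ 0) (s : Finset ℕ) :
    ∑ n ∈ s with ¬ n.Coprime m, logPrime n ≤ log m := by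
  calc ∑ n ∈ s with ¬ n.Coprime m, logPrime n
      = ∑ n ∈ (s.filter fun n => ¬ n.Coprime m).filter Nat.Prime, log n := by
        rw [sum_filter (p := Nat.Prime)]; rfl
    _ ≤ ∑ p ∈ m.primeFactors, log p := by
        refine sum_le_sum_of_subset_of_nonneg ?_ fun p _ _ => log_natCast_nonneg p
        intro p hp
        rw [mem_filter, mem_filter] at hp
        rw [mem_primeFactors]
        refine ⟨hp.2, ?_, hm⟩
        by_contra h
        exact hp.1.2 ((Nat.Prime.coprime_iff_not_dvd hp.2).2 h)
    _ = log (∏ p ∈ m.primeFactors, p : ℕ) := by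
        push_cast
        rw [log_prod fun p hp => by exact_mod_cast (prime_of_mem_primeFactors hp).ne_zero]
    _ ≤ log m := by
        refine log_le_log ?_ (mod_cast (le_of_dvd (Nat.pos_of_ne_zero hm) (prod_primeFactors_dvd m)))
        exact_mod_cast prod_pos fun p hp => (prime_of_mem_primeFactors hp).pos

lemma sum_vonMangoldt_sub_logPrime_le (x : ℕ) :
    ∑ n ∈ Icc 1 x, (Λ n - logPrime n) ≤ 2 * √x * log x := by
  rcases Nat.eq_zero_or_pos x with rfl | hx
  · simp
  refine le_trans (le_of_eq ?_) ((le_abs_self _).trans (Chebyshev.abs_psi_sub_theta_le_sqrt_mul_log (x := x) (mod_cast hx)))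
  rw [sum_sub_distrib, Chebyshev.psi, Chebyshev.theta, floor_natCast, sum_filter]
  rfl

lemma dvd_sub_iff_zmod_eq (m : ℕ) (n : ℕ) (l : ℤ) :
    (m : ℤ) ∣ n - l ↔ (l : ZMod m) = n := by
  rw [← ZMod.intCast_eq_intCast_iff_dvd_sub]; simp

/-- Primes in a residue class in terms of character sums. -/
lemma abs_sum_logPrime_sub_le {m : ℕ} [NeZero m] (l : ℤ) (x : ℕ) :
    |∑ n ∈ Icc 1 x with (m : ℤ) ∣ (n : ℕ) - l, logPrime n -
        (if Int.gcd m l = 1 then (x : ℝ) / φ m else 0)| ≤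
      1 / (φ m) * (∑ χ : DirichletCharacter ℂ m with χ ≠ 1,
        ‖∑ n ∈ Icc 1 x, χ n * (logPrime n)‖ + |∑ n ∈ Icc 1 x, logPrime n - x| + log m)
        + log m := by
  have hm := NeZero.ne m
  have hφ : (0 : ℝ) < m.totient := mod_cast totient_pos.2 (NeZero.pos m)
  have hfilter : ∑ n ∈ Icc 1 x with (m : ℤ) ∣ (n : ℕ) - l, logPrime n =
      ∑ n ∈ Icc 1 x, if (l : ZMod m) = n then logPrime n else 0 := by
    rw [sum_filter]
    refine sum_congr rfl fun n _ => ?_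
    simp only [dvd_sub_iff_zmod_eq]
  split_ifs with hl
  · have hu : IsUnit (l : ZMod m) := by
      rw [ZMod.coe_int_isUnit_iff_isCoprime, Int.isCoprime_iff_gcd_eq_one]
      exact hl
    set Θ : DirichletCharacter ℂ m → ℂ := fun χ => ∑ n ∈ Icc 1 x, χ n * (logPrime n) with hΘ
    have h1 : (φ m) * ((∑ n ∈ Icc 1 x, if (l : ZMod m) = n then logPrime n else 0)) =
        ∑ χ : DirichletCharacter ℂ m, χ l⁻¹ * Θ χ := by
      simp_rw [hΘ, mul_sum]
      rw [sum_comm, ofReal_sum, mul_sum]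
      refine sum_congr rfl fun n _ => ?_
      have := sum_char_inv_mul_char_eq ℂ hu n
      simp_rw [← mul_assoc]
      rw [← sum_mul, this]
      split_ifs <;> simp
    have h2 : ‖Θ 1 - x‖ ≤ |∑ n ∈ Icc 1 x, logPrime n - x| + log m := by
      have : Θ 1 = ((∑ n ∈ Icc 1 x, logPrime n -
          ∑ n ∈ Icc 1 x with ¬ n.Coprime m, logPrime n : ℝ)) := by
        rw [sum_filter, ← sum_sub_distrib, ofReal_sum]
        refine sum_congr rfl fun n _ => ?_
        by_cases h : n.Coprime m
        · rw [MulChar.one_apply ((ZMod.isUnit_iff_coprime n m).2 h)]; simp [h]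
        · rw [MulChar.map_nonunit _ (by rwa [ZMod.isUnit_iff_coprime])]; simp [h]
      rw [this, ← ofReal_natCast, ← ofReal_sub, norm_real, norm_eq_abs]
      have h3 := sum_logPrime_not_coprime_le hm (Icc 1 x)
      have h4 : 0 ≤ ∑ n ∈ Icc 1 x with ¬ n.Coprime m, logPrime n :=
        sum_nonneg fun n _ => logPrime_nonneg n
      rw [abs_le]
      constructor
      · linarith [neg_abs_le (∑ n ∈ Icc 1 x, logPrime n - x)]
      · linarith [le_abs_self (∑ n ∈ Icc 1 x, logPrime n - x)]
    have h3 : (φ m) * ((∑ n ∈ Icc 1 x with (m : ℤ) ∣ (n : ℕ) - l, logPrime n -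
        x / φ m : ℝ)) =
        (Θ 1 - x) + ∑ χ : DirichletCharacter ℂ m with χ ≠ 1, χ l⁻¹ * Θ χ := by
      have h5 : ∑ χ : DirichletCharacter ℂ m, χ l⁻¹ * Θ χ =
          Θ 1 + ∑ χ : DirichletCharacter ℂ m with χ ≠ 1, χ l⁻¹ * Θ χ := by
        rw [← add_sum_erase _ _ (mem_univ 1)]
        congr 1
        · rw [MulChar.one_apply, one_mul]
          exact IsUnit.of_mul_eq_one _ ((ZMod.inv_mul_eq_one_of_isUnit hu _).2 rfl)
        · refine sum_congr ?_ fun _ _ => rfl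
          ext χ; simp
      rw [ofReal_sub, mul_sub, hfilter, h1, h5]
      push_cast
      have : (φ m) ≠ 0 := mod_cast hφ.ne'
      field_simp
      ring
    have h4 := congrArg norm h3
    rw [norm_mul, Complex.norm_natCast, norm_real, norm_eq_abs] at h4
    set X := |∑ n ∈ Icc 1 x with (m : ℤ) ∣ (n : ℕ) - l, logPrime n - x / φ m|
    have h5 : (φ m) * X ≤ ∑ χ : DirichletCharacter ℂ m with χ ≠ 1, ‖Θ χ‖ +
        |∑ n ∈ Icc 1 x, logPrime n - x| + log m := by
      rw [h4]
      refine (norm_add_le _ _).trans ?_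
      have : ‖∑ χ : DirichletCharacter ℂ m with χ ≠ 1, χ l⁻¹ * Θ χ‖ ≤
          ∑ χ : DirichletCharacter ℂ m with χ ≠ 1, ‖Θ χ‖ := by
        refine (norm_sum_le _ _).trans (sum_le_sum fun χ _ => ?_)
        rw [norm_mul]
        exact mul_le_of_le_one_left (norm_nonneg _) (χ.norm_le_one _)
      linarith
    rw [one_div_mul_eq_div]
    exact ((le_div_iff₀' hφ).2 h5).trans (le_add_of_nonneg_right (log_natCast_nonneg m))
  · rw [sub_zero, abs_of_nonneg (sum_nonneg fun n _ => logPrime_nonneg n)]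
    refine le_trans ?_ (le_add_of_nonneg_left (by positivity))
    refine le_trans (sum_le_sum_of_subset_of_nonneg ?_ fun n _ _ => logPrime_nonneg n)
      (sum_logPrime_not_coprime_le hm (Icc 1 x))
    intro n hn
    rw [mem_filter] at hn ⊢
    refine ⟨hn.1, fun hc => hl ?_⟩
    rw [dvd_sub_iff_zmod_eq] at hn
    have := (ZMod.isUnit_iff_coprime n m).2 hc
    rw [← hn.2, ZMod.coe_int_isUnit_iff_isCoprime, Int.isCoprime_iff_gcd_eq_one] at this
    exact this

/-- The total size of the twisted prime sums over the primitive characters of one modulus. -/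
def primCharSum (x r : ℕ) : ℝ := ∑ χ : DirichletCharacter ℂ r with χ.IsPrimitive,
  ‖∑ n ∈ Icc 1 x, χ n * (Λ n : ℂ)‖

lemma primCharSum_nonneg (x r : ℕ) : 0 ≤ primCharSum x r :=
  sum_nonneg fun _ _ => norm_nonneg _

lemma card_dirichletCharacter (m : ℕ) [NeZero m] :
    (Finset.univ : Finset (DirichletCharacter ℂ m)).card = m.totient := by
  rw [card_univ, ← card_eq_fintype_card, card_eq_totient_of_hasEnoughRootsOfUnity]

lemma sum_norm_logPrime_le_primCharSum {m : ℕ} [NeZero m] (x : ℕ) :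
    ∑ χ : DirichletCharacter ℂ m with χ ≠ 1, ‖∑ n ∈ Icc 1 x, χ n * (logPrime n)‖ ≤
      ∑ r ∈ Ioc 1 m with r ∣ m, primCharSum x r +
        m.totient * (log m + 2 * √x * log x) := by
  have hm := NeZero.ne m
  have hlm := log_natCast_nonneg m
  have hlx := log_natCast_nonneg x
  set T : (Σ r, DirichletCharacter ℂ r) → ℝ := fun r =>
    ‖∑ n ∈ Icc 1 x, r.2 n * (Λ n)‖
  set i : DirichletCharacter ℂ m → (Σ r, DirichletCharacter ℂ r) := fun χ =>
    ⟨χ.conductor, χ.primitiveCharacter⟩ with hi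
  have key : ∀ χ : DirichletCharacter ℂ m, ‖∑ n ∈ Icc 1 x, χ n * (logPrime n)‖ ≤
      T (i χ) + (log m + 2 * √x * log x) := by
    intro χ
    have e : ∑ n ∈ Icc 1 x, χ n * (logPrime n) =
        ∑ n ∈ Icc 1 x, χ.primitiveCharacter n * (Λ n)
        - ∑ n ∈ Icc 1 x, χ.primitiveCharacter n *
          ((Λ n - logPrime n : ℝ))
        - ∑ n ∈ Icc 1 x with ¬ n.Coprime m, χ.primitiveCharacter n * (logPrime n) := by
      rw [sum_filter, ← sum_sub_distrib, ← sum_sub_distrib]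
      refine sum_congr rfl fun n _ => ?_
      by_cases h : n.Coprime m
      · have hχ : χ n = χ.primitiveCharacter n := by
          have := primitiveCharacter_apply_of_isCoprime (χ := χ)
            (isCoprime_iff_coprime.2 h)
          push_cast at this
          exact this.symm
        rw [if_neg (not_not.2 h), sub_zero, hχ]
        push_cast; ring
      · rw [MulChar.map_nonunit χ (by rwa [ZMod.isUnit_iff_coprime])]
        rw [if_pos h]
        push_cast; ring
    rw [e]
    refine (norm_sub_le _ _).trans ?_
    refine (add_le_add_left (norm_sub_le _ _) _).trans ?_
    have h1 : ‖∑ n ∈ Icc 1 x, χ.primitiveCharacter n *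
          ((Λ n - logPrime n : ℝ))‖ ≤ 2 * √x * log x := by
      refine (norm_sum_le _ _).trans (le_trans (sum_le_sum fun n _ => ?_)
        (sum_vonMangoldt_sub_logPrime_le x))
      rw [norm_mul, norm_real, norm_of_nonneg (sub_nonneg.2 (logPrime_le_vonMangoldt n))]
      exact mul_le_of_le_one_left (sub_nonneg.2 (logPrime_le_vonMangoldt n))
        (norm_le_one _ _)
    have h2 : ‖∑ n ∈ Icc 1 x with ¬ n.Coprime m, χ.primitiveCharacter n * (logPrime n)‖ ≤
        log m := by
      refine (norm_sum_le _ _).trans (le_trans (sum_le_sum fun n _ => ?_)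
        (sum_logPrime_not_coprime_le hm (Icc 1 x)))
      rw [norm_mul, norm_real, norm_of_nonneg (logPrime_nonneg n)]
      exact mul_le_of_le_one_left (logPrime_nonneg n) (norm_le_one _ _)
    have : T (i χ) = ‖∑ n ∈ Icc 1 x, χ.primitiveCharacter n *
      (Λ n)‖ := rfl
    linarith
  have hinj : ∀ χ ψ, i χ = i ψ → χ = ψ := by
    have gen : ∀ (r s : Σ r, DirichletCharacter ℂ r), r = s → ∀ (h : r.1 ∣ m) (h' : s.1 ∣ m),
        changeLevel h r.2 = changeLevel h' s.2 := by
      rintro r s rfl h h'; rfl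
    intro χ ψ h
    rw [← changeLevel_primitiveCharacter χ,
      ← changeLevel_primitiveCharacter ψ]
    exact gen _ _ h χ.conductor_dvd_level ψ.conductor_dvd_level
  refine (sum_le_sum fun χ _ => key χ).trans ?_
  calc ∑ χ : DirichletCharacter ℂ m with χ ≠ 1, (T (i χ) + (log m + 2 * √x * log x))
      = ∑ r ∈ (univ.filter fun χ => χ ≠ 1).image i, T r +
        (univ.filter fun χ : DirichletCharacter ℂ m => χ ≠ 1).card *
          (log m + 2 * √x * log x) := by
        rw [sum_add_distrib, sum_const, nsmul_eq_mul, sum_image fun χ _ ψ _ h => hinj χ ψ h]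
    _ ≤ ∑ r ∈ ((Ioc 1 m).filter (· ∣ m)).sigma (fun r => univ.filter fun
          χ => χ.IsPrimitive), T r +
        m.totient * (log m + 2 * √x * log x) := by
        refine add_le_add (sum_le_sum_of_subset_of_nonneg ?_ fun _ _ _ => norm_nonneg _) ?_
        · intro r hr
          rw [mem_image] at hr
          obtain ⟨χ, hχ, rfl⟩ := hr
          rw [mem_filter] at hχ
          have h0 : χ.conductor ≠ 0 := fun h => by
            have := χ.conductor_dvd_level
            rw [h, zero_dvd_iff] at this
            exact hm this
          have h1 : χ.conductor ≠ 1 := fun h => hχ.2 ((eq_one_iff_conductor_eq_one).2 h)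
          simp only [mem_sigma, mem_filter, mem_Ioc, hi, mem_univ, true_and]
          exact ⟨⟨⟨by omega, le_of_dvd (NeZero.pos m) χ.conductor_dvd_level⟩,
            χ.conductor_dvd_level⟩, χ.primitiveCharacter_isPrimitive⟩
        · refine mul_le_mul_of_nonneg_right ?_ (by positivity)
          rw [← card_dirichletCharacter m]
          exact_mod_cast card_filter_le _ _
    _ = _ := by rw [sum_sigma]; rfl

lemma sum_primCharSum_div_totient_le (A : ℕ) : ∃ B, ∃ C, 0 ≤ C ∧ ∃ N0 : ℕ, ∀ N,
    N0 ≤ N → ∀ K : ℕ, K ≤ √N / log N ^ B → ∀ x ≤ N,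
      ∑ r ∈ Ioc 1 K, primCharSum x r / φ r ≤ C * N / log N ^ A := by
  set e := A + 6 with he
  obtain ⟨C1, hC1, N1, hN1⟩ := siegel_walfisz (e + A) (e + 1)
  obtain ⟨N2, hN2⟩ := exists_le_log 2
  refine ⟨4 * e + 1 + A, 2 * C1 + 589852, by positivity, max N1 N2, fun N hN K hK x hx => ?_⟩
  have hL := hN2 N (le_of_max_le_right hN)
  set L := log N with hLdef
  have hL0 : 0 < L := by linarith
  have hL1 : 1 ≤ L := by linarith
  have hN0 : 0 < N := by
    rcases Nat.eq_zero_or_pos N with h | h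
    · rw [hLdef, h] at hL; norm_num at hL
    · exact h
  rcases Nat.eq_zero_or_pos x with rfl | hx0
  · simp [primCharSum]; positivity
  have hxr : 0 < x := mod_cast hx0
  have hxN : x ≤ N := mod_cast hx
  set R := ⌈L ^ e⌉₊
  set W := ⌈L ^ (2 * e)⌉₊
  have hLe : 1 ≤ L ^ e := one_le_pow₀ hL1
  have hL2e : 1 ≤ L ^ (2 * e) := one_le_pow₀ hL1
  have hR1 : L ^ e ≤ R := le_ceil _
  have hR2 : R ≤ 2 * L ^ e := by
    have := ceil_lt_add_one (show 0 ≤ L ^ e by positivity); linarith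
  have hW1 : L ^ (2 * e) ≤ W := le_ceil _
  have hW2 : W ≤ 2 * L ^ (2 * e) := by
    have := ceil_lt_add_one (show 0 ≤ L ^ (2 * e) by positivity); linarith
  have hR0 : 1 ≤ R := mod_cast hLe.trans hR1
  have hRr : 0 < R := mod_cast hR0
  have hsW : L ^ e ≤ √W := by
    refine le_sqrt_of_sq_le ?_
    rw [← pow_mul, mul_comm]; exact hW1
  have hsN : √N * √N = N := mul_self_sqrt (mod_cast hN0 : (0 : ℝ) < N).le
  have hKs : K ≤ √N := hK.trans (div_le_self (sqrt_nonneg _) (one_le_pow₀ hL1))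
  have hs1 : 1 ≤ √N := one_le_sqrt.2 (mod_cast hN0)
  have hlogK := log_le_log_of_le (mod_cast (by nlinarith : (K : ℝ) ≤ N))
  have hlogK0 := log_natCast_nonneg K
  have hlogx := log_le_log_of_le hx
  have hlogx0 := log_natCast_nonneg x
  have hH : (1 + log x) ^ 5 ≤ 32 * L ^ 5 := by
    calc (1 + log x) ^ 5 ≤ (2 * L) ^ 5 := by gcongr; linarith
      _ = _ := by ring
  -- small moduli
  have small : ∑ r ∈ Ioc 1 R, primCharSum x r / φ r ≤ 2 * C1 * N / L ^ A := by
    calc ∑ r ∈ Ioc 1 R, primCharSum x r / φ r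
        ≤ ∑ r ∈ Ioc 1 R, C1 * N / L ^ (e + A) := by
          refine sum_le_sum fun r hr => ?_
          rw [mem_Ioc] at hr
          haveI : NeZero r := ⟨by omega⟩
          rw [div_le_iff₀ (mod_cast totient_pos.2 (by omega)), primCharSum]
          calc _ ≤ ∑ χ : DirichletCharacter ℂ r with χ.IsPrimitive, C1 * N / L ^ (e + A) := by
                refine sum_le_sum fun χ hχ => (hN1 N (le_of_max_le_left hN)) r χ (mem_filter.1 hχ).2 ?_ ?_ x hx
                · rintro rfl
                  have := (mem_filter.1 hχ).2
                  rw [isPrimitive_def, conductor_one] at this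
                  omega
                · calc (r : ℝ) ≤ R := mod_cast hr.2
                    _ ≤ 2 * L ^ e := hR2
                    _ ≤ L * L ^ e := by gcongr
                    _ = _ := by ring
            _ ≤ _ := by
                rw [sum_const, nsmul_eq_mul, mul_comm]
                gcongr
                rw [← card_dirichletCharacter r]
                exact card_filter_le _ _
      _ ≤ R * (C1 * N / L ^ (e + A)) := by
          rw [sum_const, nsmul_eq_mul, card_Ioc]
          gcongr; omega
      _ ≤ (2 * L ^ e) * (C1 * N / L ^ (e + A)) := by gcongr
      _ = _ := by rw [pow_add L e A]; field_simp
  -- large moduli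
  set S : ℕ → ℝ := fun q => if 1 < q then q / φ q * primCharSum x q else 0 with hS
  have large := sum_div_le_of_sum_le S (fun q => by
      rw [hS]; dsimp only; split_ifs
      · exact mul_nonneg (by positivity) (primCharSum_nonneg x q)
      · rfl) hR0 (a := 73728 * (N * L ^ 5)) (b := 147456 * (N * L ^ 5 / L ^ e))
    (c := √N * (36878 * L ^ (4 * e + 1))) (by positivity) (by positivity) (by positivity) (by
      intro P _ hPK
      have hP : P ≤ √N := le_trans (mod_cast hPK) hKs
      have h1 : ∑ q ∈ Icc 1 P, S q = ∑ q ∈ Ioc 1 P, q / φ q * primCharSum x q := by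
        rw [hS, ← sum_filter]
        congr 1
        ext q; simp only [mem_filter, mem_Icc, mem_Ioc]; omega
      rw [h1]
      refine (sum_primitive_vonMangoldt_le hx0 (mod_cast hL2e.trans hW1)).trans ?_
      have t1 : W * log x + 3 * (W * W) * log x * P ≤ √N * (14 * L ^ (4 * e + 1)) := by
        calc W * log x + 3 * (W * W) * log x * P
            ≤ (2 * L ^ (2 * e)) * L + 3 * ((2 * L ^ (2 * e)) * (2 * L ^ (2 * e))) * L * √N := by
              gcongr
          _ = 2 * L ^ (2 * e + 1) * 1 + 12 * L ^ (4 * e + 1) * √N := by ring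
          _ ≤ 2 * L ^ (4 * e + 1) * √N + 12 * L ^ (4 * e + 1) * √N := by gcongr <;> linarith
          _ = _ := by ring
      have t2 : P * x / √W ≤ P * N / L ^ e := by gcongr
      have t4 : L ^ 5 ≤ L ^ (4 * e + 1) := pow_le_pow_right₀ hL1 (by omega)
      have t5 : 4 * 288 * (32 * L ^ 5) * (√N * P ^ 2) ≤
        √N * (36864 * L ^ (4 * e + 1)) * P ^ 2 := by
        calc _ = √N * (36864 * L ^ 5) * P ^ 2 := by ring
          _ ≤ _ := by gcongr
      calc _ ≤ P ^ 2 * (√N * (14 * L ^ (4 * e + 1))) +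
            4 * 288 * (32 * L ^ 5) * (2 * N + 4 * (P * N / L ^ e) + √N * P ^ 2) :=
            add_le_add (by gcongr) (by gcongr)
        _ = 73728 * (N * L ^ 5) + 147456 * (N * L ^ 5 / L ^ e) * P +
            (P ^ 2 * (√N * (14 * L ^ (4 * e + 1))) +
              4 * 288 * (32 * L ^ 5) * (√N * P ^ 2)) := by ring
        _ ≤ 73728 * (N * L ^ 5) + 147456 * (N * L ^ 5 / L ^ e) * P +
            (P ^ 2 * (√N * (14 * L ^ (4 * e + 1))) + √N * (36864 * L ^ (4 * e + 1)) * P ^ 2) := by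
            gcongr
        _ = _ := by ring)
  have hSd : ∑ q ∈ Ioc R K, S q / q = ∑ r ∈ Ioc R K, primCharSum x r / φ r := by
    refine sum_congr rfl fun q hq => ?_
    rw [mem_Ioc] at hq
    have hq0 : q ≠ 0 := by norm_cast; omega
    rw [hS]; dsimp only
    rw [if_pos (by omega)]
    field_simp
  rw [hSd] at large
  have l1 : 73728 * (N * L ^ 5) / R ≤ 73728 * (N / L ^ A) := by
    calc 73728 * (N * L ^ 5) / R ≤ 73728 * (N * L ^ 5) / L ^ e := by gcongr
      _ ≤ 73728 * (N * L ^ 6) / L ^ e := by gcongr <;> linarith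
      _ = _ := by rw [he, pow_add]; field_simp
  have l2 : 147456 * (N * L ^ 5 / L ^ e) * (2 + log K) ≤ 442368 * (N / L ^ A) := by
    calc _ ≤ 147456 * (N * L ^ 5 / L ^ e) * (3 * L) := by gcongr; linarith
      _ = 442368 * (N * L ^ 6 / L ^ e) := by ring
      _ = _ := by rw [he, pow_add]; field_simp
  have l3 : 2 * (√N * (36878 * L ^ (4 * e + 1))) * K ≤ 73756 * (N / L ^ A) := by
    calc _ ≤ 2 * (√N * (36878 * L ^ (4 * e + 1))) * (√N / L ^ (4 * e + 1 + A)) := by gcongr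
      _ = 73756 * (√N * √N) * (L ^ (4 * e + 1) / L ^ (4 * e + 1 + A)) := by ring
      _ = _ := by rw [hsN, pow_add L (4 * e + 1) A]; field_simp
  calc _ ≤ ∑ r ∈ Ioc 1 R ∪ Ioc R K, primCharSum x r / φ r := by
        refine sum_le_sum_of_subset_of_nonneg ?_ fun r _ _ =>
          div_nonneg (primCharSum_nonneg x r) (cast_nonneg _)
        intro r; simp only [mem_union, mem_Ioc]; omega
    _ = ∑ r ∈ Ioc 1 R, primCharSum x r / φ r + ∑ r ∈ Ioc R K, primCharSum x r / φ r := by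
        refine sum_union ?_
        rw [disjoint_left]; intro r; simp only [mem_Ioc]; omega
    _ ≤ 2 * C1 * N / L ^ A + 589852 * (N / L ^ A) := by linarith
    _ = _ := by ring

/-- A majorant for the error term in the distribution of the primes up to `x` modulo `m`. -/
def primeModErr (x m : ℕ) : ℝ :=
  1 / (φ m : ℝ) * (∑ r ∈ Ioc 1 m with r ∣ m, primCharSum x r) +
    1 / (φ m : ℝ) * |∑ n ∈ Icc 1 x, logPrime n - x| +
    (3 * log m + 2 * √x * log x)

lemma primeModErr_nonneg (x m : ℕ) : 0 ≤ primeModErr x m := by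
  have h1 := log_natCast_nonneg m
  have h2 := log_natCast_nonneg x
  have h3 : 0 ≤ ∑ r ∈ Ioc 1 m with r ∣ m, primCharSum x r :=
    sum_nonneg fun _ _ => primCharSum_nonneg _ _
  rw [primeModErr]; positivity

lemma abs_sum_logPrime_sub_le_primeModErr {m : ℕ} (hm : m ≠ 0) (l : ℤ) (x : ℕ) :
    |∑ n ∈ Icc 1 x with (m : ℤ) ∣ (n : ℕ) - l, logPrime n -
        (if Int.gcd m l = 1 then (x : ℝ) / φ m else 0)| ≤ primeModErr x m := by
  haveI : NeZero m := ⟨hm⟩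
  have hφ : (1 : ℝ) ≤ m.totient := mod_cast totient_pos.2 (NeZero.pos m)
  refine (abs_sum_logPrime_sub_le l x).trans ?_
  have h2 : 1 / (φ m) * log m ≤ log m :=
    mul_le_of_le_one_left (log_natCast_nonneg m) ((div_le_one (by linarith)).2 hφ)
  have h3 := mul_le_mul_of_nonneg_left (sum_norm_logPrime_le_primCharSum (m := m) x) (show 0 ≤ 1 / (φ m : ℝ) by positivity)
  rw [mul_add, (by field_simp : 1 / (φ m) * (φ m * (log m + 2 * √x * log x)) = log m + 2 * √x * log x)] at h3
  rw [primeModErr, mul_add, mul_add]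
  linarith

lemma abs_sum_logPrime_sub_self_le (x : ℕ) : |∑ n ∈ Icc 1 x, logPrime n - x| ≤
    |∑ n ∈ Icc 1 x, Λ n - x| + 2 * √x * log x := by
  have h1 := sum_vonMangoldt_sub_logPrime_le x
  have h2 : 0 ≤ ∑ n ∈ Icc 1 x, (Λ n - logPrime n) :=
    sum_nonneg fun n _ => sub_nonneg.2 (logPrime_le_vonMangoldt n)
  rw [sum_sub_distrib] at h1 h2
  rw [abs_le]
  constructor
  · linarith [neg_abs_le (∑ n ∈ Icc 1 x, Λ n - x)]
  · have h3 : 0 ≤ 2 * √x * log x := by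
      have := log_natCast_nonneg x; positivity
    linarith [le_abs_self (∑ n ∈ Icc 1 x, Λ n - x)]

lemma card_filter_dvd_sub_le {m : ℕ} (hm : m ≠ 0) (l : ℤ) (x y : ℕ) :
    #{n ∈ Ioc x y | (m : ℤ) ∣ (n : ℕ) - l} ≤ (y - x) / m + 1 := by
  have hm0 := Nat.pos_of_ne_zero hm
  have h := card_le_card_of_injOn (s := {n ∈ Ioc x y | (m : ℤ) ∣ (n : ℕ) - l})
    (t := range ((y - x) / m + 1)) (fun n => (n - x - 1) / m) ?_ ?_
  · rwa [card_range] at h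
  · intro n hn
    simp only [coe_filter, Set.mem_ofPred_eq, mem_Ioc] at hn
    simp only [coe_range, Set.mem_Iio]
    have := Nat.div_le_div_right (c := m) (show n - x - 1 ≤ y - x by omega)
    omega
  · intro n hn n' hn' hq
    simp only [coe_filter, Set.mem_ofPred_eq, mem_Ioc] at hn hn'
    simp only at hq
    have e1 := div_add_mod (n - x - 1) m
    have e2 := div_add_mod (n' - x - 1) m
    have l1 := mod_lt (n - x - 1) hm0
    have l2 := mod_lt (n' - x - 1) hm0
    rw [hq] at e1
    have hd : (m : ℤ) ∣ n - n' := by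
      have := dvd_sub hn.2 hn'.2
      rwa [sub_sub_sub_cancel_right] at this
    have habs : |(n : ℤ) - n'| < m := by
      generalize m * ((n' - x - 1) / m) = z at e1 e2
      rw [abs_lt]; omega
    have := Int.eq_zero_of_abs_lt_dvd hd habs
    omega

lemma sum_primeModErr_le (A : ℕ) : ∃ B, ∃ C, 0 ≤ C ∧ ∃ N0 : ℕ, ∀ N,
    N0 ≤ N → ∀ K : ℕ, K ≤ √N / log N ^ B → ∀ x ≤ N,
      ∑ m ∈ Icc 1 K, primeModErr x m ≤ C * N / log N ^ A := by
  obtain ⟨B, C1, hC1, N1, h1⟩ := sum_primCharSum_div_totient_le (A + 2)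
  obtain ⟨C2, hC2, N2, h2⟩ := prime_number_theorem (A + 2)
  obtain ⟨N3, h3⟩ := exists_le_log 1
  obtain ⟨N4, h4⟩ := exists_log_pow_le 1 (A + 3) (ε := 1 / 2) (by norm_num)
  refine ⟨max B (A + 1), 4 * C1 + 4 * C2 + 13, by positivity, max (max N1 N2) (max N3 N4),
    fun N hN K hK x hx => ?_⟩
  simp only [max_le_iff] at hN
  obtain ⟨⟨hN1, hN2⟩, hN3, hN4⟩ := hN
  have hL1 := h3 N hN3
  have hs := h4 N hN4
  set L := log N with hLdef
  have hL0 : 0 < L := by linarith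
  have hN0 : 0 < N := by
    rcases Nat.eq_zero_or_pos N with h | h
    · rw [hLdef, h] at hL1; norm_num at hL1
    · exact h
  have hxN : x ≤ N := mod_cast hx
  rw [one_mul, ← sqrt_eq_rpow] at hs
  have hsN : √N * √N = N := mul_self_sqrt (mod_cast hN0 : (0 : ℝ) < N).le
  have hs1 : 1 ≤ √N := one_le_sqrt.2 (mod_cast hN0)
  have hKA : K ≤ √N / L ^ (A + 1) := hK.trans (by gcongr; exact le_max_right _ _)
  have hKs : K ≤ √N := hK.trans (div_le_self (sqrt_nonneg _) (one_le_pow₀ hL1))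
  have hlogK := log_le_log_of_le (mod_cast (by nlinarith : (K : ℝ) ≤ N))
  have hlogK0 := log_natCast_nonneg K
  have hlogx := log_le_log_of_le hx
  have hlogx0 := log_natCast_nonneg x
  have hsq : (1 + log K) ^ 2 ≤ 4 * L ^ 2 := by
    calc (1 + log K) ^ 2 ≤ (2 * L) ^ 2 := by gcongr; linarith
      _ = _ := by ring
  have hK1 : √N * K ≤ N / L ^ (A + 1) := by
    calc √N * K ≤ √N * (√N / L ^ (A + 1)) := by gcongr
      _ = _ := by rw [← mul_div_assoc, hsN]
  have p1 : ∑ m ∈ Icc 1 K, 1 / (φ m) * (∑ r ∈ Ioc 1 m with r ∣ m, primCharSum x r) ≤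
      4 * C1 * N / L ^ A := by
    calc _ = ∑ m ∈ Icc 1 K, ∑ r ∈ Ioc 1 K, if r ∣ m then primCharSum x r * (1 / φ m) else 0 := by
          refine sum_congr rfl fun m hm => ?_
          rw [mem_Icc] at hm
          rw [mul_sum, ← sum_filter]
          refine sum_congr ?_ fun r _ => by ring
          ext r
          simp only [mem_filter, mem_Ioc]
          constructor
          · rintro ⟨⟨a, b⟩, c⟩; exact ⟨⟨a, by omega⟩, c⟩
          · rintro ⟨⟨a, b⟩, c⟩; exact ⟨⟨a, le_of_dvd (by omega) c⟩, c⟩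
      _ = ∑ r ∈ Ioc 1 K, primCharSum x r *
            ∑ m ∈ (Icc 1 K).filter (r ∣ ·), 1 / (φ m : ℝ) := by
          rw [sum_comm]
          refine sum_congr rfl fun r _ => ?_
          rw [← sum_filter, mul_sum]
      _ ≤ ∑ r ∈ Ioc 1 K, primCharSum x r * (1 / φ r * (1 + log K) ^ 2) := by
          refine sum_le_sum fun r hr => mul_le_mul_of_nonneg_left ?_ (primCharSum_nonneg x r)
          rw [mem_Ioc] at hr
          exact sum_filter_dvd_inv_totient_le K (by omega)
      _ = (∑ r ∈ Ioc 1 K, primCharSum x r / φ r) * (1 + log K) ^ 2 := by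
          rw [sum_mul]; refine sum_congr rfl fun r _ => by ring
      _ ≤ (C1 * N / L ^ (A + 2)) * (4 * L ^ 2) := by
          have := h1 N hN1 K (hK.trans (by gcongr; exact le_max_left _ _)) x hx
          gcongr
      _ = _ := by rw [pow_add]; field_simp
  have hθ : |∑ n ∈ Icc 1 x, logPrime n - x| ≤ (C2 + 2) * N / L ^ (A + 2) := by
    refine (abs_sum_logPrime_sub_self_le x).trans ?_
    have : 2 * √x * log x ≤ 2 * N / L ^ (A + 2) := by
      rw [le_div_iff₀ (by positivity)]
      calc 2 * √x * log x * L ^ (A + 2) ≤ 2 * √N * L * L ^ (A + 2) := by gcongr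
        _ = 2 * √N * L ^ (A + 3) := by ring
        _ ≤ 2 * √N * √N := by gcongr
        _ = _ := by rw [mul_assoc, hsN]
    calc _ ≤ C2 * N / L ^ (A + 2) + 2 * N / L ^ (A + 2) := add_le_add (h2 N hN2 x hx) this
      _ = _ := by ring
  have p2 : ∑ m ∈ Icc 1 K, 1 / (φ m) * |∑ n ∈ Icc 1 x, logPrime n - x| ≤
      4 * (C2 + 2) * N / L ^ A := by
    rw [← sum_mul]
    calc _ ≤ (4 * L ^ 2) * ((C2 + 2) * N / L ^ (A + 2)) := by
          have := (sum_inv_totient_le K).trans hsq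
          gcongr
      _ = _ := by rw [pow_add]; field_simp
  have p3 : ∑ m ∈ Icc 1 K, (3 * log m + 2 * √x * log x) ≤ 5 * N / L ^ A := by
    calc _ ≤ ∑ m ∈ Icc 1 K, (3 * L * √N + 2 * √N * L) := by
          refine sum_le_sum fun m hm => ?_
          rw [mem_Icc] at hm
          have hm' := (log_le_log_of_le hm.2).trans hlogK
          have : 3 * log m ≤ 3 * L * √N := by nlinarith
          gcongr
      _ = 5 * L * (√N * K) := by
          rw [sum_const, nsmul_eq_mul, card_Icc]; push_cast; ring_nf
      _ ≤ 5 * L * (N / L ^ (A + 1)) := by gcongr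
      _ = _ := by rw [pow_add]; field_simp
  simp_rw [primeModErr]
  rw [sum_add_distrib, sum_add_distrib]
  calc _ ≤ 4 * C1 * N / L ^ A + 4 * (C2 + 2) * N / L ^ A + 5 * N / L ^ A := by gcongr
    _ = _ := by ring

/-- The Bombieri–Vinogradov theorem. -/
theorem bombieri_vinogradov (A : ℕ) : ∃ B, ∃ C, 0 ≤ C ∧ ∃ N0, ∀ N, N0 ≤ N →
    ∃ E : ℕ → ℝ, (∀ m, 0 ≤ E m) ∧
      (∀ m : ℕ, m ≠ 0 → ∀ l, ∀ y ≤ N, |∑ n ∈ Icc 1 y with (m : ℤ) ∣ (n : ℕ) - l, logPrime n -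
        (if Int.gcd m l = 1 then (y : ℝ) / φ m else 0)| ≤ E m) ∧
      ∀ K : ℕ, K ≤ √N / log N ^ B → ∑ m ∈ Icc 1 K, E m ≤ C * N / log N ^ A := by
  obtain ⟨B, C1, hC1, N1, h1⟩ := sum_primeModErr_le (2 * A + 3)
  obtain ⟨N2, h2⟩ := exists_le_log 1
  obtain ⟨N3, h3⟩ := exists_log_pow_le 2 (A + 3) (ε := 1 / 2) (by norm_num)
  refine ⟨max B (A + 1), 2 * C1 + 13, by positivity, max N1 (max N2 N3), fun N hN => ?_⟩
  simp only [max_le_iff] at hN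
  obtain ⟨hN1, hN2, hN3⟩ := hN
  have hL1 := h2 N hN2
  have hs := h3 N hN3
  set L := log N with hLdef
  have hL0 : 0 < L := by linarith
  have hN0 : 0 < N := by
    rcases Nat.eq_zero_or_pos N with h | h
    · rw [hLdef, h] at hL1; norm_num at hL1
    · exact h
  rw [← sqrt_eq_rpow] at hs
  have hsN : √N * √N = N := mul_self_sqrt (mod_cast hN0 : (0 : ℝ) < N).le
  have hs1 : 1 ≤ √N := one_le_sqrt.2 (mod_cast hN0)
  set G := ⌈L ^ (A + 3)⌉₊
  have hLA : 1 ≤ L ^ (A + 3) := one_le_pow₀ hL1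
  have hG1 : L ^ (A + 3) ≤ G := le_ceil _
  have hG2 : G ≤ 2 * L ^ (A + 3) := by
    have := ceil_lt_add_one (show 0 ≤ L ^ (A + 3) by positivity); linarith
  have hG0 : 0 < G := by exact_mod_cast (show (0 : ℝ) < G by linarith)
  have hGr : 0 < G := mod_cast hG0
  set h := N / G + 1 with hh
  have hh0 : 0 < h := succ_pos _
  have hNh : N / h < G := by
    rw [Nat.div_lt_iff_lt_mul hh0, hh, mul_comm, mul_comm]
    have := lt_mul_div_succ N hG0
    exact this
  have hhr : h ≤ 2 * (N / L ^ (A + 3)) := by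
    have e1 : (h : ℝ) ≤ N / G + 1 := by rw [hh]; push_cast; gcongr; exact cast_div_le
    have e2 : N / G ≤ N / L ^ (A + 3) := by gcongr
    have e3 : 1 ≤ N / L ^ (A + 3) := by
      rw [le_div_iff₀ (by positivity)]
      nlinarith
    linarith
  refine ⟨fun m => ∑ j ∈ range (N / h + 1), primeModErr (j * h) m + (h / m + 1) * L +
    h * (1 / φ m), fun m => ?_, fun m hm l y hy => ?_, fun K hK => ?_⟩
  · have : 0 ≤ ∑ j ∈ range (N / h + 1), primeModErr (j * h) m :=
      sum_nonneg fun _ _ => primeModErr_nonneg _ _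
    positivity
  · set x := y / h * h
    have hxy := div_mul_le_self y h
    have hyx : y < x + h := by
      have := lt_div_mul_add (a := y) hh0; omega
    have hE := abs_sum_logPrime_sub_le_primeModErr hm l x
    have hj : primeModErr x m ≤ ∑ j ∈ range (N / h + 1), primeModErr (j * h) m := by
      refine single_le_sum (f := fun j => primeModErr (j * h) m)
        (fun _ _ => primeModErr_nonneg _ _) ?_
      rw [mem_range, Nat.lt_succ_iff]
      exact Nat.div_le_div_right hy
    have hsplit : ∑ n ∈ Icc 1 y with (m : ℤ) ∣ (n : ℕ) - l, logPrime n =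
        ∑ n ∈ Icc 1 x with (m : ℤ) ∣ (n : ℕ) - l, logPrime n +
        ∑ n ∈ Ioc x y with (m : ℤ) ∣ (n : ℕ) - l, logPrime n := by
      rw [← sum_union]
      · refine sum_congr ?_ fun _ _ => rfl
        rw [← filter_union]
        congr 1
        ext n; simp only [mem_union, mem_Icc, mem_Ioc]; omega
      · rw [disjoint_left]; intro n; simp only [mem_filter, mem_Icc, mem_Ioc]; omega
    have hpart0 : 0 ≤ ∑ n ∈ Ioc x y with (m : ℤ) ∣ (n : ℕ) - l, logPrime n :=
      sum_nonneg fun n _ => logPrime_nonneg n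
    have hpart : ∑ n ∈ Ioc x y with (m : ℤ) ∣ (n : ℕ) - l, logPrime n ≤ (h / m + 1) * L := by
      calc _ ≤ ∑ n ∈ Ioc x y with (m : ℤ) ∣ (n : ℕ) - l, L := by
            refine sum_le_sum fun n hn => (logPrime_le_log n).trans ?_
            rw [mem_filter, mem_Ioc] at hn
            exact log_le_log_of_le (hn.1.2.trans hy)
        _ ≤ _ := by
            rw [sum_const, nsmul_eq_mul]
            gcongr
            calc _ ≤ (((y - x) / m + 1 : ℕ) : ℝ) := mod_cast card_filter_dvd_sub_le hm l x y
              _ ≤ ((h / m + 1 : ℕ)) := by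
                  exact_mod_cast Nat.add_le_add_right (Nat.div_le_div_right (by omega)) 1
              _ ≤ _ := by push_cast; gcongr; exact cast_div_le
    have hmain : |(if Int.gcd m l = 1 then (x : ℝ) / φ m else 0) -
        (if Int.gcd m l = 1 then (y : ℝ) / φ m else 0)| ≤ h * (1 / φ m) := by
      split_ifs
      · rw [← sub_div, abs_div, abs_of_pos (mod_cast totient_pos.2 (Nat.pos_of_ne_zero hm) : (0 : ℝ) < m.totient), mul_one_div]
        gcongr
        have a1 : (x : ℝ) ≤ y := mod_cast hxy
        have a2 : (y : ℝ) ≤ x + h := mod_cast hyx.le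
        rw [abs_le]; constructor <;> linarith
      · rw [sub_zero, abs_zero]; positivity
    rw [hsplit]
    rw [abs_le] at hE hmain ⊢
    have hh1 : 0 ≤ (h / m + 1) * L := by positivity
    constructor <;> linarith [hE.1, hE.2, hmain.1, hmain.2]
  · have hKA : K ≤ √N / L ^ (A + 1) := hK.trans (by gcongr; exact le_max_right _ _)
    have hKs : K ≤ √N := hK.trans (div_le_self (sqrt_nonneg _) (one_le_pow₀ hL1))
    have hlogK := log_le_log_of_le (mod_cast (by nlinarith : (K : ℝ) ≤ N))
    have hlogK0 := log_natCast_nonneg K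
    have hsq : (1 + log K) ^ 2 ≤ 4 * L ^ 2 := by
      calc (1 + log K) ^ 2 ≤ (2 * L) ^ 2 := by gcongr; linarith
        _ = _ := by ring
    rw [sum_add_distrib, sum_add_distrib]
    have p1 : ∑ m ∈ Icc 1 K, ∑ j ∈ range (N / h + 1), primeModErr (j * h) m ≤
        2 * C1 * N / L ^ A := by
      rw [sum_comm]
      calc _ ≤ ∑ j ∈ range (N / h + 1), C1 * N / L ^ (2 * A + 3) := by
            refine sum_le_sum fun j hj => (h1 N hN1) K (hK.trans (by gcongr; exact le_max_left _ _)) _ ?_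
            rw [mem_range, Nat.lt_succ_iff] at hj
            exact (Nat.mul_le_mul_right h hj).trans (div_mul_le_self N h)
        _ ≤ G * (C1 * N / L ^ (2 * A + 3)) := by
            rw [sum_const, nsmul_eq_mul, card_range]
            gcongr
            omega
        _ ≤ (2 * L ^ (A + 3)) * (C1 * N / L ^ (2 * A + 3)) := by gcongr
        _ = _ := by
            rw [show 2 * A + 3 = (A + 3) + A by ring, pow_add L (A + 3) A]; field_simp
    have p2 : ∑ m ∈ Icc 1 K, (h / m + 1) * L ≤ 5 * (N / L ^ A) := by
      have e1 : ∑ m ∈ Icc 1 K, (h / m + 1) * L = (h * ∑ m ∈ Icc 1 K, 1 / (m : ℝ)) * L +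
          K * L := by
        rw [mul_sum, sum_mul]
        simp_rw [add_mul, sum_add_distrib]
        simp [div_eq_mul_inv]
      have e2 : ∑ m ∈ Icc 1 K, 1 / (m : ℝ) ≤ 2 * L := (sum_inv_le_log K).trans (by linarith)
      rw [e1]
      have e3 : K * L ≤ N / L ^ A := by
        calc K * L ≤ √N / L ^ (A + 1) * L := by gcongr
          _ = √N * 1 / L ^ A := by rw [pow_succ]; field_simp
          _ ≤ √N * √N / L ^ A := by gcongr
          _ = _ := by rw [hsN]
      have e4 : (h * ∑ m ∈ Icc 1 K, 1 / (m : ℝ)) * L ≤ 4 * (N / L ^ A) := by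
        calc _ ≤ (2 * (N / L ^ (A + 3)) * (2 * L)) * L := by gcongr
          _ ≤ (2 * (N / L ^ (A + 3)) * (2 * L)) * L * L := le_mul_of_one_le_right (by positivity) hL1
          _ = _ := by rw [pow_add]; field_simp; ring
      linarith
    have p3 : ∑ m ∈ Icc 1 K, (h : ℝ) * (1 / φ m) ≤ 8 * (N / L ^ A) := by
      rw [← mul_sum]
      calc _ ≤ 2 * (N / L ^ (A + 3)) * (4 * L ^ 2) := by
            have := (sum_inv_totient_le K).trans hsq
            gcongr
        _ ≤ 2 * (N / L ^ (A + 3)) * (4 * L ^ 2) * L := le_mul_of_one_le_right (by positivity) hL1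
        _ = _ := by rw [pow_add]; field_simp; ring
    calc _ ≤ 2 * C1 * N / L ^ A + 5 * (N / L ^ A) + 8 * (N / L ^ A) := by gcongr
      _ = _ := by ring

lemma sum_range_div_eq {E : Type*} [AddCommMonoid E] {k : ℕ} (hk : k ≠ 0) (F : ℝ → E) :
    ∑ a ∈ range k, F (a / k) =
      ∑ d ∈ k.divisors, ∑ b ∈ range d with d.Coprime b, F (b / d) := by
  have hkr : k ≠ 0 := mod_cast hk
  rw [sum_sigma']
  symm
  refine sum_nbij' (fun x => x.2 * (k / x.1)) (fun a => ⟨k / k.gcd a, a / k.gcd a⟩) ?_ ?_ ?_ ?_ ?_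
  · rintro ⟨d, b⟩ h
    simp only [mem_sigma, mem_divisors, mem_filter, mem_range] at h ⊢
    obtain ⟨⟨⟨e, rfl⟩, -⟩, hb, -⟩ := h
    have hd : 0 < d := by omega
    rw [Nat.mul_div_cancel_left _ hd]
    exact Nat.mul_lt_mul_of_pos_right hb (Nat.pos_of_ne_zero (right_ne_zero_of_mul hk))
  · intro a ha
    simp only [mem_sigma, mem_divisors, mem_filter, mem_range] at ha ⊢
    exact ⟨⟨div_dvd_of_dvd (Nat.gcd_dvd_left _ _), hk⟩,
      div_lt_div_of_lt_of_dvd (Nat.gcd_dvd_left _ _) ha, coprime_div_gcd_div_gcd (gcd_pos_of_pos_left _ (Nat.pos_of_ne_zero hk))⟩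
  · rintro ⟨d, b⟩ h
    simp only [mem_sigma, mem_divisors, mem_filter, mem_range] at h ⊢
    obtain ⟨⟨⟨e, rfl⟩, -⟩, hb, hc⟩ := h
    have hd : 0 < d := by omega
    have he := Nat.pos_of_ne_zero (right_ne_zero_of_mul hk)
    rw [Nat.mul_div_cancel_left _ hd, (by rw [Nat.gcd_mul_right, hc, one_mul] : (d * e).gcd (b * e) = e), Nat.mul_div_cancel _ he, Nat.mul_div_cancel _ he]
  · intro a ha
    simp only
    rw [Nat.div_div_self (Nat.gcd_dvd_left _ _) hk, Nat.div_mul_cancel (Nat.gcd_dvd_right _ _)]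
  · rintro ⟨d, b⟩ h
    simp only [mem_sigma, mem_divisors, mem_filter, mem_range] at h ⊢
    obtain ⟨⟨⟨e, rfl⟩, -⟩, hb, hc⟩ := h
    have hd : 0 < d := by omega
    have hdr : d ≠ 0 := mod_cast hd.ne'
    have her : e ≠ 0 := mod_cast right_ne_zero_of_mul hk
    rw [Nat.mul_div_cancel_left _ hd]
    congr 1
    push_cast
    field_simp

/-- The function `d ↦ d` restricted to the divisors of `n`. -/
def divisorPart (n : ℤ) : ArithmeticFunction ℝ :=
  ⟨fun d => if (d : ℤ) ∣ n then (d : ℝ) else 0, by simp⟩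

/-- The Ramanujan sum, as a function of the modulus. -/
def ramanujanSum (n : ℤ) : ArithmeticFunction ℝ :=
  divisorPart n * ((μ : ArithmeticFunction ℤ) : ArithmeticFunction ℝ)

lemma ramanujanSum_apply (n : ℤ) (q : ℕ) :
    ramanujanSum n q = ∑ x ∈ q.divisorsAntidiagonal,
      (if (x.1 : ℤ) ∣ n then (x.1 : ℝ) else 0) * (μ x.2) := by
  rw [ramanujanSum, ArithmeticFunction.mul_apply]; rfl

lemma isMultiplicative_ramanujanSum (n : ℤ) : (ramanujanSum n).IsMultiplicative := by
  refine IsMultiplicative.mul ?_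
    ArithmeticFunction.isMultiplicative_moebius.intCast
  refine IsMultiplicative.iff_ne_zero.2 ⟨by simp [divisorPart], fun {a b} _ _ hab => ?_⟩
  simp only [divisorPart, coe_mk, cast_mul]
  by_cases h1 : (a : ℤ) ∣ n <;> by_cases h2 : (b : ℤ) ∣ n <;> simp [(⟨fun h => ⟨(dvd_mul_right _ _).trans h, (dvd_mul_left _ _).trans h⟩, fun h => IsCoprime.mul_dvd (isCoprime_iff_coprime.2 hab) h.1 h.2⟩ : ((a : ℤ) * b ∣ n) ↔ (a : ℤ) ∣ n ∧ (b : ℤ) ∣ n), h1, h2]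

lemma ramanujanSum_prime (n : ℤ) {p : ℕ} (hp : p.Prime) :
    ramanujanSum n p = (if (p : ℤ) ∣ n then (p : ℝ) else 0) - 1 := by
  rw [ramanujanSum_apply, sum_divisorsAntidiagonal (fun a b =>
    (if (a : ℤ) ∣ n then (a : ℝ) else 0) * (μ b)),
    Prime.sum_divisors hp, Nat.div_self hp.pos, Nat.div_one,
    moebius_apply_prime hp]
  simp; ring

lemma ramanujanSum_eq_of_dvd_sub {q : ℕ} {m n : ℤ} (h : (q : ℤ) ∣ m - n) :
    ramanujanSum m q = ramanujanSum n q := by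
  rw [ramanujanSum_apply, ramanujanSum_apply]
  refine sum_congr rfl fun x hx => ?_
  simp only [(dvd_iff_dvd_of_dvd_sub ((Int.natCast_dvd_natCast.2 ⟨x.2, (mem_divisorsAntidiagonal.1 hx).1.symm⟩).trans h))]

lemma ramanujanSum_of_coprime {q : ℕ} (hq : q ≠ 0) {n : ℤ} (h : IsCoprime n q) :
    ramanujanSum n q = μ q := by
  rw [ramanujanSum_apply, sum_eq_single (1, q)]
  · simp
  · rintro ⟨d, e⟩ hx hne
    rw [mem_divisorsAntidiagonal] at hx
    rw [if_neg, zero_mul]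
    intro hd
    have h1 := Int.isUnit_iff_natAbs_eq.1 (h.isUnit_of_dvd' hd (⟨e, mod_cast hx.1.symm⟩))
    simp only [Int.natAbs_natCast] at h1
    subst h1
    exact hne (by rw [← hx.1]; simp)
  · intro hx; exact absurd (mem_divisorsAntidiagonal.2 ⟨by simp, hq⟩) hx

lemma sum_range_ee (n : ℤ) {q : ℕ} (hq : 0 < q) :
    ∑ b ∈ range q, ee (n * (b / q)) = if (q : ℤ) ∣ n then (q : ℂ) else 0 := by
  have hqr : q ≠ 0 := mod_cast hq.ne'
  simp_rw [(fun b => by rw [← ee_nat_mul]; congr 1; ring : ∀ b : ℕ, ee (n * (b / q)) = ee (n / q) ^ b)]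
  split_ifs with h
  · obtain ⟨m, rfl⟩ := h
    rw [(by push_cast; field_simp : ((q * m : ℤ) : ℝ) / q = m), ee_int]; simp
  · haveI : NeZero q := ⟨hq.ne'⟩
    have h1 : ee (n / q) ≠ 1 := by
      rw [← stdAddChar_eq_ee]
      intro h0
      apply h
      rw [← ZMod.intCast_zmod_eq_zero_iff_dvd]
      refine ZMod.injective_stdAddChar ?_
      rw [h0]; simp
    rw [geom_sum_eq h1, ← ee_nat_mul, show (q : ℝ) * (n / q) = n by field_simp, ee_int,
      sub_self, zero_div]

lemma sum_coprime_ee (n : ℤ) {q : ℕ} (hq : 0 < q) :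
    ∑ b ∈ range q with q.Coprime b, ee (n * (b / q)) = (ramanujanSum n q) := by
  have h := (sum_eq_iff_sum_mul_moebius_eq
    (f := fun q => ∑ b ∈ range q with q.Coprime b, ee (n * (b / q)))
    (g := fun q => if (q : ℤ) ∣ n then q else 0)).1 (fun k hk => by
      rw [← sum_range_ee n hk, sum_range_div_eq hk.ne' (fun x => ee (n * x)) ]) q hq
  rw [← h, ramanujanSum_apply]
  conv_lhs => rw [← map_swap_divisorsAntidiagonal, sum_map]
  push_cast
  refine sum_congr rfl fun x _ => ?_
  by_cases h1 : (x.1 : ℤ) ∣ n <;> simp [h1, mul_comm]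

/-- The truncated Ramanujan expansion of the primes. -/
def primeModel (Q : ℕ) (n : ℤ) : ℝ :=
  ∑ q ∈ Icc 1 Q, (μ q : ℝ) / φ q * ramanujanSum n q

lemma abs_ramanujanSum_le (n : ℤ) (q : ℕ) :
    |ramanujanSum n q| ≤ ∑ d ∈ q.divisors with ((d : ℕ) : ℤ) ∣ n, (d : ℝ) := by
  rw [ramanujanSum_apply, sum_filter, ← sum_divisorsAntidiagonal
    (fun d _ => if (d : ℤ) ∣ n then (d : ℝ) else 0)]
  refine (abs_sum_le_sum_abs _ _).trans (sum_le_sum fun x _ => ?_)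
  rw [abs_mul, abs_of_nonneg (by positivity)]
  exact mul_le_of_le_one_right (by positivity) (abs_moebius_le_one_real _)

lemma abs_ramanujanSum_le_sq (n : ℤ) (q : ℕ) : |ramanujanSum n q| ≤ q ^ 2 := by
  refine (abs_ramanujanSum_le n q).trans ?_
  calc _ ≤ ∑ d ∈ q.divisors, (q : ℝ) := by
        refine (sum_le_sum_of_subset_of_nonneg (filter_subset _ _)
          fun _ _ _ => cast_nonneg _).trans (sum_le_sum fun d hd => ?_)
        exact_mod_cast divisor_le hd
    _ ≤ _ := by
        rw [sum_const, nsmul_eq_mul, sq]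
        gcongr; exact_mod_cast card_divisors_le_self q

lemma abs_primeModel_le (Q : ℕ) {n : ℕ} (hn : n ≠ 0) :
    |primeModel Q n| ≤ (tau n) ^ 2 * (1 + log Q) ^ 2 := by
  have hL := one_add_log_nonneg Q
  calc |primeModel Q n| ≤ ∑ q ∈ Icc 1 Q, ∑ d ∈ n.divisors,
        if d ∣ q then (d : ℝ) * (1 / φ q) else 0 := by
        refine (abs_sum_le_sum_abs _ _).trans (sum_le_sum fun q hq => ?_)
        rw [abs_mul, abs_div, abs_cast]
        calc _ ≤ 1 / (φ q) * ∑ d ∈ q.divisors with ((d : ℕ) : ℤ) ∣ n, (d : ℝ) := by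
              gcongr
              · exact abs_moebius_le_one_real q
              · exact abs_ramanujanSum_le _ _
          _ = _ := by
              rw [← sum_filter, mul_sum]
              refine sum_congr ?_ fun d _ => mul_comm _ _
              ext d
              rw [mem_Icc] at hq
              simp only [mem_filter, mem_divisors, Int.natCast_dvd_natCast]
              have : q ≠ 0 := by omega
              tauto
    _ = ∑ d ∈ n.divisors, d * ∑ q ∈ Icc 1 Q with d ∣ q, 1 / (φ q : ℝ) := by
        rw [sum_comm]
        refine sum_congr rfl fun d _ => ?_
        rw [mul_sum, sum_filter]
    _ ≤ ∑ d ∈ n.divisors, (tau n) * (1 + log Q) ^ 2 := by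
        refine sum_le_sum fun d hd => ?_
        have hd0 := pos_of_mem_divisors hd
        have hdt : 0 < d.totient := mod_cast totient_pos.2 hd0
        have h1 : (d : ℝ) ≤ d.totient * tau n := by
          have := card_le_card
            (divisors_subset_of_dvd hn (dvd_of_mem_divisors hd))
          exact_mod_cast (le_totient_mul_tau d).trans (Nat.mul_le_mul_left _ this)
        calc _ ≤ (φ d * tau n) * (1 / (φ d) * (1 + log Q) ^ 2) := by
              gcongr
              exact sum_filter_dvd_inv_totient_le Q hd0
          _ = _ := by field_simp
    _ = _ := by rw [sum_const, nsmul_eq_mul, sq]; simp only [tau]; ring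

lemma parseval_ee {κ : Type*} (t : Finset κ) (e : κ → ℤ) {M : ℕ} (hM : 0 < M)
    (he : ∀ x ∈ t, ∀ y ∈ t, (M : ℤ) ∣ e x - e y → x = y) (f : κ → ℂ) :
    ∑ a ∈ range M, ‖∑ x ∈ t, f x * ee (e x * (a / M))‖ ^ 2 = M * ∑ x ∈ t, ‖f x‖ ^ 2 := by
  refine parseval_of_orthogonal (range M) t (fun a x => ee (e x * (a / M))) f fun x hx y hy => ?_
  have h : ∀ a, ee (e x * (a / M)) * conj (ee (e y * (a / M))) =
      ee (((e x - e y : ℤ)) * (a / M)) := fun a => by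
    rw [conj_ee, ← ee_add]; congr 1; push_cast; ring
  simp_rw [h, sum_range_ee _ hM]
  by_cases hxy : x = y
  · simp [hxy]
  · rw [if_neg fun h => hxy (he x hx y hy h), if_neg hxy]

lemma sum_residue_norm_sq (N : ℕ) {k : ℕ} (hk : 0 < k) (w : ℕ → ℂ) :
    ∑ r ∈ range k, ‖∑ u ∈ Icc 1 N with u % k = r, w u‖ ^ 2 =
      1 / k * ∑ a ∈ range k, ‖∑ u ∈ Icc 1 N, w u * ee (u * (a / k))‖ ^ 2 := by
  have h := parseval_ee (range k) (fun r => r) hk (fun x hx y hy hxy => by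
    rw [mem_range] at hx hy
    exact ModEq.eq_of_lt_of_lt (modEq_iff_dvd.2 hxy) hy hx |>.symm)
    (fun r => ∑ u ∈ Icc 1 N with u % k = r, w u)
  rw [eq_comm, one_div_mul_eq_div, div_eq_iff (mod_cast hk.ne'), mul_comm, ← h]
  refine sum_congr rfl fun a _ => ?_
  congr 2
  rw [← sum_fiberwise_of_maps_to
    fun u _ => mem_range.2 (mod_lt _ hk)]
  refine sum_congr rfl fun r _ => ?_
  rw [sum_mul]
  refine sum_congr rfl fun u hu => ?_
  congr 1
  obtain ⟨m, rfl⟩ : ∃ m, u = r + k * m := ⟨u / k, by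
    rw [← (mem_filter.1 hu).2, mod_add_div]⟩
  have : ((r + k * m : ℕ) : ℝ) * (a / k) = r * (a / k) + ((m * a) : ℤ) := by
    push_cast; field_simp
  rw [this, ee_add_int]
  push_cast; rfl

lemma sum_sum_residue_norm_sq_le (N K : ℕ) {R : ℕ} (hR : 1 ≤ R) (w : ℕ → ℂ) :
    ∑ k ∈ Icc 1 K, ∑ r ∈ range k, ‖∑ u ∈ Icc 1 N with u % k = r, w u‖ ^ 2 ≤
      (1 + log K) * (∑ q ∈ Icc 1 R, (∑ b ∈ range q with q.Coprime b,
        ‖∑ u ∈ Icc 1 N, w u * ee (u * (b / q))‖ ^ 2) / q +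
        288 * (N / R + 2 * K) * ∑ u ∈ Icc 1 N, ‖w u‖ ^ 2) := by
  set S : ℕ → ℝ := fun q => ∑ b ∈ range q with q.Coprime b,
        ‖∑ u ∈ Icc 1 N, w u * ee (u * (b / q))‖ ^ 2 with hS
  set D := ∑ u ∈ Icc 1 N, ‖w u‖ ^ 2
  have hS0 : ∀ q, 0 ≤ S q := fun q => sum_nonneg fun _ _ => by positivity
  have hD0 : 0 ≤ D := sum_nonneg fun _ _ => by positivity
  have hsieve : ∑ q ∈ Ioc R K, S q / q ≤ 288 * N * D / R + 0 * (2 + log K) + 2 * (288 * D) * K :=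
    sum_div_le_of_sum_le S hS0 hR (by positivity) le_rfl (by positivity)
      fun P _ _ => (large_sieve_farey P N w).trans_eq (by ring)
  have hsplit : ∑ q ∈ Icc 1 K, S q / q ≤ ∑ q ∈ Icc 1 R, S q / q + ∑ q ∈ Ioc R K, S q / q := by
    rw [← sum_union (disjoint_left.2 fun x hx hy => by
      rw [mem_Icc] at hx; rw [mem_Ioc] at hy; omega)]
    refine sum_le_sum_of_subset_of_nonneg (fun x hx => ?_) fun q _ _ => div_nonneg (hS0 q) (by simp)
    rw [mem_union, mem_Icc, mem_Ioc]; rw [mem_Icc] at hx; omega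
  calc _ = ∑ k ∈ Icc 1 K, ∑ d ∈ Icc 1 K, if d ∣ k then S d * (1 / k) else 0 := by
        refine sum_congr rfl fun k hk => ?_
        rw [mem_Icc] at hk
        rw [sum_residue_norm_sq N hk.1, sum_range_div_eq (by omega)
          (fun x => ‖∑ u ∈ Icc 1 N, w u * ee (u * x)‖ ^ 2), ← sum_filter, mul_sum]
        refine sum_congr ?_ fun d _ => mul_comm _ _
        ext d
        simp only [mem_divisors, mem_filter, mem_Icc]
        refine ⟨fun h => ⟨⟨pos_of_dvd_of_pos h.1 hk.1, (le_of_dvd hk.1 h.1).trans hk.2⟩, h.1⟩,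
          fun h => ⟨h.2, by omega⟩⟩
    _ = ∑ d ∈ Icc 1 K, S d * ∑ k ∈ Icc 1 K with d ∣ k, 1 / (k : ℝ) := by
        rw [sum_comm]
        refine sum_congr rfl fun d _ => ?_
        rw [mul_sum, sum_filter]
    _ ≤ ∑ d ∈ Icc 1 K, S d * (1 / d * (1 + log K)) := by
        refine sum_le_sum fun d hd => ?_
        exact mul_le_mul_of_nonneg_left (sum_filter_dvd_inv_le K (mem_Icc.1 hd).1) (hS0 d)
    _ = (1 + log K) * ∑ d ∈ Icc 1 K, S d / d := by
        rw [mul_sum]; exact sum_congr rfl fun d _ => by ring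
    _ ≤ _ := by
        refine mul_le_mul_of_nonneg_left ?_ (one_add_log_nonneg K)
        refine hsplit.trans ?_
        have : 288 * (N / R + 2 * K) * D = 288 * N * D / R + 0 * (2 + log K) + 2 * (288 * D) * K := by
          ring
        linarith

lemma sum_shift_eq {E : Type*} [AddCommMonoid E] {N : ℕ} {H : ℤ → E}
    (hH : ∀ v, v ∉ Icc (1 : ℤ) N → H v = 0) {u : ℕ} (hu : u ≤ N) :
    ∑ b ∈ Icc (-N : ℤ) N, H (u + b) = ∑ v ∈ Icc 1 N, H v := by
  symm
  refine sum_of_injOn (fun v => v - u) (fun v _ w _ h => by simpa using h) ?_ ?_ ?_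
  · intro v hv
    simp only [coe_Icc, Set.mem_Icc] at hv ⊢
    omega
  · intro b hb hb'
    refine hH _ fun h => hb' ?_
    rw [mem_Icc] at h
    refine ⟨(u + b).toNat, ?_, ?_⟩
    · simp only [coe_Icc, Set.mem_Icc]; omega
    · simp only; omega
  · intro v _
    congr 1; ring

/-- The Fourier transform of the autocorrelation of `g` at the shift `b`. -/
def corr (N : ℕ) (g : ℤ → ℝ) (b : ℤ) (θ : ℝ) : ℂ :=
  ∑ u ∈ Icc 1 N, ((g u * g (u + b) : ℝ) : ℂ) * ee (u * θ)

lemma sum_norm_sq_corr_dvd_le {N : ℕ} {g : ℤ → ℝ} (hg : ∀ v, v ∉ Icc (1 : ℤ) N → g v = 0)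
    {k : ℕ} (hk : 0 < k) (θ : ℝ) :
    ∑ b ∈ Icc (-N : ℤ) N with (k : ℤ) ∣ b, ‖corr N g b θ‖ ^ 2 ≤
      ∑ c ∈ Icc (-N : ℤ) N, ∑ r ∈ range k,
        ‖∑ u ∈ Icc 1 N with u % k = r, ((g u * g (u + c) : ℝ) : ℂ)‖ ^ 2 := by
  have hswap : ∀ u ∈ Icc 1 N, ∀ u' ∈ Icc 1 N,
      ∑ b ∈ Icc (-N : ℤ) N with (k : ℤ) ∣ b, (g (u + b) * g (u' + b)) =
      ∑ v ∈ Icc 1 N, if v % k = u % k then g v * g (v + (u' - u)) else 0 := by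
    intro u hu u' _
    have h := sum_shift_eq (H := fun v => if (k : ℤ) ∣ v - u then g v * g (v + (u' - u)) else 0)
      (fun v hv => by simp [hg v hv]) (mem_Icc.1 hu).2
    rw [sum_filter]
    convert h using 2 with b _ v _
    · simp only [(by ring : u + b - u = b), (by ring : u + b + (u' - u) = u' + b)]
    · have : ((k : ℤ) ∣ v - u) ↔ v % k = u % k := by
        rw [← modEq_iff_dvd]; exact eq_comm
      simp only [this]
  have hright : ∀ c, ∑ u ∈ Icc 1 N, ∑ v ∈ Icc 1 N,
      (if v % k = u % k then (g u * g (u + c)) * (g v * g (v + c)) else 0) =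
      ∑ r ∈ range k, ‖∑ u ∈ Icc 1 N with u % k = r, ((g u * g (u + c) : ℝ) : ℂ)‖ ^ 2 := by
    intro c
    rw [← sum_fiberwise_of_maps_to
      fun u _ => mem_range.2 (mod_lt _ hk)]
    refine sum_congr rfl fun r _ => ?_
    rw [← ofReal_sum, norm_real, norm_eq_abs, sq_abs, sq, sum_mul_sum]
    refine sum_congr rfl fun u hu => ?_
    rw [sum_filter (fun v => v % k = r), (mem_filter.1 hu).2]
  have hmain : ((∑ b ∈ Icc (-N : ℤ) N with (k : ℤ) ∣ b, ‖corr N g b θ‖ ^ 2)) =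
      ∑ c ∈ Icc (-N : ℤ) N, ee (-(c * θ)) * ((∑ r ∈ range k,
        ‖∑ u ∈ Icc 1 N with u % k = r, ((g u * g (u + c) : ℝ) : ℂ)‖ ^ 2)) := by
    calc _ = ∑ b ∈ Icc (-N : ℤ) N with (k : ℤ) ∣ b, ∑ u ∈ Icc 1 N, ∑ u' ∈ Icc 1 N,
          ((g u * g u' : ℝ)) * ee (u * θ - u' * θ) * ((g (u + b) * g (u' + b) : ℝ)) := by
          rw [ofReal_sum]
          refine sum_congr rfl fun b _ => ?_
          rw [(fun z => by rw [mul_conj, normSq_eq_norm_sq] : ∀ z, ((‖z‖ ^ 2 : ℝ)) = z * (starRingEnd ℂ) z), corr, map_sum, sum_mul_sum]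
          refine sum_congr rfl fun u _ => sum_congr rfl fun u' _ => ?_
          rw [map_mul, conj_ofReal, conj_ee, sub_eq_add_neg, ee_add]
          push_cast; ring
      _ = ∑ u ∈ Icc 1 N, ∑ u' ∈ Icc 1 N, ((g u * g u' : ℝ)) * ee (u * θ - u' * θ) *
          ((∑ v ∈ Icc 1 N, if v % k = u % k then g v * g (v + (u' - u)) else 0)) := by
          rw [sum_comm]
          refine sum_congr rfl fun u hu => ?_
          rw [sum_comm]
          refine sum_congr rfl fun u' hu' => ?_
          rw [← hswap u hu u' hu', ofReal_sum, mul_sum]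
      _ = ∑ u ∈ Icc 1 N, ∑ c ∈ Icc (-N : ℤ) N, ((g u * g (u + c) : ℝ)) * ee (-(c * θ)) *
          ((∑ v ∈ Icc 1 N, if v % k = u % k then g v * g (v + c) else 0)) := by
          refine sum_congr rfl fun u hu => ?_
          have h := sum_shift_eq (H := fun w => ((g u * g w : ℝ)) * ee (u * θ - w * θ) *
            ((∑ v ∈ Icc 1 N, if v % k = u % k then g v * g (v + (w - u)) else 0)))
            (fun v hv => by simp [hg v hv]) (mem_Icc.1 hu).2
          refine Eq.trans ?_ (h.symm.trans ?_)
          · simp only [Int.cast_natCast]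
          · refine sum_congr rfl fun c _ => ?_
            simp only [(by ring : u + c - u = c), (by push_cast; ring : u * θ - ((u + c : ℤ)) * θ = -(c * θ))]
      _ = _ := by
          rw [sum_comm]
          refine sum_congr rfl fun c _ => ?_
          rw [← hright c, ofReal_sum, mul_sum]
          refine sum_congr rfl fun u _ => ?_
          rw [← mul_comm (ee _), mul_assoc, ← ofReal_mul, mul_sum]
          simp only [mul_ite, mul_zero]
  have h := congrArg norm hmain
  rw [norm_real, norm_of_nonneg (sum_nonneg fun _ _ => by positivity)] at h
  rw [h]
  refine (norm_sum_le _ _).trans (sum_le_sum fun c _ => ?_)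
  rw [norm_mul, norm_ee, one_mul, norm_real,
    norm_of_nonneg (sum_nonneg fun _ _ => by positivity)]

lemma sum_norm_sq_corr_le {N : ℕ} {g : ℤ → ℝ} (hg : ∀ v, v ∉ Icc (1 : ℤ) N → g v = 0) {G : ℝ}
    (hG : ∀ α, ‖∑ n ∈ Icc 1 N, (g n) * ee (n * α)‖ ≤ G) (θ : ℝ) :
    ∑ c ∈ Icc (-N : ℤ) N, ‖corr N g c θ‖ ^ 2 ≤ G ^ 2 * ∑ n ∈ Icc 1 N, g n ^ 2 := by
  set M := 2 * N + 1
  have h1 := parseval_ee (Icc (-N : ℤ) N) id (M := M) (by omega) (fun x hx y hy h => by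
    rw [mem_Icc] at hx hy
    have := Int.eq_zero_of_abs_lt_dvd h (by rw [abs_lt]; simp only [id]; omega)
    simp only [id] at this; omega) (fun c => corr N g c θ)
  have h2 := parseval_ee (Icc 1 N) (fun n => n) (M := M) (by omega) (fun x hx y hy h => by
    rw [mem_Icc] at hx hy
    have := Int.eq_zero_of_abs_lt_dvd h (by rw [abs_lt]; omega)
    omega) (fun n => (g n))
  simp only [id, Int.cast_natCast, norm_real, norm_eq_abs, sq_abs] at h1 h2
  refine le_of_mul_le_mul_left ?_ (by positivity : (0 : ℝ) < M)
  rw [← h1, mul_left_comm, ← h2, mul_sum]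
  refine sum_le_sum fun a _ => ?_
  have h3 : ∑ c ∈ Icc (-N : ℤ) N, corr N g c θ * ee (c * (a / M)) =
      (∑ u ∈ Icc 1 N, (g u) * ee (u * (θ - a / M))) *
        ∑ v ∈ Icc 1 N, (g v) * ee (v * (a / M)) := by
    simp_rw [corr, sum_mul]
    rw [sum_comm]
    refine sum_congr rfl fun u hu => ?_
    rw [mul_sum]
    refine Eq.trans ?_ ((sum_shift_eq (H := fun w => (g u) * ee (u * (θ - a / M)) * ((g w) * ee (w * (a / M)))) (fun v hv => by simp [hg v hv]) (mem_Icc.1 hu).2).trans ?_)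
    · refine sum_congr rfl fun c _ => ?_
      have : u * (θ - a / M) + ((u + c : ℤ)) * (a / M) = u * θ + c * (a / M) := by
        push_cast; ring
      rw [mul_mul_mul_comm, ← ee_add, this, ee_add]
      push_cast; ring
    · simp only [Int.cast_natCast]
  rw [h3, norm_mul, mul_pow]
  gcongr
  exact hG _

/-- An upper bound for the number of divisors of `b` among the integers from `1` to `K`. -/
def shiftWeight (K : ℕ) (b : ℤ) : ℝ := (if b = 0 then (K : ℝ) else 0) + tau b.natAbs

lemma shiftWeight_nonneg (K : ℕ) (b : ℤ) : 0 ≤ shiftWeight K b := by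
  unfold shiftWeight; positivity

lemma sum_sum_dvd_le_shiftWeight (K : ℕ) (s : Finset ℤ) (X : ℤ → ℝ) (hX : ∀ b, 0 ≤ X b) :
    ∑ k ∈ Icc 1 K, ∑ b ∈ s with (k : ℤ) ∣ b, X b ≤ ∑ b ∈ s, shiftWeight K b * X b := by
  simp_rw [sum_filter]
  rw [sum_comm]
  refine sum_le_sum fun b _ => ?_
  rw [← sum_filter, sum_const, nsmul_eq_mul]
  refine mul_le_mul_of_nonneg_right ?_ (hX b)
  rw [shiftWeight]
  split_ifs with hb
  · exact (mod_cast ((card_filter_le _ _).trans (by simp)) : (#{k ∈ Icc 1 K | ((k : ℕ) : ℤ) ∣ b} : ℝ) ≤ K).trans (le_add_of_nonneg_right (cast_nonneg _))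
  · rw [zero_add, cast_le]
    refine card_le_card fun k hk => ?_
    rw [mem_divisors]
    exact ⟨Int.natCast_dvd.1 (mem_filter.1 hk).2, by simpa using hb⟩

lemma sum_shiftWeight_le (N K : ℕ) :
    ∑ b ∈ Icc (-N : ℤ) N, shiftWeight K b ≤ K + 2 * N * (1 + log N) ^ 2 := by
  simp_rw [shiftWeight]
  rw [sum_add_distrib]
  refine add_le_add ?_ ?_
  · rw [sum_ite_eq']; split_ifs <;> simp
  rw [← sum_fiberwise_of_maps_to (g := Int.natAbs) (t := insert 0 (Icc 1 N)) (fun b hb => by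
    rw [mem_Icc] at hb; rw [mem_insert, mem_Icc]; omega), sum_insert (by simp)]
  rw [sum_eq_zero fun b hb => by rw [(mem_filter.1 hb).2]; simp [tau], zero_add]
  have h1 := sum_tau_pow_le N 1
  simp only [pow_one] at h1
  rw [mul_assoc]
  refine le_trans ?_ (mul_le_mul_of_nonneg_left h1 (by norm_num))
  rw [mul_sum]
  refine sum_le_sum fun n _ => ?_
  rw [sum_congr rfl (fun b hb => by rw [(mem_filter.1 hb).2]), sum_const, nsmul_eq_mul]
  refine mul_le_mul_of_nonneg_right ?_ (by positivity)
  have : #{b ∈ Icc (-N : ℤ) N | b.natAbs = n} ≤ #{(n : ℤ), -(n : ℤ)} := by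
    refine card_le_card fun b hb => ?_
    rw [mem_insert, mem_singleton]
    have := (mem_filter.1 hb).2
    omega
  exact_mod_cast this.trans card_le_two

lemma sum_shiftWeight_mul_le {N K : ℕ} {g : ℤ → ℝ}
    (hg : ∀ v, v ∉ Icc (1 : ℤ) N → g v = 0) :
    ∑ b ∈ Icc (-N : ℤ) N, shiftWeight K b * ∑ u ∈ Icc 1 N, (g u * g (u + b)) ^ 2 ≤
      (K + 2 * N * (1 + log N) ^ 2) * ∑ n ∈ Icc 1 N, g n ^ 4 := by
  have hW := sum_shiftWeight_le N K
  have h1 : ∑ b ∈ Icc (-N : ℤ) N, shiftWeight K b * ∑ u ∈ Icc 1 N, g u ^ 4 ≤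
      (K + 2 * N * (1 + log N) ^ 2) * ∑ n ∈ Icc 1 N, g n ^ 4 := by
    rw [← sum_mul]
    exact mul_le_mul_of_nonneg_right hW (sum_nonneg fun _ _ => by positivity)
  have h2 : ∑ b ∈ Icc (-N : ℤ) N, shiftWeight K b * ∑ u ∈ Icc 1 N, g (u + b) ^ 4 ≤
      (K + 2 * N * (1 + log N) ^ 2) * ∑ n ∈ Icc 1 N, g n ^ 4 := by
    simp_rw [mul_sum]
    rw [sum_comm]
    calc _ = ∑ u ∈ Icc 1 N, ∑ v ∈ Icc 1 N, shiftWeight K (v - u) * g v ^ 4 := by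
          refine sum_congr rfl fun u hu => ?_
          rw [← sum_shift_eq (H := fun v => shiftWeight K (v - u) * g v ^ 4)
            (fun v hv => by simp [hg v hv]) (mem_Icc.1 hu).2]
          exact sum_congr rfl fun b _ => by rw [add_sub_cancel_left]
      _ = ∑ v ∈ Icc 1 N, (∑ u ∈ Icc 1 N, shiftWeight K (v - u)) * g v ^ 4 := by
          rw [sum_comm]; exact sum_congr rfl fun v _ => by rw [sum_mul]
      _ ≤ _ := by
          refine sum_le_sum fun v hv => mul_le_mul_of_nonneg_right (le_trans ?_ hW) (by positivity)
          rw [← sum_image (s := Icc 1 N) (g := fun u => (v : ℤ) - u)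
            (fun x _ y _ h => by simpa using h)]
          refine sum_le_sum_of_subset_of_nonneg (fun b hb => ?_) fun b _ _ => shiftWeight_nonneg K b
          obtain ⟨u, hu, rfl⟩ := mem_image.1 hb
          rw [mem_Icc] at hu hv ⊢
          omega
  have h3 : ∑ b ∈ Icc (-N : ℤ) N, shiftWeight K b * ∑ u ∈ Icc 1 N, (g u * g (u + b)) ^ 2 ≤
      (∑ b ∈ Icc (-N : ℤ) N, shiftWeight K b * ∑ u ∈ Icc 1 N, g u ^ 4 +
      ∑ b ∈ Icc (-N : ℤ) N, shiftWeight K b * ∑ u ∈ Icc 1 N, g (u + b) ^ 4) / 2 := by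
    rw [← sum_add_distrib, sum_div]
    refine sum_le_sum fun b _ => ?_
    rw [← mul_add, ← sum_add_distrib, mul_div_assoc, sum_div]
    refine mul_le_mul_of_nonneg_left (sum_le_sum fun u _ => ?_) (shiftWeight_nonneg K b)
    nlinarith [sq_nonneg (g u ^ 2 - g (u + b) ^ 2)]
  linarith

/-- The fourth-moment correlation controlling a bilinear sum over two progressions. -/
def corrEnergy (N : ℕ) (g : ℤ → ℝ) (k1 k2 : ℕ) : ℝ :=
  ∑ b ∈ Icc (-N : ℤ) N with (k2 : ℤ) ∣ b, ∑ r ∈ range k1,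
    ‖∑ u ∈ Icc 1 N with u % k1 = r, ((g u * g (u + b) : ℝ) : ℂ)‖ ^ 2

lemma sum_norm_sq_corr_zero {N : ℕ} {g : ℤ → ℝ} (hg : ∀ v, v ∉ Icc (1 : ℤ) N → g v = 0) :
    ∑ c ∈ Icc (-N : ℤ) N, ∑ u ∈ Icc 1 N, (g u * g (u + c)) ^ 2 = (∑ n ∈ Icc 1 N, g n ^ 2) ^ 2 := by
  rw [sum_comm, sq, sum_mul]
  refine sum_congr rfl fun u hu => ?_
  rw [← sum_shift_eq (H := fun v => g v ^ 2) (fun v hv => by simp [hg v hv]) (mem_Icc.1 hu).2, mul_sum]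
  exact sum_congr rfl fun c _ => mul_pow _ _ _

lemma sum_totient_filter_le {R : ℕ} {c : ℝ} (F : ℕ → ℕ → ℝ) (hc : 0 ≤ c) (hF : ∀ q b, F q b ≤ c) :
    ∑ q ∈ Icc 1 R, (∑ b ∈ range q with q.Coprime b, F q b) / q ≤ R * c := by
  calc _ ≤ ∑ q ∈ Icc 1 R, c := by
        refine sum_le_sum fun q hq => ?_
        rw [div_le_iff₀ (mod_cast (mem_Icc.1 hq).1)]
        calc _ ≤ ∑ b ∈ range q with q.Coprime b, c := sum_le_sum fun b _ => hF q b
          _ ≤ c * q := by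
              rw [sum_const, nsmul_eq_mul, mul_comm]
              gcongr
              exact (card_filter_le _ _).trans (by simp)
    _ = _ := by simp

lemma sum_corrEnergy_le {N K : ℕ} {g : ℤ → ℝ} (hg : ∀ v, v ∉ Icc (1 : ℤ) N → g v = 0) {G : ℝ}
    (hG : ∀ α, ‖∑ n ∈ Icc 1 N, (g n) * ee (n * α)‖ ≤ G) {R R' : ℕ} (hR : 1 ≤ R)
    (hR' : 1 ≤ R') :
    ∑ k1 ∈ Icc 1 K, ∑ k2 ∈ Icc 1 K, corrEnergy N g k1 k2 ≤
      (1 + log K) * (R * ((1 + log K) * (R' * (G ^ 2 * ∑ n ∈ Icc 1 N, g n ^ 2) +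
        288 * (N / R' + 2 * K) * (∑ n ∈ Icc 1 N, g n ^ 2) ^ 2)) +
        288 * (N / R + 2 * K) * ((K + 2 * N * (1 + log N) ^ 2) * ∑ n ∈ Icc 1 N, g n ^ 4)) := by
  set I := Icc (-N : ℤ) N
  have hG0 := (norm_nonneg _).trans (hG 0)
  have hstar : ∀ {P : ℕ}, 1 ≤ P → ∀ b, ∑ k ∈ Icc 1 K, ∑ r ∈ range k,
      ‖∑ u ∈ Icc 1 N with u % k = r, ((g u * g (u + b) : ℝ) : ℂ)‖ ^ 2 ≤
      (1 + log K) * (∑ q ∈ Icc 1 P, (∑ a ∈ range q with q.Coprime a,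
        ‖corr N g b (a / q)‖ ^ 2) / q +
        288 * (N / P + 2 * K) * ∑ u ∈ Icc 1 N, (g u * g (u + b)) ^ 2) := by
    intro P hP b
    refine (sum_sum_residue_norm_sq_le N K hP _).trans_eq ?_
    rw [(fun b => sum_congr rfl fun u _ => by rw [norm_real, norm_eq_abs, sq_abs] : ∀ b, ∑ u ∈ Icc 1 N, ‖((g u * g (u + b) : ℝ) : ℂ)‖ ^ 2 = ∑ u ∈ Icc 1 N, (g u * g (u + b)) ^ 2)]; rfl
  have hpush : ∀ (s : Finset ℤ) (P : ℕ), ∑ b ∈ s, ∑ q ∈ Icc 1 P,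
      (∑ a ∈ range q with q.Coprime a, ‖corr N g b (a / q)‖ ^ 2) / q =
      ∑ q ∈ Icc 1 P, (∑ a ∈ range q with q.Coprime a, ∑ b ∈ s, ‖corr N g b (a / q)‖ ^ 2) / q := by
    intro s P
    rw [sum_comm]
    refine sum_congr rfl fun q _ => ?_
    rw [← sum_div, sum_comm]
  set Y : ℝ := (1 + log K) * (R' * (G ^ 2 * ∑ n ∈ Icc 1 N, g n ^ 2) +
        288 * (N / R' + 2 * K) * (∑ n ∈ Icc 1 N, g n ^ 2) ^ 2) with hY
  have hY0 : 0 ≤ Y := by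
    refine mul_nonneg (one_add_log_nonneg K) (add_nonneg (mul_nonneg (by positivity)
      (mul_nonneg (by positivity) (sum_nonneg fun _ _ => by positivity))) (by positivity))
  have hYle : ∀ θ, ∑ k ∈ Icc 1 K, ∑ b ∈ I with (k : ℤ) ∣ b, ‖corr N g b θ‖ ^ 2 ≤ Y := by
    intro θ
    calc _ ≤ ∑ k ∈ Icc 1 K, ∑ c ∈ I, ∑ r ∈ range k,
          ‖∑ u ∈ Icc 1 N with u % k = r, ((g u * g (u + c) : ℝ) : ℂ)‖ ^ 2 :=
          sum_le_sum fun k hk => sum_norm_sq_corr_dvd_le hg (mem_Icc.1 hk).1 θ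
      _ ≤ ∑ c ∈ I, (1 + log K) * (∑ q ∈ Icc 1 R', (∑ a ∈ range q with q.Coprime a,
          ‖corr N g c (a / q)‖ ^ 2) / q +
          288 * (N / R' + 2 * K) * ∑ u ∈ Icc 1 N, (g u * g (u + c)) ^ 2) := by
          rw [sum_comm]
          exact sum_le_sum fun c _ => hstar hR' c
      _ ≤ Y := by
          rw [← mul_sum, sum_add_distrib, ← mul_sum, sum_norm_sq_corr_zero hg, hpush, hY]
          gcongr
          exact sum_totient_filter_le _ (mul_nonneg (by positivity)
            (sum_nonneg fun _ _ => by positivity)) fun q a => sum_norm_sq_corr_le hg hG _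
  calc _ ≤ ∑ k2 ∈ Icc 1 K, ∑ b ∈ I with (k2 : ℤ) ∣ b,
        (1 + log K) * (∑ q ∈ Icc 1 R, (∑ a ∈ range q with q.Coprime a,
        ‖corr N g b (a / q)‖ ^ 2) / q +
        288 * (N / R + 2 * K) * ∑ u ∈ Icc 1 N, (g u * g (u + b)) ^ 2) := by
        rw [sum_comm]
        refine sum_le_sum fun k2 _ => ?_
        simp_rw [corrEnergy]
        rw [sum_comm]
        exact sum_le_sum fun b _ => hstar hR b
    _ = (1 + log K) * (∑ q ∈ Icc 1 R, (∑ a ∈ range q with q.Coprime a,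
        ∑ k ∈ Icc 1 K, ∑ b ∈ I with (k : ℤ) ∣ b, ‖corr N g b (a / q)‖ ^ 2) / q +
        288 * (N / R + 2 * K) * ∑ k ∈ Icc 1 K, ∑ b ∈ I with (k : ℤ) ∣ b,
          ∑ u ∈ Icc 1 N, (g u * g (u + b)) ^ 2) := by
        simp_rw [← mul_sum, sum_add_distrib, ← mul_sum, hpush]
        congr 2
        rw [sum_comm]
        refine sum_congr rfl fun q _ => ?_
        rw [← sum_div, sum_comm]
    _ ≤ _ := by
        gcongr
        · exact sum_totient_filter_le _ hY0 fun q a => hYle _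
        · exact (sum_sum_dvd_le_shiftWeight K I _ fun b => sum_nonneg fun _ _ => by positivity).trans
            (sum_shiftWeight_mul_le hg)

lemma card_filter_dvd_dvd_le {k1 k2 N : ℕ} (hk1 : 0 < k1) (hk2 : 0 < k2) (hkN : k1 * k2 ≤ N)
    (a b : ℤ) :
    (#{n ∈ Icc 1 N | (k1 : ℤ) ∣ (n : ℕ) - a ∧ (k2 : ℤ) ∣ n - b} : ℝ) ≤
      2 * N * (k1.gcd k2 / (k1 * k2)) := by
  have hN := (Nat.mul_pos hk1 hk2).trans_le hkN
  have hm := lcm_pos hk1 hk2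
  have hk1r : 0 < k1 := mod_cast hk1
  have hk2r : 0 < k2 := mod_cast hk2
  rcases eq_empty_or_nonempty {n ∈ Icc 1 N | (k1 : ℤ) ∣ (n : ℕ) - a ∧ (k2 : ℤ) ∣ n - b} with
    h | ⟨n0, h0⟩
  · rw [h, card_empty, cast_zero]; positivity
  · have h1 : {n ∈ Icc 1 N | (k1 : ℤ) ∣ (n : ℕ) - a ∧ (k2 : ℤ) ∣ n - b} ⊆
        {n ∈ Ioc 0 N | ((k1.lcm k2) : ℤ) ∣ n - n0} := by
      intro n hn
      simp only [mem_filter, mem_Icc, mem_Ioc] at hn h0 ⊢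
      refine ⟨⟨by omega, hn.1.2⟩, ?_⟩
      rw [Int.natCast_dvd]
      refine Nat.lcm_dvd ?_ ?_ <;> rw [← Int.natCast_dvd]
      · simpa using dvd_sub hn.2.1 h0.2.1
      · simpa using dvd_sub hn.2.2 h0.2.2
    calc _ ≤ (((N - 0) / k1.lcm k2 + 1 : ℕ) : ℝ) := mod_cast ((card_le_card h1).trans (card_filter_dvd_sub_le hm.ne' n0 0 N))
      _ ≤ N / k1.lcm k2 + N / k1.lcm k2 := by
          push_cast
          gcongr
          · exact cast_div_le
          · rw [le_div_iff₀ (mod_cast hm), one_mul]; exact_mod_cast ((le_of_dvd (Nat.mul_pos hk1 hk2) (Nat.lcm_dvd_mul _ _)).trans hkN)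
      _ = _ := by rw [← (mod_cast Nat.gcd_mul_lcm k1 k2 : (k1.gcd k2 : ℝ) * k1.lcm k2 = k1 * k2)]; field_simp; norm_num

lemma card_filter_dvd_le {k N : ℕ} (hk : 0 < k) (hkN : k ≤ N) (a : ℤ) :
    (#{n ∈ Icc 1 N | (k : ℤ) ∣ (n : ℕ) - a} : ℝ) ≤ 2 * N / k := by
  simpa [div_eq_mul_inv] using (card_filter_dvd_dvd_le (N := N) hk one_pos (by rwa [mul_one]) a 0)

lemma pow_four_sum_progressions_le {N k1 k2 : ℕ} {g : ℤ → ℝ}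
    (hg : ∀ v, v ∉ Icc (1 : ℤ) N → g v = 0) (hk1 : 0 < k1) (hk2 : 0 < k2) (hkN : k1 * k2 ≤ N)
    (l1 l2 : ℤ) {f1 f2 : ℕ → ℝ} {ℓ : ℝ} (hf1 : ∀ n ∈ Icc 1 N, |f1 n| ≤ ℓ)
    (hf2 : ∀ n ∈ Icc 1 N, |f2 n| ≤ ℓ) :
    (∑ n1 ∈ Icc 1 N with (k1 : ℤ) ∣ (n1 : ℕ) - l1, ∑ n2 ∈ Icc 1 N with (k2 : ℤ) ∣ (n2 : ℕ) - l2,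
      f1 n1 * f2 n2 * g (N - n1 - n2)) ^ 4 ≤
      32 * ℓ ^ 8 * N ^ 5 * ((1 / (k1 * k2)) ^ 2 * (k1.gcd k2 / (k1 * k2)) *
        corrEnergy N g k1 k2) := by
  have hℓ := (abs_nonneg _).trans (hf1 1 (mem_Icc.2 ⟨le_rfl, ((Nat.mul_pos hk1 hk2).trans_le hkN)⟩))
  set A1 := {n ∈ Icc 1 N | (k1 : ℤ) ∣ (n : ℕ) - l1} with hA1
  set A2 := {n ∈ Icc 1 N | (k2 : ℤ) ∣ (n : ℕ) - l2} with hA2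
  set B1 := {n ∈ Icc (-N : ℤ) N | (k1 : ℤ) ∣ n - l1} with hB1
  set h : ℤ → ℝ := fun n => ∑ n2 ∈ A2, f2 n2 * g (N - n - n2) with hh
  set v : ℤ → ℕ → ℝ := fun b r =>
    ‖∑ u ∈ Icc 1 N with u % k1 = r, ((g u * g (u + b) : ℝ) : ℂ)‖ ^ 2 with hv
  have hv0 : ∀ b r, 0 ≤ v b r := fun b r => by positivity
  set W : ℕ → ℕ → ℝ := fun m n => ∑ x ∈ B1, g (N - x - m) * g (N - x - n) with hW
  set ρ : ℕ → ℕ := fun n => ((N - l1 - n) % k1).toNat with hρ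
  have hsq : ∀ {f : ℕ → ℝ} {A : Finset ℕ} {c : ℝ}, A ⊆ Icc 1 N → (∀ n ∈ Icc 1 N, |f n| ≤ ℓ) →
      (#A) ≤ c → ∑ n ∈ A, f n ^ 2 ≤ c * ℓ ^ 2 := by
    intro f A c hA hf hc
    calc _ ≤ ∑ n ∈ A, ℓ ^ 2 := sum_le_sum fun n hn => by
          rw [← sq_abs]; exact pow_le_pow_left₀ (abs_nonneg _) (hf n (hA hn)) 2
      _ ≤ _ := by rw [sum_const, nsmul_eq_mul]; gcongr
  have hT : (∑ n1 ∈ A1, ∑ n2 ∈ A2, f1 n1 * f2 n2 * g (N - n1 - n2)) ^ 2 ≤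
      (2 * N / k1 * ℓ ^ 2) * ∑ n ∈ B1, h n ^ 2 := by
    simp_rw [mul_assoc, ← mul_sum]
    refine (sum_mul_sq_le_sq_mul_sq A1 f1 (fun n => h n)).trans ?_
    have : ∑ n ∈ A1, h n ^ 2 ≤ ∑ n ∈ B1, h n ^ 2 := by
      rw [← sum_image (s := A1) (g := fun n => n) (f := fun n => h n ^ 2)
        (fun x _ y _ e => by simpa using e)]
      refine sum_le_sum_of_subset_of_nonneg (fun x hx => ?_) fun _ _ _ => sq_nonneg _
      obtain ⟨n, hn, rfl⟩ := mem_image.1 hx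
      simp only [hA1, hB1, mem_filter, mem_Icc] at hn ⊢
      exact ⟨by omega, hn.2⟩
    rw [← mul_assoc]
    exact mul_le_mul (hsq (filter_subset _ _) hf1 (card_filter_dvd_le hk1 ((Nat.le_mul_of_pos_right _ hk2).trans hkN) l1)) this (sum_nonneg fun _ _ => sq_nonneg _) (by positivity)
  have hH : ∑ n ∈ B1, h n ^ 2 = ∑ p ∈ A2 ×ˢ A2, (f2 p.1 * f2 p.2) * W p.1 p.2 := by
    rw [sum_product]
    simp_rw [hW, mul_sum, hh, sq, sum_mul_sum]
    rw [sum_comm]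
    refine sum_congr rfl fun m _ => ?_
    rw [sum_comm]
    exact sum_congr rfl fun n _ => sum_congr rfl fun x _ => by ring
  have hWv : ∀ m ∈ A2, ∀ n ∈ A2, W m n ^ 2 = v (n - m) (ρ n) := by
    intro m _ n hn
    have h2 : W m n = ∑ u ∈ Icc 1 N with u % k1 = ρ n, g u * g (u + (n - m)) := by
      rw [sum_filter]
      refine Eq.trans ?_ ((sum_shift_eq (H := fun u => if (k1 : ℤ) ∣ (N - n - u) - l1 then g u * g (u + (n - m)) else 0) (fun u hu => by simp [hg u hu]) (sub_le N n)).trans (sum_congr rfl fun u _ => ?_))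
      · simp only [hW, hB1]
        rw [sum_filter]
        refine sum_nbij' (fun x => -x) (fun x => -x) ?_ ?_ ?_ ?_ ?_
        · intro x hx; rw [mem_Icc] at hx ⊢; omega
        · intro x hx; rw [mem_Icc] at hx ⊢; omega
        · simp
        · simp
        · intro x _
          rw [cast_sub (mem_Icc.1 (mem_filter.1 hn).1).2]
          have e1 : N - n - (N - n + -x) - l1 = x - l1 := by ring
          simp only [e1]
          rw [(by ring : N - n + -x = N - x - n), (by ring : N - x - n + (n - m) = N - x - m), mul_comm]
      · have : ((k1 : ℤ) ∣ (N - n - u) - l1) ↔ u % k1 = ρ n := by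
          have e0 : 0 ≤ (N - l1 - n) % k1 := Int.emod_nonneg _ (mod_cast hk1.ne')
          rw [show N - n - u - l1 = (N - l1 - n) - u by ring, ← Int.modEq_iff_dvd, Int.ModEq]
          simp only [hρ]
          omega
        simp only [this]
    rw [h2]
    simp only [hv]
    rw [← ofReal_sum, norm_real, norm_eq_abs, sq_abs]
  have hWsum : ∑ p ∈ A2 ×ˢ A2, W p.1 p.2 ^ 2 ≤
      2 * N * (k1.gcd k2 / (k1 * k2)) * corrEnergy N g k1 k2 := by
    set I := {b ∈ Icc (-N : ℤ) N | (k2 : ℤ) ∣ b} with hI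
    calc _ = ∑ n ∈ A2, ∑ m ∈ A2, v (n - m) (ρ n) := by
          rw [sum_product_right]
          exact sum_congr rfl fun n hn => sum_congr rfl fun m hm => hWv m hm n hn
      _ ≤ ∑ n ∈ A2, ∑ b ∈ I, v b (ρ n) := by
          refine sum_le_sum fun n hn => ?_
          rw [← sum_image (s := A2) (g := fun m => n - m) (f := fun b => v b (ρ n))
            (fun x _ y _ e => by simpa using e)]
          refine sum_le_sum_of_subset_of_nonneg (fun x hx => ?_) fun _ _ _ => hv0 _ _
          obtain ⟨m, hm, rfl⟩ := mem_image.1 hx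
          simp only [hA2, hI, mem_filter, mem_Icc] at hn hm ⊢
          refine ⟨by omega, ?_⟩
          simpa using dvd_sub hn.2 hm.2
      _ = ∑ b ∈ I, ∑ r ∈ range k1, (#{n ∈ A2 | ρ n = r}) * v b r := by
          rw [sum_comm]
          refine sum_congr rfl fun b _ => ?_
          rw [← sum_fiberwise_of_maps_to (g := ρ) (fun n _ => ?_)]
          · refine sum_congr rfl fun r _ => ?_
            rw [sum_congr rfl (fun n hn => by rw [(mem_filter.1 hn).2]), sum_const, nsmul_eq_mul]
          · have := Int.emod_lt_of_pos (N - l1 - n) (mod_cast hk1 : (0 : ℤ) < k1)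
            have e0 : (0 : ℤ) ≤ (N - l1 - n) % k1 := Int.emod_nonneg _ (by omega)
            rw [mem_range]; simp only [hρ]; omega
      _ ≤ ∑ b ∈ I, ∑ r ∈ range k1, 2 * N * (k1.gcd k2 / (k1 * k2)) * v b r := by
          refine sum_le_sum fun b _ => sum_le_sum fun r _ =>
            mul_le_mul_of_nonneg_right ?_ (hv0 b r)
          refine le_trans ?_ (card_filter_dvd_dvd_le hk1 hk2 hkN (N - l1 - r) l2)
          refine cast_le.2 (card_le_card fun n hn => ?_)
          simp only [hA2, mem_filter] at hn ⊢
          refine ⟨hn.1.1, ?_, hn.1.2⟩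
          have e0 : 0 ≤ (N - l1 - n) % k1 := Int.emod_nonneg _ (by omega)
          have e1 : r = (N - l1 - n) % k1 := by
            rw [← hn.2]; simp only [hρ]; omega
          rw [show n - (N - l1 - r) = r - (N - l1 - n) by ring]
          exact Int.dvd_sub_self_of_emod_eq e1.symm
      _ = _ := by simp_rw [← mul_sum]; rfl
  have hH2 : (∑ n ∈ B1, h n ^ 2) ^ 2 ≤ (2 * N / k2 * ℓ ^ 2) ^ 2 *
      (2 * N * (k1.gcd k2 / (k1 * k2)) * corrEnergy N g k1 k2) := by
    rw [hH]
    refine (sum_mul_sq_le_sq_mul_sq (A2 ×ˢ A2) (fun p => f2 p.1 * f2 p.2)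
      (fun p => W p.1 p.2)).trans ?_
    refine mul_le_mul ?_ hWsum (sum_nonneg fun _ _ => sq_nonneg _) (by positivity)
    rw [sum_product]
    simp_rw [mul_pow]
    rw [← sum_mul_sum, ← sq, ← mul_pow]
    exact pow_le_pow_left₀ (sum_nonneg fun _ _ => sq_nonneg _) (hsq (filter_subset _ _) hf2 (card_filter_dvd_le hk2 ((Nat.le_mul_of_pos_left _ hk1).trans hkN) l2)) 2
  calc _ = ((∑ n1 ∈ A1, ∑ n2 ∈ A2, f1 n1 * f2 n2 * g (N - n1 - n2)) ^ 2) ^ 2 := by ring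
    _ ≤ ((2 * N / k1 * ℓ ^ 2) * ∑ n ∈ B1, h n ^ 2) ^ 2 := by gcongr
    _ = (2 * N / k1 * ℓ ^ 2) ^ 2 * (∑ n ∈ B1, h n ^ 2) ^ 2 := by rw [mul_pow]
    _ ≤ (2 * N / k1 * ℓ ^ 2) ^ 2 * ((2 * N / k2 * ℓ ^ 2) ^ 2 *
      (2 * N * (k1.gcd k2 / (k1 * k2)) * corrEnergy N g k1 k2)) := by gcongr
    _ = _ := by
        have : k1 ≠ 0 := mod_cast hk1.ne'
        have : k2 ≠ 0 := mod_cast hk2.ne'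
        field_simp; ring

lemma sum_filter_dvd_tau_pow_div_le (K j : ℕ) {d : ℕ} (hd : 0 < d) :
    ∑ k ∈ Icc 1 K with d ∣ k, (tau k : ℝ) ^ j / k ≤
      (tau d) ^ j / d * (1 + log K) ^ 2 ^ j := by
  rw [sum_filter_dvd_Icc K hd]
  calc _ ≤ ∑ i ∈ Icc 1 (K / d), (tau d : ℝ) ^ j / d * ((tau i) ^ j / i) := by
        refine sum_le_sum fun i _ => ?_
        have : (tau (d * i) : ℝ) ≤ tau d * tau i := mod_cast tau_mul_le d i
        rw [div_mul_div_comm, ← mul_pow, cast_mul]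
        gcongr
    _ ≤ _ := by
        rw [← mul_sum]
        gcongr
        refine (sum_le_sum_of_subset_of_nonneg (Icc_subset_Icc_right (Nat.div_le_self K d))
          fun _ _ _ => by positivity).trans (sum_tau_pow_div_le K j)

lemma sum_tau_pow_mul_gcd_div_le (K j : ℕ) :
    ∑ k1 ∈ Icc 1 K, ∑ k2 ∈ Icc 1 K,
      (tau k1 : ℝ) ^ j * (tau k2) ^ j * (k1.gcd k2 / (k1 * k2)) ≤
      (1 + log K) ^ (2 * 2 ^ j + 2 ^ (2 * j)) := by
  calc _ ≤ ∑ k1 ∈ Icc 1 K, ∑ k2 ∈ Icc 1 K, ∑ d ∈ Icc 1 K,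
        d * ((if d ∣ k1 then (tau k1 : ℝ) ^ j / k1 else 0) *
          (if d ∣ k2 then (tau k2 : ℝ) ^ j / k2 else 0)) := by
        refine sum_le_sum fun k1 h1 => sum_le_sum fun k2 h2 => ?_
        rw [mem_Icc] at h1 h2
        refine le_trans (le_of_eq ?_) (single_le_sum (f := fun d => d *
          ((if d ∣ k1 then (tau k1 : ℝ) ^ j / k1 else 0) *
          (if d ∣ k2 then (tau k2 : ℝ) ^ j / k2 else 0))) (fun d _ => by positivity) (mem_Icc.2 ⟨gcd_pos_of_pos_left _ h1.1, (gcd_le_left _ h1.1).trans h1.2⟩ : k1.gcd k2 ∈ Icc 1 K))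
        simp only [Nat.gcd_dvd_left, Nat.gcd_dvd_right, if_true]
        ring
    _ = ∑ d ∈ Icc 1 K, d * (∑ k ∈ Icc 1 K with d ∣ k, (tau k : ℝ) ^ j / k) ^ 2 := by
        simp_rw [sum_comm (t := Icc 1 K) (f := fun k2 d => (d : ℝ) * _)]
        rw [sum_comm]
        refine sum_congr rfl fun d _ => ?_
        simp_rw [← mul_sum]
        rw [sq, sum_filter, sum_mul_sum]
        simp_rw [← mul_sum]
    _ ≤ ∑ d ∈ Icc 1 K, (1 + log K) ^ (2 * 2 ^ j) * ((tau d) ^ (2 * j) / d) := by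
        refine sum_le_sum fun d hd => ?_
        have hd0 : 0 < d := mod_cast (mem_Icc.1 hd).1
        calc _ ≤ d * ((tau d) ^ j / d * (1 + log K) ^ 2 ^ j) ^ 2 := by
              have := sum_filter_dvd_tau_pow_div_le K j (mem_Icc.1 hd).1
              gcongr
          _ = _ := by rw [mul_pow, div_pow, ← pow_mul, ← pow_mul, mul_comm 2, mul_comm 2]; field_simp
    _ ≤ _ := by
        rw [← mul_sum, pow_add]
        have := one_add_log_nonneg K
        gcongr
        exact sum_tau_pow_div_le K (2 * j)

lemma corrEnergy_nonneg (N : ℕ) (g : ℤ → ℝ) (k1 k2 : ℕ) : 0 ≤ corrEnergy N g k1 k2 :=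
  sum_nonneg fun _ _ => sum_nonneg fun _ _ => by positivity

lemma sum_abs_le_of_pow_four_le {N K : ℕ} {g : ℤ → ℝ} {T : ℕ → ℕ → ℝ} {ℓ V ρ : ℝ} (hV : 0 < V)
    (hρ : 0 ≤ ρ) (hρV : 32 * ℓ ^ 8 * N ^ 5 * V ≤ ρ ^ 4)
    (hsum : ∑ k1 ∈ Icc 1 K, ∑ k2 ∈ Icc 1 K, corrEnergy N g k1 k2 ≤ V)
    (hT : ∀ k1 ∈ Icc 1 K, ∀ k2 ∈ Icc 1 K, T k1 k2 ^ 4 ≤ 32 * ℓ ^ 8 * N ^ 5 *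
      ((1 / (k1 * k2)) ^ 2 * (k1.gcd k2 / (k1 * k2)) * corrEnergy N g k1 k2)) :
    ∑ k1 ∈ Icc 1 K, ∑ k2 ∈ Icc 1 K, |T k1 k2| ≤
      ρ * ((1 + log K) ^ 2 + (1 + log K) ^ 3 + 1) := by
  calc _ ≤ ∑ k1 ∈ Icc 1 K, ∑ k2 ∈ Icc 1 K, ρ * (1 / k1 * (1 / k2) +
        (tau k1) ^ 0 * (tau k2) ^ 0 * (k1.gcd k2 / (k1 * k2)) +
          corrEnergy N g k1 k2 / V) := by
        refine sum_le_sum fun k1 h1 => sum_le_sum fun k2 h2 => ?_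
        have hx : (0 : ℝ) ≤ 1 / (k1 * k2) := by positivity
        have hy : (0 : ℝ) ≤ k1.gcd k2 / (k1 * k2) := by positivity
        have hz : 0 ≤ corrEnergy N g k1 k2 / V := div_nonneg (corrEnergy_nonneg _ _ _ _) hV.le
        rw [pow_zero, pow_zero, one_mul, one_mul, div_mul_div_comm, one_mul]
        have h := hT k1 h1 k2 h2
        set x := (1 : ℝ) / (k1 * k2)
        set y := (k1.gcd k2 : ℝ) / (k1 * k2)
        obtain ⟨z, hzV⟩ : ∃ z, z = corrEnergy N g k1 k2 / V := ⟨_, rfl⟩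
        rw [← hzV] at hz ⊢
        rw [(by rw [hzV]; field_simp : corrEnergy N g k1 k2 = z * V)] at h
        refine le_of_pow_le_pow_left₀ four_ne_zero (by positivity) ?_
        rw [← abs_pow, abs_of_nonneg (by positivity)]
        calc _ ≤ _ := h
          _ = (32 * ℓ ^ 8 * N ^ 5 * V) * (x ^ 2 * y * z) := by ring
          _ ≤ ρ ^ 4 * ((x + y + z) ^ 2 * (x + y + z) * (x + y + z)) := by
              gcongr <;> linarith
          _ = _ := by ring
    _ = ρ * ((∑ k ∈ Icc 1 K, 1 / (k : ℝ)) ^ 2 + ∑ k1 ∈ Icc 1 K, ∑ k2 ∈ Icc 1 K,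
        (tau k1 : ℝ) ^ 0 * (tau k2) ^ 0 * (k1.gcd k2 / (k1 * k2)) +
          (∑ k1 ∈ Icc 1 K, ∑ k2 ∈ Icc 1 K, corrEnergy N g k1 k2) / V) := by
        simp_rw [← mul_sum, sum_add_distrib, ← sum_div]
        rw [sq, sum_mul_sum]
    _ ≤ _ := by
        have h1 := sum_inv_le_log K
        gcongr
        · exact sum_tau_pow_mul_gcd_div_le K 0
        · rwa [div_le_one hV]

/-- The difference between the logarithmic prime indicator and its model on `[1, N]`. -/
def modelError (N Q : ℕ) (v : ℤ) : ℝ :=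
  if v ∈ Icc (1 : ℤ) N then logPrime v.toNat - primeModel Q v else 0

lemma modelError_natCast {N Q n : ℕ} (hn : n ∈ Icc 1 N) :
    modelError N Q n = logPrime n - primeModel Q n := by
  rw [mem_Icc] at hn
  rw [modelError, if_pos (by rw [mem_Icc]; omega), Int.toNat_natCast]

lemma norm_sum_mul_ee_le {u : ℕ → ℂ} {N : ℕ} {E : ℝ} (hu : ∀ y ≤ N, ‖∑ n ∈ Icc 1 y, u n‖ ≤ E)
    (β : ℝ) : ‖∑ n ∈ Icc 1 N, u n * ee (n * β)‖ ≤ (1 + 7 * (N * |β|)) * E := by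
  have hz : ‖ee β - 1‖ ≤ 7 * |β| := by
    have e : ee β = Complex.exp (I * (2 * pi * β : ℝ)) := by
      rw [ee]; congr 1; push_cast; ring
    rw [e]
    refine (norm_exp_I_mul_ofReal_sub_one_le (x := 2 * pi * β)).trans ?_
    rw [norm_eq_abs, abs_mul, abs_of_pos (by positivity)]
    have := pi_lt_d2
    gcongr
    linarith
  have key : ∀ y ≤ N, ‖∑ n ∈ Icc 1 y, u n * ee (n * β) - (∑ n ∈ Icc 1 y, u n) * ee (y * β)‖ ≤
      y * (7 * |β| * E) := by
    intro y
    induction y with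
    | zero => simp
    | succ y ih =>
      intro hy
      have e : ∑ n ∈ Icc 1 (y + 1), u n * ee (n * β) -
          (∑ n ∈ Icc 1 (y + 1), u n) * ee ((y + 1 : ℕ) * β) =
          (∑ n ∈ Icc 1 y, u n * ee (n * β) - (∑ n ∈ Icc 1 y, u n) * ee (y * β)) -
          (∑ n ∈ Icc 1 y, u n) * ee (y * β) * (ee β - 1) := by
        rw [sum_Icc_succ_top (by omega), sum_Icc_succ_top (by omega)]
        have : ee ((y + 1 : ℕ) * β) = ee (y * β) * ee β := by
          rw [← ee_add]; congr 1; push_cast; ring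
        rw [this]; ring
      rw [e]
      refine (norm_sub_le _ _).trans ?_
      rw [norm_mul, norm_mul, norm_ee, mul_one]
      have h1 := ih (by omega)
      have h2 := mul_le_mul (hu y (by omega)) hz (norm_nonneg _)
        ((norm_nonneg _).trans (hu y (by omega)))
      push_cast
      linarith
  have h1 := key N le_rfl
  have h2 : ‖(∑ n ∈ Icc 1 N, u n) * ee (N * β)‖ ≤ E := by
    rw [norm_mul, norm_ee, mul_one]; exact hu N le_rfl
  have h3 := norm_add_le (∑ n ∈ Icc 1 N, u n * ee (n * β) - (∑ n ∈ Icc 1 N, u n) * ee (N * β))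
    ((∑ n ∈ Icc 1 N, u n) * ee (N * β))
  rw [sub_add_cancel] at h3
  linarith

lemma norm_sum_logPrime_ee_sub_le {q N : ℕ} (hq : 0 < q) {E : ℝ}
    (hE : ∀ l, ∀ y ≤ N, |∑ n ∈ Icc 1 y with (q : ℤ) ∣ (n : ℕ) - l, logPrime n -
      (if Int.gcd q l = 1 then (y : ℝ) / φ q else 0)| ≤ E) {a : ℤ} (ha : IsCoprime a q)
    {y : ℕ} (hy : y ≤ N) :
    ‖∑ n ∈ Icc 1 y, ((logPrime n) * ee (n * (a / q)) -
      ((μ q) / φ q : ℝ))‖ ≤ q * E := by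
  have hq' : q ≠ 0 := by positivity
  have h1 : ∑ n ∈ Icc 1 y, (logPrime n) * ee (n * (a / q)) =
      ∑ l ∈ range q, ee (a * (l / q)) *
        ((∑ n ∈ Icc 1 y with (q : ℤ) ∣ (n : ℕ) - l, logPrime n)) := by
    rw [← sum_fiberwise_of_maps_to
      (fun n _ => mem_range.2 (mod_lt _ hq))]
    refine sum_congr rfl fun l hl => ?_
    simp only [(fun n => by rw [← Int.modEq_iff_dvd, Int.natCast_modEq_iff, ModEq, mod_eq_of_lt (mem_range.1 hl), eq_comm] : ∀ n, n % q = l ↔ (q : ℤ) ∣ n - l)]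
    rw [ofReal_sum, mul_sum]
    refine sum_congr rfl fun n hn => ?_
    obtain ⟨c, hc⟩ := (mem_filter.1 hn).2
    have : (n : ℝ) * (a / q) = a * (l / q) + (a * c : ℤ) := by
      have : (n : ℝ) - l = q * c := mod_cast hc
      rw [show (n : ℝ) = l + q * c by linarith]
      push_cast; field_simp
    rw [this, ee_add_int, mul_comm]
  have h2 : y * ((μ q) / φ q : ℝ) =
      ∑ l ∈ range q, ee (a * (l / q)) *
        ((if Int.gcd q l = 1 then (y : ℝ) / φ q else 0)) := by
    have h := sum_coprime_ee a hq
    rw [ramanujanSum_of_coprime hq.ne' ha] at h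
    calc _ = ((μ q) : ℂ) * (y / φ q) := by
          push_cast; ring
      _ = _ := by
          push_cast at h ⊢
          rw [← h, sum_mul, sum_filter]
          refine sum_congr rfl fun l _ => ?_
          rw [Int.gcd_natCast_natCast]
          by_cases h : q.gcd l = 1 <;> simp [Coprime, h]
  rw [sum_sub_distrib, sum_const, card_Icc, Nat.add_sub_cancel, nsmul_eq_mul, h1, h2,
    ← sum_sub_distrib]
  refine (norm_sum_le _ _).trans ((sum_le_card_nsmul _ _ E fun l _ => ?_).trans (by simp))
  rw [← mul_sub, norm_mul, norm_ee, one_mul, ← ofReal_sub, norm_real]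
  exact hE l y hy

lemma norm_sum_primeModel_ee_sub_le {N Q M q : ℕ} (hq : 0 < q) (hM : 2 * Q ≤ M) {α : ℝ} {a : ℤ}
    (ha : IsCoprime a q) (hα : |α - a / q| ≤ 1 / (q * M)) :
    ‖∑ n ∈ Icc 1 N, (primeModel Q n) * ee (n * α) -
      if q ≤ Q then ((μ q) / φ q : ℝ) *
        ∑ n ∈ Icc 1 N, ee (n * (α - a / q)) else 0‖ ≤ q * Q ^ 2 := by
  set S : ℝ → ℂ := fun x => ∑ n ∈ Icc 1 N, ee (n * x) with hS
  set c : ℕ → ℝ := fun r => (μ r) / φ r with hc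
  have h1 : ∑ n ∈ Icc 1 N, (primeModel Q n) * ee (n * α) =
      ∑ r ∈ Icc 1 Q, c r * ∑ b ∈ range r with r.Coprime b, S (α + b / r) := by
    simp_rw [hS, primeModel, ofReal_sum, sum_mul]
    rw [sum_comm]
    refine sum_congr rfl fun r hr => ?_
    rw [sum_comm, mul_sum]
    refine sum_congr rfl fun n _ => ?_
    rw [ofReal_mul, ← sum_coprime_ee n (mem_Icc.1 hr).1, mul_assoc, sum_mul]
    congr 1
    refine sum_congr rfl fun b _ => ?_
    rw [← ee_add]; congr 1; push_cast; ring
  have h2 : (if q ≤ Q then (c q) * S (α - a / q) else 0) =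
      ∑ r ∈ Icc 1 Q, (c r) * ∑ b ∈ range r with r.Coprime b,
        if r = q ∧ (q : ℤ) ∣ a + b then S (α - a / q) else 0 := by
    have hb : ∑ b ∈ range q with q.Coprime b, (if (q : ℤ) ∣ a + b then S (α - a / q) else 0) =
        S (α - a / q) := by
      have hqz : (0 : ℤ) < q := mod_cast hq
      have e0 := Int.emod_nonneg (-a) hqz.ne'
      have e1 := Int.emod_lt_of_pos (-a) hqz
      have e2 : (q : ℤ) ∣ a + (-a) % q := by
        rw [Int.dvd_iff_emod_eq_zero, Int.add_emod_emod, add_neg_cancel, Int.zero_emod]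
      rw [sum_eq_single ((-a) % q).toNat]
      · rw [Int.toNat_of_nonneg e0, if_pos e2]
      · intro b hb hne
        refine if_neg fun h => hne ?_
        have hbq := mem_range.1 (mem_filter.1 hb).1
        obtain ⟨t, ht⟩ := h
        have : (-a) % q = b := by
          rw [show -a = b + q * (-t) by linarith, Int.add_mul_emod_self_left]
          exact Int.emod_eq_of_lt (by omega) (by omega)
        omega
      · intro h
        refine absurd (mem_filter.2 ⟨mem_range.2 (by omega), ?_⟩) h
        rw [← isCoprime_iff_coprime, Int.toNat_of_nonneg e0]
        obtain ⟨t, ht⟩ := e2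
        rw [show (-a) % q = -a + q * t by linarith]
        exact (IsCoprime.add_mul_left_right (ha.symm.neg_right) t)
    split_ifs with hqQ
    · rw [sum_eq_single_of_mem q (mem_Icc.2 ⟨hq, hqQ⟩) (fun r _ hr => by simp [hr])]
      simp only [true_and]
      rw [hb]
    · refine (sum_eq_zero fun r hr => ?_).symm
      have : r ≠ q := by rintro rfl; exact hqQ (mem_Icc.1 hr).2
      simp [this]
  rw [h1, h2, ← sum_sub_distrib]
  have h3 : ∀ r ∈ Icc 1 Q, ‖(c r) * ∑ b ∈ range r with r.Coprime b, S (α + b / r) -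
      (c r) * ∑ b ∈ range r with r.Coprime b,
        if r = q ∧ (q : ℤ) ∣ a + b then S (α - a / q) else 0‖ ≤ q * Q := by
    intro r hr
    have hr1 := (mem_Icc.1 hr).1
    have hrr : 0 < r := mod_cast hr1
    rw [← mul_sub, ← sum_sub_distrib, norm_mul, norm_real]
    have hb : ∀ b ∈ {b ∈ range r | r.Coprime b}, ‖S (α + b / r) -
        if r = q ∧ (q : ℤ) ∣ a + b then S (α - a / q) else 0‖ ≤ q * Q := by
      intro b hb
      split_ifs with h
      · obtain ⟨rfl, t, ht⟩ := h
        have e : S (α + b / r) = S (α - a / r) := by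
          refine sum_congr rfl fun n _ => ?_
          have : n * (α + b / r) = n * (α - a / r) + (n * t : ℤ) := by
            have : (a : ℝ) + b = r * t := mod_cast ht
            push_cast
            rw [show (b : ℝ) = r * t - a by linarith]
            field_simp; ring
          rw [this, ee_add_int]
        rw [e, sub_self, norm_zero]; positivity
      · rw [sub_zero]
        have hδ : ∀ m : ℤ, 1 / (2 * (q * r)) ≤ |α + b / r - m| := by
          intro m
          have hne : a * r + b * q - m * (q * r) ≠ 0 := by
            intro h0
            have hrq := Nat.dvd_antisymm (mod_cast ((isCoprime_iff_coprime.2 (mem_filter.1 hb).2).dvd_of_dvd_mul_left ⟨m * q - a, by linarith⟩ : (r : ℤ) ∣ q)) (mod_cast (ha.symm.dvd_of_dvd_mul_left ⟨m * r - b, by linarith⟩ : (q : ℤ) ∣ r))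
            subst hrq
            exact h ⟨rfl, m, mul_left_cancel₀ (by omega : (r : ℤ) ≠ 0)
              (by linarith)⟩
          have h5 : (1 : ℝ) ≤ |(a * r + b * q - m * (q * r))| := by
            exact_mod_cast Int.one_le_abs hne
          have h6 : 1 / (q * r) ≤ |(a / q + b / r - m : ℝ)| := by
            rw [show (a / q + b / r - m : ℝ) = ((a * r + b * q - m * (q * r))) / (q * r) by
              push_cast; field_simp, abs_div, abs_of_pos (by positivity : (0 : ℝ) < q * r)]
            push_cast at h5 ⊢
            gcongr
          have h7 : 1 / (q * M : ℝ) ≤ 1 / (2 * (q * r)) := by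
            have : (2 * r : ℝ) ≤ M := mod_cast (by have := (mem_Icc.1 hr).2; omega)
            apply one_div_le_one_div_of_le (by positivity)
            nlinarith
          have h8 : |(a / q + b / r - m : ℝ)| ≤ |α + b / r - m| + |α - a / q| := by
            rw [show (a / q + b / r - m) = (α + b / r - m) - (α - a / q) by ring]
            exact abs_sub _ _
          have h9 : (1 : ℝ) / (q * r) = 1 / (2 * (q * r)) + 1 / (2 * (q * r)) := by
            field_simp; norm_num
          linarith
        refine ((norm_geom_sum_ee_le (by positivity) hδ 1 (N + 1)).trans (le_of_eq ?_)).trans (mul_le_mul_of_nonneg_left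
          (mod_cast (mem_Icc.1 hr).2 : (r : ℝ) ≤ Q) (mod_cast hq : (0 : ℝ) < q).le)
        field_simp
    calc _ ≤ 1 / (φ r : ℝ) * (φ r * (q * Q)) := by
          gcongr
          · rw [hc, norm_eq_abs, abs_div, abs_of_pos (mod_cast totient_pos.2 hr1 : (0 : ℝ) < r.totient)]
            gcongr
            exact abs_moebius_le_one_real r
          · refine (norm_sum_le _ _).trans ((sum_le_card_nsmul _ _ _ hb).trans (le_of_eq ?_))
            rw [nsmul_eq_mul, totient_eq_card_coprime]
      _ = _ := by field_simp
  refine (norm_sum_le _ _).trans ((sum_le_card_nsmul _ _ _ h3).trans (le_of_eq ?_))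
  rw [nsmul_eq_mul, card_Icc, Nat.add_sub_cancel]; ring

/-- The exponential sum of `modelError` is uniformly small. -/
lemma norm_sum_modelError_ee_le {N Q M W : ℕ} {E : ℝ} (hN : 1 ≤ N) (hQ : 1 ≤ Q) (hM : 2 * Q ≤ M)
    (hW : 1 ≤ W) (hWQ : 2 * (W * W) ≤ Q)
    (hE : ∀ q ∈ Icc 1 Q, ∀ l, ∀ y ≤ N, |∑ n ∈ Icc 1 y with (q : ℤ) ∣ (n : ℕ) - l, logPrime n -
      (if Int.gcd q l = 1 then (y : ℝ) / φ q else 0)| ≤ E) (α : ℝ) :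
    ‖∑ n ∈ Icc 1 N, (modelError N Q n) * ee (n * α)‖ ≤
      M * Q ^ 2 + (1 + 7 * (N / M)) * (Q * E) + (2 * √N * log N + (W * log N +
        3 * (W * W) * log N * M + 4 * (1 + log N) ^ 5 *
          √(288 * N * (2 * N / Q + 6 * N / W + 2 * M)))) := by
  have hMpos : 0 < M := by omega
  have hE0 := (abs_nonneg _).trans (hE 1 (mem_Icc.2 ⟨le_rfl, hQ⟩) 0 0 (Nat.zero_le _))
  have hlog := log_natCast_nonneg N
  obtain ⟨t, ht1, ht2⟩ := exists_rat_abs_sub_le_and_den_le α hMpos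
  set q := t.den
  have hq := t.den_pos
  have hqr : 0 < q := mod_cast hq
  have hMr : (0 : ℝ) < M := mod_cast hMpos
  have hqM : q ≤ M := mod_cast ht2
  have ha : IsCoprime t.num q := by
    rw [Int.isCoprime_iff_nat_coprime, Int.natAbs_natCast]; exact t.reduced
  have hα : |α - t.num / q| ≤ 1 / (q * M) := by
    rw [← Rat.cast_def]
    refine ht1.trans ?_
    rw [mul_comm (q : ℝ)]
    gcongr
    linarith
  have hmodel := norm_sum_primeModel_ee_sub_le (N := N) hq hM ha hα
  have hg : ∑ n ∈ Icc 1 N, (modelError N Q n) * ee (n * α) =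
      ∑ n ∈ Icc 1 N, (logPrime n) * ee (n * α) -
        ∑ n ∈ Icc 1 N, (primeModel Q n) * ee (n * α) := by
    rw [← sum_sub_distrib]
    refine sum_congr rfl fun n hn => ?_
    rw [modelError_natCast hn, ofReal_sub, sub_mul]
  have hqQ2 : (q * Q ^ 2 : ℝ) ≤ M * Q ^ 2 := by gcongr
  rw [hg]
  split_ifs at hmodel with hqQ
  · have hβ : N * |α - t.num / q| ≤ N / M := by
      rw [div_eq_mul_one_div (N : ℝ)]
      refine mul_le_mul_of_nonneg_left ?_ (cast_nonneg _)
      refine hα.trans (one_div_le_one_div_of_le hMr ?_)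
      exact le_mul_of_one_le_left hMr.le (mod_cast hq)
    have h1 := norm_sum_mul_ee_le (fun y hy => norm_sum_logPrime_ee_sub_le hq
      (hE q (mem_Icc.2 ⟨hq, hqQ⟩)) ha hy) (α - t.num / q)
    have h2 : ∑ n ∈ Icc 1 N, ((logPrime n) * ee (n * (t.num / q)) -
        ((μ q) / φ q : ℝ)) * ee (n * (α - t.num / q)) =
        ∑ n ∈ Icc 1 N, (logPrime n) * ee (n * α) -
        ((μ q) / φ q : ℝ) *
          ∑ n ∈ Icc 1 N, ee (n * (α - t.num / q)) := by
      rw [mul_sum, ← sum_sub_distrib]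
      refine sum_congr rfl fun n _ => ?_
      rw [sub_mul, mul_assoc, ← ee_add]
      congr 4; ring
    rw [h2] at h1
    have h3 := norm_sub_le_norm_sub_add_norm_sub
      (∑ n ∈ Icc 1 N, (logPrime n) * ee (n * α))
      (((μ q) / φ q : ℝ) *
          ∑ n ∈ Icc 1 N, ee (n * (α - t.num / q)))
      (∑ n ∈ Icc 1 N, (primeModel Q n) * ee (n * α))
    rw [norm_sub_rev] at hmodel
    have h4 : (1 + 7 * (N * |α - t.num / q|)) * (q * E) ≤ (1 + 7 * (N / M)) * (Q * E) := by
      gcongr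
    have h5 : 0 ≤ 2 * √N * log N + (W * log N +
        3 * (W * W) * log N * M + 4 * (1 + log N) ^ 5 *
          √(288 * N * (2 * N / Q + 6 * N / W + 2 * M))) := by positivity
    linarith
  · rw [sub_zero] at hmodel
    push Not at hqQ
    have h1 := norm_sum_vonMangoldt_ee_le hq ha (hα.trans (by rw [sq]; gcongr)) hW (hWQ.trans hqQ.le) hN
    have h2 : ‖∑ n ∈ Icc 1 N, (Λ n) * ee (n * α) -
        ∑ n ∈ Icc 1 N, (logPrime n) * ee (n * α)‖ ≤ 2 * √N * log N := by
      rw [← sum_sub_distrib]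
      refine (norm_sum_le _ _).trans ((sum_le_sum fun n _ => ?_).trans
        (sum_vonMangoldt_sub_logPrime_le N))
      rw [← sub_mul, norm_mul, norm_ee, mul_one, ← ofReal_sub, norm_real,
        norm_of_nonneg (sub_nonneg.2 (logPrime_le_vonMangoldt n))]
    have h3 := norm_sub_le (∑ n ∈ Icc 1 N, (logPrime n) * ee (n * α))
        (∑ n ∈ Icc 1 N, (primeModel Q n) * ee (n * α))
    rw [norm_sub_rev] at h2
    have h4 := norm_le_norm_add_norm_sub' (∑ n ∈ Icc 1 N, (logPrime n) * ee (n * α))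
      (∑ n ∈ Icc 1 N, (Λ n) * ee (n * α))
    have h5 : W * log N + 3 * (W * W) * log N * q + 4 * (1 + log N) ^ 5 *
        √(288 * N * (2 * N / q + 6 * N / W + 2 * q)) ≤ W * log N +
        3 * (W * W) * log N * M + 4 * (1 + log N) ^ 5 *
          √(288 * N * (2 * N / Q + 6 * N / W + 2 * M)) := by
      gcongr
    have h6 : 0 ≤ (1 + 7 * (N / M)) * (Q * E) := by positivity
    linarith

/-- The reduced residues modulo `q` that are compatible with the progression `l` modulo `k`. -/
def compatible (k : ℕ) (l : ℤ) (q : ℕ) : Finset ℕ :=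
  {r ∈ range q | q.Coprime r ∧ ((k.gcd q : ℕ) : ℤ) ∣ (r : ℕ) - l}

lemma abs_sum_logPrime_inter_sub_le {k q N : ℕ} {l : ℤ}
    (hl : Int.gcd k l = 1) {E : ℝ}
    (hE : ∀ c, ∀ y ≤ N, |∑ n ∈ Icc 1 y with ((k.lcm q) : ℤ) ∣ (n : ℕ) - c, logPrime n -
      (if Int.gcd (k.lcm q) c = 1 then (y : ℝ) / (k.lcm q).totient else 0)| ≤ E)
    {r : ℕ} (hr : r < q) {y : ℕ} (hy : y ≤ N) :
    |∑ n ∈ Icc 1 y with (k : ℤ) ∣ (n : ℕ) - l ∧ (q : ℤ) ∣ n - r, logPrime n -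
      (if r ∈ compatible k l q then (y : ℝ) / (k.lcm q).totient else 0)| ≤ E := by
  by_cases h : ((k.gcd q) : ℤ) ∣ r - l
  · obtain ⟨s, t, hst⟩ : ∃ s t, (r - l) = k * s + q * t := by
      obtain ⟨w, hw⟩ := h
      exact ⟨k.gcdA q * w, k.gcdB q * w, by rw [hw, gcd_eq_gcd_ab]; ring⟩
    have hset : ∀ n, ((k : ℤ) ∣ n - l ∧ (q : ℤ) ∣ n - r) ↔
        ((k.lcm q) : ℤ) ∣ n - (l + k * s) := by
      intro n
      have e1 : (k : ℤ) ∣ n - l ↔ (k : ℤ) ∣ n - (l + k * s) := by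
        rw [← sub_sub, dvd_sub_left (dvd_mul_right (k : ℤ) s)]
      have e2 : (q : ℤ) ∣ n - r ↔ (q : ℤ) ∣ n - (l + k * s) := by
        rw [show n - (l + k * s) = n - r - q * -t by linarith,
          dvd_sub_left (dvd_mul_right (q : ℤ) (-t))]
      rw [e1, e2]
      simp only [Int.natCast_dvd, Nat.lcm_dvd_iff]
    have hc : Int.gcd (k.lcm q) (l + k * s) = 1 ↔ r ∈ compatible k l q := by
      have e2 : IsCoprime (q : ℤ) (l + k * s) ↔ q.Coprime r := by
        rw [show l + k * s = r + q * (-t) by linarith, IsCoprime.add_mul_left_right_iff,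
          isCoprime_iff_coprime]
      rw [compatible, mem_filter, mem_range, ← e2, ← Int.isCoprime_iff_gcd_eq_one]
      constructor
      · intro h1
        exact ⟨hr, h1.of_isCoprime_of_dvd_left (mod_cast Nat.dvd_lcm_right k q), h⟩
      · intro h1
        exact ((IsCoprime.add_mul_left_right (Int.isCoprime_iff_gcd_eq_one.2 hl) s).mul_left h1.2.1).of_isCoprime_of_dvd_left
          (mod_cast Nat.lcm_dvd_mul k q)
    have h1 := hE (l + k * s) y hy
    simp only [hset, ← hc]
    exact h1
  · have h2 : {n ∈ Icc 1 y | (k : ℤ) ∣ (n : ℕ) - l ∧ (q : ℤ) ∣ n - r} = ∅ := by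
      refine filter_eq_empty_iff.2 fun n _ hn => h ?_
      simpa using dvd_sub ((Int.natCast_dvd_natCast.2 (Nat.gcd_dvd_left k q)).trans hn.1) ((Int.natCast_dvd_natCast.2 (Nat.gcd_dvd_right k q)).trans hn.2)
    rw [h2, sum_empty, if_neg fun h1 => h (mem_filter.1 h1).2.2, sub_zero, abs_zero]
    exact (abs_nonneg _).trans (hE 0 0 (Nat.zero_le _))

/-- Primes in a progression, weighted by a periodic function. -/
lemma abs_sum_logPrime_mul_periodic_sub_le {k q N : ℕ} (hq : 0 < q) {l : ℤ}
    (hl : Int.gcd k l = 1) {E : ℝ}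
    (hE : ∀ c, ∀ y ≤ N, |∑ n ∈ Icc 1 y with ((k.lcm q) : ℤ) ∣ (n : ℕ) - c, logPrime n -
      (if Int.gcd (k.lcm q) c = 1 then (y : ℝ) / (k.lcm q).totient else 0)| ≤ E)
    {ψ : ℤ → ℝ} (hψ : ∀ m n, (q : ℤ) ∣ m - n → ψ m = ψ n) {c : ℝ} (hc : ∀ n, |ψ n| ≤ c)
    {a b : ℕ} (ha : 1 ≤ a) (hb : b ≤ N) :
    |∑ n ∈ Icc a b with (k : ℤ) ∣ (n : ℕ) - l, logPrime n * ψ n -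
      #(Icc a b) * ((∑ r ∈ compatible k l q, ψ r) / (k.lcm q).totient)| ≤ 2 * (q * (c * E)) := by
  have hc0 := (abs_nonneg _).trans (hc 0)
  have hE0 := (abs_nonneg _).trans (hE 0 0 (Nat.zero_le _))
  set D := (∑ r ∈ compatible k l q, ψ r) / (k.lcm q).totient with hD
  have key : ∀ y ≤ N, |∑ n ∈ Icc 1 y with (k : ℤ) ∣ (n : ℕ) - l, logPrime n * ψ n - y * D| ≤
      q * (c * E) := by
    intro y hy
    have h1 : ∑ n ∈ Icc 1 y with (k : ℤ) ∣ (n : ℕ) - l, logPrime n * ψ n =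
        ∑ r ∈ range q, ψ r * ∑ n ∈ Icc 1 y with (k : ℤ) ∣ (n : ℕ) - l ∧
          (q : ℤ) ∣ n - r, logPrime n := by
      rw [← sum_fiberwise_of_maps_to
        (fun n _ => mem_range.2 (mod_lt _ hq))]
      refine sum_congr rfl fun r hr => ?_
      simp only [(fun n => by rw [← Int.modEq_iff_dvd, Int.natCast_modEq_iff, ModEq, mod_eq_of_lt (mem_range.1 hr), eq_comm] : ∀ n, n % q = r ↔ (q : ℤ) ∣ n - r), filter_filter, mul_sum]
      refine sum_congr rfl fun n hn => ?_
      rw [hψ n r (mem_filter.1 hn).2.2, mul_comm]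
    have h2 : y * D = ∑ r ∈ range q, ψ r *
        (if r ∈ compatible k l q then (y : ℝ) / (k.lcm q).totient else 0) := by
      simp only [mul_ite, mul_zero]
      rw [← sum_filter, hD, ← sum_mul, show {r ∈ range q | r ∈ compatible k l q} =
        compatible k l q by
          ext r; simp only [compatible, mem_filter]; tauto]
      ring
    rw [h1, h2, ← sum_sub_distrib]
    refine (abs_sum_le_sum_abs _ _).trans
      ((sum_le_card_nsmul _ _ (c * E) fun r hr => ?_).trans (by simp))
    rw [← mul_sub, abs_mul]
    exact mul_le_mul (hc r) (abs_sum_logPrime_inter_sub_le hl hE (mem_range.1 hr) hy)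
      (abs_nonneg _) hc0
  rcases le_or_gt a b with hab | hab
  · obtain ⟨a, rfl⟩ : ∃ a', a = a' + 1 := ⟨a - 1, by omega⟩
    have h1 : ∑ n ∈ Icc (a + 1) b with (k : ℤ) ∣ (n : ℕ) - l, logPrime n * ψ n =
        ∑ n ∈ Icc 1 b with (k : ℤ) ∣ (n : ℕ) - l, logPrime n * ψ n -
        ∑ n ∈ Icc 1 a with (k : ℤ) ∣ (n : ℕ) - l, logPrime n * ψ n := by
      rw [eq_sub_iff_add_eq, ← sum_union]
      · refine sum_congr ?_ fun _ _ => rfl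
        rw [← filter_union]
        congr 1
        ext n; simp only [mem_union, mem_Icc]; omega
      · refine disjoint_filter_filter (disjoint_left.2 fun n h1 h2 => ?_)
        rw [mem_Icc] at h1 h2; omega
    have h2 : (#(Icc (a + 1) b) : ℝ) = b - a := by
      rw [card_Icc, Nat.add_sub_add_right, cast_sub (by omega)]
    rw [h1, h2]
    have k1 := abs_le.1 (key b hb)
    have k2 := abs_le.1 (key a (by omega))
    rw [abs_le]
    constructor <;> linarith
  · rw [Icc_eq_empty (by omega)]
    simp only [filter_empty, sum_empty, card_empty, cast_zero, zero_mul, sub_zero, abs_zero]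
    positivity

lemma filter_add_lt_eq_Icc {a b n N : ℕ} (ha : 1 ≤ a) :
    {m ∈ Icc a b | n + m < N} = Icc a (min b (N - 1 - n)) := by
  ext m; simp only [mem_filter, mem_Icc]; omega

/-- Two primes in progressions, weighted by a periodic function of `N` minus their sum. -/
lemma abs_sum_sum_logPrime_mul_periodic_sub_le {k1 k2 q N : ℕ} (hk1 : 0 < k1) (hk2 : 0 < k2)
    (hq : 0 < q) {l1 l2 : ℤ} (hl1 : Int.gcd k1 l1 = 1) (hl2 : Int.gcd k2 l2 = 1) {E : ℕ → ℝ}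
    (hE : ∀ k : ℕ, k ≠ 0 → ∀ c, ∀ y ≤ N, |∑ n ∈ Icc 1 y with (k : ℤ) ∣ (n : ℕ) - c, logPrime n -
      (if Int.gcd k c = 1 then (y : ℝ) / φ k else 0)| ≤ E k)
    {ψ : ℤ → ℝ} (hψ : ∀ m n, (q : ℤ) ∣ m - n → ψ m = ψ n) {c : ℝ} (hc : ∀ n, |ψ n| ≤ c)
    {a1 b1 a2 b2 : ℕ} (ha1 : 1 ≤ a1) (hb1 : b1 ≤ N) (ha2 : 1 ≤ a2) (hb2 : b2 ≤ N) :
    |∑ n1 ∈ Icc a1 b1 with (k1 : ℤ) ∣ (n1 : ℕ) - l1, ∑ n2 ∈ Icc a2 b2 with (k2 : ℤ) ∣ (n2 : ℕ) - l2,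
      logPrime n1 * logPrime n2 * (if n1 + n2 < N then ψ (N - n1 - n2) else 0) -
      (∑ m2 ∈ Icc a2 b2, (#{m1 ∈ Icc a1 b1 | m1 + m2 < N} : ℝ)) *
        ((∑ r1 ∈ compatible k1 l1 q, ∑ r2 ∈ compatible k2 l2 q, ψ (N - r1 - r2)) /
          ((k1.lcm q).totient * (k2.lcm q).totient))| ≤
      (∑ n ∈ Icc 1 N with (k1 : ℤ) ∣ (n : ℕ) - l1, logPrime n) * (2 * (q * (c * E (k2.lcm q)))) +
        N * (2 * (q * (q * c / φ k2 * E (k1.lcm q)))) := by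
  have hm1 := (lcm_pos hk1 hq).ne'
  have hm2 := (lcm_pos hk2 hq).ne'
  have hc0 := (abs_nonneg _).trans (hc 0)
  have hE0 : ∀ {m}, m ≠ 0 → 0 ≤ E m := fun hm =>
    (abs_nonneg _).trans (hE _ hm 0 0 (Nat.zero_le _))
  set D : ℤ → ℝ := fun n =>
    (∑ r2 ∈ compatible k2 l2 q, ψ (N - n - r2)) / (k2.lcm q).totient with hD
  have hDper : ∀ m n, (q : ℤ) ∣ m - n → D m = D n := by
    intro m n h
    simp only [hD]
    congr 1
    refine sum_congr rfl fun r _ => hψ _ _ ?_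
    rw [show N - m - r - (N - n - r) = -(m - n) by ring]
    exact (dvd_neg).2 h
  have hφ2 : 0 < k2.totient := mod_cast totient_pos.2 hk2
  have hφle : (φ k2) ≤ (k2.lcm q).totient := by
    exact_mod_cast le_of_dvd (totient_pos.2 (lcm_pos hk2 hq))
      (totient_dvd_of_dvd (Nat.dvd_lcm_left k2 q))
  have hDle : ∀ n, |D n| ≤ q * c / φ k2 := by
    intro n
    simp only [hD]
    rw [abs_div, abs_cast]
    gcongr
    refine (abs_sum_le_sum_abs _ _).trans ((sum_le_card_nsmul _ _ c fun r _ => hc _).trans ?_)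
    rw [nsmul_eq_mul]
    gcongr
    exact (card_filter_le _ _).trans (by simp)
  have hinner : ∀ n1, |∑ n2 ∈ Icc a2 b2 with (k2 : ℤ) ∣ (n2 : ℕ) - l2,
      logPrime n2 * (if n1 + n2 < N then ψ (N - n1 - n2) else 0) -
      #{m2 ∈ Icc a2 b2 | n1 + m2 < N} * D n1| ≤ 2 * (q * (c * E (k2.lcm q))) := by
    intro n1
    have h := abs_sum_logPrime_mul_periodic_sub_le hq hl2 (hE _ hm2) (fun m n h => hψ _ _ (by
        rw [show N - n1 - m - (N - n1 - n) = -(m - n) by ring]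
        exact (dvd_neg).2 h)) (fun n => hc _) ha2 ((min_le_left b2 (N - 1 - n1)).trans hb2)
    rw [← filter_add_lt_eq_Icc ha2] at h
    convert h using 3
    simp only [mul_ite, mul_zero]
    rw [← sum_filter, filter_filter, filter_filter]
    exact sum_congr (filter_congr fun _ _ => and_comm) fun _ _ => rfl
  have houter : ∀ m2, |∑ n1 ∈ Icc a1 b1 with (k1 : ℤ) ∣ (n1 : ℕ) - l1,
      logPrime n1 * (if n1 + m2 < N then D n1 else 0) -
      #{m1 ∈ Icc a1 b1 | m1 + m2 < N} * ((∑ r1 ∈ compatible k1 l1 q, D r1) /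
        (k1.lcm q).totient)| ≤ 2 * (q * (q * c / φ k2 * E (k1.lcm q))) := by
    intro m2
    have h := abs_sum_logPrime_mul_periodic_sub_le hq hl1 (hE _ hm1) hDper hDle ha1
      ((min_le_left b1 (N - 1 - m2)).trans hb1)
    rw [← filter_add_lt_eq_Icc ha1] at h
    simp only [add_comm m2] at h
    convert h using 3
    simp only [mul_ite, mul_zero]
    rw [← sum_filter, filter_filter, filter_filter]
    exact sum_congr (filter_congr fun _ _ => and_comm) fun _ _ => rfl
  set A1 := {n1 ∈ Icc a1 b1 | (k1 : ℤ) ∣ (n1 : ℕ) - l1} with hA1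
  have hDsum : (∑ r1 ∈ compatible k1 l1 q, ∑ r2 ∈ compatible k2 l2 q, ψ (N - r1 - r2)) /
      ((k1.lcm q).totient * (k2.lcm q).totient) =
      (∑ r1 ∈ compatible k1 l1 q, D r1) / (k1.lcm q).totient := by
    simp only [hD]
    rw [← sum_div, div_div, mul_comm]
  have hsplit : ∑ n1 ∈ A1, ∑ n2 ∈ Icc a2 b2 with (k2 : ℤ) ∣ (n2 : ℕ) - l2,
      logPrime n1 * logPrime n2 * (if n1 + n2 < N then ψ (N - n1 - n2) else 0) -
      (∑ m2 ∈ Icc a2 b2, (#{m1 ∈ Icc a1 b1 | m1 + m2 < N} : ℝ)) *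
        ((∑ r1 ∈ compatible k1 l1 q, D r1) / (k1.lcm q).totient) =
      ∑ n1 ∈ A1, logPrime n1 * (∑ n2 ∈ Icc a2 b2 with (k2 : ℤ) ∣ (n2 : ℕ) - l2,
        logPrime n2 * (if n1 + n2 < N then ψ (N - n1 - n2) else 0) -
        #{m2 ∈ Icc a2 b2 | n1 + m2 < N} * D n1) +
      ∑ m2 ∈ Icc a2 b2, (∑ n1 ∈ A1, logPrime n1 * (if n1 + m2 < N then D n1 else 0) -
        #{m1 ∈ Icc a1 b1 | m1 + m2 < N} * ((∑ r1 ∈ compatible k1 l1 q, D r1) /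
        (k1.lcm q).totient)) := by
    have e : ∑ n1 ∈ A1, logPrime n1 * (#{m2 ∈ Icc a2 b2 | n1 + m2 < N} * D n1) =
        ∑ m2 ∈ Icc a2 b2, ∑ n1 ∈ A1, logPrime n1 * (if n1 + m2 < N then D n1 else 0) := by
      rw [sum_comm]
      refine sum_congr rfl fun n1 _ => ?_
      rw [← mul_sum, ← sum_filter, sum_const, nsmul_eq_mul]
    simp_rw [mul_sub, sum_sub_distrib]
    rw [e, ← sum_mul]
    simp_rw [mul_sum, mul_assoc]
    ring
  rw [hDsum, hsplit]
  refine (abs_add_le _ _).trans (add_le_add ?_ ?_)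
  · refine (abs_sum_le_sum_abs _ _).trans ?_
    calc _ ≤ ∑ n1 ∈ A1, logPrime n1 * (2 * (q * (c * E (k2.lcm q)))) := by
          refine sum_le_sum fun n1 _ => ?_
          rw [abs_mul, abs_of_nonneg (logPrime_nonneg n1)]
          exact mul_le_mul_of_nonneg_left (hinner n1) (logPrime_nonneg n1)
      _ ≤ _ := by
          rw [← sum_mul]
          have := hE0 hm2
          refine mul_le_mul_of_nonneg_right ?_ (by positivity)
          refine sum_le_sum_of_subset_of_nonneg (fun n hn => ?_) fun n _ _ => logPrime_nonneg n
          simp only [hA1, mem_filter, mem_Icc] at hn ⊢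
          exact ⟨by omega, hn.2⟩
  · refine (abs_sum_le_sum_abs _ _).trans ((sum_le_card_nsmul _ _ _ fun m2 _ => houter m2).trans ?_)
    rw [nsmul_eq_mul, card_Icc]
    have := hE0 hm1
    gcongr
    omega

lemma mem_compatible_iff_mod {k a r : ℕ} {l : ℤ} (ha : 0 < a) :
    r % a ∈ compatible k l a ↔ a.Coprime r ∧ ((k.gcd a) : ℤ) ∣ r - l := by
  have h1 : a.Coprime (r % a) ↔ a.Coprime r := by
    rw [coprime_iff_gcd_eq_one, coprime_iff_gcd_eq_one, Nat.gcd_comm, ← gcd_rec]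
  have h2 : ((k.gcd a) : ℤ) ∣ ((r % a : ℕ)) - l ↔ ((k.gcd a) : ℤ) ∣ r - l := by
    rw [show ((r % a : ℕ)) - l = r - l - a * (r / a : ℕ) by
      rw [eq_sub_iff_add_eq, sub_add_eq_add_sub]; congr 1; exact_mod_cast mod_add_div r a]
    rw [dvd_sub_left ((Int.natCast_dvd_natCast.2 (Nat.gcd_dvd_right k a)).mul_right _)]
  rw [compatible, mem_filter, mem_range, h1, h2]
  simp [mod_lt r ha]

lemma sum_compatible_mul {k a b : ℕ} (l : ℤ) (hab : a.Coprime b) (ha : 0 < a) (hb : 0 < b)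
    {F G : ℤ → ℝ} (hF : ∀ m n, (a : ℤ) ∣ m - n → F m = F n)
    (hG : ∀ m n, (b : ℤ) ∣ m - n → G m = G n) :
    ∑ r ∈ compatible k l (a * b), F r * G r =
      (∑ r ∈ compatible k l a, F r) * ∑ r ∈ compatible k l b, G r := by
  have hmod : ∀ c r : ℕ, (c : ℤ) ∣ r - ((r % c : ℕ)) := fun c r => by
    rw [Int.natCast_mod]; exact Int.dvd_self_sub_emod
  have hmem : ∀ r, r < a * b → (r ∈ compatible k l (a * b) ↔
      r % a ∈ compatible k l a ∧ r % b ∈ compatible k l b) := fun r hr => by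
    rw [mem_compatible_iff_mod ha, mem_compatible_iff_mod hb, compatible, mem_filter, mem_range,
      Coprime.gcd_mul k hab, coprime_mul_iff_left]
    have : ((k.gcd a * k.gcd b : ℕ) : ℤ) ∣ r - l ↔
        ((k.gcd a) : ℤ) ∣ r - l ∧ ((k.gcd b) : ℤ) ∣ r - l := by
      refine ⟨fun h => ⟨dvd_trans (by simp) h, dvd_trans (by simp) h⟩, fun h => ?_⟩
      rw [cast_mul]
      refine IsCoprime.mul_dvd (isCoprime_iff_coprime.2 ?_) h.1 h.2
      exact (hab.coprime_dvd_left (Nat.gcd_dvd_right k a)).coprime_dvd_right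
        (Nat.gcd_dvd_right k b)
    rw [this]; tauto
  rw [sum_mul_sum, ← sum_product']
  refine sum_nbij' (fun r => (r % a, r % b)) (fun p => chineseRemainder hab p.1 p.2)
    (fun r hr => ?_) (fun p hp => ?_) (fun r hr => ?_) (fun p hp => ?_) (fun r hr => ?_)
  · exact mem_product.2 ((hmem r (mem_range.1 (mem_filter.1 hr).1)).1 hr)
  · obtain ⟨h1, h2⟩ := mem_product.1 hp
    have h4 := (chineseRemainder hab p.1 p.2).2
    rw [hmem _ (chineseRemainder_lt_mul hab p.1 p.2 ha.ne' hb.ne'), h4.1, h4.2, mod_eq_of_lt (mem_range.1 (mem_filter.1 h1).1),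
      mod_eq_of_lt (mem_range.1 (mem_filter.1 h2).1)]
    exact ⟨h1, h2⟩
  · have h4 := chineseRemainder_modEq_unique hab (mod_modEq r a).symm
      (mod_modEq r b).symm
    exact (ModEq.eq_of_lt_of_lt h4 (mem_range.1 (mem_filter.1 hr).1) (chineseRemainder_lt_mul hab (r % a) (r % b) ha.ne' hb.ne')).symm
  · obtain ⟨h1, h2⟩ := mem_product.1 hp
    have h4 := (chineseRemainder hab p.1 p.2).2
    refine Prod.ext ?_ ?_
    · exact Eq.trans h4.1 (mod_eq_of_lt (mem_range.1 (mem_filter.1 h1).1))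
    · exact Eq.trans h4.2 (mod_eq_of_lt (mem_range.1 (mem_filter.1 h2).1))
  · rw [hF _ _ (hmod a r), hG _ _ (hmod b r)]

/-- The correlation sum of the Ramanujan sum over the residues compatible with both
progressions. -/
def compatibleSum (k1 k2 : ℕ) (l1 l2 n : ℤ) (q : ℕ) : ℝ :=
  ∑ r1 ∈ compatible k1 l1 q, ∑ r2 ∈ compatible k2 l2 q, ramanujanSum (n - r1 - r2) q

lemma ramanujanSum_sub_congr {q : ℕ} (n : ℤ) {m m' : ℤ} (h : (q : ℤ) ∣ m - m') :
    ramanujanSum (n - m) q = ramanujanSum (n - m') q :=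
  ramanujanSum_eq_of_dvd_sub (by rw [sub_sub_sub_cancel_left, ← dvd_neg, neg_sub]; exact h)

lemma compatibleSum_mul (k1 k2 : ℕ) (l1 l2 n : ℤ) {a b : ℕ} (hab : a.Coprime b) (ha : 0 < a)
    (hb : 0 < b) : compatibleSum k1 k2 l1 l2 n (a * b) =
      compatibleSum k1 k2 l1 l2 n a * compatibleSum k1 k2 l1 l2 n b := by
  simp only [compatibleSum, (isMultiplicative_ramanujanSum _).map_mul_of_coprime hab]
  rw [← sum_compatible_mul l1 hab ha hb
    (F := fun m => ∑ r2 ∈ compatible k2 l2 a, ramanujanSum (n - m - r2) a)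
    (G := fun m => ∑ r2 ∈ compatible k2 l2 b, ramanujanSum (n - m - r2) b)]
  · exact sum_congr rfl fun r _ => sum_compatible_mul l2 hab ha hb
      (fun _ _ => ramanujanSum_sub_congr _) (fun _ _ => ramanujanSum_sub_congr _)
  · exact fun m m' h => sum_congr rfl fun r _ => by
      simpa only [sub_right_comm n] using ramanujanSum_sub_congr (n - r) h
  · exact fun m m' h => sum_congr rfl fun r _ => by
      simpa only [sub_right_comm n] using ramanujanSum_sub_congr (n - r) h

lemma sum_compatible_prime {k p : ℕ} {l : ℤ} (hp : p.Prime) (hl : Int.gcd k l = 1) {ψ : ℤ → ℝ}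
    (hψ : ∀ m n, (p : ℤ) ∣ m - n → ψ m = ψ n) (h0 : ∑ r ∈ range p, ψ r = 0) :
    ∑ r ∈ compatible k l p, ψ r = if p ∣ k then ψ l else -ψ 0 := by
  have hp0 : (p : ℤ) ≠ 0 := mod_cast hp.ne_zero
  split_ifs with h
  · have hlt : (l % p).toNat < p := by
      have := Int.emod_lt_of_pos l (b := p) (mod_cast hp.pos); omega
    have hd : (p : ℤ) ∣ ((l % p).toNat) - l := by
      rw [Int.toNat_of_nonneg (Int.emod_nonneg _ hp0), ← dvd_neg, neg_sub]; exact Int.dvd_self_sub_emod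
    have hnd : ¬ (p : ℤ) ∣ l := fun h' => by
      have := Int.dvd_coe_gcd (Int.natCast_dvd_natCast.2 h) h'
      rw [hl] at this
      exact hp.one_lt.ne' (mod_cast Int.eq_one_of_dvd_one (by positivity) this)
    rw [show compatible k l p = {(l % p).toNat} from ?_, sum_singleton, hψ _ _ hd]
    ext r
    rw [compatible, mem_filter, mem_range, mem_singleton, gcd_eq_right h]
    constructor
    · rintro ⟨h1, -, h3⟩
      have h4 : (p : ℤ) ∣ r - ((l % p).toNat) := by
        have := dvd_sub h3 hd
        rwa [sub_sub_sub_cancel_right] at this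
      rw [← Int.modEq_iff_dvd] at h4
      exact (ModEq.eq_of_lt_of_lt (Int.natCast_modEq_iff.1 h4) hlt h1).symm
    · rintro rfl
      refine ⟨hlt, (hp.coprime_iff_not_dvd).2 fun h' => hnd ?_, hd⟩
      exact (dvd_sub_right (Int.natCast_dvd_natCast.2 h')).1 hd
  · rw [show compatible k l p = (range p).erase 0 from ?_]
    · rw [← sum_erase_add _ _ (mem_range.2 hp.pos)] at h0
      simpa using eq_neg_of_add_eq_zero_left h0
    · ext r
      rw [compatible, mem_filter, mem_range, mem_erase, mem_range,
        Coprime.gcd_eq_one ((hp.coprime_iff_not_dvd).2 h).symm]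
      constructor
      · rintro ⟨h1, h2, -⟩
        exact ⟨fun h' => by subst h'; simp at h2; exact hp.one_lt.ne' h2, h1⟩
      · rintro ⟨h1, h2⟩
        exact ⟨h2, (hp.coprime_iff_not_dvd).2 (not_dvd_of_pos_of_lt (by omega) h2), by simp⟩

lemma sum_range_ramanujanSum_prime {p : ℕ} (hp : p.Prime) (m : ℤ) :
    ∑ r ∈ range p, ramanujanSum (m - r) p = 0 := by
  have hr0 : ((m % p).toNat) = m % p := Int.toNat_of_nonneg (Int.emod_nonneg _ (mod_cast hp.ne_zero))
  have hlt : (m % p).toNat < p := by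
    have := Int.emod_lt_of_pos m (b := p) (mod_cast hp.pos); omega
  simp only [ramanujanSum_prime _ hp, sum_sub_distrib]
  rw [sum_eq_single_of_mem (m % p).toNat (mem_range.2 hlt)]
  · rw [if_pos]
    · simp
    · rw [hr0]; exact Int.dvd_self_sub_emod
  · intro r hr hne
    rw [if_neg]
    intro h
    refine hne (ModEq.eq_of_lt_of_lt (Int.natCast_modEq_iff.1 ?_) (mem_range.1 hr) hlt)
    rw [hr0]
    exact (Int.modEq_iff_dvd.2 h).trans (Int.mod_modEq m p).symm

lemma compatibleSum_prime {k1 k2 p : ℕ} {l1 l2 : ℤ} (n : ℤ) (hp : p.Prime)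
    (hl1 : Int.gcd k1 l1 = 1) (hl2 : Int.gcd k2 l2 = 1) :
    compatibleSum k1 k2 l1 l2 n p =
      if p ∣ k1 then if p ∣ k2 then ramanujanSum (n - l1 - l2) p else -ramanujanSum (n - l1) p
      else if p ∣ k2 then -ramanujanSum (n - l2) p else ramanujanSum n p := by
  have h : ∀ r1 : ℕ, ∑ r2 ∈ compatible k2 l2 p, ramanujanSum (n - r1 - r2) p =
      if p ∣ k2 then ramanujanSum (n - r1 - l2) p else -ramanujanSum (n - r1 - 0) p := fun r1 =>
    sum_compatible_prime hp hl2 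
      (fun _ _ => ramanujanSum_sub_congr _)
      (sum_range_ramanujanSum_prime hp _)
  have h' : ∀ c, ∑ r1 ∈ compatible k1 l1 p, ramanujanSum (n - c - r1) p =
      if p ∣ k1 then ramanujanSum (n - c - l1) p else -ramanujanSum (n - c - 0) p := fun c =>
    sum_compatible_prime hp hl1 
      (fun _ _ => ramanujanSum_sub_congr _)
      (sum_range_ramanujanSum_prime hp _)
  rw [compatibleSum, sum_congr rfl fun r1 _ => h r1]
  by_cases hk2 : p ∣ k2
  · simp only [hk2, if_true]
    rw [sum_congr rfl fun r1 _ => by rw [sub_right_comm], h']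
    simp only [sub_zero, sub_right_comm n l2 l1]
  · simp only [hk2, if_false, sub_zero, sum_neg_distrib]
    have := h' 0
    simp only [sub_zero] at this
    rw [this]
    split_ifs <;> simp

/-- The general term of the singular series, as a sum over moduli. -/
def singularTerm (k1 k2 : ℕ) (l1 l2 n : ℤ) (q : ℕ) : ℝ :=
  (moebius q : ℝ) / q.totient * compatibleSum k1 k2 l1 l2 n q *
    ((k1.gcd q).totient * (k2.gcd q).totient / (q.totient : ℝ) ^ 2)

lemma moebius_mul_compatibleSum_div {k1 k2 q : ℕ} (hk1 : 0 < k1) (hk2 : 0 < k2) (l1 l2 n : ℤ) :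
    (μ q) / φ q * (compatibleSum k1 k2 l1 l2 n q /
      ((k1.lcm q).totient * (k2.lcm q).totient)) =
      singularTerm k1 k2 l1 l2 n q / (φ k1 * φ k2) := by
  rcases Nat.eq_zero_or_pos q with rfl | hq
  · simp [singularTerm]
  have h : ∀ k : ℕ, ((k.lcm q).totient : ℝ) * (k.gcd q).totient = k.totient * φ q :=
    fun k => by
      have := totient_gcd_mul_totient_mul k q
      have h2 := totient_gcd_mul_totient_mul (k.gcd q) (k.lcm q)
      rw [Nat.gcd_mul_lcm, gcd_eq_left ((Nat.gcd_dvd_left k q).trans (Nat.dvd_lcm_left k q)),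
        this] at h2
      have := eq_of_mul_eq_mul_right (gcd_pos_of_pos_right k hq) h2
      rw [mul_comm]
      exact_mod_cast this.symm
  have p1 : 0 < k1.totient := mod_cast totient_pos.2 hk1
  have p2 : 0 < k2.totient := mod_cast totient_pos.2 hk2
  have p3 : 0 < q.totient := mod_cast totient_pos.2 hq
  have p4 : ∀ k : ℕ, (0 : ℝ) < (k.gcd q).totient := fun k => by
    exact_mod_cast totient_pos.2 (gcd_pos_of_pos_right k hq)
  rw [singularTerm, eq_div_of_mul_eq (p4 k1).ne' (h k1), eq_div_of_mul_eq (p4 k2).ne' (h k2)]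
  have := p4 k1
  have := p4 k2
  field_simp

lemma singularTerm_one (k1 k2 : ℕ) (l1 l2 n : ℤ) : singularTerm k1 k2 l1 l2 n 1 = 1 := by
  simp [singularTerm, compatibleSum, (fun k l => by simp [compatible] : ∀ (k : ℕ) (l : ℤ), compatible k l 1 = {0}), (isMultiplicative_ramanujanSum _).map_one]

lemma singularTerm_mul (k1 k2 : ℕ) (l1 l2 n : ℤ) {a b : ℕ} (hab : a.Coprime b) :
    singularTerm k1 k2 l1 l2 n (a * b) =
      singularTerm k1 k2 l1 l2 n a * singularTerm k1 k2 l1 l2 n b := by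
  rcases Nat.eq_zero_or_pos a with rfl | ha
  · simp [singularTerm]
  rcases Nat.eq_zero_or_pos b with rfl | hb
  · simp [singularTerm]
  have hg : ∀ k : ℕ, ((k.gcd (a * b)).totient : ℝ) = (k.gcd a).totient * (k.gcd b).totient :=
    fun k => by
      rw [Coprime.gcd_mul k hab, totient_mul]
      · push_cast; rfl
      · exact (hab.coprime_dvd_left (Nat.gcd_dvd_right k a)).coprime_dvd_right
          (Nat.gcd_dvd_right k b)
  rw [singularTerm, singularTerm, singularTerm, compatibleSum_mul _ _ _ _ _ hab ha hb, hg, hg,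
    ArithmeticFunction.isMultiplicative_moebius.map_mul_of_coprime hab, totient_mul hab]
  push_cast
  ring

lemma singularTerm_prime {k1 k2 p : ℕ} {l1 l2 : ℤ} (n : ℤ) (hp : p.Prime)
    (hl1 : Int.gcd k1 l1 = 1) (hl2 : Int.gcd k2 l2 = 1) :
    1 + singularTerm k1 k2 l1 l2 n p =
      if p ∣ k1 ∧ p ∣ k2 ∧ (p : ℤ) ∣ n - l1 - l2 then 0 else S3factor k1 k2 l1 l2 n p := by
  have hp1 : (0 : ℝ) < p - 1 := by have := hp.one_lt; rw [sub_pos]; exact_mod_cast this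
  have hφ : (φ p : ℝ) = p - 1 := by
    rw [totient_prime hp, cast_sub hp.one_lt.le, cast_one]
  have hg : ∀ k, ((k.gcd p).totient) = if p ∣ k then (p : ℝ) - 1 else 1 := fun k => by
    split_ifs with h
    · rw [gcd_eq_right h, hφ]
    · rw [((hp.coprime_iff_not_dvd).2 h).symm.gcd_eq_one]; simp
  rw [singularTerm, compatibleSum_prime n hp hl1 hl2, hg, hg, hφ,
    moebius_apply_prime hp, S3factor]
  simp only [ramanujanSum_prime _ hp]
  by_cases h1 : p ∣ k1 <;> by_cases h2 : p ∣ k2 <;>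
    simp only [h1, h2, if_true, if_false, true_and, false_and] <;>
    split_ifs <;> push_cast <;> field_simp <;> ring

lemma singularTerm_prime_pow (k1 k2 : ℕ) (l1 l2 n : ℤ) {p : ℕ} (hp : p.Prime) {e : ℕ}
    (he : 2 ≤ e) : singularTerm k1 k2 l1 l2 n (p ^ e) = 0 := by
  rw [singularTerm, moebius_apply_prime_pow hp (by omega), if_neg (by omega)]
  simp

lemma pow_three_le_totient_pow (q : ℕ) :
    q ^ 3 ≤ (if 2 ∣ q then 8 else 1) * φ q ^ 5 := by
  induction q using recOnPosPrimePosCoprime with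
  | zero => simp
  | one => simp
  | prime_pow p e hp he =>
    obtain ⟨e, rfl⟩ := exists_eq_succ_of_ne_zero he.ne'
    rw [totient_prime_pow_succ hp]
    rcases hp.eq_two_or_odd' with rfl | ho
    · rw [if_pos (dvd_pow_self 2 he.ne')]
      have : 1 ≤ (2 ^ e) ^ 2 := one_le_pow _ _ (by positivity)
      calc (2 ^ e.succ) ^ 3 = 8 * (2 ^ e) ^ 3 * 1 := by rw [succ_eq_add_one, pow_succ]; ring
        _ ≤ 8 * (2 ^ e) ^ 3 * (2 ^ e) ^ 2 := by gcongr
        _ = _ := by ring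
    · have h2 : ¬ 2 ∣ p ^ e.succ := fun h =>
        (not_even_iff_odd.2 ho) (even_iff_two_dvd.2 (Nat.prime_two.dvd_of_dvd_pow h))
      rw [if_neg h2, one_mul]
      have : 1 ≤ (p ^ e) ^ 2 := one_le_pow _ _ (pow_pos hp.pos e)
      have h3 : p ^ 3 ≤ (p - 1) ^ 5 := by
        have h4 : 3 ≤ p := by
          have := hp.two_le
          rcases this.eq_or_lt with h | h
          · subst h; exact absurd ho (by decide)
          · exact h
        obtain ⟨m, rfl⟩ := Nat.exists_eq_add_of_le h4
        rw [show 3 + m - 1 = m + 2 by omega]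
        ring_nf
        nlinarith [Nat.zero_le m, Nat.zero_le (m ^ 2), Nat.zero_le (m ^ 3), Nat.zero_le (m ^ 4),
          Nat.zero_le (m ^ 5)]
      calc (p ^ e.succ) ^ 3 = (p ^ e) ^ 3 * 1 * p ^ 3 := by
            rw [succ_eq_add_one, pow_succ]; ring
        _ ≤ (p ^ e) ^ 3 * (p ^ e) ^ 2 * (p - 1) ^ 5 := by gcongr
        _ = _ := by ring
  | coprime a b _ _ hab iha ihb =>
    rw [totient_mul hab, mul_pow, mul_pow]
    refine (Nat.mul_le_mul iha ihb).trans ?_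
    rw [mul_mul_mul_comm]
    refine Nat.mul_le_mul_right _ ?_
    by_cases h1 : 2 ∣ a
    · have h2 : ¬ 2 ∣ b := fun h => by
        have := Nat.dvd_gcd h1 h; rw [hab.gcd_eq_one] at this; omega
      simp [h1, h2, Dvd.dvd.mul_right h1 b]
    · by_cases h2 : 2 ∣ b
      · simp [h1, h2, Dvd.dvd.mul_left h2 a]
      · simp [h1, h2, Nat.prime_two.dvd_mul]

lemma abs_moebius_mul_compatibleSum_le (k1 k2 : ℕ) (l1 l2 n : ℤ) (hl1 : Int.gcd k1 l1 = 1)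
    (hl2 : Int.gcd k2 l2 = 1) (q : ℕ) :
    |(μ q) * compatibleSum k1 k2 l1 l2 n q| ≤ q.totient := by
  induction q using recOnPosPrimePosCoprime with
  | zero => simp
  | one =>
    simp [compatibleSum, (fun k l => by simp [compatible] : ∀ (k : ℕ) (l : ℤ), compatible k l 1 = {0}), (isMultiplicative_ramanujanSum _).map_one]
  | prime_pow p e hp he =>
    rcases Nat.eq_or_lt_of_le (succ_le_of_lt he) with rfl | h
    · have hp1 : (1 : ℝ) ≤ p - 1 := by
        have := hp.two_le
        rw [le_sub_iff_add_le]; norm_num; exact_mod_cast this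
      have : ∀ m, |ramanujanSum m p| ≤ p - 1 := fun m => by
        rw [ramanujanSum_prime m hp, abs_le]
        split_ifs <;> constructor <;> linarith
      simp only [succ_eq_add_one, zero_add, pow_one]
      rw [abs_mul, moebius_apply_prime hp, compatibleSum_prime n hp hl1 hl2,
        totient_prime hp, cast_sub hp.one_lt.le]
      split_ifs <;> simpa using this _
    · rw [moebius_apply_prime_pow hp (by omega), if_neg (by omega)]
      simp
  | coprime a b ha hb hab iha ihb =>
    rw [ArithmeticFunction.isMultiplicative_moebius.map_mul_of_coprime hab,
      compatibleSum_mul _ _ _ _ _ hab (by omega) (by omega), totient_mul hab, Int.cast_mul,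
      mul_mul_mul_comm, abs_mul, cast_mul]
    exact mul_le_mul iha ihb (abs_nonneg _) (cast_nonneg _)

lemma abs_singularTerm_le {k1 k2 q : ℕ} {l1 l2 : ℤ} (n : ℤ) (hl1 : Int.gcd k1 l1 = 1)
    (hl2 : Int.gcd k2 l2 = 1) (hq : 0 < q) :
    |singularTerm k1 k2 l1 l2 n q| ≤ 4 * (k1.gcd q * k2.gcd q * q ^ (-(6 / 5) : ℝ)) := by
  have hq' : (0 : ℝ) < q := mod_cast hq
  have h1 : |singularTerm k1 k2 l1 l2 n q| ≤ k1.gcd q * k2.gcd q * (1 / (φ q) ^ 2) := by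
    rw [singularTerm, div_mul_eq_mul_div, abs_mul, abs_div, abs_of_pos (mod_cast totient_pos.2 hq : (0 : ℝ) < q.totient),
      abs_of_nonneg (by positivity : (0 : ℝ) ≤ (k1.gcd q).totient * (k2.gcd q).totient /
        (φ q) ^ 2)]
    calc _ ≤ (φ q : ℝ) / φ q * (k1.gcd q * k2.gcd q / (φ q) ^ 2) := by
          gcongr
          · exact abs_moebius_mul_compatibleSum_le k1 k2 l1 l2 n hl1 hl2 q
          · exact totient_le _
          · exact totient_le _
      _ = _ := by field_simp
  refine h1.trans ?_
  have h2 : ((q : ℝ) ^ (6 / 5 : ℝ)) ^ 5 ≤ (4 * (φ q) ^ 2) ^ 5 := by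
    rw [← rpow_natCast, ← rpow_mul hq'.le]
    have h4 : ((q : ℝ) ^ 3) ^ 2 ≤ (8 * (φ q) ^ 5) ^ 2 := by
      gcongr; exact_mod_cast ((pow_three_le_totient_pow q).trans (Nat.mul_le_mul_right _ (by split_ifs <;> omega)))
    calc (q : ℝ) ^ ((6 / 5 : ℝ) * 5) = (q ^ 3) ^ 2 := by
          rw [← pow_mul, ← rpow_natCast]; norm_num
      _ ≤ (8 * (φ q) ^ 5) ^ 2 := h4
      _ ≤ _ := by
          rw [mul_pow, mul_pow, ← pow_mul, ← pow_mul]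
          gcongr; norm_num
  have h5 := le_of_pow_le_pow_left₀ (by norm_num) (by positivity) h2
  rw [rpow_neg hq'.le, mul_left_comm]
  refine mul_le_mul_of_nonneg_left ?_ (by positivity)
  rw [div_le_iff₀ (by positivity), ← div_eq_mul_inv, div_mul_eq_mul_div, le_div_iff₀ (by positivity)]
  linarith

lemma summable_singularTerm {k1 k2 : ℕ} {l1 l2 : ℤ} (n : ℤ) (hk1 : 0 < k1) (hk2 : 0 < k2)
    (hl1 : Int.gcd k1 l1 = 1) (hl2 : Int.gcd k2 l2 = 1) :
    Summable fun q => ‖singularTerm k1 k2 l1 l2 n q‖ := by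
  refine Summable.of_nonneg_of_le (fun _ => norm_nonneg _) (fun q => ?_)
    ((summable_nat_rpow (p := -(6 / 5))).2 (by norm_num) |>.mul_left (4 * (k1 * k2 : ℝ)))
  rcases Nat.eq_zero_or_pos q with rfl | hq
  · simp [singularTerm]
  refine (abs_singularTerm_le n hl1 hl2 hq).trans ?_
  rw [mul_assoc 4]
  gcongr
  · exact gcd_le_left _ hk1
  · exact gcd_le_left _ hk2

lemma S3kl_eq_tsum {k1 k2 : ℕ} {l1 l2 : ℤ} (n : ℤ) (hk1 : 0 < k1) (hk2 : 0 < k2)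
    (hl1 : Int.gcd k1 l1 = 1) (hl2 : Int.gcd k2 l2 = 1) :
    S3kl k1 k2 l1 l2 n = ∑' q, singularTerm k1 k2 l1 l2 n q := by
  rw [← EulerProduct.eulerProduct_tprod (singularTerm_one k1 k2 l1 l2 n)
    (singularTerm_mul k1 k2 l1 l2 n) (summable_singularTerm n hk1 hk2 hl1 hl2)
    (by simp [singularTerm])]
  have hloc : ∀ p : Primes, ∑' e, singularTerm k1 k2 l1 l2 n (p ^ e) =
      if (p : ℕ) ∣ k1 ∧ (p : ℕ) ∣ k2 ∧ (p : ℤ) ∣ n - l1 - l2 then 0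
      else S3factor k1 k2 l1 l2 n p := fun p => by
    rw [tsum_eq_sum, sum_range_succ, sum_range_one, pow_zero, pow_one,
      singularTerm_one, singularTerm_prime n p.2 hl1 hl2]
    exact fun e he => singularTerm_prime_pow _ _ _ _ _ p.2 (not_lt.1 (mem_range.not.1 he))
  rw [tprod_congr hloc, S3kl]
  split_ifs with h
  · obtain ⟨p, hp, h1⟩ := h
    exact (tprod_of_exists_eq_zero (f := fun p : Primes => if (p : ℕ) ∣ k1 ∧ (p : ℕ) ∣ k2 ∧
      (p : ℤ) ∣ n - l1 - l2 then 0 else S3factor k1 k2 l1 l2 n p)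
      ⟨⟨p, hp⟩, if_pos h1⟩).symm
  · exact tprod_congr fun p => (if_neg fun h1 => h ⟨p, p.2, h1⟩).symm

lemma sum_gcd_mul_gcd_rpow_le {k1 k2 : ℕ} (hk1 : 0 < k1) (hk2 : 0 < k2) (X : ℕ) :
    ∑ q ∈ Icc 1 X, (k1.gcd q * k2.gcd q * (q : ℝ) ^ (-(11 / 10) : ℝ)) ≤
      (∑' q : ℕ, (q : ℝ) ^ (-(11 / 10) : ℝ)) * (tau k1 * tau k2 * k1.gcd k2) := by
  have hgcd : ∀ k q : ℕ, 0 < k → (k.gcd q) ≤ ∑ d ∈ k.divisors, if d ∣ q then (d : ℝ) else 0 :=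
    fun k q hk => by
      have : (k.gcd q) = if k.gcd q ∣ q then ((k.gcd q) : ℝ) else 0 := by
        rw [if_pos (Nat.gcd_dvd_right k q)]
      rw [this]
      exact single_le_sum (f := fun d => if d ∣ q then (d : ℝ) else 0)
        (fun d _ => by split_ifs <;> positivity)
        (mem_divisors.2 ⟨Nat.gcd_dvd_left k q, hk.ne'⟩)
  calc _ ≤ ∑ q ∈ Icc 1 X, ∑ d1 ∈ k1.divisors, ∑ d2 ∈ k2.divisors,
        (if d1.lcm d2 ∣ q then (d1 * d2 * (q : ℝ) ^ (-(11 / 10) : ℝ)) else 0) := by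
        refine sum_le_sum fun q _ => ?_
        calc _ ≤ (∑ d1 ∈ k1.divisors, if d1 ∣ q then (d1 : ℝ) else 0) *
              (∑ d2 ∈ k2.divisors, if d2 ∣ q then (d2 : ℝ) else 0) *
              q ^ (-(11 / 10) : ℝ) := by
              gcongr
              · exact hgcd k1 q hk1
              · exact hgcd k2 q hk2
          _ = _ := by
              rw [sum_mul_sum, sum_mul]
              refine sum_congr rfl fun d1 _ => ?_
              rw [sum_mul]
              refine sum_congr rfl fun d2 _ => ?_
              by_cases h1 : d1 ∣ q <;> by_cases h2 : d2 ∣ q <;> simp [h1, h2, Nat.lcm_dvd_iff]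
    _ = ∑ d1 ∈ k1.divisors, ∑ d2 ∈ k2.divisors, (d1 * d2) *
          ∑ q ∈ (Icc 1 X).filter (d1.lcm d2 ∣ ·), (q : ℝ) ^ (-(11 / 10) : ℝ) := by
        rw [sum_comm]
        refine sum_congr rfl fun d1 _ => ?_
        rw [sum_comm]
        refine sum_congr rfl fun d2 _ => ?_
        rw [← sum_filter, mul_sum]
    _ ≤ ∑ d1 ∈ k1.divisors, ∑ d2 ∈ k2.divisors, (k1.gcd k2) *
          ∑' q : ℕ, (q : ℝ) ^ (-(11 / 10) : ℝ) := by
        refine sum_le_sum fun d1 hd1 => sum_le_sum fun d2 hd2 => ?_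
        have hm := lcm_pos (pos_of_mem_divisors hd1) (pos_of_mem_divisors hd2)
        have e1 : (d1 * d2 : ℝ) = d1.gcd d2 * d1.lcm d2 := by
          exact_mod_cast (Nat.gcd_mul_lcm d1 d2).symm
        have e2 : (d1.gcd d2 : ℝ) ≤ k1.gcd k2 := by
          exact_mod_cast le_of_dvd (gcd_pos_of_pos_left _ hk1)
            (gcd_dvd_gcd (dvd_of_mem_divisors hd1) (dvd_of_mem_divisors hd2))
        rw [sum_filter_dvd_Icc X hm, e1, mul_assoc]
        have e3 : ∑ j ∈ Icc 1 (X / d1.lcm d2), ((d1.lcm d2 * j : ℕ) : ℝ) ^ (-(11 / 10) : ℝ) ≤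
            (d1.lcm d2 : ℝ)⁻¹ * ∑' q : ℕ, (q : ℝ) ^ (-(11 / 10) : ℝ) := by
          refine le_trans ?_ (mul_le_mul_of_nonneg_left
            (((summable_nat_rpow (p := -(11 / 10))).2 (by norm_num)).sum_le_tsum (Icc 1 (X / d1.lcm d2)) fun _ _ => by positivity) (by positivity))
          rw [mul_sum]
          refine sum_le_sum fun j _ => ?_
          rw [cast_mul, mul_rpow (by positivity) (by positivity), ← rpow_neg_one]
          gcongr ?_ * _
          exact rpow_le_rpow_of_exponent_le (mod_cast hm) (by norm_num)
        have hZ0 : 0 ≤ ∑' q : ℕ, (q : ℝ) ^ (-(11 / 10) : ℝ) := tsum_nonneg fun _ => by positivity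
        refine mul_le_mul e2 ?_ (by positivity) (by positivity)
        refine (mul_le_mul_of_nonneg_left e3 (by positivity)).trans (le_of_eq ?_)
        field_simp
    _ = _ := by
        rw [sum_const, sum_const, nsmul_eq_mul, nsmul_eq_mul]
        simp only [tau]
        ring

/-- Truncation of the singular series. -/
lemma exists_abs_S3kl_sub_le : ∃ Z, 0 ≤ Z ∧ ∀ (k1 k2 : ℕ) (l1 l2 n : ℤ) (Q : ℕ), 0 < k1 →
    0 < k2 → Int.gcd k1 l1 = 1 → Int.gcd k2 l2 = 1 → 1 ≤ Q →
    |S3kl k1 k2 l1 l2 n - ∑ q ∈ Icc 1 Q, singularTerm k1 k2 l1 l2 n q| ≤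
      Z * (tau k1 * tau k2 * k1.gcd k2) * Q ^ (-(1 / 10) : ℝ) := by
  refine ⟨4 * ∑' q : ℕ, (q : ℝ) ^ (-(11 / 10) : ℝ),
    mul_nonneg (by norm_num) (tsum_nonneg fun _ => by positivity), ?_⟩
  intro k1 k2 l1 l2 n Q hk1 hk2 hl1 hl2 hQ
  rw [S3kl_eq_tsum n hk1 hk2 hl1 hl2]
  refine le_of_tendsto ((((summable_singularTerm n hk1 hk2 hl1 hl2).of_norm).hasSum.tendsto_sum_nat.sub_const (∑ q ∈ Icc 1 Q, singularTerm k1 k2 l1 l2 n q)).abs) (Filter.eventually_atTop.2 ⟨Q + 1, fun X hX => ?_⟩)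
  have e : ∑ q ∈ range X, singularTerm k1 k2 l1 l2 n q - ∑ q ∈ Icc 1 Q,
      singularTerm k1 k2 l1 l2 n q = ∑ q ∈ Ico (Q + 1) X, singularTerm k1 k2 l1 l2 n q := by
    rw [← sum_range_add_sum_Ico _ hX, sum_range_eq_add_Ico _ (by omega),
      show Icc 1 Q = Ico 1 (Q + 1) by ext; simp]
    simp [singularTerm]
  rw [e]
  calc _ ≤ ∑ q ∈ Ico (Q + 1) X, 4 * (Q : ℝ) ^ (-(1 / 10) : ℝ) *
        (k1.gcd q * k2.gcd q * q ^ (-(11 / 10) : ℝ)) := by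
        refine (abs_sum_le_sum_abs _ _).trans (sum_le_sum fun q hq => ?_)
        have hq' := mem_Ico.1 hq
        refine (abs_singularTerm_le n hl1 hl2 (by omega)).trans ?_
        have : (q : ℝ) ^ (-(6 / 5) : ℝ) ≤
            Q ^ (-(1 / 10) : ℝ) * q ^ (-(11 / 10) : ℝ) := by
          rw [show (-(6 / 5) : ℝ) = -(1 / 10) + -(11 / 10) by norm_num, rpow_add (mod_cast (by omega))]
          refine mul_le_mul_of_nonneg_right ?_ (by positivity)
          exact rpow_le_rpow_of_nonpos (mod_cast hQ)
            (mod_cast (by omega)) (by norm_num)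
        calc _ ≤ 4 * (k1.gcd q * k2.gcd q *
              ((Q : ℝ) ^ (-(1 / 10) : ℝ) * q ^ (-(11 / 10) : ℝ))) := by gcongr
          _ = _ := by ring
    _ ≤ 4 * Q ^ (-(1 / 10) : ℝ) * ∑ q ∈ Icc 1 X,
        (k1.gcd q * k2.gcd q * (q : ℝ) ^ (-(11 / 10) : ℝ)) := by
        rw [← mul_sum]
        refine mul_le_mul_of_nonneg_left (sum_le_sum_of_subset_of_nonneg (fun q hq => ?_)
          fun _ _ _ => by positivity) (by positivity)
        simp only [mem_Ico, mem_Icc] at hq ⊢; omega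
    _ ≤ 4 * Q ^ (-(1 / 10) : ℝ) * ((∑' q : ℕ, (q : ℝ) ^ (-(11 / 10) : ℝ)) *
        (tau k1 * tau k2 * k1.gcd k2)) := by
        gcongr; exact sum_gcd_mul_gcd_rpow_le hk1 hk2 X
    _ = _ := by ring

lemma I3_eq (k1 k2 : ℕ) (l1 l2 : ℤ) {N a1 b1 a2 b2 : ℕ} (hb1 : b1 ≤ N) (hb2 : b2 ≤ N) :
    I3 k1 k2 l1 l2 N a1 b1 a2 b2 =
      ∑ n1 ∈ Icc a1 b1 with (k1 : ℤ) ∣ (n1 : ℕ) - l1,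
        ∑ n2 ∈ Icc a2 b2 with (k2 : ℤ) ∣ (n2 : ℕ) - l2,
          logPrime n1 * logPrime n2 *
            (if n1 + n2 < N then logPrime (N - (n1 + n2)) else 0) := by
  have hs : ∀ (k : ℕ) (l : ℤ) (a b : ℕ), b ≤ N → {n ∈ Icc a b | (k : ℤ) ∣ (n : ℕ) - l} =
      {n ∈ range (N + 1) | (k : ℤ) ∣ (n : ℕ) - l ∧ a ≤ n ∧ n ≤ b} := fun k l a b hb => by
    ext n; simp only [mem_filter, mem_Icc, mem_range]
    constructor
    · rintro ⟨h1, h2⟩; exact ⟨by omega, h2, h1⟩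
    · rintro ⟨-, h2, h1⟩; exact ⟨h1, h2⟩
  rw [I3, hs k1 l1 a1 b1 hb1, hs k2 l2 a2 b2 hb2, sum_filter]
  refine sum_congr rfl fun p1 _ => ?_
  rw [sum_filter, ite_sum_zero]
  refine sum_congr rfl fun p2 _ => ?_
  rw [← ite_and]
  by_cases h : p1 + p2 < N
  · rw [sum_eq_single_of_mem (N - (p1 + p2)) (mem_range.2 (by omega))]
    · simp only [h, (by omega : p1 + p2 + (N - (p1 + p2)) = N), if_true, logPrime]
      split_ifs <;> first | rfl | (exfalso; tauto) | simp only [mul_zero, zero_mul]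
    · exact fun p3 _ hne => if_neg fun h' => hne (by omega)
  · rw [if_neg h, mul_zero, ite_self]
    exact sum_eq_zero fun p3 _ => if_neg fun h' => by
      have := h'.2.2.1.pos; omega

lemma Phi3_eq {N a1 b1 a2 b2 : ℕ} (ha1 : 1 ≤ a1) (hb1 : b1 ≤ N) (ha2 : 1 ≤ a2) (hb2 : b2 ≤ N) :
    (Phi3 N a1 b1 a2 b2) =
      ∑ m2 ∈ Icc a2 b2, (#{m1 ∈ Icc a1 b1 | m1 + m2 < N} : ℝ) := by
  rw [Phi3, ← cast_sum, ← card_sigma]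
  congr 1
  refine card_nbij' (fun x => ⟨x.2.1, x.1⟩) (fun x => (x.2, x.1, N - (x.2 + x.1))) ?_ ?_ ?_ ?_
  · rintro ⟨x, y, z⟩ h
    simp only [coe_filter, mem_product, mem_Icc, coe_sigma, Set.mem_sigma_iff, Set.mem_ofPred_eq,
      coe_Icc, Set.mem_Icc] at h ⊢
    omega
  · rintro ⟨x, y⟩ h
    simp only [coe_filter, mem_product, mem_Icc, coe_sigma, Set.mem_sigma_iff, Set.mem_ofPred_eq,
      coe_Icc, Set.mem_Icc] at h ⊢
    omega
  · rintro ⟨x, y, z⟩ h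
    simp only [coe_filter, mem_product, mem_Icc, Set.mem_ofPred_eq, Prod.mk.injEq, true_and] at h ⊢
    omega
  · rintro ⟨x, y⟩ _
    rfl

lemma modelError_sub {N Q n1 n2 : ℕ} (h1 : 1 ≤ n1) :
    modelError N Q (N - n1 - n2) =
      if n1 + n2 < N then logPrime (N - (n1 + n2)) - primeModel Q (N - n1 - n2) else 0 := by
  rw [modelError]
  simp only [(by rw [mem_Icc]; omega : (N : ℤ) - n1 - n2 ∈ Icc (1 : ℤ) N ↔ n1 + n2 < N)]
  split_ifs with h
  · congr 2; omega
  · rfl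

lemma sum_filter_ite_mem_mul {N a b : ℕ} (ha : 1 ≤ a) (hb : b ≤ N) (P : ℕ → Prop) [DecidablePred P]
    (F : ℕ → ℝ) :
    ∑ n ∈ Icc 1 N with P n, (if n ∈ Icc a b then logPrime n else 0) * F n =
      ∑ n ∈ Icc a b with P n, logPrime n * F n := by
  simp only [ite_mul, zero_mul]
  rw [← sum_filter]
  congr 1
  ext n; simp only [mem_filter, mem_Icc]
  constructor
  · rintro ⟨⟨-, h1⟩, h2⟩; exact ⟨h2, h1⟩
  · rintro ⟨h2, h1⟩; exact ⟨⟨by omega, h1⟩, h2⟩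

/-- The contribution of the model error of the third prime to the ternary sum. -/
def errorTriple (Q k1 k2 : ℕ) (l1 l2 : ℤ) (N a1 b1 a2 b2 : ℕ) : ℝ :=
  ∑ n1 ∈ Icc a1 b1 with (k1 : ℤ) ∣ (n1 : ℕ) - l1, ∑ n2 ∈ Icc a2 b2 with (k2 : ℤ) ∣ (n2 : ℕ) - l2,
    logPrime n1 * logPrime n2 * modelError N Q ((N : ℤ) - n1 - n2)

lemma abs_logPrime_ite_le {N n : ℕ} (s : Finset ℕ) (hn : n ∈ Icc 1 N) :
    |if n ∈ s then logPrime n else 0| ≤ log N := by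
  have h1 : logPrime n ≤ log N := (logPrime_le_log n).trans (log_le_log
    (mod_cast (mem_Icc.1 hn).1) (mod_cast (mem_Icc.1 hn).2))
  have h2 := logPrime_nonneg n
  split_ifs
  · rwa [abs_of_nonneg h2]
  · simpa using h2.trans h1

lemma errorTriple_pow_four_le {Q k1 k2 N a1 b1 a2 b2 : ℕ} (hk1 : 0 < k1) (hk2 : 0 < k2)
    (hkN : k1 * k2 ≤ N) (l1 l2 : ℤ) (ha1 : 1 ≤ a1) (hb1 : b1 ≤ N) (ha2 : 1 ≤ a2) (hb2 : b2 ≤ N) :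
    errorTriple Q k1 k2 l1 l2 N a1 b1 a2 b2 ^ 4 ≤ 32 * log N ^ 8 * N ^ 5 *
      ((1 / (k1 * k2)) ^ 2 * (k1.gcd k2 / (k1 * k2)) *
        corrEnergy N (modelError N Q) k1 k2) := by
  refine le_trans (le_of_eq (Eq.symm ?_)) (pow_four_sum_progressions_le
    (fun v hv => if_neg hv) hk1 hk2 hkN l1 l2 (fun n hn => abs_logPrime_ite_le (Icc a1 b1) hn)
    (fun n hn => abs_logPrime_ite_le (Icc a2 b2) hn))
  congr 1
  simp only [errorTriple, mul_assoc, ← mul_sum]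
  exact (sum_filter_ite_mem_mul ha1 hb1 _ _).trans (sum_congr rfl fun n1 _ =>
    congrArg _ (sum_filter_ite_mem_mul ha2 hb2 _ _))

lemma I3_sub_errorTriple {Q k1 k2 N a1 b1 a2 b2 : ℕ} (l1 l2 : ℤ) (ha1 : 1 ≤ a1) (hb1 : b1 ≤ N)
    (hb2 : b2 ≤ N) :
    I3 k1 k2 l1 l2 N a1 b1 a2 b2 - errorTriple Q k1 k2 l1 l2 N a1 b1 a2 b2 =
      ∑ q ∈ Icc 1 Q, (μ q) / φ q *
        ∑ n1 ∈ Icc a1 b1 with (k1 : ℤ) ∣ (n1 : ℕ) - l1,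
          ∑ n2 ∈ Icc a2 b2 with (k2 : ℤ) ∣ (n2 : ℕ) - l2, logPrime n1 * logPrime n2 *
            (if n1 + n2 < N then ramanujanSum (N - n1 - n2) q else 0) := by
  simp only [mul_sum]
  rw [I3_eq k1 k2 l1 l2 hb1 hb2, errorTriple, ← sum_sub_distrib, sum_comm]
  refine sum_congr rfl fun n1 hn1 => ?_
  rw [← sum_sub_distrib, sum_comm]
  refine sum_congr rfl fun n2 _ => ?_
  have h1 := (mem_Icc.1 (mem_filter.1 hn1).1).1
  rw [modelError_sub (by omega), ← mul_sub]
  split_ifs with h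
  · rw [sub_sub_cancel, primeModel, mul_sum]
    exact sum_congr rfl fun q _ => by ring
  · simp

/-- The error for moduli that are multiples of `k`. -/
def multipleError (E : ℕ → ℝ) (Q k : ℕ) : ℝ := ∑ j ∈ Icc 1 Q, E (k * j)

lemma apply_lcm_le_multipleError {E : ℕ → ℝ} (hE : ∀ m, 0 ≤ E m) {Q k q : ℕ} (hq : q ∈ Icc 1 Q) :
    E (k.lcm q) ≤ multipleError E Q k := by
  have hq' := mem_Icc.1 hq
  rw [Nat.lcm, Nat.mul_div_assoc _ (Nat.gcd_dvd_right k q)]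
  exact single_le_sum (fun j _ => hE _) (mem_Icc.2
    ⟨Nat.div_pos (le_of_dvd hq'.1 (Nat.gcd_dvd_right k q)) (gcd_pos_of_pos_right k hq'.1),
      (Nat.div_le_self _ _).trans hq'.2⟩)

lemma sum_multipleError_le {E : ℕ → ℝ} (hE : ∀ m, 0 ≤ E m) (K Q : ℕ) :
    ∑ k ∈ Icc 1 K, multipleError E Q k ≤ Q * ∑ m ∈ Icc 1 (K * Q), E m := by
  simp only [multipleError]
  rw [sum_comm]
  calc _ ≤ ∑ j ∈ Icc 1 Q, ∑ m ∈ Icc 1 (K * Q), E m := by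
        refine sum_le_sum fun j hj => ?_
        have hj' := mem_Icc.1 hj
        rw [← sum_image
          fun x _ y _ h => eq_of_mul_eq_mul_right hj'.1 h]
        refine sum_le_sum_of_subset_of_nonneg (fun m hm => ?_) fun _ _ _ => hE _
        obtain ⟨k, hk, rfl⟩ := mem_image.1 hm
        have hk' := mem_Icc.1 hk
        exact mem_Icc.2 ⟨Nat.mul_pos hk'.1 hj'.1, Nat.mul_le_mul hk'.2 hj'.2⟩
    _ = _ := by simp

lemma sum_logPrime_filter_le {k N : ℕ} (hk : 0 < k) (hkN : k ≤ N) (l : ℤ) :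
    ∑ n ∈ Icc 1 N with (k : ℤ) ∣ (n : ℕ) - l, logPrime n ≤ 2 * N / k * log N := by
  calc _ ≤ ∑ n ∈ Icc 1 N with (k : ℤ) ∣ (n : ℕ) - l, log N := by
        refine sum_le_sum fun n hn => ?_
        have := abs_logPrime_ite_le {n} (mem_filter.1 hn).1
        rw [if_pos (mem_singleton_self n)] at this
        exact (le_abs_self _).trans this
    _ ≤ _ := by
        rw [sum_const, nsmul_eq_mul]
        exact mul_le_mul_of_nonneg_right (card_filter_dvd_le hk hkN l) (log_natCast_nonneg N)

lemma Phi3_le_sq {N a1 b1 a2 b2 : ℕ} (ha1 : 1 ≤ a1) (hb1 : b1 ≤ N) (ha2 : 1 ≤ a2) (hb2 : b2 ≤ N) :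
    (Phi3 N a1 b1 a2 b2 : ℝ) ≤ N ^ 2 := by
  rw [Phi3_eq ha1 hb1 ha2 hb2]
  calc _ ≤ ∑ m2 ∈ Icc a2 b2, (N : ℝ) := by
        refine sum_le_sum fun m2 _ => ?_
        exact_mod_cast (card_filter_le _ _).trans (by rw [card_Icc]; omega)
    _ ≤ _ := by
        rw [sum_const, nsmul_eq_mul, card_Icc, sq]
        gcongr
        omega

lemma abs_Delta3_sub_errorTriple_le {Z : ℝ} (hZ : ∀ (k1 k2 : ℕ) (l1 l2 n : ℤ) (Q : ℕ), 0 < k1 →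
      0 < k2 → Int.gcd k1 l1 = 1 → Int.gcd k2 l2 = 1 → 1 ≤ Q →
      |S3kl k1 k2 l1 l2 n - ∑ q ∈ Icc 1 Q, singularTerm k1 k2 l1 l2 n q| ≤
        Z * (tau k1 * tau k2 * k1.gcd k2) * Q ^ (-(1 / 10) : ℝ))
    {N Q k1 k2 a1 b1 a2 b2 : ℕ} {l1 l2 : ℤ} (hQ : 1 ≤ Q) (hk1 : 0 < k1) (hk2 : 0 < k2)
    (hk1N : k1 ≤ N) (hl1 : Int.gcd k1 l1 = 1) (hl2 : Int.gcd k2 l2 = 1) {E : ℕ → ℝ}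
    (hE0 : ∀ m, 0 ≤ E m)
    (hE : ∀ k : ℕ, k ≠ 0 → ∀ c, ∀ y ≤ N, |∑ n ∈ Icc 1 y with (k : ℤ) ∣ (n : ℕ) - c, logPrime n -
      (if Int.gcd k c = 1 then (y : ℝ) / φ k else 0)| ≤ E k)
    (ha1 : 1 ≤ a1) (hb1 : b1 ≤ N) (ha2 : 1 ≤ a2) (hb2 : b2 ≤ N) :
    |Delta3 k1 k2 l1 l2 N a1 b1 a2 b2 - errorTriple Q k1 k2 l1 l2 N a1 b1 a2 b2| ≤
      4 * N * log N * Q ^ 4 * (1 / k1 * multipleError E Q k2) +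
        2 * N * Q ^ 5 * (1 / φ k2 * multipleError E Q k1) +
        Z * N ^ 2 * Q ^ (-(1 / 10) : ℝ) *
          ((tau k1) ^ 2 * (tau k2) ^ 2 * (k1.gcd k2 / (k1 * k2))) := by
  set Φ := (Phi3 N a1 b1 a2 b2 : ℝ) with hΦ
  set s := singularTerm k1 k2 l1 l2 N
  have p1 : 0 < k1.totient := mod_cast totient_pos.2 hk1
  have p2 : 0 < k2.totient := mod_cast totient_pos.2 hk2
  have hL := log_natCast_nonneg N
  have hdec : Delta3 k1 k2 l1 l2 N a1 b1 a2 b2 - errorTriple Q k1 k2 l1 l2 N a1 b1 a2 b2 =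
      (I3 k1 k2 l1 l2 N a1 b1 a2 b2 - errorTriple Q k1 k2 l1 l2 N a1 b1 a2 b2 -
        ∑ q ∈ Icc 1 Q, Φ * (s q / (φ k1 * φ k2))) -
      (S3kl k1 k2 l1 l2 N - ∑ q ∈ Icc 1 Q, s q) * (Φ * (1 / φ k1 * (1 / φ k2))) := by
    rw [Delta3, ← mul_sum, ← sum_div]
    field_simp
    ring
  rw [hdec]
  refine (abs_sub _ _).trans (add_le_add ?_ ?_)
  · rw [I3_sub_errorTriple l1 l2 ha1 hb1 hb2, ← sum_sub_distrib]
    calc _ ≤ ∑ q ∈ Icc 1 Q, (4 * N * log N * Q ^ 3 * (1 / k1 * multipleError E Q k2) +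
          2 * N * Q ^ 4 * (1 / φ k2 * multipleError E Q k1)) := by
          refine (abs_sum_le_sum_abs _ _).trans (sum_le_sum fun q hq => ?_)
          have hq' := mem_Icc.1 hq
          have hqQ : q ≤ Q := mod_cast hq'.2
          have hμ : |(μ q : ℝ) / φ q| ≤ 1 := by
            have h1 : (1 : ℝ) ≤ q.totient := mod_cast totient_pos.2 hq'.1
            rw [abs_div, abs_cast, div_le_one (by linarith)]
            exact (abs_moebius_le_one_real q).trans h1
          rw [← moebius_mul_compatibleSum_div hk1 hk2, mul_left_comm Φ, ← mul_sub, abs_mul, hΦ,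
            Phi3_eq ha1 hb1 ha2 hb2, compatibleSum]
          refine (mul_le_mul hμ (abs_sum_sum_logPrime_mul_periodic_sub_le hk1 hk2 hq'.1 hl1 hl2 hE (fun m n h => ramanujanSum_eq_of_dvd_sub h) (fun m => abs_ramanujanSum_le_sq m q) ha1 hb1 ha2 hb2) (abs_nonneg _) zero_le_one).trans ?_
          have h1 := sum_logPrime_filter_le hk1 hk1N l1
          have h2 := apply_lcm_le_multipleError hE0 hq (k := k1)
          have h3 := apply_lcm_le_multipleError hE0 hq (k := k2)
          have h4 := (hE0 _).trans h2
          have h5 := (hE0 _).trans h3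
          have h6 := hE0 (k1.lcm q)
          have h7 := hE0 (k2.lcm q)
          rw [one_mul]
          calc _ ≤ 2 * N / k1 * log N * (2 * (Q * (Q ^ 2 * multipleError E Q k2))) +
                N * (2 * (Q * (Q * Q ^ 2 / φ k2 * multipleError E Q k1))) := by
                gcongr
            _ = _ := by ring
      _ = _ := by
          rw [sum_const, card_Icc, nsmul_eq_mul, Nat.add_sub_cancel]; ring
  · have h0 : 0 ≤ Φ := cast_nonneg _
    rw [abs_mul, abs_of_nonneg (by positivity : 0 ≤ Φ * (1 / φ k1 * (1 / φ k2)))]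
    have h1 := hZ k1 k2 l1 l2 N Q hk1 hk2 hl1 hl2 hQ
    calc _ ≤ Z * (tau k1 * tau k2 * k1.gcd k2) * Q ^ (-(1 / 10) : ℝ) *
          (N ^ 2 * ((tau k1) / k1 * (tau k2 / k2))) := by
          refine mul_le_mul h1 ?_ (by positivity) ((abs_nonneg _).trans h1)
          exact mul_le_mul (Phi3_le_sq ha1 hb1 ha2 hb2) (mul_le_mul (inv_totient_le k1) (inv_totient_le k2) (by positivity) (by positivity)) (by positivity)
            (by positivity)
      _ = _ := by field_simp

lemma mul_pow_div_pow_le {x D : ℝ} (hx : 1 ≤ x) (hD : D ≤ x) {a b d : ℕ} (h : a + b + 1 ≤ d) :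
    D * x ^ a / x ^ d ≤ 1 / x ^ b := by
  have h0 : 0 < x := by linarith
  rw [div_le_div_iff₀ (by positivity) (by positivity), one_mul]
  calc D * x ^ a * x ^ b ≤ x * x ^ a * x ^ b := by gcongr
    _ = x ^ (a + b + 1) := by ring
    _ ≤ x ^ d := pow_le_pow_right₀ hx h

lemma one_add_log_le {K N : ℕ} (hK : K ≤ N) (hL : 1 ≤ log N) :
    1 + log K ≤ 2 * log N := by
  have : log K ≤ log N := by
    rcases Nat.eq_zero_or_pos K with rfl | h
    · simp [log_natCast_nonneg]
    · exact log_le_log (mod_cast h) (mod_cast hK)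
  linarith

lemma abs_modelError_le {N Q n : ℕ} (hQ : Q ≤ N) (hL : 1 ≤ log N) (hn : n ∈ Icc 1 N) :
    |modelError N Q n| ≤ 5 * (tau n) ^ 2 * log N ^ 2 := by
  have h1 : |logPrime n| ≤ log N := by
    simpa using abs_logPrime_ite_le {n} hn
  have h3 := one_add_log_le hQ hL
  have h4 : (1 : ℝ) ≤ (tau n) ^ 2 :=
    one_le_pow₀ (mod_cast tau_pos (by have := (mem_Icc.1 hn).1; omega))
  rw [modelError_natCast hn]
  have h5 := one_add_log_nonneg Q
  calc _ ≤ log N + (tau n) ^ 2 * (1 + log Q) ^ 2 :=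
        (abs_sub _ _).trans (add_le_add h1 (abs_primeModel_le Q (n := n) (by have := (mem_Icc.1 hn).1; omega)))
    _ ≤ (tau n) ^ 2 * log N ^ 2 + (tau n) ^ 2 * (2 * log N) ^ 2 := by
        gcongr; nlinarith
    _ = _ := by ring

lemma sum_modelError_pow_le {N Q : ℕ} (hQ : Q ≤ N) (hL : 625 * 2 ^ 256 ≤ log N) :
    ∑ n ∈ Icc 1 N, modelError N Q n ^ 2 ≤ N * log N ^ 265 ∧
      ∑ n ∈ Icc 1 N, modelError N Q n ^ 4 ≤ N * log N ^ 265 := by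
  have hL1 : 1 ≤ log N := le_trans (by norm_num) hL
  have h0 := one_add_log_nonneg N
  have h1 := one_add_log_le (le_refl N) hL1
  have key : ∀ j, ∑ n ∈ Icc 1 N, |modelError N Q n| ^ j ≤
      5 ^ j * log N ^ (2 * j) * (N * (2 * log N) ^ 2 ^ (2 * j)) := fun j => by
    calc _ ≤ ∑ n ∈ Icc 1 N, 5 ^ j * log N ^ (2 * j) * (tau n) ^ (2 * j) := by
          refine sum_le_sum fun n hn => ?_
          refine (pow_le_pow_left₀ (abs_nonneg _) (abs_modelError_le hQ hL1 hn) j).trans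
            (le_of_eq ?_)
          rw [mul_pow, mul_pow, ← pow_mul, ← pow_mul]; ring
      _ ≤ _ := by
          rw [← mul_sum]
          gcongr
          exact (sum_tau_pow_le N (2 * j)).trans (by gcongr)
  constructor
  · have h2 := key 2
    simp only [sq_abs] at h2
    refine h2.trans ?_
    calc _ = (25 * 2 ^ 16) * (N * log N ^ 20) := by ring
      _ ≤ log N * (N * log N ^ 20) := by
          gcongr; exact le_trans (by norm_num) hL
      _ = N * log N ^ 21 := by ring
      _ ≤ _ := by gcongr; norm_num
  · have h2 := key 4
    simp only [Even.pow_abs (⟨2, rfl⟩)] at h2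
    refine h2.trans ?_
    generalize log N = x at *
    rw [show 2 ^ (2 * 4) = 256 by norm_num, (fun m => by rw [mul_pow]; ring : ∀ m, 5 ^ 4 * x ^ (2 * 4) * (N * (2 * x) ^ m) = (625 * 2 ^ m) * (N * x ^ (m + 8)))]
    calc (625 * 2 ^ 256) * (N * x ^ (256 + 8)) ≤ x * (N * x ^ (256 + 8)) := by gcongr
      _ = N * (x ^ (256 + 8) * x) := by ring_nf
      _ = _ := by rw [← pow_succ]

lemma exists_sum_corrEnergy_le (v : ℕ) : ∃ g κ, ∃ N0 : ℕ, ∀ N, N0 ≤ N → ∀ Q K,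
    Q ≤ N → K ≤ N → K ≤ N / log N ^ κ →
    (∀ α, ‖∑ n ∈ Icc 1 N, modelError N Q n * ee (n * α)‖ ≤ N / log N ^ g) →
    ∑ k1 ∈ Icc 1 K, ∑ k2 ∈ Icc 1 K, corrEnergy N (modelError N Q) k1 k2 ≤
      N ^ 3 / log N ^ v := by
  obtain ⟨N0, hN0⟩ := exists_le_log (625 * 2 ^ 256)
  obtain ⟨s, hs⟩ : ∃ s, s = 265 := ⟨_, rfl⟩
  obtain ⟨r, hr⟩ : ∃ r, r = v + s + 5 := ⟨_, rfl⟩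
  obtain ⟨r', hr'⟩ : ∃ r', r' = v + r + 2 * s + 4 := ⟨_, rfl⟩
  refine ⟨v + r + r' + s + 4, r', N0, fun N hN Q K hQN hKN hK hG => ?_⟩
  set x := log N
  have hS := sum_modelError_pow_le hQN (hN0 N hN)
  rw [← hs] at hS
  obtain ⟨hS2, hS4⟩ := hS
  have hx : 15552 ≤ x := le_trans (by norm_num) (hN0 N hN)
  clear hN0 hN
  have hx1 : 1 ≤ x := le_trans (by norm_num) hx
  have hx0 : 0 < x := by linarith
  have hlK := one_add_log_le hKN hx1
  have hlN := one_add_log_le le_rfl hx1 (N := N)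
  have h0K := one_add_log_nonneg K
  have h0N := one_add_log_nonneg N
  have hceil : ∀ s, x ^ s ≤ (⌈x ^ s⌉₊) ∧ (⌈x ^ s⌉₊) ≤ 2 * x ^ s ∧ 1 ≤ ⌈x ^ s⌉₊ :=
    fun s => by
      have h1 : 1 ≤ x ^ s := one_le_pow₀ hx1
      refine ⟨le_ceil _, ?_, one_le_ceil_iff.2 (by linarith)⟩
      have := ceil_lt_add_one (by linarith : 0 ≤ x ^ s)
      linarith
  obtain ⟨hR1, hR2, hR3⟩ := hceil r
  obtain ⟨hS1, hS2', hS3⟩ := hceil r'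
  refine (sum_corrEnergy_le (g := modelError N Q) (fun v hv => if_neg hv) hG hR3 hS3).trans ?_
  have hd : ∀ s, s ≤ r' → x ^ s ≤ (⌈x ^ s⌉₊) →
      N / (⌈x ^ s⌉₊) + 2 * K ≤ 3 * (N / x ^ s) := fun s hs h => by
    have h1 : N / (⌈x ^ s⌉₊) ≤ N / x ^ s := by gcongr
    have h2 : (N : ℝ) / x ^ r' ≤ N / x ^ s := by gcongr
    linarith
  have hKN' : K + 2 * N * (1 + log N) ^ 2 ≤ 9 * (N * x ^ 2) := by
    have h1 : (K : ℝ) ≤ N := mod_cast hKN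
    have h2 : (1 + log N) ^ 2 ≤ (2 * x) ^ 2 := by gcongr
    have h3 : 1 ≤ x ^ 2 := one_le_pow₀ hx1
    have h4 : 0 ≤ N := cast_nonneg N
    nlinarith
  have hd1 := hd r (by omega) hR1
  have hd2 := hd r' le_rfl hS1
  have hs2 : 0 ≤ ∑ n ∈ Icc 1 N, modelError N Q n ^ 2 := sum_nonneg fun _ _ => sq_nonneg _
  have hs4 : 0 ≤ ∑ n ∈ Icc 1 N, modelError N Q n ^ 4 :=
    sum_nonneg fun _ _ => Even.pow_nonneg (⟨2, rfl⟩) _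
  calc _ ≤ 2 * x * (2 * x ^ r * (2 * x * (2 * x ^ r' *
        ((N / x ^ (v + r + r' + s + 4)) ^ 2 * (N * x ^ s)) +
        288 * (3 * (N / x ^ r')) * (N * x ^ s) ^ 2)) +
        288 * (3 * (N / x ^ r)) * (9 * (N * x ^ 2) * (N * x ^ s))) := by gcongr
    _ = N ^ 3 * (16 * x ^ (r + r' + s + 2) / x ^ ((v + r + r' + s + 4) * 2) +
        6912 * x ^ (r + 2 * s + 2) / x ^ r' + 15552 * x ^ (s + 3) / x ^ r) := by
        rw [pow_mul]
        field_simp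
        ring
    _ ≤ N ^ 3 * (1 / x ^ (v + 1) + 1 / x ^ (v + 1) + 1 / x ^ (v + 1)) := by
        refine mul_le_mul_of_nonneg_left (add_le_add (add_le_add ?_ ?_) ?_) (by positivity) <;>
          exact mul_pow_div_pow_le hx1 (by linarith) (by omega)
    _ = N ^ 3 * (3 * x ^ 0 / x ^ (v + 1)) := by ring
    _ ≤ N ^ 3 * (1 / x ^ v) := by
        exact mul_le_mul_of_nonneg_left (mul_pow_div_pow_le hx1 (by linarith) (by omega))
          (by positivity)
    _ = _ := by ring

lemma exists_norm_sum_modelError_le (g t : ℕ) : ∃ B e, t ≤ B ∧ t + 6 * B ≤ e ∧ ∀ C, ∃ N0 : ℕ,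
    ∀ N, N0 ≤ N → ∀ E, E ≤ C * N / log N ^ e →
    (∀ q ∈ Icc 1 ⌈log N ^ B⌉₊, ∀ l, ∀ y ≤ N,
      |∑ n ∈ Icc 1 y with (q : ℤ) ∣ (n : ℕ) - l, logPrime n -
        (if Int.gcd q l = 1 then (y : ℝ) / φ q else 0)| ≤ E) → ∀ α,
    ‖∑ n ∈ Icc 1 N, (modelError N ⌈log N ^ B⌉₊ n) * ee (n * α)‖ ≤
      N / log N ^ g := by
  obtain ⟨w, hw⟩ : ∃ w, w = g + 7 := ⟨_, rfl⟩
  obtain ⟨B, hB⟩ : ∃ B, B = 4 * w + 4 + t := ⟨_, rfl⟩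
  obtain ⟨p, hp⟩ : ∃ p, p = 2 * B + g + 5 := ⟨_, rfl⟩
  refine ⟨B, p + 6 * B + g + 4 + t, by omega, by omega, fun C => ?_⟩
  obtain ⟨N1, hN1⟩ := exists_le_log (max 6912 (30 * C))
  obtain ⟨N2, hN2⟩ := exists_log_pow_le 2 (g + 2) (ε := 1 / 2) (by norm_num)
  obtain ⟨N3, hN3⟩ := exists_log_pow_le 8 (B + p + g + 2 * w) (ε := 1) (by norm_num)
  refine ⟨max N1 (max N2 N3), fun N hN E hE hBV α => ?_⟩
  set x := log N
  have hxm := hN1 N ((le_max_left _ _).trans hN)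
  have hx := (le_max_left _ _).trans hxm
  have hsq := hN2 N ((le_max_left _ _).trans ((le_max_right _ _).trans hN))
  have hbig := hN3 N ((le_max_right _ _).trans ((le_max_right _ _).trans hN))
  rw [rpow_one] at hbig
  rw [← sqrt_eq_rpow] at hsq
  have hx1 : 1 ≤ x := le_trans (by norm_num) hx
  have hx0 : 0 < x := by linarith
  have hpow : ∀ s, 1 ≤ x ^ s := fun s => one_le_pow₀ hx1
  have hceil : ∀ s, x ^ s ≤ (⌈x ^ s⌉₊) ∧ (⌈x ^ s⌉₊) ≤ 2 * x ^ s ∧ 1 ≤ ⌈x ^ s⌉₊ :=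
    fun s => by
      have h1 := hpow s
      refine ⟨le_ceil _, ?_, one_le_ceil_iff.2 (by linarith)⟩
      have := ceil_lt_add_one (by linarith : 0 ≤ x ^ s)
      linarith
  obtain ⟨hQ1, hQ2, hQ3⟩ := hceil B
  obtain ⟨hW1, hW2, hW3⟩ := hceil (2 * w)
  set Q := ⌈x ^ B⌉₊
  set W := ⌈x ^ (2 * w)⌉₊
  have hsplit : x ^ (B + p + g + 2 * w) = x ^ B * x ^ p * x ^ g * x ^ (2 * w) := by ring
  have hNB : 8 * (x ^ B * x ^ p) ≤ N := by
    refine le_trans ?_ hbig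
    rw [hsplit]
    have h1 := one_le_mul_of_one_le_of_one_le (hpow g) (hpow (2 * w))
    nlinarith [mul_pos (pow_pos hx0 B) (pow_pos hx0 p)]
  have hNp : 8 * x ^ B ≤ N / x ^ p := by
    rw [le_div_iff₀ (by positivity)]; linarith
  have hN0 := lt_of_lt_of_le (by positivity) hNB
  have hM1 : ((⌊N / x ^ p⌋₊)) ≤ N / x ^ p := floor_le (by positivity)
  have hM2 : N / x ^ p ≤ 2 * (⌊N / x ^ p⌋₊) := by
    have h1 := lt_floor_add_one (N / x ^ p)
    have := hpow B
    linarith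
  set M := ⌊N / x ^ p⌋₊
  have hWQ : 2 * (W * W) ≤ Q := by
    have : (2 * (W * W) : ℝ) ≤ Q := by
      calc (2 * (W * W)) ≤ 2 * ((2 * x ^ (2 * w)) * (2 * x ^ (2 * w))) := by gcongr
        _ = 8 * x ^ (4 * w) := by ring
        _ ≤ x * x ^ (4 * w) := by gcongr; linarith
        _ = x ^ (4 * w + 1) := by ring
        _ ≤ x ^ B := pow_le_pow_right₀ hx1 (by omega)
        _ ≤ Q := hQ1
    exact_mod_cast this
  have hQM : 2 * Q ≤ M := by
    exact_mod_cast (by linarith : (2 * Q : ℝ) ≤ M)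
  have hNM : N / M ≤ 2 * x ^ p := by
    rw [div_le_iff₀ (by have := hpow B; linarith)]
    rw [div_le_iff₀ (by positivity)] at hM2
    linarith
  refine (norm_sum_modelError_ee_le (mod_cast hN0) hQ3 hQM hW3 hWQ hBV α).trans ?_
  have hE0 := (abs_nonneg _).trans (hBV 1 (mem_Icc.2 ⟨le_rfl, hQ3⟩) 0 0 (Nat.zero_le _))
  have ha : M * Q ^ 2 ≤ N * (1 / x ^ (g + 1)) := by
    calc M * Q ^ 2 ≤ N / x ^ p * (2 * x ^ B) ^ 2 := by gcongr
      _ = N * (4 * x ^ (2 * B) / x ^ p) := by ring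
      _ ≤ _ := mul_le_mul_of_nonneg_left (mul_pow_div_pow_le hx1 (by linarith) (by omega)) hN0.le
  have hb : (1 + 7 * (N / M)) * (Q * E) ≤ N * (1 / x ^ (g + 1)) := by
    calc (1 + 7 * (N / M)) * (Q * E) ≤
          (x ^ p + 7 * (2 * x ^ p)) * (2 * x ^ B * (C * N / x ^ (p + 6 * B + g + 4 + t))) := by
          gcongr; exact hpow p
      _ = N * ((30 * C) * x ^ (p + B) / x ^ (p + 6 * B + g + 4 + t)) := by ring
      _ ≤ _ := mul_le_mul_of_nonneg_left (mul_pow_div_pow_le hx1 ((le_max_right _ _).trans hxm) (by omega)) hN0.le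
  have hc : 2 * √N * x ≤ N * (1 / x ^ (g + 1)) := by
    rw [mul_one_div, le_div_iff₀ (by positivity)]
    calc 2 * √N * x * x ^ (g + 1) = √N * (2 * x ^ (g + 2)) := by ring
      _ ≤ √N * √N := by gcongr
      _ = N := mul_self_sqrt hN0.le
  have hd : W * x ≤ N * (1 / x ^ (g + 1)) := by
    rw [mul_one_div, le_div_iff₀ (by positivity)]
    calc W * x * x ^ (g + 1) ≤ 2 * x ^ (2 * w) * x * x ^ (g + 1) := by gcongr
      _ = 2 * (x ^ 2 * x ^ g * x ^ (2 * w)) := by ring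
      _ ≤ 8 * (x ^ B * x ^ p * x ^ g * x ^ (2 * w)) := by
          gcongr
          · norm_num
          · rw [← pow_add]; exact pow_le_pow_right₀ hx1 (by omega)
      _ ≤ N := by rw [← hsplit]; exact hbig
  have he : 3 * (W * W) * x * M ≤ N * (1 / x ^ (g + 1)) := by
    calc 3 * (W * W) * x * M ≤ 3 * ((2 * x ^ (2 * w)) * (2 * x ^ (2 * w))) * x * (N / x ^ p) := by
          gcongr
      _ = N * (12 * x ^ (4 * w + 1) / x ^ p) := by ring
      _ ≤ _ := mul_le_mul_of_nonneg_left (mul_pow_div_pow_le hx1 (by linarith) (by omega)) hN0.le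
  have hf : 4 * (1 + log N) ^ 5 * √(288 * N * (2 * N / Q + 6 * N / W + 2 * M)) ≤
      N * (1 / x ^ (g + 1)) := by
    have h1 : 2 * N / Q + 6 * N / W + 2 * M ≤ 10 * (N / x ^ (2 * w)) := by
      have e1 : 2 * N / Q ≤ 2 * N / x ^ (2 * w) := by
        gcongr
        exact (pow_le_pow_right₀ hx1 (by omega)).trans hQ1
      have e2 : 6 * N / W ≤ 6 * N / x ^ (2 * w) := by gcongr
      have e3 : N / x ^ p ≤ N / x ^ (2 * w) := by
        gcongr
        omega
      calc _ ≤ 2 * N / x ^ (2 * w) + 6 * N / x ^ (2 * w) + 2 * (N / x ^ (2 * w)) := by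
            linarith
        _ = _ := by ring
    have h2 : √(288 * N * (2 * N / Q + 6 * N / W + 2 * M)) ≤ 54 * (N / x ^ w) := by
      rw [sqrt_le_left (by positivity)]
      calc _ ≤ 288 * N * (10 * (N / x ^ (2 * w))) := by gcongr
        _ = 2880 * (N ^ 2 / (x ^ w) ^ 2) := by rw [← pow_mul, mul_comm w]; ring
        _ ≤ 2916 * (N ^ 2 / (x ^ w) ^ 2) := by gcongr; norm_num
        _ = _ := by ring
    calc _ ≤ 4 * (x + x) ^ 5 * (54 * (N / x ^ w)) := by gcongr
      _ = N * (6912 * x ^ 5 / x ^ w) := by ring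
      _ ≤ _ := mul_le_mul_of_nonneg_left (mul_pow_div_pow_le hx1 hx (by omega)) hN0.le
  calc _ ≤ N * (6 * x ^ 0 / x ^ (g + 1)) := by
        rw [show N * (6 * x ^ 0 / x ^ (g + 1)) = 6 * (N * (1 / x ^ (g + 1))) by ring]
        linarith
    _ ≤ N * (1 / x ^ g) := by
        exact mul_le_mul_of_nonneg_left (mul_pow_div_pow_le hx1 (by linarith) (by omega)) hN0.le
    _ = _ := by ring

lemma exists_sum_abs_Delta3_le (m : ℕ) : ∃ c : ℕ, 0 < c ∧ ∃ C : ℝ, 0 < C ∧ ∃ N0 : ℕ, ∀ N : ℕ,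
    N0 ≤ N → 1 ≤ log N ∧ ∀ K : ℕ, (K : ℝ) ≤ √N / log N ^ c →
    ∀ l1 l2 : ℕ → ℕ → ℤ, ∀ a1 b1 a2 b2 : ℕ → ℕ → ℕ,
    (∀ k1 k2 : ℕ, Int.gcd (k1 : ℤ) (l1 k1 k2) = 1 ∧ Int.gcd (k2 : ℤ) (l2 k1 k2) = 1) →
    (∀ k1 k2 : ℕ, 1 ≤ a1 k1 k2 ∧ b1 k1 k2 ≤ N ∧ 1 ≤ a2 k1 k2 ∧ b2 k1 k2 ≤ N) →
    ∑ k1 ∈ Icc 1 K, ∑ k2 ∈ Icc 1 K,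
      |Delta3 k1 k2 (l1 k1 k2) (l2 k1 k2) N (a1 k1 k2) (b1 k1 k2) (a2 k1 k2) (b2 k1 k2)| ≤
      C * N ^ 2 / log N ^ m := by
  obtain ⟨g, κ, N1, hcorr⟩ := exists_sum_corrEnergy_le (4 * m + 24)
  obtain ⟨B, e, htB, hte, hmodel⟩ := exists_norm_sum_modelError_le g (10 * (m + 24))
  obtain ⟨B0, C, hC, N2, hbv⟩ := bombieri_vinogradov e
  obtain ⟨N3, hmodel⟩ := hmodel C
  obtain ⟨Z, hZ0, hZ⟩ := exists_abs_S3kl_sub_le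
  obtain ⟨N4, hN4⟩ := exists_log_pow_le 2 (B + B0 + κ) (ε := 1 / 2) (by norm_num)
  obtain ⟨N5, hN5⟩ := exists_le_log 2
  refine ⟨B + B0 + κ + 1, by omega, 39 + 768 * C + 2 ^ 24 * Z, by positivity,
    max N1 (max N2 (max N3 (max N4 N5))), fun N hN => ?_⟩
  simp only [max_le_iff] at hN
  obtain ⟨hN1, hN2, hN3, hN4', hN5'⟩ := hN
  have hx := hN5 N hN5'
  have hsq := hN4 N hN4'
  rw [← sqrt_eq_rpow] at hsq
  refine ⟨by linarith, fun K hK l1 l2 a1 b1 a2 b2 hl hab => ?_⟩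
  obtain ⟨E, hE0, hE, hEsum⟩ := hbv N hN2
  replace hcorr := hcorr N hN1
  replace hmodel := hmodel N hN3
  clear hN1 hN2 hN3 hN4' hN5' hbv hN4 hN5
  set x := log N
  have hx1 : 1 ≤ x := by linarith
  have hpow : ∀ s : ℕ, 1 ≤ x ^ s := fun s => one_le_pow₀ hx1
  have hs2 : 2 ≤ √N := by linarith [hpow (B + B0 + κ)]
  have hss : √N * √N = N := mul_self_sqrt (cast_nonneg N)
  have hsN : √N ≤ N := by nlinarith
  have hN0 : (0 : ℝ) < N := by linarith
  obtain ⟨hQ1, hQ2, hQ3⟩ : x ^ B ≤ (⌈x ^ B⌉₊ : ℝ) ∧ (⌈x ^ B⌉₊ : ℝ) ≤ 2 * x ^ B ∧ 1 ≤ ⌈x ^ B⌉₊ := by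
    have h1 := hpow B
    refine ⟨le_ceil _, ?_, one_le_ceil_iff.2 (by linarith)⟩
    have := ceil_lt_add_one (by linarith : 0 ≤ x ^ B)
    linarith
  set Q := ⌈x ^ B⌉₊
  have hK1 : (K : ℝ) ≤ √N := hK.trans (div_le_self (by positivity) (hpow _))
  have hKN : K ≤ N := by exact_mod_cast hK1.trans hsN
  have hKQ : ((K * Q : ℕ) : ℝ) ≤ √N / x ^ B0 := by
    push_cast
    calc (K * Q : ℝ) ≤ √N / x ^ (B + B0 + κ + 1) * (2 * x ^ B) := by gcongr
      _ = √N * (2 * x ^ B / x ^ (B + B0 + κ + 1)) := by ring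
      _ ≤ √N * (1 / x ^ B0) :=
        mul_le_mul_of_nonneg_left (mul_pow_div_pow_le hx1 hx (by omega)) (by positivity)
      _ = _ := by ring
  have hQB : (Q : ℝ) ≤ √N / x ^ B0 := by
    rw [le_div_iff₀ (by positivity)]
    calc (Q : ℝ) * x ^ B0 ≤ 2 * x ^ B * x ^ B0 := by gcongr
      _ = 2 * x ^ (B + B0) := by ring
      _ ≤ 2 * x ^ (B + B0 + κ) :=
        mul_le_mul_of_nonneg_left (pow_le_pow_right₀ hx1 (by omega)) zero_le_two
      _ ≤ _ := hsq
  have hQN : Q ≤ N := by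
    exact_mod_cast hQB.trans ((div_le_self (by positivity) (hpow _)).trans hsN)
  have hlK := one_add_log_le hKN hx1
  have h0K := one_add_log_nonneg K
  have hT := sum_abs_le_of_pow_four_le (T := fun k1 k2 => errorTriple Q k1 k2 (l1 k1 k2) (l2 k1 k2) N
      (a1 k1 k2) (b1 k1 k2) (a2 k1 k2) (b2 k1 k2)) (ℓ := x) (ρ := 3 * (N ^ 2 / x ^ (m + 4)))
    (by positivity) (by positivity)
    (by
      rw [show 4 * m + 24 = (m + 4) * 4 + 8 by ring, pow_add, pow_mul]
      calc _ = 32 * (N ^ 8 / (x ^ (m + 4)) ^ 4) := by field_simp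
        _ ≤ 81 * (N ^ 8 / (x ^ (m + 4)) ^ 4) := by gcongr; norm_num
        _ = _ := by ring) (hcorr Q K hQN hKN (hK.trans (by gcongr; omega)) (hmodel (C * N / x ^ e) le_rfl fun q hq l y hy => (hE q (by have := (mem_Icc.1 hq).1; omega) l y hy).trans ((single_le_sum (fun i _ => hE0 i) hq).trans (hEsum Q hQB))))
    fun k1 h1 k2 h2 => by
      have h1' := mem_Icc.1 h1
      have h2' := mem_Icc.1 h2
      obtain ⟨u1, u2, u3, u4⟩ := hab k1 k2
      refine errorTriple_pow_four_le h1'.1 h2'.1 ?_ _ _ u1 u2 u3 u4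
      have : ((K * K) : ℝ) ≤ N := by
        push_cast; rw [← hss]; gcongr
      exact (Nat.mul_le_mul h1'.2 h2'.2).trans (mod_cast this)
  have hME :=
    (sum_multipleError_le hE0 K Q).trans (mul_le_mul hQ2 (hEsum _ hKQ)
      (sum_nonneg fun _ _ => hE0 _) (by positivity))
  have hME0 : ∀ k ∈ Icc 1 K, 0 ≤ multipleError E Q k := fun k _ => sum_nonneg fun _ _ => hE0 _
  have h1 :=
    mul_le_mul ((sum_inv_le_log K).trans hlK) hME (sum_nonneg hME0) (by positivity)
  have h2 : (∑ k ∈ Icc 1 K, 1 / (k.totient : ℝ)) * ∑ k ∈ Icc 1 K, multipleError E Q k ≤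
      (2 * x) ^ 2 * (2 * x ^ B * (C * N / x ^ e)) :=
    mul_le_mul ((sum_inv_totient_le K).trans (by gcongr)) hME (sum_nonneg hME0) (by positivity)
  have h3 : ∑ k1 ∈ Icc 1 K, ∑ k2 ∈ Icc 1 K,
      (tau k1 : ℝ) ^ 2 * (tau k2) ^ 2 * (k1.gcd k2 / (k1 * k2)) ≤ (2 * x) ^ 24 :=
    (sum_tau_pow_mul_gcd_div_le K 2).trans (by norm_num; gcongr)
  have hQr : Q ^ (-(1 / 10) : ℝ) ≤ 1 / x ^ (m + 24) := by
    rw [rpow_neg (by positivity), ← one_div]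
    gcongr
    calc x ^ (m + 24) = ((x ^ (m + 24)) ^ 10) ^ (1 / 10 : ℝ) := by
          rw [show (1 / 10 : ℝ) = ((10 : ℕ) : ℝ)⁻¹ by norm_num,
            pow_rpow_inv_natCast (by positivity) (by norm_num)]
      _ ≤ _ := by
          gcongr
          rw [← pow_mul, mul_comm]
          exact (pow_le_pow_right₀ hx1 htB).trans hQ1
  have hxe : ∀ s : ℕ, s + m ≤ e → x ^ s / x ^ e ≤ 1 / x ^ m := fun s hs => by
    rw [div_le_div_iff₀ (by positivity) (by positivity), ← pow_add, one_mul]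
    exact pow_le_pow_right₀ hx1 hs
  calc _ ≤ ∑ k1 ∈ Icc 1 K, ∑ k2 ∈ Icc 1 K,
        (|errorTriple Q k1 k2 (l1 k1 k2) (l2 k1 k2) N (a1 k1 k2) (b1 k1 k2) (a2 k1 k2) (b2 k1 k2)| +
          (4 * N * x * Q ^ 4 * (1 / k1 * multipleError E Q k2) +
          2 * N * Q ^ 5 * (1 / k2.totient * multipleError E Q k1) +
          Z * N ^ 2 * (Q : ℝ) ^ (-(1 / 10) : ℝ) *
            ((tau k1) ^ 2 * (tau k2 : ℝ) ^ 2 * (k1.gcd k2 / (k1 * k2))))) := by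
        refine sum_le_sum fun k1 h1 => sum_le_sum fun k2 h2 => ?_
        have h1' := mem_Icc.1 h1
        obtain ⟨u1, u2, u3, u4⟩ := hab k1 k2
        refine le_trans ?_ (add_le_add_right (abs_Delta3_sub_errorTriple_le hZ hQ3 h1'.1 (mem_Icc.1 h2).1
          (h1'.2.trans hKN) (hl k1 k2).1 (hl k1 k2).2 hE0 hE u1 u2 u3 u4) _)
        rw [add_comm, ← sub_le_iff_le_add]
        exact abs_sub_abs_le_abs_sub _ _
    _ = _ + (4 * N * x * Q ^ 4 * ((∑ k ∈ Icc 1 K, (1 : ℝ) / k) *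
          ∑ k ∈ Icc 1 K, multipleError E Q k) +
        2 * N * Q ^ 5 * ((∑ k ∈ Icc 1 K, 1 / (k.totient : ℝ)) *
          ∑ k ∈ Icc 1 K, multipleError E Q k) +
        Z * N ^ 2 * Q ^ (-(1 / 10) : ℝ) * ∑ k1 ∈ Icc 1 K, ∑ k2 ∈ Icc 1 K,
          tau k1 ^ 2 * (tau k2 : ℝ) ^ 2 * (k1.gcd k2 / (k1 * k2))) := by
        simp only [sum_add_distrib, ← mul_sum]
        congr 2
        rw [sum_mul_sum, sum_mul_sum, sum_comm (t := Icc 1 K)]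
        simp only [← mul_sum]
    _ ≤ 3 * (N ^ 2 / x ^ (m + 4)) * ((2 * x) ^ 2 + (2 * x) ^ 3 + 1) +
        (4 * N * x * (2 * x ^ B) ^ 4 * (2 * x * (2 * x ^ B * (C * N / x ^ e))) +
        2 * N * (2 * x ^ B) ^ 5 * ((2 * x) ^ 2 * (2 * x ^ B * (C * N / x ^ e))) +
        Z * N ^ 2 * (1 / x ^ (m + 24)) * (2 * x) ^ 24) := by
        refine add_le_add (hT.trans (by gcongr)) ?_
        have h4 := sum_nonneg hME0
        gcongr
    _ = N ^ 2 * (3 * (4 * x ^ 2 + 8 * x ^ 3 + 1) / x ^ (m + 4) +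
        256 * C * (x ^ (5 * B + 2) / x ^ e) + 512 * C * (x ^ (6 * B + 2) / x ^ e) +
        2 ^ 24 * Z / x ^ m) := by
        rw [pow_add x m 24]
        field_simp
        ring
    _ ≤ N ^ 2 * (39 * (1 / x ^ m) + 256 * C * (1 / x ^ m) + 512 * C * (1 / x ^ m) +
        2 ^ 24 * Z / x ^ m) := by
        have h4 : 3 * (4 * x ^ 2 + 8 * x ^ 3 + 1) / x ^ (m + 4) ≤ 39 * (1 / x ^ m) := by
          rw [mul_one_div, div_le_div_iff₀ (by positivity) (by positivity), pow_add]
          have : 3 * (4 * x ^ 2 + 8 * x ^ 3 + 1) ≤ 39 * x ^ 4 := by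
            linarith [hpow 4, pow_le_pow_right₀ hx1 (by norm_num : 2 ≤ 4),
              pow_le_pow_right₀ hx1 (by norm_num : 3 ≤ 4)]
          linarith [mul_le_mul_of_nonneg_right this (pow_pos (by linarith : 0 < x) m).le]
        have h5 := hxe (5 * B + 2) (by omega)
        have h6 := hxe (6 * B + 2) (by omega)
        gcongr
    _ = _ := by ring

/-- for any A > 0 there is C' > 0 with
∑_{k₁ ≤ √N L^{-C'}} ∑_{k₂ ≤ √N L^{-C'}} max_{l₁,l₂} max_{J₁,J₂} |Δ⁽³⁾| ≪ N² L^{-A}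
for large odd N; the maxima are expressed via arbitrary choice functions of (k₁, k₂). -/
theorem ternary_goldbach_two_progressions_average :
    ∀ A : ℝ, 0 < A → ∃ C' : ℝ, 0 < C' ∧ ∃ C, 0 < C ∧ ∃ N0, ∀ N, N0 ≤ N → Odd N →
      ∀ l1 l2 : ℕ → ℕ → ℤ, ∀ a1 b1 a2 b2 : ℕ → ℕ → ℕ,
        (∀ k1 k2 : ℕ, Int.gcd k1 (l1 k1 k2) = 1 ∧ Int.gcd k2 (l2 k1 k2) = 1) →
        (∀ k1 k2, 1 ≤ a1 k1 k2 ∧ b1 k1 k2 ≤ N ∧ 1 ≤ a2 k1 k2 ∧ b2 k1 k2 ≤ N) →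
        (∑ k1 ∈ Finset.Icc 1 N, ∑ k2 ∈ Finset.Icc 1 N,
            if k1 ≤ sqrt N * log N ^ (-C') ∧
                k2 ≤ sqrt N * log N ^ (-C') then
              |Delta3 k1 k2 (l1 k1 k2) (l2 k1 k2) N (a1 k1 k2) (b1 k1 k2) (a2 k1 k2) (b2 k1 k2)|
            else 0) ≤
          C * N ^ 2 * log N ^ (-A) := by
  intro A _
  obtain ⟨c, hc, C, hC, N0, h⟩ := exists_sum_abs_Delta3_le ⌈A⌉₊
  refine ⟨c, mod_cast hc, C, hC, N0, fun N hN _ l1 l2 a1 b1 a2 b2 hl hab => ?_⟩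
  obtain ⟨hx, h⟩ := h N hN
  have hx0 : 0 < log N := by linarith
  have hc : √N * log N ^ (-(c : ℝ)) = √N / log N ^ c := by
    rw [rpow_neg hx0.le, rpow_natCast, div_eq_mul_inv]
  rw [hc]
  set K := ⌊√N / log N ^ c⌋₊
  have hI : ∀ k, (k ∈ Icc 1 N ∧ k ≤ √N / log N ^ c) → k ∈ Icc 1 K := fun k hk =>
    mem_Icc.2 ⟨(mem_Icc.1 hk.1).1, le_floor hk.2⟩
  calc _ ≤ ∑ k1 ∈ Icc 1 K, ∑ k2 ∈ Icc 1 K, |Delta3 k1 k2 (l1 k1 k2) (l2 k1 k2) N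
        (a1 k1 k2) (b1 k1 k2) (a2 k1 k2) (b2 k1 k2)| := by
        rw [← sum_product', ← sum_product', ← sum_filter]
        refine sum_le_sum_of_subset_of_nonneg (fun k hk => ?_) fun k _ _ => by positivity
        simp only [mem_filter, mem_product] at hk ⊢
        exact ⟨hI _ ⟨hk.1.1, hk.2.1⟩, hI _ ⟨hk.1.2, hk.2.2⟩⟩
    _ ≤ C * N ^ 2 / log N ^ ⌈A⌉₊ := h K (floor_le (by positivity)) l1 l2 a1 b1 a2 b2 hl hab
    _ ≤ _ := by
        rw [div_eq_mul_inv, ← rpow_natCast (log N), ← rpow_neg hx0.le]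
        gcongr
        exact le_ceil A
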